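/- For every constant C and every positive integer n, there exist E₂ numbers q₁ = p₁p₂ and q₂ = p₃p₄, where p₁, p₂, p₃, p₄ are four distinct primes each exceeding C and none dividing 2n, such that q₂ − q₁ ∈ {4, 6, 10}. -/

import Mathlib

section Karamata

open Filter Topology MeasureTheory Set Real

theorem tendsto_of_forall_approx {α : Type*} {l : Filter α} {F : α → ℝ} {B : ℝ}
    (h : ∀ ε > 0, ∃ (F' : α → ℝ) (B' : ℝ), Tendsto F' l (𝓝 B') ∧
      (∀ᶠ x in l, |F x - F' x| ≤ ε) ∧ |B - B'| ≤ ε) : Tendsto F l (𝓝 B) := by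
  rw [Metric.tendsto_nhds]
  intro ε hε
  obtain ⟨F', B', h1, h2, h3⟩ := h (ε / 4) (by positivity)
  rw [Metric.tendsto_nhds] at h1
  filter_upwards [h1 (ε / 4) (by positivity), h2] with x hx1 hx2
  rw [Real.dist_eq] at *
  rw [abs_lt] at *
  rw [abs_le] at *
  constructor <;> linarith

/-- The density `e^{-t} t^j / j!` on `(0, ∞)`. -/
noncomputable def gammaWeight (j : ℕ) (t : ℝ) : ℝ := exp (-t) * t ^ j / (j.factorial : ℝ)

theorem integral_exp_mul_gammaWeight (j m : ℕ) :
    ∫ t in Ioi (0 : ℝ), exp (-t) ^ m * gammaWeight j t = (1 / ((m : ℝ) + 1)) ^ (j + 1) := by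
  have h := integral_rpow_mul_exp_neg_mul_Ioi (a := (j : ℝ) + 1) (r := (m : ℝ) + 1)
    (by positivity) (by positivity)
  have h2 : ∫ t in Ioi (0 : ℝ), exp (-t) ^ m * gammaWeight j t =
      (∫ t in Ioi (0 : ℝ), t ^ ((j : ℝ) + 1 - 1) * exp (-(((m : ℝ) + 1) * t))) / j.factorial := by
    rw [← integral_div]
    refine setIntegral_congr_fun measurableSet_Ioi fun t ht ↦ ?_
    simp only [gammaWeight, add_sub_cancel_right, rpow_natCast]
    rw [← exp_nat_mul, show -(((m : ℝ) + 1) * t) = m * -t + -t by ring, exp_add]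
    ring
  rw [h2, h, Gamma_nat_eq_factorial]
  have : ((j.factorial : ℕ) : ℝ) ≠ 0 := by positivity
  rw [mul_div_assoc, div_self this, mul_one]
  exact_mod_cast rpow_natCast _ _

theorem integrableOn_gammaWeight (j : ℕ) : IntegrableOn (gammaWeight j) (Ioi 0) := by
  have h := (GammaIntegral_convergent (s := (j : ℝ) + 1) (by positivity)).div_const
    (j.factorial : ℝ)
  refine h.congr (Eventually.of_forall fun t ↦ ?_)
  simp [gammaWeight]

theorem integral_gammaWeight (j : ℕ) : ∫ t in Ioi (0 : ℝ), gammaWeight j t = 1 := by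
  simpa using integral_exp_mul_gammaWeight j 0

theorem gammaWeight_nonneg (j : ℕ) {t : ℝ} (ht : 0 < t) : 0 ≤ gammaWeight j t := by
  unfold gammaWeight; positivity

theorem exp_neg_mem_Icc {t : ℝ} (ht : 0 ≤ t) : exp (-t) ∈ Icc (0 : ℝ) 1 :=
  ⟨(exp_pos _).le, exp_le_one_iff.2 (by linarith)⟩

theorem integrableOn_comp_exp_mul_gammaWeight (j : ℕ) {h : ℝ → ℝ} {M : ℝ}
    (hm : AEStronglyMeasurable (fun t ↦ h (exp (-t))) (volume.restrict (Ioi 0)))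
    (hM : ∀ x ∈ Icc (0 : ℝ) 1, |h x| ≤ M) :
    IntegrableOn (fun t ↦ h (exp (-t)) * gammaWeight j t) (Ioi 0) := by
  refine (integrableOn_gammaWeight j).bdd_mul hm (c := M) ?_
  filter_upwards [ae_restrict_mem measurableSet_Ioi] with t ht
  exact hM _ (exp_neg_mem_Icc (le_of_lt ht))

theorem ContinuousOn.aestronglyMeasurable_comp_exp_neg {h : ℝ → ℝ}
    (hh : ContinuousOn h (Icc 0 1)) :
    AEStronglyMeasurable (fun t ↦ h (exp (-t))) (volume.restrict (Ioi 0)) := by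
  refine ContinuousOn.aestronglyMeasurable ?_ measurableSet_Ioi
  exact hh.comp (by fun_prop) fun t ht ↦ exp_neg_mem_Icc (le_of_lt ht)

section

variable {ι : Type*} {f ℓ : ι → ℝ} {j : ℕ} {c : ℝ}

/-- Laplace-weighted mean of `h (e^{-ℓ/L})`. -/
noncomputable def laplaceMean (f ℓ : ι → ℝ) (j : ℕ) (h : ℝ → ℝ) (L : ℝ) : ℝ :=
  (∑' i, f i * exp (-(ℓ i / L)) * h (exp (-(ℓ i / L)))) / L ^ (j + 1)

theorem summable_laplaceMean (hf : ∀ i, 0 ≤ f i) (hℓ : ∀ i, 0 ≤ ℓ i)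
    (hsum : ∀ s > 0, Summable fun i ↦ f i * exp (-(s * ℓ i))) {h : ℝ → ℝ} {M : ℝ}
    (hM : ∀ x ∈ Icc (0 : ℝ) 1, |h x| ≤ M) {L : ℝ} (hL : 0 < L) :
    Summable fun i ↦ f i * exp (-(ℓ i / L)) * h (exp (-(ℓ i / L))) := by
  have h1 := (hsum (1 / L) (by positivity)).mul_right M
  refine Summable.of_norm_bounded h1 fun i ↦ ?_
  rw [norm_mul, Real.norm_eq_abs, Real.norm_eq_abs,
    abs_of_nonneg (mul_nonneg (hf i) (exp_pos _).le), one_div_mul_eq_div]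
  gcongr
  · exact mul_nonneg (hf i) (exp_pos _).le
  · exact hM _ (exp_neg_mem_Icc (div_nonneg (hℓ i) hL.le))

theorem abs_laplaceMean_sub_le (hf : ∀ i, 0 ≤ f i) (hℓ : ∀ i, 0 ≤ ℓ i)
    (hsum : ∀ s > 0, Summable fun i ↦ f i * exp (-(s * ℓ i))) {h₁ h₂ g : ℝ → ℝ} {M₁ M₂ M : ℝ}
    (hM₁ : ∀ x ∈ Icc (0 : ℝ) 1, |h₁ x| ≤ M₁) (hM₂ : ∀ x ∈ Icc (0 : ℝ) 1, |h₂ x| ≤ M₂)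
    (hM : ∀ x ∈ Icc (0 : ℝ) 1, |g x| ≤ M)
    (hg : ∀ x ∈ Icc (0 : ℝ) 1, |h₁ x - h₂ x| ≤ g x) {L : ℝ} (hL : 0 < L) :
    |laplaceMean f ℓ j h₁ L - laplaceMean f ℓ j h₂ L| ≤ laplaceMean f ℓ j g L := by
  have s1 := summable_laplaceMean hf hℓ hsum hM₁ hL
  have s2 := summable_laplaceMean hf hℓ hsum hM₂ hL
  have s3 := summable_laplaceMean hf hℓ hsum hM hL
  unfold laplaceMean
  rw [← sub_div, abs_div, abs_of_pos (pow_pos hL _), ← s1.tsum_sub s2]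
  gcongr
  rw [← Real.norm_eq_abs]
  refine tsum_of_norm_bounded s3.hasSum fun i ↦ ?_
  rw [← mul_sub, norm_mul, Real.norm_eq_abs, Real.norm_eq_abs,
    abs_of_nonneg (mul_nonneg (hf i) (exp_pos _).le)]
  gcongr
  · exact mul_nonneg (hf i) (exp_pos _).le
  · exact hg _ (exp_neg_mem_Icc (div_nonneg (hℓ i) hL.le))

theorem tendsto_laplaceMean_pow
    (hlim : Tendsto (fun s ↦ s ^ (j + 1) * ∑' i, f i * exp (-(s * ℓ i))) (𝓝[>] 0) (𝓝 c)) (m : ℕ) :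
    Tendsto (laplaceMean f ℓ j fun x ↦ x ^ m) atTop
      (𝓝 (c * ∫ t in Ioi (0 : ℝ), exp (-t) ^ m * gammaWeight j t)) := by
  rw [integral_exp_mul_gammaWeight]
  have h1 : Tendsto (fun L : ℝ ↦ ((m : ℝ) + 1) / L) atTop (𝓝[>] 0) := by
    refine tendsto_nhdsWithin_iff.2 ⟨tendsto_const_nhds.div_atTop tendsto_id, ?_⟩
    filter_upwards [eventually_gt_atTop 0] with L hL
    exact div_pos (by positivity) hL
  have h2 := (hlim.comp h1).mul_const ((1 / ((m : ℝ) + 1)) ^ (j + 1))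
  refine h2.congr' ?_
  filter_upwards [eventually_gt_atTop 0] with L hL
  simp only [Function.comp, laplaceMean]
  have h3 : ∀ i, f i * exp (-(ℓ i / L)) * exp (-(ℓ i / L)) ^ m =
      f i * exp (-(((m : ℝ) + 1) / L * ℓ i)) := by
    intro i
    rw [← exp_nat_mul, mul_assoc, ← exp_add]
    congr 2
    ring
  simp_rw [h3]
  rw [div_pow, one_div, inv_pow]
  field_simp

theorem tendsto_laplaceMean_polynomial (hf : ∀ i, 0 ≤ f i) (hℓ : ∀ i, 0 ≤ ℓ i)
    (hsum : ∀ s > 0, Summable fun i ↦ f i * exp (-(s * ℓ i)))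
    (hlim : Tendsto (fun s ↦ s ^ (j + 1) * ∑' i, f i * exp (-(s * ℓ i))) (𝓝[>] 0) (𝓝 c))
    (p : Polynomial ℝ) :
    Tendsto (laplaceMean f ℓ j fun x ↦ p.eval x) atTop
      (𝓝 (c * ∫ t in Ioi (0 : ℝ), p.eval (exp (-t)) * gammaWeight j t)) := by
  have hb : ∀ m : ℕ, ∀ x ∈ Icc (0 : ℝ) 1, |x ^ m| ≤ 1 := fun m x hx ↦ by
    rw [abs_of_nonneg (pow_nonneg hx.1 _)]; exact pow_le_one₀ hx.1 hx.2
  have h1 : (c * ∫ t in Ioi (0 : ℝ), p.eval (exp (-t)) * gammaWeight j t) =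
      ∑ m ∈ Finset.range (p.natDegree + 1),
        p.coeff m * (c * ∫ t in Ioi (0 : ℝ), exp (-t) ^ m * gammaWeight j t) := by
    simp_rw [Polynomial.eval_eq_sum_range, Finset.sum_mul]
    rw [integral_finsetSum, Finset.mul_sum]
    · refine Finset.sum_congr rfl fun m _ ↦ ?_
      simp_rw [mul_assoc]
      rw [integral_const_mul]
      ring
    · intro m _
      simp_rw [mul_assoc]
      exact (integrableOn_comp_exp_mul_gammaWeight j (h := fun x ↦ x ^ m)
        (by fun_prop) (hb m)).const_mul _
  rw [h1]
  refine (tendsto_finsetSum _ fun m _ ↦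
    (tendsto_laplaceMean_pow hlim m).const_mul (p.coeff m)).congr' ?_
  filter_upwards [eventually_gt_atTop 0] with L hL
  simp only [laplaceMean, Polynomial.eval_eq_sum_range, Finset.mul_sum]
  rw [Summable.tsum_finsetSum, Finset.sum_div]
  · refine Finset.sum_congr rfl fun m _ ↦ ?_
    rw [← mul_div_assoc, ← tsum_mul_left]
    congr 2
    ext i; ring
  · intro m _
    refine ((summable_laplaceMean hf hℓ hsum (hb m) hL).mul_left (p.coeff m)).congr fun i ↦ ?_
    ring

theorem exists_abs_le_of_continuousOn_Icc {h : ℝ → ℝ} (hh : ContinuousOn h (Icc 0 1)) :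
    ∃ M, 0 ≤ M ∧ ∀ x ∈ Icc (0 : ℝ) 1, |h x| ≤ M := by
  obtain ⟨M, hM⟩ := isCompact_Icc.exists_bound_of_continuousOn hh
  exact ⟨M, (abs_nonneg _).trans (hM 0 (by simp)), hM⟩

theorem abs_integral_sub_le {h₁ h₂ g : ℝ → ℝ}
    (h1 : IntegrableOn (fun t ↦ h₁ (exp (-t)) * gammaWeight j t) (Ioi 0))
    (h2 : IntegrableOn (fun t ↦ h₂ (exp (-t)) * gammaWeight j t) (Ioi 0))
    (h3 : IntegrableOn (fun t ↦ g (exp (-t)) * gammaWeight j t) (Ioi 0))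
    (hg : ∀ x ∈ Icc (0 : ℝ) 1, |h₁ x - h₂ x| ≤ g x) :
    |(∫ t in Ioi (0 : ℝ), h₁ (exp (-t)) * gammaWeight j t) -
      ∫ t in Ioi (0 : ℝ), h₂ (exp (-t)) * gammaWeight j t| ≤
      ∫ t in Ioi (0 : ℝ), g (exp (-t)) * gammaWeight j t := by
  rw [← integral_sub h1 h2, ← Real.norm_eq_abs]
  refine norm_integral_le_of_norm_le h3 ?_
  filter_upwards [ae_restrict_mem measurableSet_Ioi] with t ht
  rw [← sub_mul, norm_mul, Real.norm_eq_abs, Real.norm_eq_abs,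
    abs_of_nonneg (gammaWeight_nonneg j ht)]
  exact mul_le_mul_of_nonneg_right (hg _ (exp_neg_mem_Icc (le_of_lt ht)))
    (gammaWeight_nonneg j ht)

theorem tendsto_laplaceMean_continuous (hf : ∀ i, 0 ≤ f i) (hℓ : ∀ i, 0 ≤ ℓ i)
    (hsum : ∀ s > 0, Summable fun i ↦ f i * exp (-(s * ℓ i)))
    (hlim : Tendsto (fun s ↦ s ^ (j + 1) * ∑' i, f i * exp (-(s * ℓ i))) (𝓝[>] 0) (𝓝 c))
    {h : ℝ → ℝ} (hh : ContinuousOn h (Icc 0 1)) :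
    Tendsto (laplaceMean f ℓ j h) atTop
      (𝓝 (c * ∫ t in Ioi (0 : ℝ), h (exp (-t)) * gammaWeight j t)) := by
  refine tendsto_of_forall_approx fun ε hε ↦ ?_
  have hd : 0 < |c| + 1 := by positivity
  obtain ⟨p, hp⟩ := exists_polynomial_near_of_continuousOn 0 1 h hh (ε / (|c| + 1))
    (by positivity)
  have hcp : ContinuousOn (fun x ↦ p.eval x) (Icc (0 : ℝ) 1) := p.continuous.continuousOn
  obtain ⟨M₁, -, hM₁⟩ := exists_abs_le_of_continuousOn_Icc hh
  obtain ⟨M₂, -, hM₂⟩ := exists_abs_le_of_continuousOn_Icc hcp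
  have hg : ∀ x ∈ Icc (0 : ℝ) 1, |h x - p.eval x| ≤ ε / (|c| + 1) := fun x hx ↦ by
    rw [abs_sub_comm]; exact (hp x hx).le
  refine ⟨_, _, tendsto_laplaceMean_polynomial hf hℓ hsum hlim p, ?_, ?_⟩
  · have hcst : Tendsto (laplaceMean f ℓ j fun _ ↦ ε / (|c| + 1)) atTop
        (𝓝 (c * (ε / (|c| + 1)))) := by
      have := tendsto_laplaceMean_polynomial hf hℓ hsum hlim (Polynomial.C (ε / (|c| + 1)))
      simp only [Polynomial.eval_C] at this
      rwa [integral_const_mul, integral_gammaWeight, mul_one] at this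
    have hlt : c * (ε / (|c| + 1)) < ε := by
      rw [← mul_div_assoc, div_lt_iff₀ hd]
      nlinarith [le_abs_self c]
    filter_upwards [hcst.eventually_lt_const hlt, eventually_gt_atTop 0] with L hL1 hL
    exact (abs_laplaceMean_sub_le hf hℓ hsum hM₁ hM₂ (M := |ε / (|c| + 1)|)
      (fun _ _ ↦ le_rfl) hg hL).trans hL1.le
  · rw [← mul_sub, abs_mul]
    have := abs_integral_sub_le (j := j) (g := fun _ ↦ ε / (|c| + 1))
      (integrableOn_comp_exp_mul_gammaWeight j hh.aestronglyMeasurable_comp_exp_neg hM₁)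
      (integrableOn_comp_exp_mul_gammaWeight j hcp.aestronglyMeasurable_comp_exp_neg hM₂)
      ((integrableOn_gammaWeight j : Integrable _ _).const_mul (ε / (|c| + 1)) :) hg
    rw [integral_const_mul, integral_gammaWeight, mul_one] at this
    calc _ ≤ |c| * (ε / (|c| + 1)) := by gcongr
      _ ≤ ε := by
        rw [← mul_div_assoc, div_le_iff₀ hd]
        nlinarith

theorem tendsto_integral_tent {y M : ℝ} :
    Tendsto (fun n : ℕ ↦ ∫ t in Ioi (0 : ℝ),
      (M * max 0 (1 - |exp (-t) - y| * (n : ℝ))) * gammaWeight j t) atTop (𝓝 0) := by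
  have h0 : (0 : ℝ) = ∫ t in Ioi (0 : ℝ), (fun _ ↦ (0 : ℝ)) t := by simp
  conv => enter [3, 1]; rw [h0]
  refine tendsto_integral_of_dominated_convergence (fun t ↦ |M| * gammaWeight j t) ?_
    (Integrable.const_mul (integrableOn_gammaWeight j) _) ?_ ?_
  · intro n
    refine Continuous.aestronglyMeasurable ?_
    unfold gammaWeight
    fun_prop
  · intro n
    filter_upwards [ae_restrict_mem measurableSet_Ioi] with t ht
    rw [norm_mul, norm_mul, Real.norm_eq_abs, Real.norm_eq_abs, Real.norm_eq_abs,
      abs_of_nonneg (gammaWeight_nonneg j ht),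
      abs_of_nonneg (le_max_left 0 (1 - |exp (-t) - y| * (n : ℝ)))]
    refine mul_le_mul_of_nonneg_right ?_ (gammaWeight_nonneg j ht)
    refine mul_le_of_le_one_right (abs_nonneg _) (max_le zero_le_one ?_)
    have : 0 ≤ |exp (-t) - y| * (n : ℝ) := by positivity
    linarith
  · have hne : ∀ᵐ t ∂(volume.restrict (Ioi (0 : ℝ))), t ≠ -log y :=
      ae_restrict_of_ae (by simp [ae_iff, measure_singleton])
    filter_upwards [hne] with t ht
    have hpos : 0 < |exp (-t) - y| := by
      rw [abs_pos, sub_ne_zero]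
      intro h
      exact ht (by rw [← h, log_exp, neg_neg])
    refine tendsto_const_nhds.congr' ?_
    have h2 : Tendsto (fun n : ℕ ↦ |exp (-t) - y| * (n : ℝ)) atTop atTop :=
      tendsto_natCast_atTop_atTop.const_mul_atTop hpos
    filter_upwards [h2.eventually_ge_atTop 1] with n hn
    rw [max_eq_left (by linarith)]
    simp

/-- The Karamata Tauberian theorem, for a continuous test function cut off to the right of `a`. -/
theorem karamata (hf : ∀ i, 0 ≤ f i) (hℓ : ∀ i, 0 ≤ ℓ i)
    (hsum : ∀ s > 0, Summable fun i ↦ f i * exp (-(s * ℓ i)))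
    (hlim : Tendsto (fun s ↦ s ^ (j + 1) * ∑' i, f i * exp (-(s * ℓ i))) (𝓝[>] 0) (𝓝 c))
    {φ : ℝ → ℝ} (hφ : Continuous φ) {a : ℝ} (ha : 0 ≤ a) :
    Tendsto (fun L : ℝ ↦ (∑' i, f i * (if ℓ i ≤ a * L then φ (ℓ i / L) else 0)) / L ^ (j + 1))
      atTop (𝓝 (c * ∫ t in (0 : ℝ)..a, φ t * (t ^ j / (j.factorial : ℝ)))) := by
  set y := exp (-a) with hy
  have hy0 : 0 < y := exp_pos _
  set Φ : ℝ → ℝ := fun x ↦ φ (-log (max x y)) / max x y with hΦ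
  have hmax : ∀ x, 0 < max x y := fun x ↦ lt_max_of_lt_right hy0
  have hΦc : Continuous Φ := by
    refine Continuous.div (hφ.comp ?_) (by fun_prop) fun x ↦ (hmax x).ne'
    exact (Continuous.log (by fun_prop) fun x ↦ (hmax x).ne').neg
  set H : ℝ → ℝ := fun x ↦ if y ≤ x then Φ x else 0 with hH
  obtain ⟨M, hM0, hM⟩ := exists_abs_le_of_continuousOn_Icc hΦc.continuousOn
  have hHM : ∀ x ∈ Icc (0 : ℝ) 1, |H x| ≤ M := fun x hx ↦ by
    simp only [hH]; split_ifs
    · exact hM x hx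
    · simpa using hM0
  have hkey : Tendsto (laplaceMean f ℓ j H) atTop
      (𝓝 (c * ∫ t in Ioi (0 : ℝ), H (exp (-t)) * gammaWeight j t)) := by
    refine tendsto_of_forall_approx fun ε hε ↦ ?_
    have htent := (tendsto_integral_tent (j := j) (M := M) (y := y)).const_mul |c|
    rw [mul_zero] at htent
    obtain ⟨n, hn⟩ := (htent.eventually_lt_const hε).exists
    set g : ℝ → ℝ := fun x ↦ M * max 0 (1 - |x - y| * (n : ℝ)) with hg
    have hgc : Continuous g := by fun_prop
    set H' : ℝ → ℝ := fun x ↦ (if y ≤ x then 1 else max 0 (1 - |x - y| * (n : ℝ))) * Φ x with hH'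
    have hH'c : Continuous H' := by
      refine Continuous.mul ?_ hΦc
      refine Continuous.if_le (by fun_prop) (by fun_prop) (by fun_prop) (by fun_prop) ?_
      intro x hx
      simp [hx]
    have hdiff : ∀ x ∈ Icc (0 : ℝ) 1, |H x - H' x| ≤ g x := fun x hx ↦ by
      simp only [hH, hH', hg]
      split_ifs with h
      · simp only [one_mul, sub_self, abs_zero]; positivity
      · rw [zero_sub, abs_neg, abs_mul, abs_of_nonneg (le_max_left _ _), mul_comm]
        exact mul_le_mul_of_nonneg_right (hM x hx) (le_max_left _ _)
    obtain ⟨M', -, hM'⟩ := exists_abs_le_of_continuousOn_Icc hH'c.continuousOn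
    obtain ⟨M'', -, hM''⟩ := exists_abs_le_of_continuousOn_Icc hgc.continuousOn
    have hcH' := tendsto_laplaceMean_continuous hf hℓ hsum hlim hH'c.continuousOn
    have hcg := tendsto_laplaceMean_continuous hf hℓ hsum hlim hgc.continuousOn
    refine ⟨_, _, hcH', ?_, ?_⟩
    · have hlt : c * ∫ t in Ioi (0 : ℝ), g (exp (-t)) * gammaWeight j t < ε := by
        refine lt_of_le_of_lt ?_ hn
        refine mul_le_mul_of_nonneg_right (le_abs_self c) ?_
        refine setIntegral_nonneg measurableSet_Ioi fun t ht ↦ ?_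
        exact mul_nonneg (mul_nonneg hM0 (le_max_left _ _)) (gammaWeight_nonneg j ht)
      filter_upwards [hcg.eventually_lt_const hlt, eventually_gt_atTop 0] with L hL1 hL
      exact (abs_laplaceMean_sub_le hf hℓ hsum hHM hM' hM'' hdiff hL).trans hL1.le
    · rw [← mul_sub, abs_mul]
      refine le_trans ?_ hn.le
      refine mul_le_mul_of_nonneg_left ?_ (abs_nonneg c)
      have hHm : Measurable H := Measurable.ite measurableSet_Ici hΦc.measurable measurable_const
      exact abs_integral_sub_le
        (integrableOn_comp_exp_mul_gammaWeight j
          (hHm.comp (by fun_prop)).aestronglyMeasurable hHM)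
        (integrableOn_comp_exp_mul_gammaWeight j
          hH'c.continuousOn.aestronglyMeasurable_comp_exp_neg hM')
        (integrableOn_comp_exp_mul_gammaWeight j
          hgc.continuousOn.aestronglyMeasurable_comp_exp_neg hM'') hdiff
  have hHexp : ∀ t, H (exp (-t)) = if t ≤ a then φ t / exp (-t) else 0 := fun t ↦ by
    simp only [hH, hΦ, hy, exp_le_exp, neg_le_neg_iff]
    split_ifs with h
    · rw [max_eq_left (by rw [exp_le_exp]; linarith), log_exp, neg_neg]
    · rfl
  have h_int : ∫ t in Ioi (0 : ℝ), H (exp (-t)) * gammaWeight j t =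
      ∫ t in (0 : ℝ)..a, φ t * (t ^ j / (j.factorial : ℝ)) := by
    rw [intervalIntegral.integral_of_le ha, ← Ioi_inter_Iic, ← setIntegral_indicator measurableSet_Iic]
    refine setIntegral_congr_fun measurableSet_Ioi fun t _ ↦ ?_
    simp only [hHexp, indicator, mem_Iic, gammaWeight]
    split_ifs
    · field_simp
    · simp
  rw [← h_int]
  refine hkey.congr' ?_
  filter_upwards [eventually_gt_atTop 0] with L hL
  simp only [laplaceMean, hHexp]
  congr 2
  ext i
  simp only [mul_assoc, div_le_iff₀ hL]
  split_ifs
  · field_simp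
  · simp

end

end Karamata

section EulerLaplace

open Filter Topology Real

/-- Local factor `1 - p^{-1-s}` of the inverse zeta function (and `1` at non-primes). -/
noncomputable def zetaFactor (s : ℝ) (p : ℕ) : ℝ :=
  if p.Prime then 1 - (p : ℝ) ^ (-(1 + s)) else 1

theorem hasProd_zetaFactor {s : ℝ} (hs : 0 < s) :
    HasProd (zetaFactor s) (∑' n : ℕ, 1 / (n : ℝ) ^ (1 + s))⁻¹ := by
  set h : ℕ →*₀ ℝ :=
    { toFun := fun n ↦ (n : ℝ) ^ (-(1 + s))
      map_zero' := by simp only [Nat.cast_zero]; exact zero_rpow (by linarith)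
      map_one' := by simp
      map_mul' := fun m n ↦ by
        push_cast
        exact mul_rpow (by positivity) (by positivity) } with hh
  have hh' : ∀ n : ℕ, h n = ((n : ℝ) ^ (1 + s))⁻¹ := fun n ↦ rpow_neg (by positivity) _
  have hsum : Summable fun n : ℕ ↦ ((n : ℝ) ^ (1 + s))⁻¹ :=
    Real.summable_nat_rpow_inv.2 (by linarith)
  have h1 : Summable fun n ↦ ‖h n‖ := by
    refine hsum.congr fun n ↦ ?_
    rw [hh', Real.norm_of_nonneg (by positivity)]
  have h2 := EulerProduct.eulerProduct_completely_multiplicative_hasProd h1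
  have hpos : 0 < ∑' n, h n := by
    have : Summable h := hsum.congr fun n ↦ (hh' n).symm
    refine this.tsum_pos (fun n ↦ ?_) 1 ?_
    · rw [hh']; positivity
    · simp
  have h3 := h2.inv₀ hpos.ne'
  simp only [inv_inv] at h3
  have h4 : HasProd (fun p : {p : ℕ | p.Prime} ↦ (1 - h (p : ℕ))) (∑' n, h n)⁻¹ := h3
  have h5 := (hasProd_subtype_iff_mulIndicator (f := fun p : ℕ ↦ 1 - h p)
    (s := {p : ℕ | p.Prime})).1 h4
  have h6 : (∑' n, h n) = ∑' n : ℕ, 1 / (n : ℝ) ^ (1 + s) := by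
    refine tsum_congr fun n ↦ ?_
    rw [hh', one_div]
  rw [h6] at h5
  convert h5 using 1
  ext p
  simp [zetaFactor, Set.mulIndicator, hh]

theorem tendsto_mul_zeta :
    Tendsto (fun s : ℝ ↦ s * ∑' n : ℕ, 1 / (n : ℝ) ^ (1 + s)) (𝓝[>] 0) (𝓝 1) := by
  have h1 : Tendsto (fun s : ℝ ↦ 1 + s) (𝓝[>] 0) (𝓝[>] 1) := by
    refine tendsto_nhdsWithin_iff.2 ⟨?_, ?_⟩
    · have : Tendsto (fun s : ℝ ↦ 1 + s) (𝓝 0) (𝓝 (1 + 0)) := by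
        exact Continuous.tendsto (by fun_prop) _
      rw [add_zero] at this
      exact this.mono_left nhdsWithin_le_nhds
    · filter_upwards [self_mem_nhdsWithin] with s hs
      simpa using hs
  refine (tendsto_sub_mul_tsum_nat_rpow.comp h1).congr fun s ↦ ?_
  simp

theorem summable_const_div_sq (C : ℝ) : Summable fun p : ℕ ↦ C / (p : ℝ) ^ 2 := by
  simp only [div_eq_mul_inv]
  exact (Real.summable_nat_pow_inv.2 (by norm_num)).mul_left C

section

variable {f : ℕ → ℝ} {k : ℕ} {C K : ℝ}

theorem summable_mul_exp_log (hf0 : ∀ p, 0 ≤ f p) (hfK : ∀ p, f p ≤ K / p) {s : ℝ} (hs : 0 < s) :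
    Summable fun p : ℕ ↦ f p * exp (-(s * log p)) := by
  have h : Summable fun p : ℕ ↦ K * ((p : ℝ) ^ (1 + s))⁻¹ :=
    (Real.summable_nat_rpow_inv.2 (by linarith)).mul_left K
  refine Summable.of_nonneg_of_le (fun p ↦ mul_nonneg (hf0 p) (exp_pos _).le) (fun p ↦ ?_) h
  rcases Nat.eq_zero_or_pos p with rfl | hp
  · have := hfK 0
    simp only [Nat.cast_zero, div_zero] at this
    simp only [Nat.cast_zero, log_zero, mul_zero, neg_zero, exp_zero, mul_one]
    rw [zero_rpow (by linarith)]
    simpa using this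
  · have hp' : (0 : ℝ) < p := by exact_mod_cast hp
    have h1 : exp (-(s * log p)) = ((p : ℝ) ^ s)⁻¹ := by
      rw [exp_neg, rpow_def_of_pos hp', mul_comm]
    rw [h1, rpow_add hp', rpow_one, mul_inv, ← mul_assoc, ← div_eq_mul_inv K]
    gcongr
    exact hfK p

theorem prod_mul_exp_sum (A : Finset ℕ) (s : ℝ) :
    (∏ p ∈ A, f p) * exp (-(s * ∑ p ∈ A, log p)) = ∏ p ∈ A, (f p * exp (-(s * log p))) := by
  rw [Finset.prod_mul_distrib, ← exp_sum, Finset.mul_sum, Finset.sum_neg_distrib]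

theorem summable_finset_laplace (hf0 : ∀ p, 0 ≤ f p) (hfK : ∀ p, f p ≤ K / p) :
    ∀ s > 0, Summable fun A : Finset ℕ ↦ (∏ p ∈ A, f p) * exp (-(s * ∑ p ∈ A, log p)) := by
  intro s hs
  simp only [prod_mul_exp_sum]
  exact summable_finsetProd_of_summable_nonneg
    (fun p ↦ mul_nonneg (hf0 p) (exp_pos _).le) (summable_mul_exp_log hf0 hfK hs)

theorem tendsto_finset_laplace (hf0 : ∀ p, 0 ≤ f p) (hfK : ∀ p, f p ≤ K / p)
    (hfC : ∀ s > 0, ∀ p, |(1 + f p * exp (-(s * log p))) * zetaFactor s p ^ k - 1| ≤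
      C / (p : ℝ) ^ 2) :
    Tendsto (fun s ↦ s ^ k * ∑' A : Finset ℕ, (∏ p ∈ A, f p) * exp (-(s * ∑ p ∈ A, log p)))
      (𝓝[>] 0) (𝓝 (∏' p, (1 + ((1 + f p) * zetaFactor 0 p ^ k - 1)))) := by
  have hdc : Tendsto (fun s ↦ ∏' p, (1 + ((1 + f p * exp (-(s * log p))) * zetaFactor s p ^ k - 1)))
      (𝓝[>] 0) (𝓝 (∏' p, (1 + ((1 + f p) * zetaFactor 0 p ^ k - 1)))) := by
    refine tendsto_tprod_one_add_of_dominated_convergence (summable_const_div_sq C) ?_ ?_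
    · intro p
      have hcont : Continuous fun s ↦
          (1 + f p * exp (-(s * log p))) * zetaFactor s p ^ k - 1 := by
        have : Continuous fun s ↦ zetaFactor s p := by
          unfold zetaFactor
          split_ifs with hp
          · have : (p : ℝ) ≠ 0 := by exact_mod_cast hp.ne_zero
            exact continuous_const.sub
              ((continuous_const_rpow this).comp (by fun_prop))
          · fun_prop
        fun_prop
      have := (hcont.tendsto 0).mono_left (nhdsWithin_le_nhds (s := Set.Ioi 0))
      simpa using this
    · filter_upwards [self_mem_nhdsWithin] with s hs p
      exact hfC s hs p
  have hz := (tendsto_mul_zeta.pow k).mul hdc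
  rw [one_pow, one_mul] at hz
  refine hz.congr' ?_
  filter_upwards [self_mem_nhdsWithin] with s hs
  have hs : 0 < s := hs
  have hsummable := summable_mul_exp_log hf0 hfK hs
  have h1 := tprod_one_add (summable_finsetProd_of_summable_nonneg
    (fun p ↦ mul_nonneg (hf0 p) (exp_pos _).le) hsummable)
  simp only [prod_mul_exp_sum]
  rw [← h1]
  have hm1 : Multipliable fun p ↦ 1 + f p * exp (-(s * log p)) :=
    Real.multipliable_one_add_of_summable hsummable
  have hp := hasProd_zetaFactor hs
  have h2 : ∏' p, (1 + ((1 + f p * exp (-(s * log p))) * zetaFactor s p ^ k - 1)) =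
      (∏' p, (1 + f p * exp (-(s * log p)))) * ((∑' n : ℕ, 1 / (n : ℝ) ^ (1 + s))⁻¹) ^ k := by
    rw [← (hp.pow k).tprod_eq, ← hm1.tprod_mul (hp.pow k).multipliable]
    exact tprod_congr fun p ↦ by ring
  rw [h2]
  have hpos : (∑' n : ℕ, 1 / (n : ℝ) ^ (1 + s)) ≠ 0 := by
    have hsum : Summable fun n : ℕ ↦ 1 / (n : ℝ) ^ (1 + s) := by
      simpa using Real.summable_nat_rpow_inv.2 (show 1 < 1 + s by linarith)
    refine (hsum.tsum_pos (fun n ↦ by positivity) 1 ?_).ne'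
    simp
  rw [mul_pow, inv_pow]
  field_simp

end

/-- Sieve weight `k / (p - b)` at primes `p > w`. -/
noncomputable def sieveWeight (k b w p : ℕ) : ℝ :=
  if p.Prime ∧ w < p then (k : ℝ) / ((p : ℝ) - b) else 0

theorem sieveWeight_of_prime {k b w p : ℕ} (hp : p.Prime) (hw : w < p) :
    sieveWeight k b w p = (k : ℝ) / ((p : ℝ) - b) := if_pos ⟨hp, hw⟩

theorem sieveWeight_nonneg {b w : ℕ} (hbw : b ≤ w) (k p : ℕ) : 0 ≤ sieveWeight k b w p := by
  unfold sieveWeight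
  split_ifs with h
  · have : (b : ℝ) ≤ p := by exact_mod_cast hbw.trans h.2.le
    exact div_nonneg (by positivity) (by linarith)
  · exact le_rfl

theorem sieveWeight_le {b w : ℕ} (hbw : 2 * b ≤ w) (k p : ℕ) :
    sieveWeight k b w p ≤ (2 * k : ℝ) / p := by
  unfold sieveWeight
  split_ifs with h
  · have h1 : (2 * b : ℝ) < p := by exact_mod_cast lt_of_le_of_lt hbw h.2
    have h0 : (0 : ℝ) ≤ b := by positivity
    rw [div_le_div_iff₀ (by linarith) (by linarith)]
    have hk : (0 : ℝ) ≤ k := by positivity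
    nlinarith
  · positivity

theorem zetaFactor_zero {p : ℕ} (hp : p.Prime) : zetaFactor 0 p = 1 - 1 / (p : ℝ) := by
  simp [zetaFactor, hp, rpow_neg_one]

theorem abs_pow_sub_le {k : ℕ} (hk : k = 1 ∨ k = 2 ∨ k = 3) {x : ℝ} (hx0 : 0 ≤ x) (hx1 : x ≤ 1) :
    |(1 + k * x) * (1 - x) ^ k - 1| ≤ 6 * x ^ 2 := by
  have h2 : 0 ≤ x ^ 2 := by positivity
  rw [abs_le]
  rcases hk with rfl | rfl | rfl <;> push_cast
  · constructor <;> nlinarith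
  · constructor <;> nlinarith [mul_nonneg h2 hx0, mul_nonneg h2 (sub_nonneg.2 hx1)]
  · have h3 := mul_nonneg h2 hx0
    have h4 := mul_nonneg h3 (sub_nonneg.2 hx1)
    have h5 := mul_nonneg h2 (sub_nonneg.2 hx1)
    constructor <;> nlinarith

theorem abs_sieveWeight_factor_le {k b w : ℕ} (hk : k = 1 ∨ k = 2 ∨ k = 3) (hb : b ≤ 3)
    (hw : 6 ≤ w) {s : ℝ} (hs : 0 < s) (p : ℕ) :
    |(1 + sieveWeight k b w p * exp (-(s * log p))) * zetaFactor s p ^ k - 1| ≤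
      (24 + (w : ℝ) ^ 2) / (p : ℝ) ^ 2 := by
  by_cases hp : p.Prime
  · have hp0 : (0 : ℝ) < p := by exact_mod_cast hp.pos
    have hp1 : (1 : ℝ) ≤ p := by exact_mod_cast hp.one_lt.le
    set y := exp (-(s * log p)) with hy
    have hy0 : 0 < y := exp_pos _
    have hy1 : y ≤ 1 := exp_le_one_iff.2 (by
      have := mul_nonneg hs.le (log_nonneg hp1); linarith)
    have hzx : zetaFactor s p = 1 - y / p := by
      simp only [zetaFactor, hp, if_true]
      rw [neg_add, rpow_add hp0, rpow_neg_one, rpow_def_of_pos hp0, hy]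
      ring_nf
    set x := y / p with hx
    have hx0 : 0 ≤ x := by positivity
    have hxp : x ≤ 1 / p := by rw [hx]; gcongr
    have hx1 : x ≤ 1 := hxp.trans (by rw [div_le_one hp0]; exact hp1)
    have hk3 : (k : ℝ) ≤ 3 := by rcases hk with rfl | rfl | rfl <;> norm_num
    have hpw0 : 0 ≤ (1 - x) ^ k := pow_nonneg (by linarith) _
    have hpw1 : (1 - x) ^ k ≤ 1 := pow_le_one₀ (by linarith) (by linarith)
    rw [hzx]
    by_cases hwp : w < p
    · have hb3 : (b : ℝ) ≤ 3 := by exact_mod_cast hb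
      have hp7 : (6 : ℝ) < p := by exact_mod_cast lt_of_le_of_lt hw hwp
      have hb0 : (0 : ℝ) ≤ b := by positivity
      have hk0 : (0 : ℝ) ≤ k := by positivity
      set e := (k : ℝ) * y * b / (p * (p - b)) with he
      have hdec : sieveWeight k b w p * y = k * x + e := by
        rw [sieveWeight_of_prime hp hwp, he, hx]
        have : (p : ℝ) - b ≠ 0 := by linarith
        field_simp
        ring
      have he0 : 0 ≤ e := div_nonneg (by positivity) (mul_nonneg hp0.le (by linarith))
      have he1 : e ≤ 18 / (p : ℝ) ^ 2 := by
        have h9 : (k : ℝ) * y * b ≤ 9 := by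
          calc (k : ℝ) * y * b ≤ 3 * 1 * 3 := by gcongr
            _ = 9 := by norm_num
        rw [he, div_le_div_iff₀ (mul_pos hp0 (by linarith)) (by positivity)]
        have : (p : ℝ) ^ 2 ≤ 2 * (p * (p - b)) := by nlinarith
        nlinarith [sq_nonneg (p : ℝ)]
      have hsplit : (1 + sieveWeight k b w p * y) * (1 - x) ^ k - 1 =
          ((1 + k * x) * (1 - x) ^ k - 1) + e * (1 - x) ^ k := by rw [hdec]; ring
      rw [hsplit]
      have h6 : 6 * x ^ 2 ≤ 6 / (p : ℝ) ^ 2 := by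
        have : x ^ 2 ≤ (1 / p) ^ 2 := by gcongr
        rw [one_div, inv_pow] at this
        rw [div_eq_mul_inv]; linarith
      calc _ ≤ |(1 + k * x) * (1 - x) ^ k - 1| + |e * (1 - x) ^ k| := abs_add_le _ _
        _ ≤ 6 * x ^ 2 + e := by
          refine add_le_add (abs_pow_sub_le hk hx0 hx1) ?_
          rw [abs_of_nonneg (mul_nonneg he0 hpw0)]
          exact mul_le_of_le_one_right he0 hpw1
        _ ≤ 6 / (p : ℝ) ^ 2 + 18 / (p : ℝ) ^ 2 := by linarith
        _ = 24 / (p : ℝ) ^ 2 := by ring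
        _ ≤ _ := by gcongr; nlinarith [sq_nonneg (w : ℝ)]
    · have h0 : sieveWeight k b w p = 0 := if_neg fun h ↦ hwp h.2
      rw [h0, zero_mul, add_zero, one_mul, abs_of_nonpos (by linarith)]
      have hwp' : (p : ℝ) ≤ w := by exact_mod_cast not_lt.1 hwp
      rw [le_div_iff₀ (by positivity)]
      have h1 : (p : ℝ) ^ 2 ≤ (w : ℝ) ^ 2 := by gcongr
      have h2 : -((1 - x) ^ k - 1) * (p : ℝ) ^ 2 ≤ 1 * (p : ℝ) ^ 2 := by
        gcongr; linarith
      linarith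
  · have h0 : sieveWeight k b w p = 0 := if_neg fun h ↦ hp h.1
    simp only [h0, zetaFactor, hp, if_false]
    simp
    positivity

/-- The singular constant attached to `sieveWeight k b w` in dimension `k`. -/
noncomputable def sieveConst (k b w : ℕ) : ℝ :=
  ∏' p, (1 + ((1 + sieveWeight k b w p) * zetaFactor 0 p ^ k - 1))

theorem tendsto_sieveWeight_laplace {k b w : ℕ} (hk : k = 1 ∨ k = 2 ∨ k = 3) (hb : b ≤ 3)
    (hw : 6 ≤ w) :
    Tendsto (fun s ↦ s ^ k * ∑' A : Finset ℕ, (∏ p ∈ A, sieveWeight k b w p) *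
      exp (-(s * ∑ p ∈ A, log p))) (𝓝[>] 0) (𝓝 (sieveConst k b w)) :=
  tendsto_finset_laplace (sieveWeight_nonneg (by omega) k) (sieveWeight_le (by omega) k)
    fun _ hs p ↦ abs_sieveWeight_factor_le hk hb hw hs p

theorem summable_sieveConst {k b w : ℕ} (hk : k = 1 ∨ k = 2 ∨ k = 3) (hb : b ≤ 3)
    (hw : 6 ≤ w) : Summable fun p ↦ |(1 + sieveWeight k b w p) * zetaFactor 0 p ^ k - 1| := by
  refine Summable.of_nonneg_of_le (fun _ ↦ abs_nonneg _) (fun p ↦ ?_)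
    (summable_const_div_sq (24 + (w : ℝ) ^ 2))
  have hc : Tendsto (fun s ↦ |(1 + sieveWeight k b w p * exp (-(s * log p))) *
      zetaFactor s p ^ k - 1|) (𝓝[>] 0)
      (𝓝 |(1 + sieveWeight k b w p) * zetaFactor 0 p ^ k - 1|) := by
    have hcont : Continuous fun s ↦ |(1 + sieveWeight k b w p * exp (-(s * log p))) *
        zetaFactor s p ^ k - 1| := by
      have : Continuous fun s ↦ zetaFactor s p := by
        unfold zetaFactor
        split_ifs with hp
        · have : (p : ℝ) ≠ 0 := by exact_mod_cast hp.ne_zero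
          exact continuous_const.sub ((continuous_const_rpow this).comp (by fun_prop))
        · fun_prop
      fun_prop
    have := (hcont.tendsto 0).mono_left (nhdsWithin_le_nhds (s := Set.Ioi 0))
    simpa using this
  refine le_of_tendsto hc ?_
  filter_upwards [self_mem_nhdsWithin] with s hs
  exact abs_sieveWeight_factor_le hk hb hw hs p

theorem multipliable_sieveConst {k b w : ℕ} (hk : k = 1 ∨ k = 2 ∨ k = 3) (hb : b ≤ 3)
    (hw : 6 ≤ w) :
    Multipliable fun p ↦ (1 + ((1 + sieveWeight k b w p) * zetaFactor 0 p ^ k - 1)) :=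
  Real.multipliable_one_add_of_summable (summable_sieveConst hk hb hw).of_abs

/-- The density `∏_{p ≤ w} (1 - 1/p)`. -/
noncomputable def mertensProd (w : ℕ) : ℝ :=
  ∏ p ∈ (Finset.range (w + 1)).filter Nat.Prime, (1 - 1 / (p : ℝ))

theorem hasProd_mertensProd (w : ℕ) :
    HasProd (fun p ↦ if p.Prime ∧ p ≤ w then 1 - 1 / (p : ℝ) else 1) (mertensProd w) := by
  have : mertensProd w = ∏ p ∈ (Finset.range (w + 1)).filter Nat.Prime,
      (if p.Prime ∧ p ≤ w then 1 - 1 / (p : ℝ) else 1) := by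
    refine Finset.prod_congr rfl fun p hp ↦ ?_
    rw [Finset.mem_filter, Finset.mem_range] at hp
    rw [if_pos ⟨hp.2, by omega⟩]
  rw [this]
  refine hasProd_prod_of_ne_finset_one fun p hp ↦ ?_
  rw [Finset.mem_filter, Finset.mem_range] at hp
  exact if_neg fun h ↦ hp ⟨by omega, h.1⟩

theorem mertensProd_pos (w : ℕ) : 0 < mertensProd w := by
  refine Finset.prod_pos fun p hp ↦ ?_
  have : (1 : ℝ) < p := by exact_mod_cast (Finset.mem_filter.1 hp).2.one_lt
  rw [sub_pos, div_lt_one (by linarith)]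
  exact this

theorem sieveConst_one {w : ℕ} : sieveConst 1 1 w = mertensProd w := by
  rw [← (hasProd_mertensProd w).tprod_eq]
  refine tprod_congr fun p ↦ ?_
  by_cases hp : p.Prime
  · have h1 : (1 : ℝ) < p := by exact_mod_cast hp.one_lt
    by_cases hw : w < p
    · rw [sieveWeight_of_prime hp hw, zetaFactor_zero hp, if_neg (by omega)]
      have : (p : ℝ) - 1 ≠ 0 := by linarith
      push_cast
      field_simp
      ring
    · rw [zetaFactor_zero hp, if_pos ⟨hp, by omega⟩, sieveWeight, if_neg (by omega)]
      ring
  · simp [zetaFactor, sieveWeight, hp]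

theorem sieveConst_three {w : ℕ} (hw : 6 ≤ w) :
    sieveConst 3 3 w = mertensProd w * sieveConst 2 3 w := by
  rw [← (hasProd_mertensProd w).tprod_eq, sieveConst, sieveConst,
    ← (hasProd_mertensProd w).multipliable.tprod_mul
      (multipliable_sieveConst (by simp) le_rfl hw)]
  refine tprod_congr fun p ↦ ?_
  by_cases hp : p.Prime
  · have h1 : (1 : ℝ) < p := by exact_mod_cast hp.one_lt
    by_cases hwp : w < p
    · rw [sieveWeight_of_prime hp hwp, sieveWeight_of_prime hp hwp, zetaFactor_zero hp,
        if_neg (by omega)]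
      have h6 : (6 : ℝ) < p := by exact_mod_cast lt_of_le_of_lt hw hwp
      have : (p : ℝ) - 3 ≠ 0 := by linarith
      push_cast
      field_simp
      ring
    · rw [zetaFactor_zero hp, if_pos ⟨hp, by omega⟩, sieveWeight, if_neg (by omega), sieveWeight,
        if_neg (by omega)]
      ring
  · simp [zetaFactor, sieveWeight, hp]

theorem sieveConst_two_pos {w : ℕ} (hw : 6 ≤ w) : 0 < sieveConst 2 3 w := by
  have hne : sieveConst 2 3 w ≠ 0 := by
    refine tprod_one_add_ne_zero_of_summable (fun p ↦ ?_) ?_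
    · rw [add_sub_cancel]
      refine mul_ne_zero ?_ (pow_ne_zero _ ?_)
      · have := sieveWeight_nonneg (b := 3) (w := w) (by omega) 2 p
        linarith
      · by_cases hp : p.Prime
        · rw [zetaFactor_zero hp]
          have h1 : (1 : ℝ) < p := by exact_mod_cast hp.one_lt
          have : 1 / (p : ℝ) < 1 := by rw [div_lt_one (by linarith)]; exact h1
          linarith
        · simp [zetaFactor, hp]
    · simpa using summable_sieveConst (k := 2) (by simp) le_rfl hw
  refine lt_of_le_of_ne ?_ hne.symm
  refine ge_of_tendsto (tendsto_sieveWeight_laplace (k := 2) (by simp) le_rfl hw) ?_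
  filter_upwards [self_mem_nhdsWithin] with s hs
  have hs : 0 < s := hs
  refine mul_nonneg (by positivity) (tsum_nonneg fun A ↦ mul_nonneg ?_ (exp_pos _).le)
  exact Finset.prod_nonneg fun p _ ↦ sieveWeight_nonneg (by omega) 2 p

/-- Asymptotics of sums of `∏ k/(p-b)` over squarefree numbers free of primes `≤ w`. -/
theorem tendsto_sieveWeight_sum {k b w : ℕ} (hb : b ≤ 3) (hw : 6 ≤ w)
    (hk : k + 1 = 1 ∨ k + 1 = 2 ∨ k + 1 = 3) {φ : ℝ → ℝ} (hφ : Continuous φ) {a : ℝ}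
    (ha : 0 ≤ a) :
    Tendsto (fun L : ℝ ↦ (∑' A : Finset ℕ, (∏ p ∈ A, sieveWeight (k + 1) b w p) *
      (if ∑ p ∈ A, log p ≤ a * L then φ ((∑ p ∈ A, log p) / L) else 0)) / L ^ (k + 1))
      atTop (𝓝 (sieveConst (k + 1) b w *
        ∫ t in (0 : ℝ)..a, φ t * (t ^ k / (k.factorial : ℝ)))) :=
  karamata (f := fun A : Finset ℕ ↦ ∏ p ∈ A, sieveWeight (k + 1) b w p)
    (ℓ := fun A ↦ ∑ p ∈ A, log p)
    (fun _ ↦ Finset.prod_nonneg fun _ _ ↦ sieveWeight_nonneg (by omega) _ _)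
    (fun _ ↦ Finset.sum_nonneg fun _ _ ↦ log_natCast_nonneg _)
    (summable_finset_laplace (sieveWeight_nonneg (by omega) _) (sieveWeight_le (by omega) _))
    (tendsto_sieveWeight_laplace hk hb hw) hφ ha

end EulerLaplace

section PrimesAP

open Filter Topology Real ArithmeticFunction.vonMangoldt

/-- The primes in the interval `(y, z]`. -/
noncomputable def primesIoc (y z : ℝ) : Finset ℕ :=
  (Finset.range (⌊z⌋₊ + 1)).filter fun p ↦ p.Prime ∧ y < p ∧ (p : ℝ) ≤ z

theorem mem_primesIoc {y z : ℝ} {p : ℕ} :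
    p ∈ primesIoc y z ↔ p.Prime ∧ y < p ∧ (p : ℝ) ≤ z := by
  simp only [primesIoc, Finset.mem_filter, Finset.mem_range, and_iff_right_iff_imp]
  rintro ⟨-, -, h⟩
  exact Nat.lt_succ_of_le (Nat.le_floor h)

section

variable {q : ℕ} {a : ZMod q}

/-- The weight `log p / p` on the primes in a residue class. -/
noncomputable def primeClass (a : ZMod q) (p : ℕ) : ℝ :=
  if p.Prime ∧ (p : ZMod q) = a then log p / p else 0

theorem primeClass_nonneg (a : ZMod q) (p : ℕ) : 0 ≤ primeClass a p := by
  unfold primeClass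
  split_ifs <;> positivity

theorem tsum_residueClass_eq [NeZero q] (ha : IsUnit a) {x : ℝ} (hx : 1 < x) :
    ∑' n, residueClass a n / (n : ℝ) ^ x =
      (LFunctionResidueClassAux a x).re + (q.totient : ℝ)⁻¹ / (x - 1) := by
  refine Complex.ofReal_injective ?_
  simp only [Complex.ofReal_tsum, Complex.ofReal_div, Complex.ofReal_cpow (Nat.cast_nonneg _),
    Complex.ofReal_natCast, Complex.ofReal_add, Complex.ofReal_inv, Complex.ofReal_sub,
    Complex.ofReal_one]
  simp_rw [← LFunctionResidueClassAux_real ha hx,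
    eqOn_LFunctionResidueClassAux ha <| Set.mem_ofPred.mpr (Complex.ofReal_re x ▸ hx),
    sub_add_cancel, LSeries, LSeries.term]
  refine tsum_congr fun n ↦ ?_
  split_ifs with hn
  · simp only [hn, residueClass_apply_zero, Complex.ofReal_zero, zero_div]
  · rfl

theorem residueClass_div_rpow_eq (a : ZMod q) (s : ℝ) (n : ℕ) :
    residueClass a n / (n : ℝ) ^ (1 + s) =
      primeClass a n * exp (-(s * log n)) +
        (if n.Prime then 0 else residueClass a n) / n * exp (-(s * log n)) := by
  rcases Nat.eq_zero_or_pos n with rfl | hn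
  · simp [primeClass]
  have hn' : (0 : ℝ) < n := by exact_mod_cast hn
  have h1 : exp (-(s * log n)) = ((n : ℝ) ^ s)⁻¹ := by
    rw [exp_neg, rpow_def_of_pos hn', mul_comm]
  rw [h1, rpow_add hn', rpow_one]
  by_cases hp : n.Prime
  · have : primeClass a n = residueClass a n / n := by
      simp only [primeClass, hp, true_and, residueClass, Set.indicator, Set.mem_ofPred_eq,
        ArithmeticFunction.vonMangoldt_apply_prime hp]
      split_ifs <;> simp
    rw [this, if_pos hp]
    field_simp
    simp
  · have : primeClass a n = 0 := by simp [primeClass, hp]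
    rw [this, if_neg hp]
    field_simp
    simp

theorem summable_primeClass (a : ZMod q) {s : ℝ} (hs : 0 < s) :
    Summable fun p : ℕ ↦ primeClass a p * exp (-(s * log p)) := by
  have h : Summable fun p : ℕ ↦ (2 / s) * ((p : ℝ) ^ (1 + s / 2))⁻¹ :=
    (Real.summable_nat_rpow_inv.2 (by linarith)).mul_left _
  refine Summable.of_nonneg_of_le
    (fun p ↦ mul_nonneg (primeClass_nonneg a p) (exp_pos _).le) (fun p ↦ ?_) h
  unfold primeClass
  split_ifs with hp
  · have hp' : (0 : ℝ) < p := by exact_mod_cast hp.1.pos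
    have h1 : exp (-(s * log p)) = ((p : ℝ) ^ s)⁻¹ := by
      rw [exp_neg, rpow_def_of_pos hp', mul_comm]
    have h2 : log p ≤ (p : ℝ) ^ (s / 2) / (s / 2) := log_le_rpow_div hp'.le (by positivity)
    have h3 : (p : ℝ) ^ s = (p : ℝ) ^ (s / 2) * (p : ℝ) ^ (s / 2) := by
      rw [← rpow_add hp']; congr 1; ring
    rw [h1, rpow_add hp', rpow_one, h3]
    have h4 : 0 < (p : ℝ) ^ (s / 2) := by positivity
    calc log p / p * ((p : ℝ) ^ (s / 2) * (p : ℝ) ^ (s / 2))⁻¹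
        ≤ (p : ℝ) ^ (s / 2) / (s / 2) / p * ((p : ℝ) ^ (s / 2) * (p : ℝ) ^ (s / 2))⁻¹ := by
          gcongr
      _ = _ := by field_simp
  · simp only [zero_mul]; positivity

theorem tendsto_primeClass_laplace [NeZero q] (ha : IsUnit a) :
    Tendsto (fun s : ℝ ↦ s ^ (0 + 1) * ∑' p : ℕ, primeClass a p * exp (-(s * log p)))
      (𝓝[>] 0) (𝓝 (q.totient : ℝ)⁻¹) := by
  set N : ℕ → ℝ := fun n ↦ (if n.Prime then 0 else residueClass a n) / n with hN
  have hN0 : ∀ n, 0 ≤ N n := fun n ↦ by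
    simp only [hN]
    split_ifs
    · simp
    · exact div_nonneg (residueClass_nonneg a n) (by positivity)
  have hNs : Summable N := summable_residueClass_non_primes_div a
  have hNle : ∀ {s : ℝ}, 0 < s → ∀ n, N n * exp (-(s * log n)) ≤ N n := fun {s} hs n ↦ by
    refine mul_le_of_le_one_right (hN0 n) (exp_le_one_iff.2 ?_)
    have := log_natCast_nonneg n
    nlinarith
  have hNs' : ∀ {s : ℝ}, 0 < s → Summable fun n : ℕ ↦ N n * exp (-(s * log n)) := fun {s} hs ↦
    Summable.of_nonneg_of_le (fun n ↦ mul_nonneg (hN0 n) (exp_pos _).le) (hNle hs) hNs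
  have h1 : Tendsto (fun s : ℝ ↦ s * ∑' n : ℕ, N n * exp (-(s * log n))) (𝓝[>] 0) (𝓝 0) := by
    have h2 : Tendsto (fun s : ℝ ↦ s * ∑' n : ℕ, N n) (𝓝[>] 0) (𝓝 0) := by
      have : Tendsto (fun s : ℝ ↦ s * ∑' n : ℕ, N n) (𝓝 0) (𝓝 (0 * ∑' n : ℕ, N n)) :=
        Continuous.tendsto (by fun_prop) _
      rw [zero_mul] at this
      exact this.mono_left nhdsWithin_le_nhds
    refine tendsto_of_tendsto_of_tendsto_of_le_of_le' tendsto_const_nhds h2 ?_ ?_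
    · filter_upwards [self_mem_nhdsWithin] with s (hs : 0 < s)
      exact mul_nonneg hs.le (tsum_nonneg fun n ↦ mul_nonneg (hN0 n) (exp_pos _).le)
    · filter_upwards [self_mem_nhdsWithin] with s (hs : 0 < s)
      exact mul_le_mul_of_nonneg_left ((hNs' hs).tsum_le_tsum (hNle hs) hNs) hs.le
  have h3 : Tendsto (fun s : ℝ ↦ s * (LFunctionResidueClassAux a ((1 + s : ℝ) : ℂ)).re)
      (𝓝[>] 0) (𝓝 0) := by
    have hc : ContinuousOn (fun x : ℝ ↦ (LFunctionResidueClassAux a x).re) (Set.Ici 1) :=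
      Complex.continuous_re.continuousOn.comp (t := Set.univ)
        (continuousOn_LFunctionResidueClassAux a) (fun ⦃x⦄ a ↦ trivial) |>.comp
        Complex.continuous_ofReal.continuousOn fun x hx ↦ by
          simpa only [Set.mem_ofPred_eq, Complex.ofReal_re] using Set.mem_Ici.1 hx
    have h4 : Tendsto (fun s : ℝ ↦ 1 + s) (𝓝[>] 0) (𝓝[≥] 1) := by
      refine tendsto_nhdsWithin_iff.2 ⟨?_, ?_⟩
      · have : Tendsto (fun s : ℝ ↦ 1 + s) (𝓝 0) (𝓝 (1 + 0)) :=
          Continuous.tendsto (by fun_prop) _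
        rw [add_zero] at this
        exact this.mono_left nhdsWithin_le_nhds
      · filter_upwards [self_mem_nhdsWithin] with s (hs : 0 < s)
        simpa using hs.le
    have h5 := (hc 1 (by simp)).tendsto.comp h4
    have h6 : Tendsto (fun s : ℝ ↦ s) (𝓝[>] 0) (𝓝 0) := nhdsWithin_le_nhds
    simpa using h6.mul h5
  have h7 := (h3.add (tendsto_const_nhds (x := (q.totient : ℝ)⁻¹))).sub h1
  rw [zero_add, sub_zero] at h7
  refine h7.congr' ?_
  filter_upwards [self_mem_nhdsWithin] with s (hs : 0 < s)
  have h8 := tsum_residueClass_eq ha (x := 1 + s) (by linarith)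
  simp_rw [residueClass_div_rpow_eq a s] at h8
  rw [(summable_primeClass a hs).tsum_add (hNs' hs)] at h8
  have h9 : s * ((q.totient : ℝ)⁻¹ / (1 + s - 1)) = (q.totient : ℝ)⁻¹ := by
    rw [add_sub_cancel_left]; field_simp
  have h10 : ∑' p : ℕ, primeClass a p * exp (-(s * log p)) =
    (LFunctionResidueClassAux a ((1 + s : ℝ) : ℂ)).re + (q.totient : ℝ)⁻¹ / (1 + s - 1)
      - ∑' n : ℕ, N n * exp (-(s * log n)) := by rw [← h8]; ring
  rw [h10, zero_add, pow_one, mul_sub, mul_add, h9]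

/-- Primes in an invertible residue class have logarithmic density `1/φ(q)`. -/
theorem tendsto_sum_primesIoc_inv [NeZero q] (ha : IsUnit a) {u v : ℝ} (hu : 0 < u)
    (huv : u ≤ v) :
    Tendsto (fun T : ℝ ↦ ∑ p ∈ (primesIoc (exp (u * T)) (exp (v * T))).filter
      (fun p : ℕ ↦ (p : ZMod q) = a), (1 : ℝ) / p) atTop
      (𝓝 ((q.totient : ℝ)⁻¹ * log (v / u))) := by
  set φ : ℝ → ℝ := fun t ↦ 1 / max t u with hφ
  have hmax : ∀ t, 0 < max t u := fun t ↦ lt_max_of_lt_right hu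
  have hφc : Continuous φ := by
    refine continuous_const.div (by fun_prop) fun t ↦ (hmax t).ne'
  have key := fun {b : ℝ} (hb : 0 ≤ b) ↦ karamata (primeClass_nonneg a)
    (fun p : ℕ ↦ log_natCast_nonneg p) (fun s hs ↦ summable_primeClass a hs)
    (tendsto_primeClass_laplace ha) hφc hb
  have h1 := (key (hu.le.trans huv)).sub (key hu.le)
  have h_int : (∫ t in (0 : ℝ)..v, φ t * (t ^ 0 / (Nat.factorial 0 : ℝ))) -
      ∫ t in (0 : ℝ)..u, φ t * (t ^ 0 / (Nat.factorial 0 : ℝ)) = log (v / u) := by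
    simp only [pow_zero, Nat.factorial_zero, Nat.cast_one, div_one, mul_one]
    rw [intervalIntegral.integral_interval_sub_left (hφc.intervalIntegrable _ _)
      (hφc.intervalIntegrable _ _)]
    rw [← integral_one_div_of_pos hu (hu.trans_le huv)]
    refine intervalIntegral.integral_congr fun t ht ↦ ?_
    rw [Set.uIcc_of_le huv] at ht
    simp only [hφ, max_eq_left ht.1]
  rw [← mul_sub, h_int] at h1
  refine h1.congr' ?_
  filter_upwards [eventually_gt_atTop 0] with T hT
  have hfin : ∀ b : ℝ, ∀ n : ℕ, n ∉ Finset.range (⌊exp (b * T)⌋₊ + 1) →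
      primeClass a n * (if log n ≤ b * T then φ (log n / T) else 0) = 0 := fun b n hn ↦ by
    by_cases hp : n.Prime
    · rw [if_neg, mul_zero]
      intro h
      have hn0 : (0 : ℝ) < n := by exact_mod_cast hp.pos
      rw [log_le_iff_le_exp hn0] at h
      exact hn (Finset.mem_range.2 (Nat.lt_succ_of_le (Nat.le_floor h)))
    · simp [primeClass, hp]
  have hsum : ∀ b : ℝ, Summable fun n : ℕ ↦
      primeClass a n * (if log n ≤ b * T then φ (log n / T) else 0) := fun b ↦
    summable_of_ne_finset_zero fun n hn ↦ hfin b n hn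
  rw [zero_add, pow_one, ← sub_div, ← (hsum v).tsum_sub (hsum u), div_eq_iff hT.ne',
    Finset.sum_mul, tsum_eq_sum (s := (primesIoc (exp (u * T)) (exp (v * T))).filter
      (fun p : ℕ ↦ (p : ZMod q) = a))]
  · refine Finset.sum_congr rfl fun p hp ↦ ?_
    rw [Finset.mem_filter, mem_primesIoc] at hp
    obtain ⟨⟨hp1, hp2, hp3⟩, hp4⟩ := hp
    have hp0 : (0 : ℝ) < p := by exact_mod_cast hp1.pos
    rw [← lt_log_iff_exp_lt hp0] at hp2
    rw [← log_le_iff_le_exp hp0] at hp3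
    have hl : 0 < log p := (by positivity : 0 < u * T).trans hp2
    rw [if_pos hp3, if_neg (not_le.2 hp2), primeClass, if_pos ⟨hp1, hp4⟩, hφ]
    simp only
    rw [max_eq_left ((le_div_iff₀ hT).2 hp2.le)]
    field_simp
    simp
  · intro p hp
    by_cases hpp : p.Prime ∧ (p : ZMod q) = a
    · have hp0 : (0 : ℝ) < p := by exact_mod_cast hpp.1.pos
      rw [Finset.mem_filter, mem_primesIoc, ← lt_log_iff_exp_lt hp0,
        ← log_le_iff_le_exp hp0] at hp
      by_cases h1 : log p ≤ u * T
      · rw [if_pos h1, if_pos (h1.trans (by gcongr)), sub_self]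
      · rw [if_neg h1, if_neg, sub_self]
        intro h2
        exact hp ⟨⟨hpp.1, not_le.1 h1, h2⟩, hpp.2⟩
    · simp [primeClass, hpp]

end

end PrimesAP

section LargeSieve

open Real

section Abel

variable {E : Type*} [NormedAddCommGroup E] [NormedSpace ℝ E]

/-- Abel summation bound for an antitone nonnegative weight. -/
theorem norm_sum_antitone_smul_le {c : ℕ → ℝ} (hc : Antitone c) (hc0 : ∀ n, 0 ≤ c n)
    {z : ℕ → E} {B : ℝ} (hB : ∀ n, ‖∑ i ∈ Finset.range n, z i‖ ≤ B) (N : ℕ) :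
    ‖∑ i ∈ Finset.range N, c i • z i‖ ≤ c 0 * B := by
  have h1 : ∑ i ∈ Finset.range N, c i • z i = c N • ∑ i ∈ Finset.range N, z i +
      ∑ i ∈ Finset.range N, (c i - c (i + 1)) • ∑ j ∈ Finset.range (i + 1), z j := by
    induction N with
    | zero => simp
    | succ N ih =>
      rw [Finset.sum_range_succ, ih, Finset.sum_range_succ (fun i ↦ (c i - c (i + 1)) • _),
        Finset.sum_range_succ z N]
      module
  have h2 : ∑ i ∈ Finset.range N, (c i - c (i + 1)) = c 0 - c N := Finset.sum_range_sub' c N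
  calc ‖∑ i ∈ Finset.range N, c i • z i‖
      ≤ c N * B + ∑ i ∈ Finset.range N, (c i - c (i + 1)) * B := by
        rw [h1]
        refine (norm_add_le _ _).trans (add_le_add ?_ ((norm_sum_le _ _).trans
          (Finset.sum_le_sum fun i _ ↦ ?_)))
        · rw [norm_smul, norm_of_nonneg (hc0 N)]
          exact mul_le_mul_of_nonneg_left (hB N) (hc0 N)
        · have : 0 ≤ c i - c (i + 1) := sub_nonneg.2 (hc (Nat.le_succ i))
          rw [norm_smul, norm_of_nonneg this]
          exact mul_le_mul_of_nonneg_left (hB _) this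
    _ = c 0 * B := by rw [← Finset.sum_mul, h2]; ring

end Abel

/-- The additive character `x ↦ exp(2πix)`. -/
noncomputable def expC (x : ℝ) : ℂ := Complex.exp ((2 * π * x : ℝ) * Complex.I)

theorem norm_expC (x : ℝ) : ‖expC x‖ = 1 := Complex.norm_exp_ofReal_mul_I _

theorem expC_add (x y : ℝ) : expC (x + y) = expC x * expC y := by
  rw [expC, expC, expC, ← Complex.exp_add]
  congr 1
  push_cast
  ring

theorem expC_zero : expC 0 = 1 := by simp [expC]

theorem conj_expC (x : ℝ) : (starRingEnd ℂ) (expC x) = expC (-x) := by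
  rw [expC, expC, ← Complex.exp_conj, map_mul, Complex.conj_I, Complex.conj_ofReal]
  congr 1
  push_cast
  ring

theorem expC_int (n : ℤ) : expC n = 1 := by
  rw [expC, Complex.exp_eq_one_iff]
  exact ⟨n, by push_cast; ring⟩

theorem expC_nat (n : ℕ) : expC n = 1 := expC_int n

theorem expC_nat_mul (m : ℕ) (x : ℝ) : expC (m * x) = expC x ^ m := by
  rw [expC, expC, ← Complex.exp_nat_mul]
  congr 1
  push_cast
  ring

theorem expC_sum {ι : Type*} (s : Finset ι) (f : ι → ℝ) :
    expC (∑ i ∈ s, f i) = ∏ i ∈ s, expC (f i) := by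
  classical
  induction s using Finset.induction_on with
  | empty => simp [expC_zero]
  | insert a s ha ih => rw [Finset.sum_insert ha, Finset.prod_insert ha, expC_add, ih]

theorem expC_add_int (x : ℝ) (n : ℤ) : expC (x + n) = expC x := by
  rw [expC_add, expC_int, mul_one]

theorem expC_fract (x : ℝ) : expC (Int.fract x) = expC x := by
  conv_rhs => rw [← Int.fract_add_floor x, expC_add_int]

theorem four_mul_min_le_norm_expC_sub_one (x : ℝ) :
    4 * min (Int.fract x) (1 - Int.fract x) ≤ ‖expC x - 1‖ := by
  rw [← expC_fract x]
  set f := Int.fract x with hf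
  have hf0 : 0 ≤ f := Int.fract_nonneg x
  have hf1 : f < 1 := Int.fract_lt_one x
  have h1 : ‖expC f - 1‖ = 2 * sin (π * f) := by
    rw [expC, mul_comm, Complex.norm_exp_I_mul_ofReal_sub_one, norm_mul, Real.norm_eq_abs,
      Real.norm_eq_abs, abs_of_pos two_pos, show 2 * π * f / 2 = π * f by ring, abs_of_nonneg]
    exact sin_nonneg_of_nonneg_of_le_pi (by positivity) (by nlinarith [pi_pos])
  have hpi := pi_pos
  rw [h1]
  rcases le_total f (1 / 2) with h | h
  · have := mul_le_sin (x := π * f) (by positivity) (by nlinarith)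
    rw [show 2 / π * (π * f) = 2 * f by field_simp] at this
    have h2 : min f (1 - f) ≤ f := min_le_left _ _
    linarith
  · have := mul_le_sin (x := π * (1 - f)) (mul_nonneg hpi.le (by linarith)) (by nlinarith)
    rw [show 2 / π * (π * (1 - f)) = 2 * (1 - f) by field_simp,
      show π * (1 - f) = π - π * f by ring, sin_pi_sub] at this
    have h2 : min f (1 - f) ≤ 1 - f := min_le_right _ _
    linarith

/-- Geometric sums of the additive character. -/
theorem norm_sum_expC_le {x : ℝ} (hx : 0 < Int.fract x) (M : ℕ) :
    ‖∑ m ∈ Finset.range M, expC (m * x)‖ ≤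
      (1 / 2) * (1 / Int.fract x + 1 / Int.fract (-x)) := by
  have hf1 : Int.fract x < 1 := Int.fract_lt_one x
  have hneg : Int.fract (-x) = 1 - Int.fract x := Int.fract_neg hx.ne'
  have h0 := four_mul_min_le_norm_expC_sub_one x
  have hmin : 0 < min (Int.fract x) (1 - Int.fract x) := lt_min hx (by linarith)
  have hpos : 0 < ‖expC x - 1‖ := by linarith
  have hne : expC x ≠ 1 := fun h ↦ by simp [h] at hpos
  simp_rw [expC_nat_mul]
  rw [geom_sum_eq hne, norm_div, hneg]
  calc ‖expC x ^ M - 1‖ / ‖expC x - 1‖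
      ≤ 2 / (4 * min (Int.fract x) (1 - Int.fract x)) := by
        gcongr
        refine (norm_sub_le _ _).trans ?_
        rw [norm_pow, norm_expC, one_pow, norm_one]
        norm_num
    _ = (1 / 2) * (1 / min (Int.fract x) (1 - Int.fract x)) := by field_simp; norm_num
    _ ≤ _ := by
        refine mul_le_mul_of_nonneg_left ?_ (by norm_num)
        have h2 : 0 < 1 / Int.fract x := by positivity
        have h3 : 0 < 1 / (1 - Int.fract x) := one_div_pos.2 (by linarith)
        rcases min_choice (Int.fract x) (1 - Int.fract x) with h | h <;> rw [h] <;> linarith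

theorem sum_one_div_le_of_spaced {ι : Type*} (A : Finset ι) (g : ι → ℝ) {δ : ℝ} (hδ : 0 < δ)
    (hδ' : δ ≤ 1) (hg : ∀ i ∈ A, δ ≤ g i) (hg1 : ∀ i ∈ A, g i < 1)
    (hsp : ∀ i ∈ A, ∀ j ∈ A, i ≠ j → δ ≤ |g i - g j|) :
    ∑ i ∈ A, 1 / g i ≤ (1 + log (1 / δ)) / δ := by
  classical
  rcases A.eq_empty_or_nonempty with rfl | ⟨i0, hi0⟩
  · have := log_nonneg (one_le_one_div hδ hδ')
    rw [Finset.sum_empty]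
    positivity
  have hδ1 : δ < 1 := (hg i0 hi0).trans_lt (hg1 i0 hi0)
  have hinj : Set.InjOn (fun i ↦ ⌊g i / δ⌋₊) A := by
    intro i hi j hj hij
    by_contra hne
    have h1 := hsp i hi j hj hne
    have hij' : (⌊g i / δ⌋₊ : ℝ) = ⌊g j / δ⌋₊ := by exact_mod_cast hij
    have hpos : ∀ k ∈ A, 0 ≤ g k / δ := fun k hk ↦ div_nonneg (hδ.le.trans (hg k hk)) hδ.le
    have h2 := Nat.floor_le (hpos i hi)
    have h3 := Nat.lt_floor_add_one (g i / δ)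
    have h4 := Nat.floor_le (hpos j hj)
    have h5 := Nat.lt_floor_add_one (g j / δ)
    have h6 : |g i / δ - g j / δ| < 1 := by rw [abs_lt]; constructor <;> linarith
    rw [← sub_div, abs_div, abs_of_pos hδ, div_lt_one hδ] at h6
    linarith
  have h1 : ∀ i ∈ A, 1 ≤ ⌊g i / δ⌋₊ := fun i hi ↦
    Nat.le_floor (by rw [Nat.cast_one]; exact (one_le_div hδ).2 (hg i hi))
  calc ∑ i ∈ A, 1 / g i ≤ ∑ i ∈ A, (1 / δ) * ((⌊g i / δ⌋₊ : ℝ))⁻¹ := by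
        refine Finset.sum_le_sum fun i hi ↦ ?_
        have h2 := Nat.floor_le (div_nonneg (hδ.le.trans (hg i hi)) hδ.le)
        have h3 : (1 : ℝ) ≤ ⌊g i / δ⌋₊ := by exact_mod_cast h1 i hi
        rw [le_div_iff₀ hδ] at h2
        rw [← div_eq_mul_inv, div_div]
        exact one_div_le_one_div_of_le (by positivity) (by linarith)
    _ = (1 / δ) * ∑ k ∈ A.image (fun i ↦ ⌊g i / δ⌋₊), ((k : ℝ))⁻¹ := by
        rw [← Finset.mul_sum, Finset.sum_image hinj]
    _ ≤ (1 / δ) * ∑ k ∈ Finset.Icc 1 ⌊1 / δ⌋₊, ((k : ℝ))⁻¹ := by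
        refine mul_le_mul_of_nonneg_left ?_ (by positivity)
        refine Finset.sum_le_sum_of_subset_of_nonneg ?_ fun _ _ _ ↦ by positivity
        intro k hk
        obtain ⟨i, hi, rfl⟩ := Finset.mem_image.1 hk
        refine Finset.mem_Icc.2 ⟨h1 i hi, Nat.floor_le_floor ?_⟩
        gcongr
        exact (hg1 i hi).le
    _ ≤ (1 / δ) * (1 + log (1 / δ)) := by
        refine mul_le_mul_of_nonneg_left ?_ (by positivity)
        have h2 := harmonic_le_one_add_log ⌊1 / δ⌋₊
        rw [harmonic_eq_sum_Icc] at h2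
        push_cast at h2
        refine h2.trans ?_
        have h3 : (1 : ℝ) ≤ ⌊1 / δ⌋₊ := by
          exact_mod_cast Nat.le_floor (by rw [Nat.cast_one]; exact (one_le_div hδ).2 hδ1.le)
        have := log_le_log (by positivity) (Nat.floor_le (by positivity : 0 ≤ 1 / δ))
        linarith
    _ = _ := by ring

section

variable {ι : Type*} {A : Finset ι} {θ : ι → ℝ} {δ : ℝ}

theorem sum_norm_kernel_le (hδ : 0 < δ) (hδ1 : δ ≤ 1)
    (hsp : ∀ i ∈ A, ∀ j ∈ A, i ≠ j → ∀ n : ℤ, δ ≤ |θ i - θ j - n|)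
    {w : ℕ → ℝ} (hw : Antitone w) (hw0 : ∀ n, 0 < w n) (N : ℕ) {i : ι} (hi : i ∈ A) :
    ∑ j ∈ A, ‖∑ m ∈ Finset.range N, (w m : ℂ) * expC (m * (θ i - θ j))‖ ≤
      ∑ m ∈ Finset.range N, w m + w 0 * ((1 + log (1 / δ)) / δ) := by
  classical
  have hfr : ∀ j ∈ A, ∀ k ∈ A, j ≠ k → δ ≤ Int.fract (θ j - θ k) := fun j hj k hk hjk ↦ by
    have := hsp j hj k hk hjk ⌊θ j - θ k⌋
    rwa [Int.self_sub_floor, abs_of_nonneg (Int.fract_nonneg _)] at this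
  have hdiff : ∀ x y : ℝ, ∃ n : ℤ, Int.fract x - Int.fract y = x - y - n := fun x y ↦
    ⟨⌊x⌋ - ⌊y⌋, by rw [← Int.self_sub_floor, ← Int.self_sub_floor]; push_cast; ring⟩
  rw [← Finset.add_sum_erase A _ hi]
  refine add_le_add ?_ ?_
  · simp only [sub_self, mul_zero, expC_zero, mul_one]
    rw [← Complex.ofReal_sum, Complex.norm_of_nonneg (Finset.sum_nonneg fun m _ ↦ (hw0 m).le)]
  · calc ∑ j ∈ A.erase i, ‖∑ m ∈ Finset.range N, (w m : ℂ) * expC (m * (θ i - θ j))‖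
        ≤ ∑ j ∈ A.erase i, w 0 * ((1 / 2) * (1 / Int.fract (θ i - θ j) +
            1 / Int.fract (θ j - θ i))) := by
          refine Finset.sum_le_sum fun j hj ↦ ?_
          have hj' := Finset.mem_erase.1 hj
          have h1 := norm_sum_antitone_smul_le hw (fun n ↦ (hw0 n).le)
            (norm_sum_expC_le (hδ.trans_le (hfr i hi j hj'.2 hj'.1.symm))) N
          rw [neg_sub] at h1
          simpa only [Complex.real_smul] using h1
      _ = w 0 * ((1 / 2) * (∑ j ∈ A.erase i, 1 / Int.fract (θ i - θ j) +
            ∑ j ∈ A.erase i, 1 / Int.fract (θ j - θ i))) := by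
          rw [← Finset.mul_sum, ← Finset.mul_sum, Finset.sum_add_distrib]
      _ ≤ w 0 * ((1 / 2) * ((1 + log (1 / δ)) / δ + (1 + log (1 / δ)) / δ)) := by
          refine mul_le_mul_of_nonneg_left (mul_le_mul_of_nonneg_left ?_ (by norm_num)) (hw0 0).le
          refine add_le_add ?_ ?_
          · refine sum_one_div_le_of_spaced _ _ hδ hδ1 (fun j hj ↦ ?_)
              (fun j _ ↦ Int.fract_lt_one _) fun j hj k hk hjk ↦ ?_
            · have hj' := Finset.mem_erase.1 hj
              exact hfr i hi j hj'.2 hj'.1.symm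
            · obtain ⟨n, hn⟩ := hdiff (θ i - θ j) (θ i - θ k)
              rw [hn, show θ i - θ j - (θ i - θ k) - n = θ k - θ j - n by ring]
              exact hsp k (Finset.mem_of_mem_erase hk) j (Finset.mem_of_mem_erase hj) hjk.symm n
          · refine sum_one_div_le_of_spaced _ _ hδ hδ1 (fun j hj ↦ ?_)
              (fun j _ ↦ Int.fract_lt_one _) fun j hj k hk hjk ↦ ?_
            · have hj' := Finset.mem_erase.1 hj
              exact hfr j hj'.2 i hi hj'.1
            · obtain ⟨n, hn⟩ := hdiff (θ j - θ i) (θ k - θ i)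
              rw [hn, show θ j - θ i - (θ k - θ i) - n = θ j - θ k - n by ring]
              exact hsp j (Finset.mem_of_mem_erase hj) k (Finset.mem_of_mem_erase hk) hjk n
      _ = _ := by ring

theorem dual_large_sieve (hδ : 0 < δ) (hδ1 : δ ≤ 1)
    (hsp : ∀ i ∈ A, ∀ j ∈ A, i ≠ j → ∀ n : ℤ, δ ≤ |θ i - θ j - n|)
    {w : ℕ → ℝ} (hw : Antitone w) (hw0 : ∀ n, 0 < w n) (N : ℕ) (c : ι → ℂ) :
    ∑ m ∈ Finset.range N, w m * ‖∑ i ∈ A, c i * expC (m * θ i)‖ ^ 2 ≤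
      (∑ m ∈ Finset.range N, w m + w 0 * ((1 + log (1 / δ)) / δ)) * ∑ i ∈ A, ‖c i‖ ^ 2 := by
  set K := ∑ m ∈ Finset.range N, w m + w 0 * ((1 + log (1 / δ)) / δ) with hK
  set G : ι → ι → ℂ := fun i j ↦ ∑ m ∈ Finset.range N, (w m : ℂ) * expC (m * (θ i - θ j)) with hG
  have hGsymm : ∀ i j, ‖G i j‖ = ‖G j i‖ := fun i j ↦ by
    have : (starRingEnd ℂ) (G i j) = G j i := by
      simp only [hG, map_sum, map_mul, Complex.conj_ofReal, conj_expC]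
      refine Finset.sum_congr rfl fun m _ ↦ ?_
      congr 2
      ring
    rw [← this, RCLike.norm_conj]
  have h1 : ((∑ m ∈ Finset.range N, w m * ‖∑ i ∈ A, c i * expC (m * θ i)‖ ^ 2 : ℝ) : ℂ) =
      ∑ i ∈ A, ∑ j ∈ A, c i * (starRingEnd ℂ) (c j) * G i j := by
    push_cast
    simp_rw [← Complex.mul_conj', map_sum, map_mul, conj_expC, Finset.sum_mul_sum, hG,
      Finset.mul_sum]
    rw [Finset.sum_comm]
    refine Finset.sum_congr rfl fun i _ ↦ ?_
    rw [Finset.sum_comm]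
    refine Finset.sum_congr rfl fun j _ ↦ Finset.sum_congr rfl fun m _ ↦ ?_
    rw [mul_sub, sub_eq_add_neg, expC_add]
    ring
  have h2 : ∀ i j, ‖c i * (starRingEnd ℂ) (c j) * G i j‖ ≤
      (1 / 2) * (‖c i‖ ^ 2 * ‖G i j‖) + (1 / 2) * (‖c j‖ ^ 2 * ‖G j i‖) := fun i j ↦ by
    rw [norm_mul, norm_mul, RCLike.norm_conj, hGsymm j i]
    nlinarith [mul_nonneg (sq_nonneg (‖c i‖ - ‖c j‖)) (norm_nonneg (G i j))]
  have h3 : ∑ i ∈ A, ∑ j ∈ A, ‖c i‖ ^ 2 * ‖G i j‖ ≤ K * ∑ i ∈ A, ‖c i‖ ^ 2 := by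
    rw [Finset.mul_sum]
    refine Finset.sum_le_sum fun i hi ↦ ?_
    rw [← Finset.mul_sum, mul_comm]
    exact mul_le_mul_of_nonneg_right (sum_norm_kernel_le hδ hδ1 hsp hw hw0 N hi) (by positivity)
  have h0 : 0 ≤ ∑ m ∈ Finset.range N, w m * ‖∑ i ∈ A, c i * expC (m * θ i)‖ ^ 2 :=
    Finset.sum_nonneg fun m _ ↦ mul_nonneg (hw0 m).le (by positivity)
  calc ∑ m ∈ Finset.range N, w m * ‖∑ i ∈ A, c i * expC (m * θ i)‖ ^ 2
      = ‖∑ i ∈ A, ∑ j ∈ A, c i * (starRingEnd ℂ) (c j) * G i j‖ := by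
        rw [← h1, Complex.norm_of_nonneg h0]
    _ ≤ ∑ i ∈ A, ∑ j ∈ A, ((1 / 2) * (‖c i‖ ^ 2 * ‖G i j‖) + (1 / 2) * (‖c j‖ ^ 2 * ‖G j i‖)) :=
        (norm_sum_le _ _).trans (Finset.sum_le_sum fun i _ ↦ (norm_sum_le _ _).trans
          (Finset.sum_le_sum fun j _ ↦ h2 i j))
    _ = ∑ i ∈ A, ∑ j ∈ A, ‖c i‖ ^ 2 * ‖G i j‖ := by
        simp_rw [Finset.sum_add_distrib]
        rw [Finset.sum_comm (f := fun i j ↦ 1 / 2 * (‖c j‖ ^ 2 * ‖G j i‖))]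
        simp_rw [← Finset.mul_sum]
        ring
    _ ≤ _ := h3

/-- The large sieve inequality with an antitone weight. -/
theorem large_sieve (hδ : 0 < δ) (hδ1 : δ ≤ 1)
    (hsp : ∀ i ∈ A, ∀ j ∈ A, i ≠ j → ∀ n : ℤ, δ ≤ |θ i - θ j - n|)
    {w : ℕ → ℝ} (hw : Antitone w) (hw0 : ∀ n, 0 < w n) (N : ℕ) (t : ℕ → ℂ) :
    ∑ i ∈ A, ‖∑ m ∈ Finset.range N, t m * expC (m * θ i)‖ ^ 2 ≤
      (∑ m ∈ Finset.range N, w m + w 0 * ((1 + log (1 / δ)) / δ)) *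
        ∑ m ∈ Finset.range N, ‖t m‖ ^ 2 / w m := by
  set K := ∑ m ∈ Finset.range N, w m + w 0 * ((1 + log (1 / δ)) / δ) with hK
  set S : ι → ℂ := fun i ↦ ∑ m ∈ Finset.range N, t m * expC (m * θ i) with hS
  set B := ∑ i ∈ A, ‖S i‖ ^ 2 with hB
  set V := ∑ m ∈ Finset.range N, ‖t m‖ ^ 2 / w m with hV
  have hB0 : 0 ≤ B := Finset.sum_nonneg fun i _ ↦ by positivity
  have h1 := dual_large_sieve hδ hδ1 hsp hw hw0 N fun i ↦ (starRingEnd ℂ) (S i)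
  simp only [RCLike.norm_conj] at h1
  have h2 : (B : ℂ) = ∑ m ∈ Finset.range N,
      t m * ∑ i ∈ A, (starRingEnd ℂ) (S i) * expC (m * θ i) := by
    rw [hB]
    push_cast
    simp_rw [Finset.mul_sum]
    rw [Finset.sum_comm]
    refine Finset.sum_congr rfl fun i _ ↦ ?_
    rw [← Complex.mul_conj', hS, Finset.sum_mul]
    exact Finset.sum_congr rfl fun m _ ↦ by ring
  have h3 : B ≤ ∑ m ∈ Finset.range N, (‖t m‖ / √(w m)) *
      (√(w m) * ‖∑ i ∈ A, (starRingEnd ℂ) (S i) * expC (m * θ i)‖) := by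
    rw [← Complex.norm_of_nonneg hB0, h2]
    refine (norm_sum_le _ _).trans (Finset.sum_le_sum fun m _ ↦ le_of_eq ?_)
    have := sqrt_pos.2 (hw0 m)
    rw [norm_mul]
    field_simp
  have h4 := Finset.sum_mul_sq_le_sq_mul_sq (Finset.range N) (fun m ↦ ‖t m‖ / √(w m))
    fun m ↦ √(w m) * ‖∑ i ∈ A, (starRingEnd ℂ) (S i) * expC (m * θ i)‖
  simp only [div_pow, mul_pow, sq_sqrt (hw0 _).le] at h4
  have h5 : B ^ 2 ≤ V * (K * B) :=
    (pow_le_pow_left₀ hB0 h3 2).trans (h4.trans (mul_le_mul_of_nonneg_left h1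
      (Finset.sum_nonneg fun m _ ↦ div_nonneg (by positivity) (hw0 m).le)))
  rcases hB0.eq_or_lt with h | h
  · rw [← h]
    have h6 : 0 ≤ (1 + log (1 / δ)) / δ := by
      have := log_nonneg (one_le_one_div hδ hδ1)
      positivity
    exact mul_nonneg (add_nonneg (Finset.sum_nonneg fun m _ ↦ (hw0 m).le)
      (mul_nonneg (hw0 0).le h6))
      (Finset.sum_nonneg fun m _ ↦ div_nonneg (by positivity) (hw0 m).le)
  · nlinarith

end

end LargeSieve

section Periodic

open Real

section Sums

variable {M : Type*} [CommSemiring M]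

theorem sum_range_mul_of_coprime {m n : ℕ} (hm : 0 < m) (hn : 0 < n) (h : m.Coprime n)
    {F G : ℕ → M} (hF : Function.Periodic F m) (hG : Function.Periodic G n) :
    ∑ c ∈ Finset.range (m * n), F c * G c =
      (∑ c ∈ Finset.range m, F c) * ∑ c ∈ Finset.range n, G c := by
  rw [Finset.sum_mul_sum, ← Finset.sum_product']
  refine Finset.sum_bij' (fun c _ ↦ (c % m, c % n)) (fun x _ ↦ Nat.chineseRemainder h x.1 x.2)
    ?_ ?_ ?_ ?_ ?_
  · intro c _
    simp [Nat.mod_lt _ hm, Nat.mod_lt _ hn]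
  · intro x _
    exact Finset.mem_range.2 (Nat.chineseRemainder_lt_mul h _ _ hm.ne' hn.ne')
  · intro c hc
    have h1 := (Nat.chineseRemainder h (c % m) (c % n)).2
    have h2 : (Nat.chineseRemainder h (c % m) (c % n) : ℕ) ≡ c [MOD m * n] :=
      (Nat.modEq_and_modEq_iff_modEq_mul h).1
        ⟨h1.1.trans (Nat.mod_modEq _ _), h1.2.trans (Nat.mod_modEq _ _)⟩
    exact h2.eq_of_lt_of_lt (Nat.chineseRemainder_lt_mul h _ _ hm.ne' hn.ne')
      (Finset.mem_range.1 hc)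
  · intro x hx
    simp only [Finset.mem_product, Finset.mem_range] at hx
    have h1 := (Nat.chineseRemainder h x.1 x.2).2
    ext
    · exact (Nat.mod_eq_of_modEq h1.1 hx.1)
    · exact (Nat.mod_eq_of_modEq h1.2 hx.2)
  · intro c _
    rw [hF.map_mod_nat, hG.map_mod_nat]

theorem periodic_finset_prod {R : Finset ℕ} {f : ℕ → ℕ → M}
    (hf : ∀ p ∈ R, Function.Periodic (f p) p) :
    Function.Periodic (fun n ↦ ∏ p ∈ R, f p n) (∏ p ∈ R, p) := by
  intro n
  refine Finset.prod_congr rfl fun p hp ↦ ?_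
  obtain ⟨k, hk⟩ := Finset.dvd_prod_of_mem (fun p ↦ p) hp
  rw [hk, mul_comm]
  exact (hf p hp).nat_mul k n

/-- The Chinese remainder theorem for products of periodic functions. -/
theorem sum_range_prod_periodic {R : Finset ℕ} (hR : ∀ p ∈ R, p.Prime) {f : ℕ → ℕ → M}
    (hf : ∀ p ∈ R, Function.Periodic (f p) p) :
    ∑ c ∈ Finset.range (∏ p ∈ R, p), ∏ p ∈ R, f p c =
      ∏ p ∈ R, ∑ c ∈ Finset.range p, f p c := by
  classical
  induction R using Finset.induction_on with
  | empty => simp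
  | insert q R hq ih =>
    have hR' : ∀ p ∈ R, p.Prime := fun p hp ↦ hR p (Finset.mem_insert_of_mem hp)
    have hf' : ∀ p ∈ R, Function.Periodic (f p) p := fun p hp ↦ hf p (Finset.mem_insert_of_mem hp)
    have hq' := hR q (Finset.mem_insert_self q R)
    simp_rw [Finset.prod_insert hq]
    rw [sum_range_mul_of_coprime hq'.pos (Finset.prod_pos fun p hp ↦ (hR' p hp).pos) ?_
      (hf q (Finset.mem_insert_self q R)) (periodic_finset_prod hf'), ih hR' hf']
    refine Nat.Coprime.prod_right fun p hp ↦ (Nat.coprime_primes hq' (hR' p hp)).2 ?_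
    rintro rfl
    exact hq hp

theorem sum_range_mul_left_periodic {m k : ℕ} (hm : 0 < m) (hk : k.Coprime m) (a : ℕ) {f : ℕ → M}
    (hf : Function.Periodic f m) :
    ∑ c ∈ Finset.range m, f (a + k * c) = ∑ c ∈ Finset.range m, f c := by
  have hinj : Set.InjOn (fun c ↦ (a + k * c) % m) (Finset.range m : Set ℕ) := by
    intro x hx y hy hxy
    simp only [Finset.coe_range, Set.mem_Iio] at hx hy
    have h1 : a + k * x ≡ a + k * y [MOD m] := hxy
    have h2 := Nat.ModEq.add_left_cancel' a h1
    exact (Nat.ModEq.cancel_left_of_coprime (Nat.coprime_comm.1 hk) h2).eq_of_lt_of_lt hx hy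
  have hmaps : Set.MapsTo (fun c ↦ (a + k * c) % m) (Finset.range m : Set ℕ)
      (Finset.range m : Set ℕ) := fun x _ ↦ by simpa using Nat.mod_lt _ hm
  refine Finset.sum_bij (fun c _ ↦ (a + k * c) % m) (fun x hx ↦ hmaps hx)
    (fun x hx y hy h ↦ hinj hx hy h) (fun y hy ↦ ?_) fun c _ ↦ (hf.map_mod_nat _).symm
  obtain ⟨x, hx, hxy⟩ := Finset.surj_on_of_inj_on_of_card_le
    (s := Finset.range m) (t := Finset.range m) (fun c _ ↦ (a + k * c) % m)
    (fun x hx ↦ hmaps hx) (fun x y hx hy h ↦ hinj hx hy h) le_rfl y hy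
  exact ⟨x, hx, hxy.symm⟩

end Sums

section Fourier

theorem sum_range_expC_div {p : ℕ} (hp : 0 < p) (k : ℤ) :
    ∑ a ∈ Finset.range p, expC (a * ((k : ℝ) / p)) = if (p : ℤ) ∣ k then (p : ℂ) else 0 := by
  have hp' : (p : ℝ) ≠ 0 := by positivity
  split_ifs with h
  · obtain ⟨l, rfl⟩ := h
    have : ∀ a ∈ Finset.range p, expC (a * (((p * l : ℤ) : ℝ) / p)) = 1 := fun a _ ↦ by
      rw [show (a : ℝ) * (((p * l : ℤ) : ℝ) / p) = ((a * l : ℤ) : ℝ) by push_cast; field_simp]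
      exact expC_int _
    rw [Finset.sum_congr rfl this]
    simp
  · simp_rw [expC_nat_mul]
    have hne : expC ((k : ℝ) / p) ≠ 1 := by
      intro h1
      rw [expC, Complex.exp_eq_one_iff] at h1
      obtain ⟨n, hn⟩ := h1
      have hn' : (((k : ℝ) / p : ℝ) : ℂ) = n := by
        have h2 : (2 * (π : ℂ) * Complex.I) ≠ 0 := Complex.two_pi_I_ne_zero
        refine mul_right_cancel₀ h2 ?_
        rw [← hn]
        push_cast
        ring
      have hn2 : (k : ℝ) / p = n := by exact_mod_cast hn'
      rw [div_eq_iff hp'] at hn2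
      exact h ⟨n, by rw [mul_comm]; exact_mod_cast hn2⟩
    rw [geom_sum_eq hne, ← expC_nat_mul, mul_div_cancel₀ _ hp', expC_int, sub_self, zero_div]

/-- Fourier coefficients of a function of period `p`. -/
noncomputable def fourierCoef (p : ℕ) (f : ℕ → ℝ) (a : ℕ) : ℂ :=
  (p : ℂ)⁻¹ * ∑ c ∈ Finset.range p, (f c : ℂ) * expC (-(a * ((c : ℝ) / p)))

theorem fourierCoef_zero {p : ℕ} {f : ℕ → ℝ} (hf : ∑ c ∈ Finset.range p, f c = 0) :
    fourierCoef p f 0 = 0 := by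
  have : ((∑ c ∈ Finset.range p, f c : ℝ) : ℂ) = 0 := by rw [hf]; simp
  push_cast at this
  simp [fourierCoef, expC_zero, this]

theorem sum_range_expC_sub {p c d : ℕ} (hc : c < p) (hd : d < p) :
    ∑ a ∈ Finset.range p, expC (a * (((c : ℝ) - d) / p)) = if c = d then (p : ℂ) else 0 := by
  have h1 : (p : ℤ) ∣ (c : ℤ) - d ↔ c = d := by
    constructor
    · intro h
      have : (d : ℤ) ≡ c [ZMOD p] := (Int.modEq_iff_dvd).2 h
      exact ((Int.natCast_modEq_iff.1 this).eq_of_lt_of_lt hd hc).symm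
    · rintro rfl
      simp
  have h2 := sum_range_expC_div (c.zero_le.trans_lt hc) ((c : ℤ) - d)
  push_cast at h2
  rw [h2]
  exact if_congr h1 rfl rfl

theorem expC_mod_mul {p : ℕ} (hp : 0 < p) (n a : ℕ) :
    expC ((n % p : ℕ) * ((a : ℝ) / p)) = expC (n * ((a : ℝ) / p)) := by
  have h3 : (n : ℝ) * ((a : ℝ) / p) = (n % p : ℕ) * ((a : ℝ) / p) + ((n / p * a : ℕ) : ℝ) := by
    have h4 : (n : ℝ) = (n % p : ℕ) + p * (n / p : ℕ) := by exact_mod_cast (Nat.mod_add_div n p).symm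
    have hp'' : (p : ℝ) ≠ 0 := by exact_mod_cast hp.ne'
    calc (n : ℝ) * ((a : ℝ) / p) = ((n % p : ℕ) + p * (n / p : ℕ)) * ((a : ℝ) / p) := by rw [← h4]
      _ = _ := by push_cast; field_simp
  rw [h3, expC_add, expC_nat, mul_one]

theorem sum_fourierCoef_mul {p : ℕ} (hp : 0 < p) {f : ℕ → ℝ} (hf : Function.Periodic f p) (n : ℕ) :
    ∑ a ∈ Finset.range p, fourierCoef p f a * expC (n * ((a : ℝ) / p)) = f n := by
  have hp' : (p : ℂ) ≠ 0 := by exact_mod_cast hp.ne'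
  have h1 : ∀ a ∈ Finset.range p, fourierCoef p f a * expC (n * ((a : ℝ) / p)) =
      ∑ c ∈ Finset.range p, (p : ℂ)⁻¹ * f c * expC (a * ((((n % p : ℕ) : ℝ) - c) / p)) := by
    intro a _
    rw [fourierCoef, mul_assoc, Finset.sum_mul, Finset.mul_sum]
    refine Finset.sum_congr rfl fun c _ ↦ ?_
    rw [← expC_mod_mul hp, mul_assoc (f c : ℂ), ← expC_add, mul_assoc]
    congr 3
    ring
  rw [Finset.sum_congr rfl h1, Finset.sum_comm]
  have h2 : ∀ c ∈ Finset.range p, ∑ a ∈ Finset.range p,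
      (p : ℂ)⁻¹ * f c * expC (a * ((((n % p : ℕ) : ℝ) - c) / p)) =
      if n % p = c then (f c : ℂ) else 0 := fun c hc ↦ by
    rw [← Finset.mul_sum, sum_range_expC_sub (Nat.mod_lt _ hp) (Finset.mem_range.1 hc), mul_ite,
      mul_zero]
    congr 1
    field_simp
  rw [Finset.sum_congr rfl h2, Finset.sum_ite_eq, if_pos (Finset.mem_range.2 (Nat.mod_lt _ hp)),
    hf.map_mod_nat]

theorem eq_sum_fourierCoef_of_mean_zero {p : ℕ} (hp : 0 < p) {f : ℕ → ℝ}
    (hf : Function.Periodic f p) (h0 : ∑ c ∈ Finset.range p, f c = 0) (n : ℕ) :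
    (f n : ℂ) = ∑ a ∈ Finset.Ico 1 p, fourierCoef p f a * expC (n * ((a : ℝ) / p)) := by
  rw [← sum_fourierCoef_mul hp hf n, Finset.range_eq_Ico, Finset.sum_eq_sum_Ico_succ_bot hp,
    fourierCoef_zero h0, zero_mul, zero_add]

theorem parseval_fourierCoef {p : ℕ} (hp : 0 < p) (f g : ℕ → ℝ) :
    ∑ a ∈ Finset.range p, fourierCoef p f a * (starRingEnd ℂ) (fourierCoef p g a) =
      ((p : ℝ)⁻¹ * ∑ c ∈ Finset.range p, f c * g c : ℝ) := by
  have hp' : (p : ℂ) ≠ 0 := by exact_mod_cast hp.ne'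
  have h1 : ∀ a ∈ Finset.range p, fourierCoef p f a * (starRingEnd ℂ) (fourierCoef p g a) =
      ∑ c ∈ Finset.range p, ∑ d ∈ Finset.range p, (p : ℂ)⁻¹ * (p : ℂ)⁻¹ * f c * g d *
        expC (a * (((d : ℝ) - c) / p)) := by
    intro a _
    simp only [fourierCoef, map_mul, map_sum, map_inv₀, Complex.conj_natCast, Complex.conj_ofReal,
      conj_expC, neg_neg]
    rw [mul_mul_mul_comm, Finset.sum_mul_sum, Finset.mul_sum]
    refine Finset.sum_congr rfl fun c _ ↦ ?_
    rw [Finset.mul_sum]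
    refine Finset.sum_congr rfl fun d _ ↦ ?_
    rw [show (a : ℝ) * (((d : ℝ) - c) / p) =
      -(a * ((c : ℝ) / p)) + a * ((d : ℝ) / p) by ring, expC_add]
    ring
  rw [Finset.sum_congr rfl h1, Finset.sum_comm]
  rw [Complex.ofReal_mul, Complex.ofReal_sum, Finset.mul_sum]
  refine Finset.sum_congr rfl fun c hc ↦ ?_
  rw [Finset.sum_comm]
  have h2 : ∀ d ∈ Finset.range p, ∑ a ∈ Finset.range p, (p : ℂ)⁻¹ * (p : ℂ)⁻¹ * f c * g d *
        expC (a * (((d : ℝ) - c) / p)) =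
      if d = c then (p : ℂ)⁻¹ * f c * g d else 0 := fun d hd ↦ by
    rw [← Finset.mul_sum, sum_range_expC_sub (Finset.mem_range.1 hd) (Finset.mem_range.1 hc),
      mul_ite, mul_zero]
    congr 1
    field_simp
  rw [Finset.sum_congr rfl h2, Finset.sum_ite_eq', if_pos hc]
  push_cast
  ring

/-- If `t` vanishes on a residue class modulo `p`, its exponential sum at `α` is controlled by the
values at the nontrivial translates `α + a/p`. -/
theorem norm_sq_expSum_le_translates {p : ℕ} (hp : 1 < p) {t : ℕ → ℂ} {h : ℕ}
    (ht : ∀ m, m ≡ h [MOD p] → t m = 0) (N : ℕ) (α : ℝ) :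
    ‖∑ m ∈ Finset.range N, t m * expC (m * α)‖ ^ 2 / ((p : ℝ) - 1) ≤
      ∑ a ∈ Finset.Ico 1 p, ‖∑ m ∈ Finset.range N, t m * expC (m * (α + (a : ℝ) / p))‖ ^ 2 := by
  classical
  have hp0 : 0 < p := by omega
  set Z : ℕ → ℂ := fun c ↦ ∑ m ∈ (Finset.range N).filter (fun m ↦ m % p = c),
    t m * expC (m * α) with hZ
  have hS : ∑ m ∈ Finset.range N, t m * expC (m * α) = ∑ c ∈ Finset.range p, Z c := by
    rw [← Finset.sum_fiberwise_of_maps_to (t := Finset.range p) (g := fun m ↦ m % p)]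
    exact fun m _ ↦ Finset.mem_range.2 (Nat.mod_lt _ hp0)
  have hZh : Z (h % p) = 0 := by
    refine Finset.sum_eq_zero fun m hm ↦ ?_
    rw [ht m (Finset.mem_filter.1 hm).2, zero_mul]
  have hSa : ∀ a : ℕ, ∑ m ∈ Finset.range N, t m * expC (m * (α + (a : ℝ) / p)) =
      ∑ c ∈ Finset.range p, Z c * expC (a * ((c : ℝ) / p)) := fun a ↦ by
    rw [← Finset.sum_fiberwise_of_maps_to (t := Finset.range p) (g := fun m ↦ m % p)
      fun m _ ↦ Finset.mem_range.2 (Nat.mod_lt _ hp0)]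
    refine Finset.sum_congr rfl fun c _ ↦ ?_
    rw [hZ, Finset.sum_mul]
    refine Finset.sum_congr rfl fun m hm ↦ ?_
    have hm' := (Finset.mem_filter.1 hm).2
    rw [mul_add, expC_add, ← expC_mod_mul hp0, hm', ← mul_assoc]
    congr 2
    ring
  have hpar : ((∑ a ∈ Finset.range p, ‖∑ c ∈ Finset.range p, Z c * expC (a * ((c : ℝ) / p))‖ ^ 2
      : ℝ) : ℂ) = ((p * ∑ c ∈ Finset.range p, ‖Z c‖ ^ 2 : ℝ) : ℂ) := by
    push_cast
    simp_rw [← Complex.mul_conj', map_sum, map_mul, conj_expC, Finset.sum_mul_sum]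
    rw [Finset.sum_comm, Finset.mul_sum]
    refine Finset.sum_congr rfl fun c hc ↦ ?_
    rw [Finset.sum_comm]
    have h2 : ∀ d ∈ Finset.range p, ∑ a ∈ Finset.range p, Z c * expC (a * ((c : ℝ) / p)) *
        ((starRingEnd ℂ) (Z d) * expC (-(a * ((d : ℝ) / p)))) =
        if c = d then (p : ℂ) * (Z c * (starRingEnd ℂ) (Z d)) else 0 := fun d hd ↦ by
      have h3 := sum_range_expC_sub (Finset.mem_range.1 hc) (Finset.mem_range.1 hd)
      calc _ = ∑ a ∈ Finset.range p, (Z c * (starRingEnd ℂ) (Z d)) *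
            expC (a * (((c : ℝ) - d) / p)) := by
            refine Finset.sum_congr rfl fun a _ ↦ ?_
            rw [show (a : ℝ) * (((c : ℝ) - d) / p) =
              a * ((c : ℝ) / p) + -(a * ((d : ℝ) / p)) by ring, expC_add]
            ring
        _ = _ := by
            rw [← Finset.mul_sum, h3, mul_ite, mul_zero, mul_comm]
    rw [Finset.sum_congr rfl h2, Finset.sum_ite_eq, if_pos hc]
  have hpar' := Complex.ofReal_injective hpar
  have hcs : ‖∑ c ∈ Finset.range p, Z c‖ ^ 2 ≤ ((p : ℝ) - 1) * ∑ c ∈ Finset.range p, ‖Z c‖ ^ 2 := by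
    have hmem : h % p ∈ Finset.range p := Finset.mem_range.2 (Nat.mod_lt _ hp0)
    rw [← Finset.add_sum_erase _ _ hmem, ← Finset.add_sum_erase _ _ hmem, hZh, zero_add, norm_zero]
    calc ‖∑ c ∈ (Finset.range p).erase (h % p), Z c‖ ^ 2
        ≤ (∑ c ∈ (Finset.range p).erase (h % p), ‖Z c‖) ^ 2 := by
          gcongr
          exact norm_sum_le _ _
      _ ≤ ((Finset.range p).erase (h % p)).card * ∑ c ∈ (Finset.range p).erase (h % p), ‖Z c‖ ^ 2 :=
          sq_sum_le_card_mul_sum_sq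
      _ = _ := by
          rw [Finset.card_erase_of_mem hmem, Finset.card_range, Nat.cast_sub hp.le]
          simp
  have hp1 : (0 : ℝ) < (p : ℝ) - 1 := by
    have : (1 : ℝ) < p := by exact_mod_cast hp
    linarith
  simp_rw [hSa]
  rw [Finset.range_eq_Ico, Finset.sum_eq_sum_Ico_succ_bot hp0, ← Finset.range_eq_Ico] at hpar'
  simp only [Nat.cast_zero, zero_mul, expC_zero, mul_one, zero_add] at hpar'
  rw [hS, div_le_iff₀ hp1]
  nlinarith

end Fourier

end Periodic

section Farey

open Real

/-- The exponential sum with coefficients `t`. -/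
noncomputable def expSum (t : ℕ → ℂ) (N : ℕ) (α : ℝ) : ℂ :=
  ∑ m ∈ Finset.range N, t m * expC (m * α)

/-- Tuples of numerators of the partial fraction expansions of the reduced fractions with
denominator `∏ p ∈ R, p`. -/
noncomputable def farey (R : Finset ℕ) : Finset (ℕ →₀ ℕ) := R.finsupp fun p ↦ Finset.Ico 1 p

/-- The fraction with a given partial fraction expansion. -/
noncomputable def fareyPoint (a : ℕ →₀ ℕ) : ℝ := ∑ p ∈ a.support, (a p : ℝ) / p

/-- The mean square of an exponential sum over reduced fractions with denominator `∏ p ∈ R, p`. -/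
noncomputable def fareySum (t : ℕ → ℂ) (N : ℕ) (R : Finset ℕ) : ℝ :=
  ∑ a ∈ farey R, ‖expSum t N (fareyPoint a)‖ ^ 2

theorem mem_farey {R : Finset ℕ} {a : ℕ →₀ ℕ} :
    a ∈ farey R ↔ a.support = R ∧ ∀ p ∈ R, 1 ≤ a p ∧ a p < p := by
  rw [farey, Finset.mem_finsupp_iff]
  simp only [Finset.mem_Ico]
  refine ⟨fun h ↦ ⟨h.1.antisymm fun p hp ↦ ?_, h.2⟩, fun h ↦ ⟨h.1.le, h.2⟩⟩
  exact Finsupp.mem_support_iff.2 (by have := h.2 p hp; omega)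

theorem fareyPoint_eq {R : Finset ℕ} {a : ℕ →₀ ℕ} (h : a.support ⊆ R) :
    fareyPoint a = ∑ p ∈ R, (a p : ℝ) / p := by
  refine Finset.sum_subset h fun p _ hp ↦ ?_
  simp [Finsupp.notMem_support_iff.1 hp]

theorem sum_farey_prod {M : Type*} [CommSemiring M] (R : Finset ℕ) (f : ℕ → ℕ → M) :
    ∑ a ∈ farey R, ∏ p ∈ R, f p (a p) = ∏ p ∈ R, ∑ b ∈ Finset.Ico 1 p, f p b := by
  classical
  rw [Finset.prod_sum, farey, Finset.finsupp, Finset.sum_map]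
  refine Finset.sum_congr (by congr!) fun g _ ↦ ?_
  rw [← Finset.prod_attach]
  refine Finset.prod_congr rfl fun p _ ↦ ?_
  simp

theorem sum_farey_insert {M : Type*} [AddCommMonoid M] {R : Finset ℕ} {q : ℕ} (hq : q ∉ R)
    (F : (ℕ →₀ ℕ) → M) :
    ∑ a ∈ farey (insert q R), F a =
      ∑ a ∈ farey R, ∑ b ∈ Finset.Ico 1 q, F (a + Finsupp.single q b) := by
  classical
  rw [← Finset.sum_product']
  symm
  refine Finset.sum_bij' (fun x _ ↦ x.1 + Finsupp.single q x.2) (fun a _ ↦ (a.erase q, a q))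
    ?_ ?_ ?_ ?_ fun _ _ ↦ rfl
  · rintro ⟨a, b⟩ hx
    simp only [Finset.mem_product, mem_farey, Finset.mem_Ico] at hx
    obtain ⟨⟨h1, h2⟩, h3⟩ := hx
    have haq : a q = 0 := Finsupp.notMem_support_iff.1 (h1 ▸ hq)
    refine mem_farey.2 ⟨?_, ?_⟩
    · ext p
      by_cases hp : p = q
      · subst hp
        simp only [Finsupp.mem_support_iff, Finsupp.add_apply, haq, Finsupp.single_eq_same,
          Finset.mem_insert, true_or, iff_true]
        omega
      · simp only [Finsupp.mem_support_iff, Finsupp.add_apply, Finsupp.single_apply,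
          if_neg (Ne.symm hp), add_zero, Finset.mem_insert, hp, false_or]
        rw [← h1, Finsupp.mem_support_iff]
    · intro p hp
      rcases Finset.mem_insert.1 hp with rfl | hp
      · simpa [haq] using h3
      · have : p ≠ q := fun h ↦ hq (h ▸ hp)
        simpa [Finsupp.single_apply, this.symm] using h2 p hp
  · intro a ha
    obtain ⟨h1, h2⟩ := mem_farey.1 ha
    refine Finset.mem_product.2 ⟨mem_farey.2 ⟨?_, fun p hp ↦ ?_⟩, ?_⟩
    · rw [Finsupp.support_erase, h1, Finset.erase_insert hq]
    · have : p ≠ q := fun h ↦ hq (h ▸ hp)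
      simpa [Finsupp.erase_ne this] using h2 p (Finset.mem_insert_of_mem hp)
    · exact Finset.mem_Ico.2 (h2 q (Finset.mem_insert_self q R))
  · rintro ⟨a, b⟩ hx
    simp only [Finset.mem_product, mem_farey, Finset.mem_Ico] at hx
    obtain ⟨⟨h1, h2⟩, h3⟩ := hx
    have haq : a q = 0 := Finsupp.notMem_support_iff.1 (h1 ▸ hq)
    simp only [Prod.mk.injEq]
    refine ⟨?_, by simp [haq]⟩
    ext p
    by_cases hp : p = q
    · subst hp; simp [haq]
    · simp [Finsupp.erase_ne hp]
  · intro a _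
    exact Finsupp.erase_add_single q a

theorem fareyPoint_add_single {R : Finset ℕ} {q : ℕ} (hq : q ∉ R) {a : ℕ →₀ ℕ} (ha : a ∈ farey R)
    (b : ℕ) : fareyPoint (a + Finsupp.single q b) = fareyPoint a + (b : ℝ) / q := by
  classical
  have h1 := (mem_farey.1 ha).1
  have haq : a q = 0 := Finsupp.notMem_support_iff.1 (h1 ▸ hq)
  have h2 : (a + Finsupp.single q b).support ⊆ insert q R := by
    refine Finsupp.support_add.trans (Finset.union_subset ?_ ?_)
    · rw [h1]; exact Finset.subset_insert _ _
    · exact Finsupp.support_single_subset.trans (by simp)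
  rw [fareyPoint_eq h2, fareyPoint_eq h1.le, Finset.sum_insert hq, add_comm]
  congr 1
  · refine Finset.sum_congr rfl fun p hp ↦ ?_
    have : q ≠ p := fun h ↦ hq (h ▸ hp)
    simp [this]
  · simp [haq]

theorem fareySum_nonneg (t : ℕ → ℂ) (N : ℕ) (R : Finset ℕ) : 0 ≤ fareySum t N R :=
  Finset.sum_nonneg fun _ _ ↦ by positivity

theorem fareySum_empty (t : ℕ → ℂ) (N : ℕ) : fareySum t N ∅ = ‖∑ m ∈ Finset.range N, t m‖ ^ 2 := by
  have h := sum_farey_prod (M := ℝ) ∅ fun _ _ ↦ 1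
  have : farey ∅ = {0} := by
    ext a
    rw [mem_farey]
    simp
  simp [fareySum, this, fareyPoint, expSum, expC_zero]

/-- Extending the denominator by primes for which the coefficients avoid a residue class. -/
theorem fareySum_mul_le_union {t : ℕ → ℂ} (N : ℕ) {R Q : Finset ℕ} (hRQ : Disjoint R Q)
    (hQ : ∀ q ∈ Q, q.Prime) (ht : ∀ q ∈ Q, ∃ h, ∀ m, m ≡ h [MOD q] → t m = 0) :
    fareySum t N R * ∏ q ∈ Q, (1 / ((q : ℝ) - 1)) ≤ fareySum t N (R ∪ Q) := by
  classical
  induction Q using Finset.induction_on with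
  | empty => simp
  | insert q Q hq ih =>
    have hq' := hQ q (Finset.mem_insert_self q Q)
    have hqR : q ∉ R ∪ Q := by
      rw [Finset.mem_union, not_or]
      exact ⟨fun h ↦ Finset.disjoint_left.1 hRQ h (Finset.mem_insert_self q Q), hq⟩
    have hq1 : (0 : ℝ) < (q : ℝ) - 1 := by
      have : (1 : ℝ) < q := by exact_mod_cast hq'.one_lt
      linarith
    have ih' := ih (Finset.disjoint_of_subset_right (Finset.subset_insert q Q) hRQ)
      (fun p hp ↦ hQ p (Finset.mem_insert_of_mem hp))
      (fun p hp ↦ ht p (Finset.mem_insert_of_mem hp))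
    obtain ⟨h, hh⟩ := ht q (Finset.mem_insert_self q Q)
    rw [Finset.prod_insert hq, Finset.union_insert]
    calc fareySum t N R * (1 / ((q : ℝ) - 1) * ∏ q ∈ Q, (1 / ((q : ℝ) - 1)))
        = (fareySum t N R * ∏ q ∈ Q, (1 / ((q : ℝ) - 1))) * (1 / ((q : ℝ) - 1)) := by ring
      _ ≤ fareySum t N (R ∪ Q) * (1 / ((q : ℝ) - 1)) :=
          mul_le_mul_of_nonneg_right ih' (by positivity)
      _ ≤ _ := by
          rw [fareySum, fareySum, sum_farey_insert hqR, Finset.sum_mul]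
          refine Finset.sum_le_sum fun a ha ↦ ?_
          have := norm_sq_expSum_le_translates hq'.one_lt hh N (fareyPoint a)
          rw [mul_one_div]
          refine this.trans (Finset.sum_le_sum fun b _ ↦ ?_)
          rw [fareyPoint_add_single hqR ha, expSum]

theorem fareyPoint_spaced {R R' : Finset ℕ} (hR : ∀ p ∈ R, p.Prime) (hR' : ∀ p ∈ R', p.Prime)
    {Q : ℝ} (hRQ : (∏ p ∈ R, p : ℕ) ≤ Q) (hRQ' : (∏ p ∈ R', p : ℕ) ≤ Q) {a a' : ℕ →₀ ℕ}
    (ha : a ∈ farey R) (ha' : a' ∈ farey R') (hne : a ≠ a') (n : ℤ) :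
    1 / Q ^ 2 ≤ |fareyPoint a - fareyPoint a' - n| := by
  classical
  obtain ⟨h1, h2⟩ := mem_farey.1 ha
  obtain ⟨h1', h2'⟩ := mem_farey.1 ha'
  set U := R ∪ R' with hU
  have hUp : ∀ p ∈ U, p.Prime := fun p hp ↦ (Finset.mem_union.1 hp).elim (hR p) (hR' p)
  have hUpos : ∀ p ∈ U, 0 < p := fun p hp ↦ (hUp p hp).pos
  set D := ∏ p ∈ U, p with hD
  have hD0 : 0 < D := Finset.prod_pos hUpos
  have hDQ : (D : ℝ) ≤ Q ^ 2 := by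
    have h3 : D ≤ (∏ p ∈ R, p) * ∏ p ∈ R', p := by
      rw [← Finset.prod_union_inter]
      exact Nat.le_mul_of_pos_right _ (Finset.prod_pos fun p hp ↦
        (hR p (Finset.mem_inter.1 hp).1).pos)
    calc (D : ℝ) ≤ ((∏ p ∈ R, p : ℕ) : ℝ) * (∏ p ∈ R', p : ℕ) := by exact_mod_cast h3
      _ ≤ Q * Q := by gcongr; exact (Nat.cast_nonneg _).trans hRQ
      _ = Q ^ 2 := (sq Q).symm
  set k : ℤ := ∑ p ∈ U, ((a p : ℤ) - a' p) * (∏ q ∈ U.erase p, (q : ℤ)) - n * ∏ q ∈ U, (q : ℤ)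
    with hk
  have hkD : (D : ℝ) * (fareyPoint a - fareyPoint a' - n) = k := by
    rw [fareyPoint_eq (h1.le.trans Finset.subset_union_left : a.support ⊆ U),
      fareyPoint_eq (h1'.le.trans Finset.subset_union_right : a'.support ⊆ U),
      ← Finset.sum_sub_distrib, hk, hD]
    push_cast
    rw [mul_sub, Finset.mul_sum, mul_comm _ (n : ℝ)]
    congr 1
    refine Finset.sum_congr rfl fun p hp ↦ ?_
    have hp0 : (p : ℝ) ≠ 0 := by exact_mod_cast (hUpos p hp).ne'
    rw [← Finset.mul_prod_erase U (fun q : ℕ ↦ (q : ℝ)) hp]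
    field_simp
  obtain ⟨p, hp⟩ := Finsupp.ne_iff.1 hne
  have hpU : p ∈ U := by
    by_contra hpU
    rw [hU, Finset.mem_union, not_or, ← h1, ← h1', Finsupp.notMem_support_iff,
      Finsupp.notMem_support_iff] at hpU
    exact hp (hpU.1.trans hpU.2.symm)
  have hlt : a p < p ∧ a' p < p := by
    have aux : ∀ {b : ℕ →₀ ℕ} {V : Finset ℕ}, b ∈ farey V → b p < p := fun {b V} hb ↦ by
      by_cases hpV : p ∈ V
      · exact ((mem_farey.1 hb).2 p hpV).2
      · rw [Finsupp.notMem_support_iff.1 ((mem_farey.1 hb).1 ▸ hpV)]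
        exact hUpos p hpU
    exact ⟨aux ha, aux ha'⟩
  have hpp : Prime (p : ℤ) := Nat.prime_iff_prime_int.1 (hUp p hpU)
  have hk0 : k ≠ 0 := by
    intro h0
    have h3 : (p : ℤ) ∣ ((a p : ℤ) - a' p) * (∏ q ∈ U.erase p, (q : ℤ)) := by
      have h4 : ((a p : ℤ) - a' p) * (∏ q ∈ U.erase p, (q : ℤ)) = n * ∏ q ∈ U, (q : ℤ) -
          ∑ x ∈ U.erase p, ((a x : ℤ) - a' x) * (∏ q ∈ U.erase x, (q : ℤ)) := by
        rw [h0, ← Finset.add_sum_erase U _ hpU] at hk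
        linarith
      rw [h4]
      refine dvd_sub (Dvd.dvd.mul_left (Finset.dvd_prod_of_mem (fun q : ℕ ↦ (q : ℤ)) hpU) n)
        (Finset.dvd_sum fun x hx ↦ Dvd.dvd.mul_left (Finset.dvd_prod_of_mem (fun q : ℕ ↦ (q : ℤ))
          (Finset.mem_erase.2 ⟨(Finset.ne_of_mem_erase hx).symm, hpU⟩)) _)
    rcases hpp.dvd_or_dvd h3 with h4 | h4
    · have : (a' p : ℤ) ≡ a p [ZMOD p] := (Int.modEq_iff_dvd).2 h4
      exact hp ((Int.natCast_modEq_iff.1 this).eq_of_lt_of_lt hlt.2 hlt.1).symm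
    · obtain ⟨q, hq, hq'⟩ := (hpp.dvd_finsetProd_iff _).1 h4
      have hq2 := Finset.mem_erase.1 hq
      exact hq2.1 ((Nat.prime_dvd_prime_iff_eq (hUp p hpU) (hUp q hq2.2)).1
        (Int.natCast_dvd_natCast.1 hq')).symm
  have hk1 : (1 : ℝ) ≤ |(k : ℝ)| := by exact_mod_cast Int.one_le_abs hk0
  have hD0' : (0 : ℝ) < D := by exact_mod_cast hD0
  rw [← hkD, abs_mul, abs_of_pos hD0'] at hk1
  calc 1 / Q ^ 2 ≤ 1 / (D : ℝ) := one_div_le_one_div_of_le hD0' hDQ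
    _ ≤ _ := by rw [div_le_iff₀ hD0', mul_comm]; exact hk1

/-- The large sieve over Farey fractions with squarefree denominators. -/
theorem sum_fareySum_le {𝓜 : Finset (Finset ℕ)} {Q : ℝ} (hQ : 1 ≤ Q)
    (h𝓜 : ∀ M ∈ 𝓜, (∀ p ∈ M, p.Prime) ∧ (∏ p ∈ M, p : ℕ) ≤ Q)
    {w : ℕ → ℝ} (hw : Antitone w) (hw0 : ∀ n, 0 < w n) (N : ℕ) (t : ℕ → ℂ) :
    ∑ M ∈ 𝓜, fareySum t N M ≤
      (∑ m ∈ Finset.range N, w m + w 0 * (Q ^ 2 * (1 + log (Q ^ 2)))) *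
        ∑ m ∈ Finset.range N, ‖t m‖ ^ 2 / w m := by
  classical
  have hQ2 : 1 ≤ Q ^ 2 := one_le_pow₀ hQ
  have h1 : ∑ M ∈ 𝓜, fareySum t N M =
      ∑ a ∈ 𝓜.biUnion farey, ‖expSum t N (fareyPoint a)‖ ^ 2 := by
    rw [Finset.sum_biUnion]
    · rfl
    · intro M _ M' _ hne
      refine Finset.disjoint_left.2 fun a ha ha' ↦ hne ?_
      rw [← (mem_farey.1 ha).1, ← (mem_farey.1 ha').1]
  rw [h1]
  have h2 := large_sieve (A := 𝓜.biUnion farey) (θ := fareyPoint) (δ := 1 / Q ^ 2)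
    (by positivity) ((div_le_one (by positivity)).2 hQ2) (fun a ha a' ha' hne n ↦ by
      obtain ⟨M, hM, haM⟩ := Finset.mem_biUnion.1 ha
      obtain ⟨M', hM', haM'⟩ := Finset.mem_biUnion.1 ha'
      exact fareyPoint_spaced (h𝓜 M hM).1 (h𝓜 M' hM').1 (h𝓜 M hM).2 (h𝓜 M' hM').2 haM haM' hne n)
    hw hw0 N t
  refine h2.trans (le_of_eq ?_)
  congr 3
  field_simp

/-- The large sieve for sets sieved by large primes. -/
theorem sum_fareySum_mul_le {𝓡 𝓠 : Finset (Finset ℕ)} {Y z : ℝ} (hY : 1 ≤ Y) (hz : 1 ≤ z)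
    (h𝓡 : ∀ R ∈ 𝓡, (∀ p ∈ R, p.Prime) ∧ (∏ p ∈ R, p : ℕ) ≤ Y)
    (h𝓠 : ∀ Q ∈ 𝓠, (∀ q ∈ Q, q.Prime ∧ Y < q) ∧ (∏ q ∈ Q, q : ℕ) ≤ z)
    {t : ℕ → ℂ} (ht : ∀ Q ∈ 𝓠, ∀ q ∈ Q, ∃ h, ∀ m, m ≡ h [MOD q] → t m = 0)
    {w : ℕ → ℝ} (hw : Antitone w) (hw0 : ∀ n, 0 < w n) (N : ℕ) :
    (∑ R ∈ 𝓡, fareySum t N R) * ∑ Q ∈ 𝓠, ∏ q ∈ Q, (1 / ((q : ℝ) - 1)) ≤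
      (∑ m ∈ Finset.range N, w m + w 0 * ((Y * z) ^ 2 * (1 + log ((Y * z) ^ 2)))) *
        ∑ m ∈ Finset.range N, ‖t m‖ ^ 2 / w m := by
  classical
  have hle : ∀ R ∈ 𝓡, ∀ p ∈ R, (p : ℝ) ≤ Y := fun R hR p hp ↦ by
    refine le_trans ?_ (h𝓡 R hR).2
    exact_mod_cast Nat.le_of_dvd (Finset.prod_pos fun q hq ↦ ((h𝓡 R hR).1 q hq).pos)
      (Finset.dvd_prod_of_mem (fun p ↦ p) hp)
  have hdisj : ∀ R ∈ 𝓡, ∀ Q ∈ 𝓠, Disjoint R Q := fun R hR Q hQ ↦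
    Finset.disjoint_left.2 fun p hp hp' ↦
      absurd (hle R hR p hp) (not_le.2 ((h𝓠 Q hQ).1 p hp').2)
  have hfR : ∀ R ∈ 𝓡, ∀ Q ∈ 𝓠, (R ∪ Q).filter (fun p : ℕ ↦ (p : ℝ) ≤ Y) = R := fun R hR Q hQ ↦ by
    rw [Finset.filter_union, Finset.filter_true_of_mem (hle R hR),
      Finset.filter_false_of_mem fun q hq ↦ not_le.2 ((h𝓠 Q hQ).1 q hq).2, Finset.union_empty]
  have hfQ : ∀ R ∈ 𝓡, ∀ Q ∈ 𝓠, (R ∪ Q).filter (fun p : ℕ ↦ ¬ (p : ℝ) ≤ Y) = Q := fun R hR Q hQ ↦ by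
    rw [Finset.filter_union, Finset.filter_true_of_mem fun q hq ↦
      not_le.2 ((h𝓠 Q hQ).1 q hq).2, Finset.filter_false_of_mem fun p hp ↦
      not_not.2 (hle R hR p hp), Finset.empty_union]
  have hinj : Set.InjOn (fun x : Finset ℕ × Finset ℕ ↦ x.1 ∪ x.2) (𝓡 ×ˢ 𝓠 : Finset _) := by
    rintro ⟨R, Q⟩ hx ⟨R', Q'⟩ hx' h
    simp only [Finset.coe_product, Set.mem_prod, Finset.mem_coe] at hx hx' h
    refine Prod.ext ?_ ?_
    · exact (hfR R hx.1 Q hx.2).symm.trans (h ▸ hfR R' hx'.1 Q' hx'.2)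
    · exact (hfQ R hx.1 Q hx.2).symm.trans (h ▸ hfQ R' hx'.1 Q' hx'.2)
  calc (∑ R ∈ 𝓡, fareySum t N R) * ∑ Q ∈ 𝓠, ∏ q ∈ Q, (1 / ((q : ℝ) - 1))
      = ∑ x ∈ 𝓡 ×ˢ 𝓠, fareySum t N x.1 * ∏ q ∈ x.2, (1 / ((q : ℝ) - 1)) := by
        rw [Finset.sum_mul_sum, ← Finset.sum_product']
    _ ≤ ∑ x ∈ 𝓡 ×ˢ 𝓠, fareySum t N (x.1 ∪ x.2) := by
        refine Finset.sum_le_sum fun x hx ↦ ?_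
        obtain ⟨hx1, hx2⟩ := Finset.mem_product.1 hx
        exact fareySum_mul_le_union N (hdisj _ hx1 _ hx2) (fun q hq ↦ ((h𝓠 _ hx2).1 q hq).1)
          (ht _ hx2)
    _ = ∑ M ∈ (𝓡 ×ˢ 𝓠).image fun x ↦ x.1 ∪ x.2, fareySum t N M := by
        rw [Finset.sum_image hinj]
    _ ≤ _ := by
        refine sum_fareySum_le (one_le_mul_of_one_le_of_one_le hY hz) (fun M hM ↦ ?_) hw hw0 N t
        obtain ⟨⟨R, Q⟩, hx, rfl⟩ := Finset.mem_image.1 hM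
        obtain ⟨hx1, hx2⟩ := Finset.mem_product.1 hx
        refine ⟨fun p hp ↦ (Finset.mem_union.1 hp).elim ((h𝓡 _ hx1).1 p)
          fun hp ↦ ((h𝓠 _ hx2).1 p hp).1, ?_⟩
        simp only at hx1 hx2 ⊢
        rw [Finset.prod_union (hdisj _ hx1 _ hx2), Nat.cast_mul]
        exact mul_le_mul (h𝓡 _ hx1).2 (h𝓠 _ hx2).2 (Nat.cast_nonneg _) (by linarith)

end Farey

section Energy

open Real

/-- A mean zero function modulo `p` supported on units, with bounded `L¹` norm. -/
structure IsSieveFactor (p : ℕ) (f : ℕ → ℝ) : Prop where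
  periodic : Function.Periodic f p
  zero : f 0 = 0
  sum_eq_zero : ∑ c ∈ Finset.range p, f c = 0
  sum_abs_le : ∑ c ∈ Finset.range p, |f c| ≤ 4

theorem IsSieveFactor.eq_zero {p : ℕ} {f : ℕ → ℝ} (h : IsSieveFactor p f) {n : ℕ} (hn : p ∣ n) :
    f n = 0 := by
  rw [← h.periodic.map_mod_nat n, Nat.mod_eq_zero_of_dvd hn, h.zero]

theorem IsSieveFactor.periodic_mul {p : ℕ} {f : ℕ → ℝ} (h : IsSieveFactor p f) (m : ℕ) :
    Function.Periodic (fun c ↦ f (m * c)) p := by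
  intro c
  simp only [mul_add]
  exact h.periodic.nat_mul m _

theorem IsSieveFactor.sum_mul_left {p : ℕ} {f : ℕ → ℝ} (h : IsSieveFactor p f) (hp : 0 < p)
    {m : ℕ} (hm : m.Coprime p) : ∑ c ∈ Finset.range p, f (m * c) = 0 := by
  have := sum_range_mul_left_periodic hp hm 0 h.periodic
  simpa [h.sum_eq_zero] using this

/-- The correlation of two dilates of a sieve factor. -/
noncomputable def corr (p : ℕ) (f : ℕ → ℝ) (m n : ℕ) : ℝ :=
  (p : ℝ)⁻¹ * ∑ c ∈ Finset.range p, |f (m * c)| * |f (n * c)|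

theorem corr_nonneg (p : ℕ) (f : ℕ → ℝ) (m n : ℕ) : 0 ≤ corr p f m n :=
  mul_nonneg (by positivity) (Finset.sum_nonneg fun _ _ ↦ by positivity)

theorem corr_periodic {p : ℕ} {f : ℕ → ℝ} (h : IsSieveFactor p f) (m : ℕ) :
    Function.Periodic (corr p f m) p := by
  intro n
  unfold corr
  congr 1
  refine Finset.sum_congr rfl fun c _ ↦ ?_
  have := h.periodic_mul c n
  simp only [mul_comm c] at this
  rw [this]

theorem sum_corr_le {p : ℕ} {f : ℕ → ℝ} (h : IsSieveFactor p f) (hp : p.Prime) {m : ℕ}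
    (hm : m.Coprime p) : ∑ d ∈ Finset.range p, corr p f m d ≤ 16 / p := by
  have habs : Function.Periodic (fun c ↦ |f c|) p := fun c ↦ by simp only [h.periodic c]
  have h1 : ∀ c ∈ Finset.range p, ∑ d ∈ Finset.range p, |f (m * c)| * |f (d * c)| ≤
      |f (m * c)| * 4 := by
    intro c hc
    rw [← Finset.mul_sum]
    rcases Nat.eq_zero_or_pos c with rfl | hc0
    · simp [h.zero]
    · refine mul_le_mul_of_nonneg_left ?_ (abs_nonneg _)
      have hcp : c.Coprime p := (Nat.coprime_of_lt_prime hc0.ne' (Finset.mem_range.1 hc) hp).symm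
      have := sum_range_mul_left_periodic hp.pos hcp 0 habs
      simp only [zero_add, mul_comm c] at this
      rw [this]
      exact h.sum_abs_le
  have h2 : ∑ c ∈ Finset.range p, |f (m * c)| ≤ 4 := by
    have := sum_range_mul_left_periodic hp.pos hm 0 habs
    simp only [zero_add] at this
    rw [this]
    exact h.sum_abs_le
  calc ∑ d ∈ Finset.range p, corr p f m d
      = (p : ℝ)⁻¹ * ∑ c ∈ Finset.range p, ∑ d ∈ Finset.range p, |f (m * c)| * |f (d * c)| := by
        simp only [corr]
        rw [← Finset.mul_sum, Finset.sum_comm]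
    _ ≤ (p : ℝ)⁻¹ * ((∑ c ∈ Finset.range p, |f (m * c)|) * 4) := by
        rw [Finset.sum_mul]
        exact mul_le_mul_of_nonneg_left (Finset.sum_le_sum h1) (by positivity)
    _ ≤ (p : ℝ)⁻¹ * (4 * 4) := by gcongr
    _ = 16 / p := by ring

theorem sum_mul_prod_corr_le {R : Finset ℕ} (hR : ∀ p ∈ R, p.Prime) {e : ℕ → ℕ → ℝ}
    (he : ∀ p ∈ R, IsSieveFactor p (e p)) {P : Finset ℕ} {b : ℕ → ℝ} {M : ℝ}
    (hM : ∀ c, ∑ n ∈ P with n % (∏ p ∈ R, p) = c, b n ≤ M) (hM0 : 0 ≤ M) {m : ℕ}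
    (hm : ∀ p ∈ R, m.Coprime p) :
    ∑ n ∈ P, b n * ∏ p ∈ R, corr p (e p) m n ≤ 16 ^ R.card / (∏ p ∈ R, p : ℕ) * M := by
  set r := ∏ p ∈ R, p with hr
  have hr0 : 0 < r := Finset.prod_pos fun p hp ↦ (hR p hp).pos
  have hper := periodic_finset_prod (f := fun p ↦ corr p (e p) m)
    fun p hp ↦ corr_periodic (he p hp) m
  have hmaps : ∀ n ∈ P, n % r ∈ Finset.range r := fun n _ ↦ Finset.mem_range.2 (Nat.mod_lt _ hr0)
  have hnn : ∀ d, 0 ≤ ∏ p ∈ R, corr p (e p) m d := fun d ↦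
    Finset.prod_nonneg fun p _ ↦ corr_nonneg _ _ _ _
  calc ∑ n ∈ P, b n * ∏ p ∈ R, corr p (e p) m n
      = ∑ d ∈ Finset.range r, (∑ n ∈ P with n % r = d, b n) * ∏ p ∈ R, corr p (e p) m d := by
        rw [← Finset.sum_fiberwise_of_maps_to hmaps]
        refine Finset.sum_congr rfl fun d _ ↦ ?_
        rw [Finset.sum_mul]
        refine Finset.sum_congr rfl fun n hn ↦ ?_
        congr 1
        have := hper.map_mod_nat n
        rw [← hr, (Finset.mem_filter.1 hn).2] at this
        exact this.symm
    _ ≤ ∑ d ∈ Finset.range r, M * ∏ p ∈ R, corr p (e p) m d :=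
        Finset.sum_le_sum fun d _ ↦ mul_le_mul_of_nonneg_right (hM d) (hnn d)
    _ = M * ∏ p ∈ R, ∑ d ∈ Finset.range p, corr p (e p) m d := by
        rw [← Finset.mul_sum, sum_range_prod_periodic hR fun p hp ↦ corr_periodic (he p hp) m]
    _ ≤ M * ∏ p ∈ R, (16 / (p : ℝ)) :=
        mul_le_mul_of_nonneg_left (Finset.prod_le_prod (fun p _ ↦ Finset.sum_nonneg fun d _ ↦
          corr_nonneg _ _ _ _) fun p hp ↦ sum_corr_le (he p hp) (hR p hp) (hm p hp)) hM0
    _ = 16 ^ R.card / r * M := by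
        rw [Finset.prod_div_distrib, Finset.prod_const, hr, Nat.cast_prod, mul_comm]

theorem exists_farey_coeff {R : Finset ℕ} (hR : ∀ p ∈ R, p.Prime) {e : ℕ → ℕ → ℝ}
    (he : ∀ p ∈ R, IsSieveFactor p (e p)) {P : Finset ℕ} {a b : ℕ → ℝ}
    (hab : ∀ n ∈ P, |a n| ≤ b n) (ha : ∀ n ∈ P, ∀ p ∈ R, p ∣ n → a n = 0) {M : ℝ}
    (hM : ∀ c, ∑ n ∈ P with n % (∏ p ∈ R, p) = c, b n ≤ M) (hM0 : 0 ≤ M) :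
    ∃ H : (ℕ →₀ ℕ) → ℂ, (∀ n : ℕ, ((∑ m ∈ P, a m * ∏ p ∈ R, e p (m * n) : ℝ) : ℂ) =
        ∑ x ∈ farey R, H x * expC (n * fareyPoint x)) ∧
      ∑ x ∈ farey R, ‖H x‖ ^ 2 ≤ 16 ^ R.card / (∏ p ∈ R, p : ℕ) * M * ∑ m ∈ P, b m := by
  have hcop : ∀ m ∈ P, a m ≠ 0 → ∀ p ∈ R, m.Coprime p := fun m hm h0 p hp ↦
    (Nat.Coprime.symm ((hR p hp).coprime_iff_not_dvd.2 fun h ↦ h0 (ha m hm p hp h)))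
  set F : ℕ → ℕ → ℕ → ℂ := fun m p x ↦ fourierCoef p (fun c ↦ e p (m * c)) x with hF
  refine ⟨fun x ↦ ∑ m ∈ P, a m * ∏ p ∈ R, F m p (x p), fun n ↦ ?_, ?_⟩
  · simp only [Finset.sum_mul]
    rw [Finset.sum_comm]
    push_cast
    refine Finset.sum_congr rfl fun m hm ↦ ?_
    by_cases h0 : a m = 0
    · simp [h0]
    have h1 : ∀ p ∈ R, (e p (m * n) : ℂ) =
        ∑ x ∈ Finset.Ico 1 p, F m p x * expC (n * ((x : ℝ) / p)) := fun p hp ↦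
      eq_sum_fourierCoef_of_mean_zero (hR p hp).pos ((he p hp).periodic_mul m)
        ((he p hp).sum_mul_left (hR p hp).pos (hcop m hm h0 p hp)) n
    rw [Finset.prod_congr rfl h1, ← sum_farey_prod, Finset.mul_sum]
    refine Finset.sum_congr rfl fun x hx ↦ ?_
    rw [Finset.prod_mul_distrib, ← expC_sum, ← Finset.mul_sum,
      fareyPoint_eq (mem_farey.1 hx).1.le, mul_assoc]
  · have h1 : ((∑ x ∈ farey R, ‖∑ m ∈ P, a m * ∏ p ∈ R, F m p (x p)‖ ^ 2 : ℝ) : ℂ) =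
        ((∑ m ∈ P, ∑ n ∈ P, a m * a n * ∏ p ∈ R, ((p : ℝ)⁻¹ * ∑ c ∈ Finset.range p,
          e p (m * c) * e p (n * c)) : ℝ) : ℂ) := by
      push_cast
      have h2 : ∀ x ∈ farey R, (‖∑ m ∈ P, a m * ∏ p ∈ R, F m p (x p)‖ : ℂ) ^ 2 =
          ∑ m ∈ P, ∑ n ∈ P, (a m : ℂ) * a n *
            ∏ p ∈ R, (F m p (x p) * (starRingEnd ℂ) (F n p (x p))) := by
        intro x _
        rw [← Complex.mul_conj', map_sum, Finset.sum_mul_sum]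
        refine Finset.sum_congr rfl fun m _ ↦ Finset.sum_congr rfl fun n _ ↦ ?_
        rw [map_mul, Complex.conj_ofReal, map_prod, Finset.prod_mul_distrib]
        ring
      rw [Finset.sum_congr rfl h2, Finset.sum_comm]
      refine Finset.sum_congr rfl fun m hm ↦ ?_
      rw [Finset.sum_comm]
      refine Finset.sum_congr rfl fun n hn ↦ ?_
      rw [← Finset.mul_sum,
        sum_farey_prod R fun p y ↦ F m p y * (starRingEnd ℂ) (F n p y)]
      by_cases h0 : a m = 0
      · simp [h0]
      congr 1
      refine Finset.prod_congr rfl fun p hp ↦ ?_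
      have h3 := parseval_fourierCoef (hR p hp).pos (fun c ↦ e p (m * c)) fun c ↦ e p (n * c)
      rw [Finset.range_eq_Ico, Finset.sum_eq_sum_Ico_succ_bot (hR p hp).pos,
        fourierCoef_zero ((he p hp).sum_mul_left (hR p hp).pos (hcop m hm h0 p hp)), zero_mul,
        zero_add] at h3
      rw [zero_add] at h3
      simp only [hF]
      rw [h3]
      push_cast
      rw [Finset.range_eq_Ico]
    rw [Complex.ofReal_inj] at h1
    rw [h1]
    have hb0 : ∀ m ∈ P, 0 ≤ b m := fun m hm ↦ (abs_nonneg _).trans (hab m hm)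
    calc _ ≤ ∑ m ∈ P, ∑ n ∈ P, |a m| * (b n * ∏ p ∈ R, corr p (e p) m n) := by
          refine Finset.sum_le_sum fun m hm ↦ Finset.sum_le_sum fun n hn ↦
            (le_abs_self _).trans ?_
          rw [abs_mul, abs_mul, mul_assoc, Finset.abs_prod]
          refine mul_le_mul_of_nonneg_left (mul_le_mul (hab n hn) (Finset.prod_le_prod
            (fun _ _ ↦ abs_nonneg _) fun p hp ↦ ?_) (Finset.prod_nonneg fun _ _ ↦ abs_nonneg _)
            (hb0 n hn)) (abs_nonneg _)
          rw [abs_mul, abs_inv, Nat.abs_cast, corr]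
          refine mul_le_mul_of_nonneg_left ((Finset.abs_sum_le_sum_abs _ _).trans
            (Finset.sum_le_sum fun c _ ↦ (abs_mul _ _).le)) (by positivity)
      _ ≤ ∑ m ∈ P, b m * (16 ^ R.card / (∏ p ∈ R, p : ℕ) * M) := by
          refine Finset.sum_le_sum fun m hm ↦ ?_
          rw [← Finset.mul_sum]
          by_cases h0 : a m = 0
          · rw [h0, abs_zero, zero_mul]
            have := hb0 m hm
            positivity
          refine mul_le_mul (hab m hm) (sum_mul_prod_corr_le hR he hM hM0 (hcop m hm h0))
            (Finset.sum_nonneg fun n hn ↦ mul_nonneg (hb0 n hn)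
              (Finset.prod_nonneg fun p _ ↦ corr_nonneg _ _ _ _)) (hb0 m hm)
      _ = _ := by rw [← Finset.sum_mul, mul_comm]

/-- Cauchy's inequality for a bilinear form expanded over Farey fractions. -/
theorem sq_bilinear_le {𝓡 : Finset (Finset ℕ)} {h : Finset ℕ → ℕ → ℝ}
    {H : Finset ℕ → (ℕ →₀ ℕ) → ℂ}
    (hH : ∀ R ∈ 𝓡, ∀ n : ℕ, (h R n : ℂ) = ∑ x ∈ farey R, H R x * expC (n * fareyPoint x))
    (t : ℕ → ℝ) (N : ℕ) :
    (∑ R ∈ 𝓡, ∑ n ∈ Finset.range N, t n * h R n) ^ 2 ≤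
      (∑ R ∈ 𝓡, ∑ x ∈ farey R, ‖H R x‖ ^ 2) * ∑ R ∈ 𝓡, fareySum (fun n ↦ (t n : ℂ)) N R := by
  have h1 : ((∑ R ∈ 𝓡, ∑ n ∈ Finset.range N, t n * h R n : ℝ) : ℂ) =
      ∑ y ∈ 𝓡.sigma farey, H y.1 y.2 * expSum (fun n ↦ (t n : ℂ)) N (fareyPoint y.2) := by
    rw [Finset.sum_sigma]
    push_cast
    refine Finset.sum_congr rfl fun R hR ↦ ?_
    simp only [expSum, Finset.mul_sum]
    rw [Finset.sum_comm]
    refine Finset.sum_congr rfl fun n _ ↦ ?_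
    rw [hH R hR, Finset.mul_sum]
    exact Finset.sum_congr rfl fun x _ ↦ by ring
  have h2 : |∑ R ∈ 𝓡, ∑ n ∈ Finset.range N, t n * h R n| ≤
      ∑ y ∈ 𝓡.sigma farey, ‖H y.1 y.2‖ * ‖expSum (fun n ↦ (t n : ℂ)) N (fareyPoint y.2)‖ := by
    rw [← Real.norm_eq_abs, ← Complex.norm_real, h1]
    exact (norm_sum_le _ _).trans (Finset.sum_le_sum fun y _ ↦ (norm_mul _ _).le)
  rw [← sq_abs]
  refine (pow_le_pow_left₀ (abs_nonneg _) h2 2).trans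
    ((Finset.sum_mul_sq_le_sq_mul_sq _ _ _).trans (le_of_eq ?_))
  rw [Finset.sum_sigma, Finset.sum_sigma]
  rfl

end Energy

section RoughSum

open Filter Topology Real

/-- Sets of primes exceeding `Y` with product at most `z`. -/
noncomputable def roughSets (Y z : ℝ) : Finset (Finset ℕ) :=
  (primesIoc Y z).powerset.filter fun Q ↦ ((∏ p ∈ Q, p : ℕ) : ℝ) ≤ z

theorem mem_roughSets {Y z : ℝ} {Q : Finset ℕ} :
    Q ∈ roughSets Y z ↔ (∀ p ∈ Q, p.Prime ∧ Y < p) ∧ ((∏ p ∈ Q, p : ℕ) : ℝ) ≤ z := by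
  rw [roughSets, Finset.mem_filter, Finset.mem_powerset]
  refine and_congr_left fun h ↦ ⟨fun h1 p hp ↦ ?_, fun h1 p hp ↦ mem_primesIoc.2
    ⟨(h1 p hp).1, (h1 p hp).2, le_trans ?_ h⟩⟩
  · have := mem_primesIoc.1 (h1 hp)
    exact ⟨this.1, this.2.1⟩
  · exact_mod_cast Nat.le_of_dvd (Finset.prod_pos fun q hq ↦ (h1 q hq).1.pos)
      (Finset.dvd_prod_of_mem (fun p ↦ p) hp)

/-- The sum of `1 / φ(m)` over squarefree `m ≤ z` with all prime factors exceeding `Y`. -/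
noncomputable def roughSum (Y z : ℝ) : ℝ :=
  ∑ Q ∈ roughSets Y z, ∏ q ∈ Q, (1 / ((q : ℝ) - 1))

theorem prod_one_div_sub_one_nonneg {Q : Finset ℕ} (hQ : ∀ q ∈ Q, q.Prime) :
    0 ≤ ∏ q ∈ Q, (1 / ((q : ℝ) - 1)) :=
  Finset.prod_nonneg fun q hq ↦ one_div_nonneg.2 (sub_nonneg.2 (by
    exact_mod_cast (hQ q hq).one_lt.le))

theorem roughSum_le_mul {y Y z : ℝ} :
    roughSum y z ≤ (∏ p ∈ primesIoc y Y, (1 + 1 / ((p : ℝ) - 1))) * roughSum Y z := by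
  classical
  rw [Finset.prod_one_add, roughSum, roughSum, Finset.sum_mul_sum, ← Finset.sum_product']
  have hinj : Set.InjOn (fun Q : Finset ℕ ↦
      (Q.filter (fun p : ℕ ↦ (p : ℝ) ≤ Y), Q.filter fun p : ℕ ↦ ¬ (p : ℝ) ≤ Y))
      (roughSets y z : Set (Finset ℕ)) := by
    intro Q _ Q' _ h
    rw [Prod.mk.injEq] at h
    rw [← Finset.filter_union_filter_not_eq (fun p : ℕ ↦ (p : ℝ) ≤ Y) Q, h.1, h.2,
      Finset.filter_union_filter_not_eq]
  have heq : ∀ Q : Finset ℕ, ∏ q ∈ Q, (1 / ((q : ℝ) - 1)) =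
      (∏ q ∈ Q.filter (fun p : ℕ ↦ (p : ℝ) ≤ Y), (1 / ((q : ℝ) - 1))) *
        ∏ q ∈ Q.filter (fun p : ℕ ↦ ¬ (p : ℝ) ≤ Y), (1 / ((q : ℝ) - 1)) := fun Q ↦
    (Finset.prod_filter_mul_prod_filter_not _ _ _).symm
  have himg := Finset.sum_image hinj (f := fun x : Finset ℕ × Finset ℕ ↦
    (∏ q ∈ x.1, (1 / ((q : ℝ) - 1))) * ∏ q ∈ x.2, (1 / ((q : ℝ) - 1)))
  rw [Finset.sum_congr rfl fun Q _ ↦ heq Q]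
  refine himg.symm.le.trans ?_
  refine Finset.sum_le_sum_of_subset_of_nonneg ?_ ?_
  · intro x hx
    obtain ⟨Q, hQ, rfl⟩ := Finset.mem_image.1 hx
    rw [mem_roughSets] at hQ
    simp only [Finset.mem_product, Finset.mem_powerset]
    refine ⟨fun p hp ↦ ?_, mem_roughSets.2 ⟨fun p hp ↦ ?_, le_trans ?_ hQ.2⟩⟩
    · rw [Finset.mem_filter] at hp
      exact mem_primesIoc.2 ⟨(hQ.1 p hp.1).1, (hQ.1 p hp.1).2, hp.2⟩
    · rw [Finset.mem_filter, not_le] at hp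
      exact ⟨(hQ.1 p hp.1).1, hp.2⟩
    · exact_mod_cast Nat.le_of_dvd (Finset.prod_pos fun q hq ↦ (hQ.1 q hq).1.pos)
        (Finset.prod_dvd_prod_of_subset _ _ _ (Finset.filter_subset _ _))
  · rintro ⟨A, Q⟩ hx _
    obtain ⟨hA, hQ⟩ := Finset.mem_product.1 hx
    exact mul_nonneg (prod_one_div_sub_one_nonneg fun q hq ↦
      (mem_primesIoc.1 (Finset.mem_powerset.1 hA hq)).1)
      (prod_one_div_sub_one_nonneg fun q hq ↦ ((mem_roughSets.1 hQ).1 q hq).1)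

theorem one_add_one_div_sub_one_le {Y : ℝ} (hY : 1 < Y) {p : ℕ} (hp : 7 ≤ p) (hpY : (p : ℝ) ≤ Y) :
    1 + 1 / ((p : ℝ) - 1) ≤ ((1 - (p : ℝ) ^ (-(1 + 1 / log Y)))⁻¹) ^ 4 := by
  have hp7 : (7 : ℝ) ≤ p := by exact_mod_cast hp
  have hlogY : 0 < log Y := log_pos hY
  have hx : exp (-1) / p ≤ (p : ℝ) ^ (-(1 + 1 / log Y)) := by
    rw [rpow_def_of_pos (by linarith), div_eq_mul_inv]
    conv_lhs => rw [← exp_log (by linarith : (0:ℝ) < p), ← exp_neg, ← exp_add]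
    refine exp_le_exp.2 ?_
    have h1 : log p ≤ log Y := log_le_log (by linarith) hpY
    have h2 : log p / log Y ≤ 1 := (div_le_one hlogY).2 h1
    have : log p * -(1 + 1 / log Y) = -log p - log p / log Y := by ring
    rw [this]
    linarith
  have hx1 : (p : ℝ) ^ (-(1 + 1 / log Y)) < 1 :=
    rpow_lt_one_of_one_lt_of_neg (by linarith) (by
      have : 0 < 1 / log Y := by positivity
      linarith)
  have he : (0.36 : ℝ) ≤ exp (-1) := by
    rw [exp_neg]
    rw [le_inv_comm₀ (by norm_num) (exp_pos _)]
    have := exp_one_lt_d9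
    norm_num at this ⊢
    linarith
  set x := (p : ℝ) ^ (-(1 + 1 / log Y)) with hxdef
  have h3 : 0.36 / (p : ℝ) ≤ x := le_trans (by gcongr) hx
  have hx0 : 0 < x := lt_of_lt_of_le (by positivity) h3
  have h4 : 1 + x ≤ (1 - x)⁻¹ := by
    rw [← one_div, le_div_iff₀ (by linarith)]
    nlinarith
  have h5 : 1 + 4 * (0.36 / (p : ℝ)) ≤ (1 + x) ^ 4 := by
    have := one_add_mul_le_pow (a := x) (by linarith) 4
    push_cast at this
    linarith
  refine le_trans ?_ (h5.trans (pow_le_pow_left₀ (by linarith) h4 4))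
  have : 1 / ((p : ℝ) - 1) ≤ 1.44 / p := by
    rw [div_le_div_iff₀ (by linarith) (by linarith)]
    linarith
  have h6 : 4 * (0.36 / (p : ℝ)) = 1.44 / p := by ring
  linarith

theorem HasProd.le_finset_prod {ι : Type*} {f : ι → ℝ} {a : ℝ} (h : HasProd f a)
    (h0 : ∀ i, 0 ≤ f i) (h1 : ∀ i, f i ≤ 1) (S : Finset ι) : a ≤ ∏ i ∈ S, f i := by
  classical
  refine le_of_tendsto h (eventually_atTop.2 ⟨S, fun S' hS ↦ ?_⟩)
  rw [← Finset.prod_sdiff hS]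
  exact mul_le_of_le_one_left (Finset.prod_nonneg fun i _ ↦ h0 i)
    (Finset.prod_le_one (fun i _ ↦ h0 i) fun i _ ↦ h1 i)

theorem zetaFactor_mem_Ioc {s : ℝ} (hs : 0 < s) (p : ℕ) :
    0 < zetaFactor s p ∧ zetaFactor s p ≤ 1 := by
  unfold zetaFactor
  split_ifs with hp
  · have h1 : (p : ℝ) ^ (-(1 + s)) < 1 :=
      rpow_lt_one_of_one_lt_of_neg (by exact_mod_cast hp.one_lt) (by linarith)
    have h2 : 0 ≤ (p : ℝ) ^ (-(1 + s)) := by positivity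
    constructor <;> linarith
  · simp

theorem eventually_prod_primesIoc_le :
    ∀ᶠ Y : ℝ in atTop, ∏ p ∈ primesIoc 6 Y, (1 + 1 / ((p : ℝ) - 1)) ≤ Y ^ (1 / 16 : ℝ) := by
  have h1 : Tendsto (fun Y : ℝ ↦ 1 / log Y) atTop (𝓝[>] 0) := by
    simp only [one_div]
    exact tendsto_inv_atTop_nhdsGT_zero.comp tendsto_log_atTop
  have h2 := (h1.eventually (tendsto_mul_zeta.eventually (gt_mem_nhds one_lt_two)))
  have h3 : ∀ᶠ Y : ℝ in atTop, log Y ≤ (1 / 2) * Y ^ (1 / 64 : ℝ) := by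
    have := (isLittleO_log_rpow_atTop (r := 1 / 64) (by norm_num)).def
      (c := 1 / 2) (by norm_num)
    filter_upwards [this, eventually_ge_atTop 1] with Y hY hY1
    rwa [norm_of_nonneg (log_nonneg hY1), norm_of_nonneg (by positivity)] at hY
  filter_upwards [h2, h3, eventually_gt_atTop 1] with Y hY2 hY3 hY1
  have hlog : 0 < log Y := log_pos hY1
  set s := 1 / log Y with hs
  have hs0 : 0 < s := by positivity
  set Z := ∑' n : ℕ, 1 / (n : ℝ) ^ (1 + s) with hZ
  have hprod := (hasProd_zetaFactor hs0).le_finset_prod (fun p ↦ (zetaFactor_mem_Ioc hs0 p).1.le)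
    (fun p ↦ (zetaFactor_mem_Ioc hs0 p).2) (primesIoc 6 Y)
  rw [← hZ] at hprod
  have hZ1 : 0 < Z := by
    have hsum : Summable fun n : ℕ ↦ 1 / (n : ℝ) ^ (1 + s) :=
      Real.summable_one_div_nat_rpow.2 (by linarith)
    exact hsum.tsum_pos (fun n ↦ by positivity) 1 (by simp)
  have hZ2 : Z ≤ 2 * log Y := by
    have : s * Z < 2 := hY2
    rw [hs, one_div_mul_eq_div, div_lt_iff₀ hlog] at this
    exact this.le
  calc ∏ p ∈ primesIoc 6 Y, (1 + 1 / ((p : ℝ) - 1))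
      ≤ ∏ p ∈ primesIoc 6 Y, ((zetaFactor s p)⁻¹) ^ 4 := by
        refine Finset.prod_le_prod (fun p hp ↦ ?_) fun p hp ↦ ?_
        · have : (6 : ℝ) < p := (mem_primesIoc.1 hp).2.1
          have : 0 < (p : ℝ) - 1 := by linarith
          positivity
        · obtain ⟨hp1, hp2, hp3⟩ := mem_primesIoc.1 hp
          rw [zetaFactor, if_pos hp1]
          refine one_add_one_div_sub_one_le hY1 ?_ hp3
          have : 6 < p := by exact_mod_cast hp2
          omega
    _ = ((∏ p ∈ primesIoc 6 Y, zetaFactor s p)⁻¹) ^ 4 := by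
        rw [Finset.prod_pow, Finset.prod_inv_distrib]
    _ ≤ Z ^ 4 := by
        refine pow_le_pow_left₀ (inv_nonneg.2 ((inv_nonneg.2 hZ1.le).trans hprod)) ?_ 4
        exact inv_le_of_inv_le₀ hZ1 hprod
    _ ≤ (Y ^ (1 / 64 : ℝ)) ^ 4 := pow_le_pow_left₀ hZ1.le (by linarith) 4
    _ = Y ^ (1 / 16 : ℝ) := by
        rw [← rpow_natCast, ← rpow_mul (by linarith)]
        norm_num

theorem roughSum_six_eq {z : ℝ} (hz : 0 < z) :
    ∑' A : Finset ℕ, (∏ p ∈ A, sieveWeight (0 + 1) 1 6 p) *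
      (if ∑ p ∈ A, log p ≤ 1 * log z then (1 : ℝ) else 0) = roughSum 6 z := by
  rw [roughSum, tsum_eq_sum (s := roughSets 6 z)]
  · refine Finset.sum_congr rfl fun Q hQ ↦ ?_
    obtain ⟨h1, h2⟩ := mem_roughSets.1 hQ
    rw [if_pos, mul_one]
    · refine Finset.prod_congr rfl fun p hp ↦ ?_
      rw [sieveWeight_of_prime (h1 p hp).1 (by exact_mod_cast (h1 p hp).2)]
      simp
    · rw [one_mul, ← log_prod fun p hp ↦ by exact_mod_cast (h1 p hp).1.ne_zero]
      push_cast at h2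
      exact log_le_log (Finset.prod_pos fun p hp ↦ by exact_mod_cast (h1 p hp).1.pos) h2
  · intro A hA
    by_cases hA1 : ∀ p ∈ A, p.Prime ∧ 6 < p
    · rw [if_neg, mul_zero]
      rw [one_mul, ← log_prod fun p hp ↦ by exact_mod_cast (hA1 p hp).1.ne_zero]
      intro h
      refine hA (mem_roughSets.2 ⟨fun p hp ↦ ⟨(hA1 p hp).1, by exact_mod_cast (hA1 p hp).2⟩, ?_⟩)
      push_cast
      exact (log_le_log_iff (Finset.prod_pos fun p hp ↦ by exact_mod_cast (hA1 p hp).1.pos) hz).1 h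
    · push Not at hA1
      obtain ⟨p, hp, h⟩ := hA1
      rw [Finset.prod_eq_zero hp, zero_mul]
      rw [sieveWeight, if_neg]
      exact fun h' ↦ absurd h'.2 (not_lt.2 (h h'.1))

theorem exists_le_roughSum :
    ∃ c > 0, ∃ Y₀ z₀ : ℝ, ∀ Y ≥ Y₀, ∀ z ≥ z₀,
      c * log z * Y ^ (-(1 / 16) : ℝ) ≤ roughSum Y z := by
  have h1 := tendsto_sieveWeight_sum (k := 0) (b := 1) (w := 6) (by norm_num) le_rfl (by simp)
    (φ := fun _ ↦ 1) continuous_const (a := 1) zero_le_one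
  simp only [zero_add, pow_one, sieveConst_one, pow_zero, Nat.factorial_zero, Nat.cast_one,
    div_one, mul_one, intervalIntegral.integral_const, sub_zero, smul_eq_mul] at h1
  have h2 := (h1.comp tendsto_log_atTop).eventually
    (lt_mem_nhds (half_lt_self (mertensProd_pos 6)))
  obtain ⟨z₀, hz₀⟩ := eventually_atTop.1 (h2.and (eventually_gt_atTop 1))
  obtain ⟨Y₀, hY₀⟩ := eventually_atTop.1 (eventually_prod_primesIoc_le.and (eventually_gt_atTop 0))
  refine ⟨mertensProd 6 / 2, half_pos (mertensProd_pos 6), Y₀, z₀, fun Y hY z hz ↦ ?_⟩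
  obtain ⟨h3, h4⟩ := hz₀ z hz
  obtain ⟨h5, h6⟩ := hY₀ Y hY
  have h7 := roughSum_six_eq (z := z) (by linarith)
  simp only [zero_add] at h7
  simp only [Function.comp_apply] at h3
  rw [h7, lt_div_iff₀ (log_pos h4)] at h3
  have h8 : 0 ≤ roughSum Y z := Finset.sum_nonneg fun Q hQ ↦
    prod_one_div_sub_one_nonneg fun q hq ↦ ((mem_roughSets.1 hQ).1 q hq).1
  have h9 := h3.le.trans (roughSum_le_mul.trans (mul_le_mul_of_nonneg_right h5 h8))
  rw [rpow_neg h6.le, ← div_eq_mul_inv, div_le_iff₀ (by positivity)]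
  linarith

end RoughSum

section BrunTitchmarsh

open Real

theorem sum_one_div_add_mul_le {x : ℝ} (hx : 0 < x) {r : ℕ} (hr : 0 < r) (N : ℕ) :
    ∑ m ∈ Finset.range N, 1 / (x + r * m) ≤ 1 / x + 1 / r * log (1 + r * N / x) := by
  have hr' : (0 : ℝ) < r := by exact_mod_cast hr
  rcases N with _ | N
  · simp [hx.le]
  refine le_trans (b := 1 / x + 1 / r * log (1 + r * N / x)) ?_ ?_
  · induction N with
    | zero => simp
    | succ N ih =>
      rw [Finset.sum_range_succ]
      refine (add_le_add_left ih _).trans ?_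
      have h1 : (0 : ℝ) < 1 + r * N / x := by positivity
      have h2 : (0 : ℝ) < 1 + r * (N + 1 : ℕ) / x := by positivity
      have h3 : log ((1 + r * N / x) / (1 + r * (N + 1 : ℕ) / x)) ≤
          (1 + r * N / x) / (1 + r * (N + 1 : ℕ) / x) - 1 := log_le_sub_one_of_pos (by positivity)
      rw [log_div h1.ne' h2.ne'] at h3
      have h4 : (1 + r * N / x) / (1 + r * (N + 1 : ℕ) / x) - 1 =
          - (r * (1 / (x + r * (N + 1 : ℕ)))) := by
        push_cast
        field_simp
        ring
      rw [h4] at h3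
      have h5 : 1 / (x + r * (N + 1 : ℕ)) = 1 / r * (r * (1 / (x + r * (N + 1 : ℕ)))) := by
        field_simp
      rw [h5, add_assoc, ← mul_add]
      gcongr
      linarith
  · gcongr
    simp

/-- The sequence `1 / n` on the elements of `P` in a residue class. -/
noncomputable def invSeq (P : Finset ℕ) (c r : ℕ) (m : ℕ) : ℝ :=
  if c + r * m ∈ P then 1 / ((c + r * m : ℕ) : ℝ) else 0

theorem sum_invSeq_apply {P : Finset ℕ} {c r N : ℕ} (hr : 0 < r) (hc : c < r)
    (hN : ∀ n ∈ P, n < r * N) (F : ℕ → ℝ) :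
    ∑ m ∈ Finset.range N, (if c + r * m ∈ P then F (c + r * m) else 0) =
      ∑ n ∈ P with n % r = c, F n := by
  rw [← Finset.sum_filter]
  refine Finset.sum_bij' (fun m _ ↦ c + r * m) (fun n _ ↦ n / r) ?_ ?_ ?_ ?_ fun _ _ ↦ rfl
  · intro m hm
    rw [Finset.mem_filter] at hm ⊢
    refine ⟨hm.2, ?_⟩
    rw [Nat.add_mul_mod_self_left, Nat.mod_eq_of_lt hc]
  · intro n hn
    rw [Finset.mem_filter] at hn
    rw [Finset.mem_filter, Finset.mem_range]
    refine ⟨Nat.div_lt_of_lt_mul (hN n hn.1), ?_⟩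
    rw [← hn.2, Nat.mod_add_div]
    exact hn.1
  · intro m _
    rw [Nat.add_mul_div_left _ _ hr, Nat.div_eq_of_lt hc, zero_add]
  · intro n hn
    rw [Finset.mem_filter] at hn
    rw [← hn.2]
    exact Nat.mod_add_div _ _

/-- The large sieve inequality for the sequence `1 / p` over primes in a residue class. -/
theorem sum_fareySum_invSeq_mul_le {P : Finset ℕ} {x : ℝ} (hx : 1 ≤ x)
    (hP : ∀ n ∈ P, n.Prime ∧ x < n) {c r N : ℕ} (hr : 0 < r) (hc : c < r)
    (hN : ∀ n ∈ P, n < r * N) {Y Y' z : ℝ} (hY : 1 ≤ Y) (hYY' : Y ≤ Y') (hrY : r ≤ Y')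
    (hz : 1 ≤ z) (hzx : z ≤ x) {𝓡 : Finset (Finset ℕ)}
    (h𝓡 : ∀ R ∈ 𝓡, (∀ p ∈ R, p.Prime) ∧ (∏ p ∈ R, p : ℕ) ≤ Y) :
    (∑ R ∈ 𝓡, fareySum (fun m ↦ (invSeq P c r m : ℂ)) N R) * roughSum Y' z ≤
      (1 / x + 1 / r * log (1 + r * N / x) + (Y * z) ^ 2 * (1 + log ((Y * z) ^ 2)) / x) *
        (2 * ∑ n ∈ P with n % r = c, (1 : ℝ) / n) := by
  have hx0 : 0 < x := by linarith
  have h1 := sum_fareySum_mul_le (𝓡 := 𝓡) (𝓠 := roughSets Y' z) hY hz h𝓡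
    (fun Q hQ ↦ by
      have := mem_roughSets.1 hQ
      exact ⟨fun q hq ↦ ⟨(this.1 q hq).1, hYY'.trans_lt (this.1 q hq).2⟩, this.2⟩)
    (t := fun m ↦ (invSeq P c r m : ℂ)) (fun Q hQ q hq ↦ by
      obtain ⟨h1, h2⟩ := mem_roughSets.1 hQ
      have hqp := (h1 q hq).1
      have hrq : r < q := by exact_mod_cast hrY.trans_lt (h1 q hq).2
      have hqz : (q : ℝ) ≤ z := by
        refine le_trans ?_ h2
        exact_mod_cast Nat.le_of_dvd (Finset.prod_pos fun q hq ↦ (h1 q hq).1.pos)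
          (Finset.dvd_prod_of_mem (fun p ↦ p) hq)
      have hcop : r.Coprime q := (Nat.coprime_of_lt_prime hr.ne' hrq hqp).symm
      obtain ⟨s, -, hs⟩ := Nat.exists_mul_mod_eq_one_of_coprime hcop hqp.one_lt
      refine ⟨(q - 1) * s * c, fun m hm ↦ ?_⟩
      have hdvd : q ∣ c + r * m := by
        have hs' : r * s ≡ 1 [MOD q] := by rw [Nat.ModEq, hs, Nat.mod_eq_of_lt hqp.one_lt]
        have e1 : c + r * m ≡ c + (q - 1) * c * 1 [MOD q] := by
          refine Nat.ModEq.add_left _ ?_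
          calc r * m ≡ r * ((q - 1) * s * c) [MOD q] := Nat.ModEq.mul_left _ hm
            _ = (q - 1) * c * (r * s) := by ring
            _ ≡ (q - 1) * c * 1 [MOD q] := Nat.ModEq.mul_left _ hs'
        have e2 : c + (q - 1) * c * 1 = q * c := by
          obtain ⟨k, rfl⟩ : ∃ k, q = k + 1 := ⟨q - 1, by have := hqp.pos; omega⟩
          simp only [Nat.add_sub_cancel]
          ring
        rw [e2] at e1
        exact (e1.dvd_iff dvd_rfl).2 (Dvd.intro _ rfl)
      have hnP : c + r * m ∉ P := fun hmem ↦ by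
        obtain ⟨h3, h4⟩ := hP _ hmem
        have h5 := (Nat.prime_dvd_prime_iff_eq hqp h3).1 hdvd
        rw [← h5] at h4
        linarith
      simp [invSeq, hnP])
    (w := fun m ↦ 1 / (x + r * m)) (fun m n hmn ↦ by
      simp only
      gcongr) (fun n ↦ by positivity) N
  refine h1.trans (mul_le_mul ?_ ?_ (Finset.sum_nonneg fun m _ ↦ by positivity) ?_)
  · refine add_le_add (sum_one_div_add_mul_le hx0 hr N) (le_of_eq ?_)
    simp
    ring
  · rw [← sum_invSeq_apply hr hc hN, Finset.mul_sum]
    refine Finset.sum_le_sum fun m _ ↦ ?_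
    rw [Complex.norm_real, norm_eq_abs, sq_abs, invSeq]
    split_ifs with h
    · have h2 : x < (c + r * m : ℕ) := (hP _ h).2
      have h3 : (0 : ℝ) < (c + r * m : ℕ) := by linarith
      have h4 : (r : ℝ) * m ≤ (c + r * m : ℕ) := by
        push_cast
        have : (0 : ℝ) ≤ c := by positivity
        linarith
      rw [div_div_eq_mul_div, div_one, div_pow, one_pow, one_div_mul_eq_div,
        div_le_iff₀ (by positivity)]
      rw [mul_one_div, div_mul_eq_mul_div, le_div_iff₀ h3]
      nlinarith
    · simp
  · have : 0 ≤ log (1 + r * N / x) := log_nonneg (by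
      have : 0 ≤ r * N / x := by positivity
      linarith)
    have : 0 ≤ log ((Y * z) ^ 2) := log_nonneg (one_le_pow₀ (one_le_mul_of_one_le_of_one_le hY hz))
    positivity

/-- A Brun–Titchmarsh type inequality. -/
theorem sum_inv_residue_mul_roughSum_le {P : Finset ℕ} {x : ℝ} (hx : 1 ≤ x)
    (hP : ∀ n ∈ P, n.Prime ∧ x < n) {r N : ℕ} (hr : 0 < r)
    (hN : ∀ n ∈ P, n < r * N) {Y' z : ℝ} (hrY : r ≤ Y') (hz : 1 ≤ z) (hzx : z ≤ x) (c : ℕ) :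
    (∑ n ∈ P with n % r = c, (1 : ℝ) / n) * roughSum Y' z ≤
      2 * (1 / x + 1 / r * log (1 + r * N / x) + z ^ 2 * (1 + log (z ^ 2)) / x) := by
  have hnn : 0 ≤ 1 / x + 1 / r * log (1 + r * N / x) + z ^ 2 * (1 + log (z ^ 2)) / x := by
    have : 0 ≤ log (1 + r * N / x) := log_nonneg (by
      have : 0 ≤ r * N / x := by positivity
      linarith)
    have : 0 ≤ log (z ^ 2) := log_nonneg (one_le_pow₀ hz)
    positivity
  by_cases hc : c < r
  · have hrY1 : (1 : ℝ) ≤ r := by exact_mod_cast hr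
    have h1 := sum_fareySum_invSeq_mul_le hx hP hr hc hN le_rfl (hrY1.trans hrY) hrY hz hzx
      (𝓡 := {∅}) (by simp)
    rw [Finset.sum_singleton, fareySum_empty, one_mul] at h1
    have h2 : ∑ m ∈ Finset.range N, (invSeq P c r m : ℂ) =
        ((∑ n ∈ P with n % r = c, (1 : ℝ) / n : ℝ) : ℂ) := by
      rw [← sum_invSeq_apply hr hc hN]
      push_cast
      refine Finset.sum_congr rfl fun m _ ↦ ?_
      simp only [invSeq]
      push_cast
      rfl
    rw [h2, Complex.norm_real, norm_eq_abs, sq_abs] at h1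
    set M := ∑ n ∈ P with n % r = c, (1 : ℝ) / n with hM
    have hM0 : 0 ≤ M := Finset.sum_nonneg fun n _ ↦ by positivity
    rcases hM0.eq_or_lt with h0 | h0
    · rw [← h0, zero_mul]
      positivity
    · refine le_of_mul_le_mul_left ?_ h0
      linarith
  · rw [Finset.filter_false_of_mem, Finset.sum_empty, zero_mul]
    · positivity
    · intro n _ h
      exact hc (h ▸ Nat.mod_lt _ hr)

end BrunTitchmarsh

section Block

open Real

/-- The bilinear form attached to a set `R` of primes. -/
noncomputable def bilinForm (P₁ P₂ : Finset ℕ) (e : ℕ → ℕ → ℝ) (a : ℕ → ℝ) (R : Finset ℕ) : ℝ :=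
  ∑ n ∈ P₂, (1 / (n : ℝ)) * ∑ m ∈ P₁, a m * ∏ p ∈ R, e p (m * n)

theorem sum_inv_prod_le {𝓡 : Finset (Finset ℕ)} (h𝓡 : ∀ R ∈ 𝓡, ∀ p ∈ R, p.Prime) {Y : ℝ}
    (hY : 0 < Y) (hlow : ∀ R ∈ 𝓡, Y / 2 ≤ (∏ p ∈ R, p : ℕ)) (hup : ∀ R ∈ 𝓡, (∏ p ∈ R, p : ℕ) ≤ Y) :
    ∑ R ∈ 𝓡, 1 / ((∏ p ∈ R, p : ℕ) : ℝ) ≤ 2 := by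
  have hcard : (𝓡.card : ℝ) ≤ Y := by
    have h1 : 𝓡.card ≤ (Finset.Icc 1 ⌊Y⌋₊).card := by
      refine Finset.card_le_card_of_injOn (fun R ↦ ∏ p ∈ R, p) (fun R hR ↦ ?_) ?_
      · simp only [Finset.coe_Icc, Set.mem_Icc]
        exact ⟨Finset.prod_pos fun p hp ↦ (h𝓡 R hR p hp).pos, Nat.le_floor (hup R hR)⟩
      · intro R hR R' hR' h
        simp only at h
        rw [← Nat.primeFactors_prod (h𝓡 R hR), h, Nat.primeFactors_prod (h𝓡 R' hR')]
    rw [Nat.card_Icc, Nat.add_sub_cancel] at h1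
    exact le_trans (by exact_mod_cast h1) (Nat.floor_le hY.le)
  calc ∑ R ∈ 𝓡, 1 / ((∏ p ∈ R, p : ℕ) : ℝ) ≤ ∑ R ∈ 𝓡, 2 / Y := by
        refine Finset.sum_le_sum fun R hR ↦ ?_
        have h0 : (0 : ℝ) < (∏ p ∈ R, p : ℕ) := by
          exact_mod_cast Finset.prod_pos fun p hp ↦ (h𝓡 R hR p hp).pos
        rw [div_le_div_iff₀ h0 hY]
        linarith [hlow R hR]
    _ = 𝓡.card * (2 / Y) := by rw [Finset.sum_const, nsmul_eq_mul]
    _ ≤ Y * (2 / Y) := by gcongr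
    _ = 2 := by field_simp

theorem sq_sum_bilinForm_le {P₁ P₂ : Finset ℕ} {x₁ x₂ X : ℝ} (hx₁ : 1 ≤ x₁) (hx₂ : 1 ≤ x₂)
    (hP₁ : ∀ n ∈ P₁, n.Prime ∧ x₁ < n ∧ n ≤ X) (hP₂ : ∀ n ∈ P₂, n.Prime ∧ x₂ < n ∧ n ≤ X)
    (hX : 0 ≤ X)
    {Y z : ℝ} (hY : 1 ≤ Y) (hz : 1 ≤ z) (hzx₁ : z ≤ x₁) (hzx₂ : z ≤ x₂)
    {𝓡 : Finset (Finset ℕ)} (h𝓡 : ∀ R ∈ 𝓡, ∀ p ∈ R, p.Prime)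
    (hlow : ∀ R ∈ 𝓡, Y / 2 ≤ (∏ p ∈ R, p : ℕ)) (hup : ∀ R ∈ 𝓡, (∏ p ∈ R, p : ℕ) ≤ Y)
    {e : ℕ → ℕ → ℝ} (he : ∀ R ∈ 𝓡, ∀ p ∈ R, IsSieveFactor p (e p)) {a : Finset ℕ → ℕ → ℝ}
    (ha : ∀ R ∈ 𝓡, ∀ n ∈ P₁, |a R n| ≤ 4 ^ R.card / n)
    (ha0 : ∀ R ∈ 𝓡, ∀ n ∈ P₁, ∀ p ∈ R, p ∣ n → a R n = 0) {K A : ℝ} (hK0 : 0 ≤ K)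
    (hK : ∀ R ∈ 𝓡, (256 : ℝ) ^ R.card ≤ K) (hA₁ : ∑ n ∈ P₁, (1 : ℝ) / n ≤ A)
    (hA₂ : ∑ n ∈ P₂, (1 : ℝ) / n ≤ A) {Λ : ℝ} (hΛ0 : 0 < Λ) (hΛ : Λ ≤ roughSum Y z) :
    (∑ R ∈ 𝓡, bilinForm P₁ P₂ e (a R) R) ^ 2 ≤
      2 * K * (2 * (1 / x₁ + 2 / Y * log (1 + X + Y) + z ^ 2 * (1 + log (z ^ 2)) / x₁) / Λ) * A *
      ((1 / x₂ + log (2 + X) + (Y * z) ^ 2 * (1 + log ((Y * z) ^ 2)) / x₂) * (2 * A) / Λ) := by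
  have hA0 : 0 ≤ A := (Finset.sum_nonneg fun n _ ↦ by positivity).trans hA₁
  have hlz : 0 ≤ log (z ^ 2) := log_nonneg (one_le_pow₀ hz)
  have hlX : 0 ≤ log (1 + X + Y) := log_nonneg (by linarith)
  set M := 2 * (1 / x₁ + 2 / Y * log (1 + X + Y) + z ^ 2 * (1 + log (z ^ 2)) / x₁) / Λ with hM
  have hM0 : 0 ≤ M := by positivity
  have hBT : ∀ R ∈ 𝓡, ∀ c, ∑ n ∈ P₁ with n % (∏ p ∈ R, p) = c, (1 : ℝ) / n ≤ M := by
    intro R hR c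
    set r := ∏ p ∈ R, p with hr
    have hr0 : 0 < r := Finset.prod_pos fun p hp ↦ (h𝓡 R hR p hp).pos
    have hr0' : (0 : ℝ) < r := by exact_mod_cast hr0
    have h1 := sum_inv_residue_mul_roughSum_le hx₁ (fun n hn ↦ ⟨(hP₁ n hn).1, (hP₁ n hn).2.1⟩)
      (N := ⌊X / r⌋₊ + 1) hr0 (fun n hn ↦ by
        have h2 : (n : ℝ) / r < (⌊X / r⌋₊ + 1 : ℕ) := by
          push_cast
          refine lt_of_le_of_lt ?_ (Nat.lt_floor_add_one _)
          have := (hP₁ n hn).2.2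
          gcongr
        rw [div_lt_iff₀ hr0'] at h2
        have h3 : n < (⌊X / r⌋₊ + 1) * r := by exact_mod_cast h2
        linarith) (hup R hR) hz hzx₁ c
    rw [hM, le_div_iff₀ hΛ0]
    refine (mul_le_mul_of_nonneg_left hΛ (Finset.sum_nonneg fun n _ ↦ by positivity)).trans
      (h1.trans ?_)
    have h4 : (r : ℝ) * (⌊X / r⌋₊ + 1 : ℕ) / x₁ ≤ X + Y := by
      have h5 : (⌊X / r⌋₊ : ℝ) ≤ X / r := Nat.floor_le (by positivity)
      rw [div_le_iff₀ (by linarith)]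
      push_cast
      calc (r : ℝ) * (⌊X / r⌋₊ + 1) ≤ r * (X / r + 1) := by gcongr
        _ = X + r := by field_simp
        _ ≤ (X + Y) * 1 := by linarith [hup R hR]
        _ ≤ (X + Y) * x₁ := by gcongr
    have h6 : 1 / (r : ℝ) ≤ 2 / Y := by
      rw [div_le_div_iff₀ hr0' (by linarith)]
      linarith [hlow R hR]
    have h7 : 0 < 1 + (r : ℝ) * (⌊X / r⌋₊ + 1 : ℕ) / x₁ := by positivity
    have h8 : log (1 + (r : ℝ) * (⌊X / r⌋₊ + 1 : ℕ) / x₁) ≤ log (1 + X + Y) :=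
      log_le_log h7 (by linarith)
    have h9 : 0 ≤ log (1 + (r : ℝ) * (⌊X / r⌋₊ + 1 : ℕ) / x₁) := log_nonneg (by
      have : 0 ≤ (r : ℝ) * (⌊X / r⌋₊ + 1 : ℕ) / x₁ := by positivity
      linarith)
    gcongr
  have hcoef : ∀ R : Finset ℕ, ∃ H : (ℕ →₀ ℕ) → ℂ, R ∈ 𝓡 →
      (∀ n : ℕ, ((∑ m ∈ P₁, a R m * ∏ p ∈ R, e p (m * n) : ℝ) : ℂ) =
        ∑ x ∈ farey R, H x * expC (n * fareyPoint x)) ∧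
      ∑ x ∈ farey R, ‖H x‖ ^ 2 ≤ K * M * A * (1 / (∏ p ∈ R, p : ℕ)) := by
    intro R
    by_cases hR : R ∈ 𝓡
    · have hfac : ∀ c, ∑ n ∈ P₁ with n % (∏ p ∈ R, p) = c, (4 : ℝ) ^ R.card / n ≤
          4 ^ R.card * M := fun c ↦ by
        have := mul_le_mul_of_nonneg_left (hBT R hR c) (by positivity : (0:ℝ) ≤ 4 ^ R.card)
        rw [Finset.mul_sum] at this
        simpa only [mul_one_div] using this
      obtain ⟨H, h1, h2⟩ := exists_farey_coeff (h𝓡 R hR) (he R hR) (ha R hR) (ha0 R hR) hfac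
        (by positivity)
      refine ⟨H, fun _ ↦ ⟨h1, h2.trans ?_⟩⟩
      have h3 : ∑ m ∈ P₁, (4 : ℝ) ^ R.card / m ≤ 4 ^ R.card * A := by
        have := mul_le_mul_of_nonneg_left hA₁ (by positivity : (0:ℝ) ≤ 4 ^ R.card)
        rw [Finset.mul_sum] at this
        simpa only [mul_one_div] using this
      calc (16 : ℝ) ^ R.card / (∏ p ∈ R, p : ℕ) * (4 ^ R.card * M) *
            ∑ m ∈ P₁, (4 : ℝ) ^ R.card / m
          ≤ (16 : ℝ) ^ R.card / (∏ p ∈ R, p : ℕ) * (4 ^ R.card * M) * (4 ^ R.card * A) := by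
            gcongr
        _ = 256 ^ R.card * M * A * (1 / (∏ p ∈ R, p : ℕ)) := by
            rw [show (256 : ℝ) = 16 * 4 * 4 by norm_num, mul_pow, mul_pow]
            ring
        _ ≤ _ := by
            have := hK R hR
            gcongr
    · exact ⟨0, fun h ↦ absurd h hR⟩
  choose H hH using hcoef
  set N := ⌊X⌋₊ + 1 with hN
  have hNP : ∀ n ∈ P₂, n < 1 * N := fun n hn ↦ by
    rw [one_mul]
    exact Nat.lt_succ_of_le (Nat.le_floor (hP₂ n hn).2.2)
  have h1 := sq_bilinear_le (𝓡 := 𝓡) (h := fun R n ↦ ∑ m ∈ P₁, a R m * ∏ p ∈ R, e p (m * n))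
    (H := H) (fun R hR n ↦ (hH R hR).1 n) (invSeq P₂ 0 1) N
  have h2 : ∑ R ∈ 𝓡, ∑ n ∈ Finset.range N,
      invSeq P₂ 0 1 n * ∑ m ∈ P₁, a R m * ∏ p ∈ R, e p (m * n) =
      ∑ R ∈ 𝓡, bilinForm P₁ P₂ e (a R) R := by
    refine Finset.sum_congr rfl fun R _ ↦ ?_
    have := sum_invSeq_apply one_pos one_pos hNP fun n : ℕ ↦
      (1 / (n : ℝ)) * ∑ m ∈ P₁, a R m * ∏ p ∈ R, e p (m * n)
    rw [Finset.filter_true_of_mem fun n _ ↦ Nat.mod_one n] at this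
    rw [bilinForm, ← this]
    refine Finset.sum_congr rfl fun n _ ↦ ?_
    simp only [invSeq, zero_add, one_mul]
    split_ifs <;> simp
  rw [h2] at h1
  refine h1.trans (mul_le_mul ?_ ?_ (Finset.sum_nonneg fun R _ ↦ fareySum_nonneg _ _ _)
    (by positivity))
  · calc ∑ R ∈ 𝓡, ∑ x ∈ farey R, ‖H R x‖ ^ 2
        ≤ ∑ R ∈ 𝓡, K * M * A * (1 / (∏ p ∈ R, p : ℕ)) :=
          Finset.sum_le_sum fun R hR ↦ (hH R hR).2
      _ ≤ K * M * A * 2 := by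
          rw [← Finset.mul_sum]
          have := sum_inv_prod_le h𝓡 (by linarith) hlow hup
          gcongr
      _ = _ := by ring
  · have h3 := sum_fareySum_invSeq_mul_le hx₂ (fun n hn ↦ ⟨(hP₂ n hn).1, (hP₂ n hn).2.1⟩)
      one_pos one_pos hNP hY le_rfl (by simpa using hY) hz hzx₂ (𝓡 := 𝓡)
      fun R hR ↦ ⟨h𝓡 R hR, hup R hR⟩
    rw [Finset.filter_true_of_mem fun n _ ↦ Nat.mod_one n] at h3
    rw [le_div_iff₀ hΛ0]
    refine (mul_le_mul_of_nonneg_left hΛ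
      (Finset.sum_nonneg fun R _ ↦ fareySum_nonneg _ _ _)).trans (h3.trans ?_)
    have h4 : ((1 : ℕ) : ℝ) * N / x₂ ≤ 1 + X := by
      rw [div_le_iff₀ (by linarith), hN]
      push_cast
      have : (⌊X⌋₊ : ℝ) ≤ X := Nat.floor_le hX
      nlinarith
    have h5 : 0 ≤ ((1 : ℕ) : ℝ) * N / x₂ := by positivity
    have h6 : log (1 + ((1 : ℕ) : ℝ) * N / x₂) ≤ log (2 + X) := log_le_log (by linarith)
      (by linarith)
    have h7 : 0 ≤ log (1 + ((1 : ℕ) : ℝ) * N / x₂) := log_nonneg (by linarith)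
    have h8 : 0 ≤ log ((Y * z) ^ 2) := log_nonneg (one_le_pow₀
      (one_le_mul_of_one_le_of_one_le hY hz))
    have h9 : 1 / ((1 : ℕ) : ℝ) * log (1 + ((1 : ℕ) : ℝ) * N / x₂) ≤ log (2 + X) := by
      rw [Nat.cast_one, div_one, one_mul]
      simpa using h6
    have h10 : 0 ≤ log (2 + X) := h7.trans h6
    gcongr

end Block

section SmallModulus

open Filter Topology Real

theorem exists_card_pow_le {ε : ℝ} (hε : 0 < ε) : ∃ C ≥ 1, ∀ R : Finset ℕ, (∀ p ∈ R, p.Prime) →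
    (256 : ℝ) ^ R.card ≤ C * ((∏ p ∈ R, p : ℕ) : ℝ) ^ ε := by
  have h1 : ∀ᶠ n : ℕ in atTop, (256 : ℝ) ≤ (n : ℝ) ^ ε :=
    ((tendsto_rpow_atTop hε).comp tendsto_natCast_atTop_atTop).eventually_ge_atTop 256
  obtain ⟨N, hN⟩ := eventually_atTop.1 h1
  refine ⟨256 ^ N, one_le_pow₀ (by norm_num), fun R hR ↦ ?_⟩
  have h2 : ∀ p ∈ R, (256 : ℝ) ≤ (if p < N then 256 else 1) * (p : ℝ) ^ ε := by
    intro p hp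
    have hp1 : (1 : ℝ) ≤ (p : ℝ) ^ ε := one_le_rpow (by exact_mod_cast (hR p hp).one_lt.le) hε.le
    split_ifs with h
    · linarith
    · rw [one_mul]
      exact hN p (not_lt.1 h)
  calc (256 : ℝ) ^ R.card = ∏ p ∈ R, 256 := (Finset.prod_const _).symm
    _ ≤ ∏ p ∈ R, ((if p < N then 256 else 1) * (p : ℝ) ^ ε) :=
        Finset.prod_le_prod (fun _ _ ↦ by norm_num) h2
    _ = 256 ^ (R.filter (· < N)).card * ((∏ p ∈ R, p : ℕ) : ℝ) ^ ε := by
        rw [Finset.prod_mul_distrib, Finset.prod_ite, Finset.prod_const, Finset.prod_const_one,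
          mul_one, Real.finsetProd_rpow _ _ (fun _ _ ↦ by positivity), Nat.cast_prod]
    _ ≤ _ := by
        have h3 : (R.filter (· < N)).card ≤ N := by
          have : R.filter (· < N) ⊆ Finset.range N := fun p hp ↦
            Finset.mem_range.2 (Finset.mem_filter.1 hp).2
          simpa using Finset.card_le_card this
        gcongr
        norm_num

theorem IsSieveFactor.abs_le {p : ℕ} {f : ℕ → ℝ} (h : IsSieveFactor p f) (hp : 0 < p) (n : ℕ) :
    |f n| ≤ 4 := by
  rw [← h.periodic.map_mod_nat n]
  exact (Finset.single_le_sum (f := fun c ↦ |f c|) (fun _ _ ↦ abs_nonneg _)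
    (Finset.mem_range.2 (Nat.mod_lt _ hp))).trans h.sum_abs_le

/-- Bilinear forms with a fixed modulus are negligible. -/
theorem eventually_bilinForm_le {q : ℕ} [NeZero q] {b : ZMod q} (hb : IsUnit b) {v v' : ℝ}
    (hv : 0 < v) (hvv' : v ≤ v') {R : Finset ℕ} (hRne : R.Nonempty)
    (hR : ∀ p ∈ R, p.Prime ∧ ¬ p ∣ q) (A : ℝ) {ε : ℝ} (hε : 0 < ε) :
    ∀ᶠ T : ℝ in atTop, ∀ (P₁ : Finset ℕ) (e : ℕ → ℕ → ℝ) (a : ℕ → ℝ),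
      (∀ p ∈ R, IsSieveFactor p (e p)) → (∀ n ∈ P₁, |a n| ≤ 4 ^ R.card / n) →
      (∀ n ∈ P₁, ∀ p ∈ R, p ∣ n → a n = 0) → ∑ n ∈ P₁, (1 : ℝ) / n ≤ A →
      |bilinForm P₁ ((primesIoc (exp (v * T)) (exp (v' * T))).filter
        fun p : ℕ ↦ (p : ZMod q) = b) e a R| ≤ ε := by
  have hRp : ∀ p ∈ R, p.Prime := fun p hp ↦ (hR p hp).1
  set r := ∏ p ∈ R, p with hr
  have hr0 : 0 < r := Finset.prod_pos fun p hp ↦ (hRp p hp).pos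
  have : NeZero r := ⟨hr0.ne'⟩
  have : NeZero (q * r) := ⟨mul_ne_zero (NeZero.ne q) hr0.ne'⟩
  have hcop : q.Coprime r := Nat.Coprime.prod_right fun p hp ↦
    ((hRp p hp).coprime_iff_not_dvd.2 (hR p hp).2).symm
  set P₂ : ℝ → Finset ℕ := fun T ↦ (primesIoc (exp (v * T)) (exp (v' * T))).filter
        fun p : ℕ ↦ (p : ZMod q) = b with hP₂
  set S : ℕ → ℝ → ℝ := fun c T ↦ ∑ n ∈ P₂ T with n % r = c, (1 : ℝ) / n with hS
  set κ : ℝ := ((q * r).totient : ℝ)⁻¹ * log (v' / v) with hκ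
  set U := (Finset.range r).filter fun c ↦ c.Coprime r with hU
  have hlim : ∀ c ∈ U, Tendsto (fun T ↦ |S c T - κ|) atTop (𝓝 0) := by
    intro c hc
    obtain ⟨hc1, hc2⟩ := Finset.mem_filter.1 hc
    set d := (ZMod.chineseRemainder hcop).symm (b, (c : ZMod r)) with hd
    have hdu : IsUnit d := by
      refine IsUnit.map _ (Prod.isUnit_iff.2 ⟨hb, ?_⟩)
      exact (ZMod.isUnit_iff_coprime c r).2 hc2
    have h1 := tendsto_sum_primesIoc_inv hdu hv hvv'
    have h2 : Tendsto (fun T ↦ S c T) atTop (𝓝 κ) := by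
      refine h1.congr fun T ↦ ?_
      refine Finset.sum_congr ?_ fun _ _ ↦ rfl
      ext p
      simp only [hP₂, Finset.mem_filter, and_assoc]
      refine and_congr_right fun _ ↦ ?_
      rw [hd, ← RingEquiv.symm_apply_eq, RingEquiv.symm_symm, map_natCast, Prod.ext_iff]
      simp only [Prod.fst_natCast, Prod.snd_natCast]
      rw [ZMod.natCast_eq_natCast_iff', Nat.mod_eq_of_lt (Finset.mem_range.1 hc1)]
    have h3 := (h2.sub_const κ).abs
    simpa using h3
  have hlim2 : Tendsto (fun T ↦ ∑ c ∈ U, |S c T - κ|) atTop (𝓝 0) := by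
    have := tendsto_finsetSum U hlim
    simpa using this
  have hA0 : 0 < 16 ^ R.card * (|A| + 1) := by positivity
  filter_upwards [hlim2.eventually (gt_mem_nhds (div_pos hε hA0))] with T hT P₁ e a he ha ha0 hA
  have hper : ∀ m, Function.Periodic (fun n ↦ ∏ p ∈ R, e p (m * n)) r := fun m ↦
    periodic_finset_prod (f := fun p n ↦ e p (m * n)) fun p hp ↦ (he p hp).periodic_mul m
  have hinner : ∀ m ∈ P₁, a m ≠ 0 → |∑ n ∈ P₂ T, (1 / (n : ℝ)) * ∏ p ∈ R, e p (m * n)| ≤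
      4 ^ R.card * ∑ c ∈ U, |S c T - κ| := by
    intro m hm h0
    have hmaps : ∀ n ∈ P₂ T, n % r ∈ Finset.range r := fun n _ ↦
      Finset.mem_range.2 (Nat.mod_lt _ hr0)
    have hmc : ∀ p ∈ R, m.Coprime p := fun p hp ↦
      ((hRp p hp).coprime_iff_not_dvd.2 fun h ↦ h0 (ha0 m hm p hp h)).symm
    have h1 : ∑ c ∈ Finset.range r, ∏ p ∈ R, e p (m * c) = 0 := by
      rw [sum_range_prod_periodic hRp (f := fun p n ↦ e p (m * n))
        fun p hp ↦ (he p hp).periodic_mul m]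
      obtain ⟨p, hp⟩ := hRne
      exact Finset.prod_eq_zero hp ((he p hp).sum_mul_left (hRp p hp).pos (hmc p hp))
    have h2 : ∑ n ∈ P₂ T, (1 / (n : ℝ)) * ∏ p ∈ R, e p (m * n) =
        ∑ c ∈ U, (S c T - κ) * ∏ p ∈ R, e p (m * c) := by
      have h3 : ∑ c ∈ U, (S c T - κ) * ∏ p ∈ R, e p (m * c) =
          ∑ c ∈ Finset.range r, (S c T - κ) * ∏ p ∈ R, e p (m * c) := by
        refine Finset.sum_subset (Finset.filter_subset _ _) fun c hc hcU ↦ ?_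
        have : ¬ c.Coprime r := fun h ↦ hcU (Finset.mem_filter.2 ⟨hc, h⟩)
        have : ∃ p ∈ R, ¬ c.Coprime p := by
          by_contra! h
          exact this (Nat.Coprime.prod_right h)
        obtain ⟨p, hp, hpc⟩ := this
        rw [Finset.prod_eq_zero hp, mul_zero]
        refine (he p hp).eq_zero (Dvd.dvd.mul_left ?_ m)
        by_contra hpd
        exact hpc ((hRp p hp).coprime_iff_not_dvd.2 hpd).symm
      rw [h3]
      simp only [sub_mul]
      rw [Finset.sum_sub_distrib, ← Finset.mul_sum, h1, mul_zero, sub_zero,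
        ← Finset.sum_fiberwise_of_maps_to hmaps]
      refine Finset.sum_congr rfl fun c _ ↦ ?_
      rw [hS, Finset.sum_mul]
      refine Finset.sum_congr rfl fun n hn ↦ ?_
      congr 1
      have := (hper m).map_mod_nat n
      rw [(Finset.mem_filter.1 hn).2] at this
      exact this.symm
    rw [h2, Finset.mul_sum]
    refine (Finset.abs_sum_le_sum_abs _ _).trans (Finset.sum_le_sum fun c _ ↦ ?_)
    rw [abs_mul, mul_comm, Finset.abs_prod]
    refine mul_le_mul_of_nonneg_right ?_ (abs_nonneg _)
    rw [← Finset.prod_const]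
    exact Finset.prod_le_prod (fun _ _ ↦ abs_nonneg _) fun p hp ↦ (he p hp).abs_le (hRp p hp).pos _
  have hswap : bilinForm P₁ (P₂ T) e a R =
      ∑ m ∈ P₁, a m * ∑ n ∈ P₂ T, (1 / (n : ℝ)) * ∏ p ∈ R, e p (m * n) := by
    simp only [bilinForm, Finset.mul_sum]
    rw [Finset.sum_comm]
    exact Finset.sum_congr rfl fun m _ ↦ Finset.sum_congr rfl fun n _ ↦ by ring
  rw [hswap]
  set F := ∑ c ∈ U, |S c T - κ| with hF
  have hF0 : 0 ≤ F := Finset.sum_nonneg fun _ _ ↦ abs_nonneg _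
  calc |∑ m ∈ P₁, a m * ∑ n ∈ P₂ T, (1 / (n : ℝ)) * ∏ p ∈ R, e p (m * n)|
      ≤ ∑ m ∈ P₁, (4 ^ R.card / m) * (4 ^ R.card * F) := by
        refine (Finset.abs_sum_le_sum_abs _ _).trans (Finset.sum_le_sum fun m hm ↦ ?_)
        by_cases h0 : a m = 0
        · rw [h0, zero_mul, abs_zero]
          positivity
        · rw [abs_mul]
          exact mul_le_mul (ha m hm) (hinner m hm h0) (abs_nonneg _) (by positivity)
    _ = 16 ^ R.card * (∑ m ∈ P₁, (1 : ℝ) / m) * F := by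
        rw [show (16 : ℝ) = 4 * 4 by norm_num, mul_pow, Finset.mul_sum (s := P₁), Finset.sum_mul]
        exact Finset.sum_congr rfl fun m _ ↦ by ring
    _ ≤ 16 ^ R.card * (|A| + 1) * F := by
        have : ∑ m ∈ P₁, (1 : ℝ) / m ≤ |A| + 1 := by linarith [le_abs_self A]
        gcongr
    _ ≤ ε := by
        rw [lt_div_iff₀ hA0] at hT
        linarith

end SmallModulus

section ErrorTerm

open Filter Topology Real

/-- The data of a bilinear sum over moduli `∏ p ∈ R, p ∈ [Y / 2, Y]`. -/
structure IsBlock (P₁ P₂ : Finset ℕ) (x₁ x₂ X A Y : ℝ) (𝓡 : Finset (Finset ℕ)) (e : ℕ → ℕ → ℝ)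
    (a : Finset ℕ → ℕ → ℝ) : Prop where
  left : ∀ n ∈ P₁, n.Prime ∧ x₁ < n ∧ n ≤ X
  right : ∀ n ∈ P₂, n.Prime ∧ x₂ < n ∧ n ≤ X
  prime : ∀ R ∈ 𝓡, ∀ p ∈ R, p.Prime
  lower : ∀ R ∈ 𝓡, Y / 2 ≤ (∏ p ∈ R, p : ℕ)
  upper : ∀ R ∈ 𝓡, (∏ p ∈ R, p : ℕ) ≤ Y
  factor : ∀ R ∈ 𝓡, ∀ p ∈ R, IsSieveFactor p (e p)
  coeff_le : ∀ R ∈ 𝓡, ∀ n ∈ P₁, |a R n| ≤ 4 ^ R.card / n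
  coeff_eq_zero : ∀ R ∈ 𝓡, ∀ n ∈ P₁, ∀ p ∈ R, p ∣ n → a R n = 0
  left_sum_le : ∑ n ∈ P₁, (1 : ℝ) / n ≤ A
  right_sum_le : ∑ n ∈ P₂, (1 : ℝ) / n ≤ A

theorem one_le_roughSum {Y z : ℝ} (hz : 1 ≤ z) : 1 ≤ roughSum Y z := by
  have h0 : (∅ : Finset ℕ) ∈ roughSets Y z := by
    rw [mem_roughSets]
    simpa using hz
  have h := Finset.single_le_sum (f := fun Q : Finset ℕ ↦ ∏ p ∈ Q, 1 / ((p : ℝ) - 1))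
    (fun Q hQ ↦ prod_one_div_sub_one_nonneg fun p hp ↦ ((mem_roughSets.1 hQ).1 p hp).1) h0
  simpa [roughSum] using h

theorem exists_abs_sum_bilinForm_le_rpow {u v σ A : ℝ} (hσ : 0 < σ) (hσu : 8 * σ ≤ u)
    (hσv : 8 * σ ≤ v) (hσ1 : σ ≤ 1 / 8) (hA : 0 ≤ A) :
    ∃ C ≥ 0, ∃ Y₀, ∀ᶠ T : ℝ in atTop, ∀ Y, Y₀ ≤ Y → 1 ≤ Y → Y ≤ exp (σ * T) →
      ∀ P₁ P₂ 𝓡 e a, IsBlock P₁ P₂ (exp (u * T)) (exp (v * T)) (exp T) A Y 𝓡 e a →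
      |∑ R ∈ 𝓡, bilinForm P₁ P₂ e (a R) R| ≤ C * Y ^ (-(3 / 8) : ℝ) := by
  obtain ⟨C₁, hC₁, hcard⟩ := exists_card_pow_le (ε := 1 / 8) (by norm_num)
  obtain ⟨c, hc, Y₀, z₀, hrough⟩ := exists_le_roughSum
  refine ⟨14 * C₁ * A / (c * σ), by positivity, Y₀, ?_⟩
  have hexp : Tendsto (fun T : ℝ ↦ exp (σ * T)) atTop atTop :=
    tendsto_exp_atTop.comp (tendsto_id.const_mul_atTop hσ)
  filter_upwards [eventually_ge_atTop 4, hexp.eventually_ge_atTop z₀]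
    with T hT hz Y hY₀ hY1 hYT P₁ P₂ 𝓡 e a hblock
  have hT0 : 0 < T := by linarith
  have hY0 : 0 < Y := by linarith
  have hσT : 0 < σ * T := by positivity
  have w1 : 8 * (σ * T) ≤ u * T := by nlinarith
  have w2 : 8 * (σ * T) ≤ v * T := by nlinarith
  have w3 : 8 * (σ * T) ≤ T := by
    have := mul_le_mul_of_nonneg_right hσ1 hT0.le
    linarith
  have hz1 : 1 ≤ exp (σ * T) := one_le_exp hσT.le
  have hΛ := hrough Y hY₀ (exp (σ * T)) hz
  rw [log_exp] at hΛ
  have hX1 : 1 ≤ exp T := one_le_exp hT0.le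
  have hYX : Y ≤ exp T := hYT.trans (exp_le_exp.2 (by linarith))
  have h3 : (4 : ℝ) ≤ exp T := by linarith [add_one_le_exp T]
  have hlog1 : log (1 + exp T + Y) ≤ 2 * T := by
    rw [← log_exp (2 * T)]
    refine log_le_log (by positivity) ?_
    rw [two_mul, exp_add]
    nlinarith
  have hlog2 : log (2 + exp T) ≤ 2 * T := by
    rw [← log_exp (2 * T)]
    refine log_le_log (by positivity) ?_
    rw [two_mul, exp_add]
    nlinarith
  have hF1 : 1 / exp (u * T) + 2 / Y * log (1 + exp T + Y) +
      exp (σ * T) ^ 2 * (1 + log (exp (σ * T) ^ 2)) / exp (u * T) ≤ 6 * T / Y := by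
    have a1 : 1 / exp (u * T) ≤ T / Y := by
      rw [div_le_div_iff₀ (exp_pos _) hY0]
      have : Y ≤ exp (u * T) := hYT.trans (exp_le_exp.2 (by linarith))
      nlinarith
    have a2 : 2 / Y * log (1 + exp T + Y) ≤ 2 / Y * (2 * T) := by gcongr
    have a3 : exp (σ * T) ^ 2 * (1 + log (exp (σ * T) ^ 2)) / exp (u * T) ≤ T / Y := by
      rw [div_le_div_iff₀ (exp_pos _) hY0, log_pow, log_exp]
      have b1 : exp (σ * T) ^ 2 * Y ≤ exp (u * T) := by
        calc exp (σ * T) ^ 2 * Y ≤ exp (σ * T) ^ 2 * exp (σ * T) := by gcongr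
          _ = exp (3 * (σ * T)) := by rw [← pow_succ, ← exp_nat_mul]; norm_num
          _ ≤ _ := exp_le_exp.2 (by linarith)
      have b2 : 1 + ((2 : ℕ) : ℝ) * (σ * T) ≤ T := by push_cast; linarith
      calc _ = (1 + ((2 : ℕ) : ℝ) * (σ * T)) * (exp (σ * T) ^ 2 * Y) := by ring
        _ ≤ T * exp (u * T) := by gcongr
    calc _ ≤ T / Y + 2 / Y * (2 * T) + T / Y := by gcongr
      _ = _ := by ring
  have hF2 : 1 / exp (v * T) + log (2 + exp T) + (Y * exp (σ * T)) ^ 2 *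
      (1 + log ((Y * exp (σ * T)) ^ 2)) / exp (v * T) ≤ 4 * T := by
    have a1 : 1 / exp (v * T) ≤ T := by
      rw [div_le_iff₀ (exp_pos _)]
      have : 1 ≤ exp (v * T) := one_le_exp (by linarith)
      nlinarith
    have a3 : (Y * exp (σ * T)) ^ 2 * (1 + log ((Y * exp (σ * T)) ^ 2)) / exp (v * T) ≤ T := by
      rw [div_le_iff₀ (exp_pos _)]
      have b1 : (Y * exp (σ * T)) ^ 2 ≤ exp (4 * (σ * T)) := by
        calc (Y * exp (σ * T)) ^ 2 ≤ (exp (σ * T) * exp (σ * T)) ^ 2 := by gcongr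
          _ = exp (4 * (σ * T)) := by rw [← exp_add, ← exp_nat_mul]; congr 1; push_cast; ring
      have b3 : log ((Y * exp (σ * T)) ^ 2) ≤ 4 * (σ * T) := by
        rw [← log_exp (4 * (σ * T))]
        exact log_le_log (by positivity) b1
      have b2 : 1 + log ((Y * exp (σ * T)) ^ 2) ≤ T := by linarith
      have b4 : exp (4 * (σ * T)) ≤ exp (v * T) := exp_le_exp.2 (by linarith)
      have b5 : 0 ≤ T := hT0.le
      calc _ ≤ (Y * exp (σ * T)) ^ 2 * T := by gcongr
        _ ≤ exp (v * T) * T := by gcongr; exact b1.trans b4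
        _ = _ := mul_comm _ _
    linarith
  have hF1' := log_nonneg (show 1 ≤ (exp (σ * T)) ^ 2 from one_le_pow₀ hz1)
  have hF1'' := log_nonneg (show 1 ≤ 1 + exp T + Y by linarith)
  have hF2' := log_nonneg (show 1 ≤ (Y * exp (σ * T)) ^ 2 from
    one_le_pow₀ (one_le_mul_of_one_le_of_one_le hY1 hz1))
  have hF2'' := log_nonneg (show 1 ≤ 2 + exp T by linarith)
  have h1 := sq_sum_bilinForm_le (x₁ := exp (u * T)) (x₂ := exp (v * T))
    (one_le_exp (by linarith)) (one_le_exp (by linarith)) hblock.left hblock.right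
    (exp_pos T).le hY1 hz1 (exp_le_exp.2 (by linarith)) (exp_le_exp.2 (by linarith))
    hblock.prime hblock.lower hblock.upper hblock.factor hblock.coeff_le hblock.coeff_eq_zero
    (K := C₁ * Y ^ (1 / 8 : ℝ)) (by positivity) (fun R hR ↦ by
      refine (hcard R (hblock.prime R hR)).trans ?_
      have := hblock.upper R hR
      gcongr) hblock.left_sum_le hblock.right_sum_le
    (Λ := c * (σ * T) * Y ^ (-(1 / 16) : ℝ)) (by positivity) hΛ
  refine abs_le_of_sq_le_sq (h1.trans ?_) (by positivity)
  calc _ ≤ 2 * (C₁ * Y ^ (1 / 8 : ℝ)) * (2 * (6 * T / Y) / (c * (σ * T) * Y ^ (-(1 / 16) : ℝ))) *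
        A * (4 * T * (2 * A) / (c * (σ * T) * Y ^ (-(1 / 16) : ℝ))) := by gcongr
    _ = 192 * C₁ * A ^ 2 / (c * σ) ^ 2 * (Y ^ (1 / 8 : ℝ) / (Y * (Y ^ (-(1 / 16) : ℝ)) ^ 2)) := by
        field_simp
        ring
    _ = 192 * C₁ * A ^ 2 / (c * σ) ^ 2 * (Y ^ (-(3 / 8) : ℝ)) ^ 2 := by
        congr 1
        rw [← rpow_natCast, ← rpow_natCast, ← rpow_mul hY0.le, ← rpow_mul hY0.le]
        nth_rewrite 2 [← rpow_one Y]
        rw [← rpow_add hY0, ← rpow_sub hY0]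
        norm_num
    _ ≤ (14 * C₁ * A / (c * σ)) ^ 2 * (Y ^ (-(3 / 8) : ℝ)) ^ 2 := by
        have : 192 * C₁ * A ^ 2 ≤ (14 * C₁ * A) ^ 2 := by 
          have h5 : C₁ * A ^ 2 ≤ C₁ * (C₁ * A ^ 2) :=
            le_mul_of_one_le_left (by positivity) hC₁
          have h6 : 0 ≤ C₁ * A ^ 2 := by positivity
          linarith [show (14 * C₁ * A) ^ 2 = 196 * (C₁ * (C₁ * A ^ 2)) by ring]
        rw [div_pow]
        gcongr
    _ = _ := by ring

theorem exists_abs_sum_bilinForm_le_exp {u v σ ϱ A : ℝ} (hu : 0 < u) (hu1 : u ≤ 1) (hv : 0 < v)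
    (hσ : 0 < σ) (hϱ : 2 * ϱ < u + v) (hϱv : ϱ < v) (hϱ1 : ϱ ≤ 1) (hA : 0 ≤ A) :
    ∃ C ≥ 0, ∃ κ > 0, ∀ᶠ T : ℝ in atTop, ∀ Y, exp (σ * T) ≤ Y → Y ≤ 2 * exp (ϱ * T) →
      ∀ P₁ P₂ 𝓡 e a, IsBlock P₁ P₂ (exp (u * T)) (exp (v * T)) (exp T) A Y 𝓡 e a →
      |∑ R ∈ 𝓡, bilinForm P₁ P₂ e (a R) R| ≤ C * T * exp (-κ * T) := by
  obtain ⟨κ, hκ, k1, k2, k3, k4⟩ : ∃ κ > 0, κ ≤ u ∧ κ ≤ σ ∧ κ ≤ u + v - 2 * ϱ ∧ κ ≤ v - ϱ := by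
    refine ⟨min (min u σ) (min (u + v - 2 * ϱ) (v - ϱ)), ?_, ?_, ?_, ?_, ?_⟩
    · exact lt_min (lt_min hu hσ) (lt_min (by linarith) (by linarith))
    · exact (min_le_left _ _).trans (min_le_left _ _)
    · exact (min_le_left _ _).trans (min_le_right _ _)
    · exact (min_le_right _ _).trans (min_le_left _ _)
    · exact (min_le_right _ _).trans (min_le_right _ _)
  obtain ⟨C₁, hC₁, hcard⟩ := exists_card_pow_le (ε := κ / 2) (by linarith)
  refine ⟨51 * C₁ * A, by positivity, κ / 4, by positivity, ?_⟩
  filter_upwards [eventually_ge_atTop 4]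
    with T hT Y hY₀ hYT P₁ P₂ 𝓡 e a hblock
  have hT0 : 0 < T := by linarith
  have w1 : κ * T ≤ u * T := by gcongr
  have w2 : κ * T ≤ σ * T := by gcongr
  have w3 : κ * T ≤ (u + v - 2 * ϱ) * T := by gcongr
  have w4 : κ * T ≤ (v - ϱ) * T := by gcongr
  have w5 : ϱ * T ≤ 1 * T := by gcongr
  have hY1 : 1 ≤ Y := (one_le_exp (by positivity)).trans hY₀
  have hY0 : 0 < Y := by linarith
  have hYX : Y ≤ 2 * exp T := hYT.trans (by gcongr; linarith)
  have hX4 : (5 : ℝ) ≤ exp T := by linarith [add_one_le_exp T]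
  have hK : Y ^ (κ / 2) ≤ 2 * exp (κ / 2 * T) := by
    calc Y ^ (κ / 2) ≤ (2 * exp T) ^ (κ / 2) := by gcongr
      _ = 2 ^ (κ / 2) * exp (κ / 2 * T) := by
        rw [mul_rpow (by norm_num) (exp_pos _).le, ← exp_mul, mul_comm T]
      _ ≤ 2 ^ (1 : ℝ) * exp (κ / 2 * T) := by
        gcongr
        · norm_num
        · linarith
      _ = _ := by rw [rpow_one]
  have hlog1 : log (1 + exp T + Y) ≤ 2 * T := by
    rw [← log_exp (2 * T)]
    refine log_le_log (by positivity) ?_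
    rw [two_mul, exp_add]
    nlinarith
  have hlog2 : log (2 + exp T) ≤ 2 * T := by
    rw [← log_exp (2 * T)]
    refine log_le_log (by positivity) ?_
    rw [two_mul, exp_add]
    nlinarith
  have hlog3 : log (Y ^ 2) ≤ 4 * T := by
    rw [← log_exp (4 * T)]
    refine log_le_log (by positivity) ?_
    have : Y ≤ exp (2 * T) := by
      rw [two_mul, exp_add]
      nlinarith
    calc Y ^ 2 ≤ exp (2 * T) ^ 2 := by gcongr
      _ = _ := by rw [← exp_nat_mul]; congr 1; push_cast; ring
  have hF1 : 1 / exp (u * T) + 2 / Y * log (1 + exp T + Y) + 1 / exp (u * T) ≤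
      4 * T * (1 / exp (u * T) + 1 / Y) := by
    have a2 : 2 / Y * log (1 + exp T + Y) ≤ 2 / Y * (2 * T) := by gcongr
    have a3 : 0 < 1 / exp (u * T) := by positivity
    calc _ ≤ 1 / exp (u * T) + 2 / Y * (2 * T) + 1 / exp (u * T) := by gcongr
      _ = 2 * (1 / exp (u * T)) + 4 * T * (1 / Y) := by ring
      _ ≤ _ := by nlinarith
  have hF2 : 1 / exp (v * T) + log (2 + exp T) + Y ^ 2 * (1 + log (Y ^ 2)) / exp (v * T) ≤
      5 * T * (1 + Y ^ 2 / exp (v * T)) := by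
    have a1 : 1 / exp (v * T) ≤ T := by
      rw [div_le_iff₀ (exp_pos _)]
      have : 1 ≤ exp (v * T) := one_le_exp (by positivity)
      nlinarith
    have a2 : Y ^ 2 * (1 + log (Y ^ 2)) / exp (v * T) ≤ Y ^ 2 * (5 * T) / exp (v * T) := by
      gcongr
      linarith
    calc _ ≤ T + 2 * T + Y ^ 2 * (5 * T) / exp (v * T) := by gcongr
      _ ≤ 5 * T + Y ^ 2 * (5 * T) / exp (v * T) := by gcongr; linarith
      _ = _ := by ring
  have hF1'' := log_nonneg (show 1 ≤ 1 + exp T + Y by linarith)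
  have hF2' := log_nonneg (show 1 ≤ Y ^ 2 from one_le_pow₀ hY1)
  have hF2'' := log_nonneg (show 1 ≤ 2 + exp T by linarith)
  have key : ∀ x y z : ℝ, x ≠ 0 → y ≠ 0 → z ≠ 0 →
      (1 / x + 1 / z) * (1 + z ^ 2 / y) = 1 / x + 1 / z + z ^ 2 / (x * y) + z / y := by
    intro x y z hx hy hz
    field_simp
    ring
  have hmain : (1 / exp (u * T) + 1 / Y) * (1 + Y ^ 2 / exp (v * T)) ≤ 8 * exp (-κ * T) := by
    have b1 : 1 / exp (u * T) ≤ exp (-κ * T) := by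
      rw [one_div, ← exp_neg]
      exact exp_le_exp.2 (by linarith)
    have b2 : 1 / Y ≤ exp (-κ * T) := by
      calc 1 / Y ≤ 1 / exp (σ * T) := by gcongr
        _ = exp (-(σ * T)) := by rw [one_div, ← exp_neg]
        _ ≤ _ := exp_le_exp.2 (by linarith)
    have b3 : Y ^ 2 / (exp (u * T) * exp (v * T)) ≤ 4 * exp (-κ * T) := by
      rw [div_le_iff₀ (by positivity)]
      calc Y ^ 2 ≤ (2 * exp (ϱ * T)) ^ 2 := by gcongr
        _ = 4 * exp (2 * (ϱ * T)) := by rw [mul_pow, ← exp_nat_mul]; norm_num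
        _ ≤ 4 * exp (-κ * T + (u * T + v * T)) := by gcongr; linarith
        _ = _ := by rw [exp_add, exp_add]; ring
    have b4 : Y / exp (v * T) ≤ 2 * exp (-κ * T) := by
      rw [div_le_iff₀ (by positivity)]
      calc Y ≤ 2 * exp (ϱ * T) := hYT
        _ ≤ 2 * exp (-κ * T + v * T) := by gcongr; linarith
        _ = _ := by rw [exp_add]; ring
    calc _ = 1 / exp (u * T) + 1 / Y + Y ^ 2 / (exp (u * T) * exp (v * T)) + Y / exp (v * T) :=
          key _ _ _ (exp_ne_zero _) (exp_ne_zero _) hY0.ne'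
      _ ≤ _ := by linarith
  have h1 := sq_sum_bilinForm_le (x₁ := exp (u * T)) (x₂ := exp (v * T)) (z := 1)
    (one_le_exp (by positivity)) (one_le_exp (by positivity)) hblock.left hblock.right
    (exp_pos T).le hY1 le_rfl (one_le_exp (by positivity)) (one_le_exp (by positivity))
    hblock.prime hblock.lower hblock.upper hblock.factor hblock.coeff_le hblock.coeff_eq_zero
    (K := C₁ * (2 * exp (κ / 2 * T))) (by positivity) (fun R hR ↦ by
      refine (hcard R (hblock.prime R hR)).trans ?_
      have := hblock.upper R hR
      gcongr
      refine le_trans ?_ hK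
      gcongr) hblock.left_sum_le hblock.right_sum_le (Λ := 1) one_pos (one_le_roughSum le_rfl)
  simp only [one_pow, log_one, add_zero, mul_one, div_one] at h1
  refine abs_le_of_sq_le_sq (h1.trans ?_) (by positivity)
  calc _ ≤ 2 * (C₁ * (2 * exp (κ / 2 * T))) * (2 * (4 * T * (1 / exp (u * T) + 1 / Y))) *
        A * (5 * T * (1 + Y ^ 2 / exp (v * T)) * (2 * A)) := by gcongr
    _ = 320 * C₁ * A ^ 2 * T ^ 2 * exp (κ / 2 * T) *
        ((1 / exp (u * T) + 1 / Y) * (1 + Y ^ 2 / exp (v * T))) := by ring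
    _ ≤ 320 * C₁ * A ^ 2 * T ^ 2 * exp (κ / 2 * T) * (8 * exp (-κ * T)) := by gcongr
    _ = 2560 * C₁ * A ^ 2 * (T ^ 2 * exp (-(κ / 4) * T) ^ 2) := by
        rw [← exp_nat_mul, show ((2 : ℕ) : ℝ) * (-(κ / 4) * T) = κ / 2 * T + -κ * T by
          push_cast; ring, exp_add]
        ring
    _ ≤ (51 * C₁ * A) ^ 2 * (T ^ 2 * exp (-(κ / 4) * T) ^ 2) := by
        have : 2560 * C₁ * A ^ 2 ≤ (51 * C₁ * A) ^ 2 := by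
          have h5 : C₁ * A ^ 2 ≤ C₁ * (C₁ * A ^ 2) :=
            le_mul_of_one_le_left (by positivity) hC₁
          have h6 : 0 ≤ C₁ * A ^ 2 := by positivity
          linarith [show (51 * C₁ * A) ^ 2 = 2601 * (C₁ * (C₁ * A ^ 2)) by ring]
        gcongr
    _ = _ := by ring

end ErrorTerm

section ErrorSum

open Filter Topology Real

theorem eventually_sum_primesIoc_inv_le {u u' A : ℝ} (hu : 0 < u) (huu' : u ≤ u')
    (hA : log (u' / u) < A) :
    ∀ᶠ T : ℝ in atTop, ∀ P ⊆ primesIoc (exp (u * T)) (exp (u' * T)), ∑ p ∈ P, (1 : ℝ) / p ≤ A := by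
  have h := tendsto_sum_primesIoc_inv (q := 1) (a := 1) (by simp) hu huu'
  simp only [Nat.totient_one, Nat.cast_one, inv_one, one_mul] at h
  filter_upwards [h.eventually (gt_mem_nhds hA)] with T hT P hP
  rw [Finset.filter_true_of_mem fun _ _ ↦ Subsingleton.elim _ _] at hT
  exact (Finset.sum_le_sum_of_subset_of_nonneg hP fun _ _ _ ↦ by positivity).trans hT.le

/-- Bilinear forms over products of two primes are negligible for moduli up to `exp (ϱ * T)`. -/
theorem eventually_sum_bilinForm_le {q : ℕ} [NeZero q] {b : ZMod q} (hb : IsUnit b)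
    {u u' v v' ϱ : ℝ} (hu : 0 < u) (huu' : u ≤ u') (hu1 : u' ≤ 1) (hv : 0 < v) (hvv' : v ≤ v')
    (hv1 : v' ≤ 1) (hϱ : 2 * ϱ < u + v) (hϱv : ϱ < v) (hϱ1 : ϱ ≤ 1) {ε : ℝ} (hε : 0 < ε) :
    ∀ᶠ T : ℝ in atTop, ∀ P₁ ⊆ primesIoc (exp (u * T)) (exp (u' * T)), ∀ 𝓡 : Finset (Finset ℕ),
      (∀ R ∈ 𝓡, R.Nonempty ∧ (∀ p ∈ R, p.Prime ∧ ¬ p ∣ q) ∧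
        ((∏ p ∈ R, p : ℕ) : ℝ) ≤ exp (ϱ * T)) →
      ∀ (e : ℕ → ℕ → ℝ) (a : Finset ℕ → ℕ → ℝ), (∀ R ∈ 𝓡, ∀ p ∈ R, IsSieveFactor p (e p)) →
      (∀ R ∈ 𝓡, ∀ n ∈ P₁, |a R n| ≤ 4 ^ R.card / n) →
      (∀ R ∈ 𝓡, ∀ n ∈ P₁, ∀ p ∈ R, p ∣ n → a R n = 0) →
      |∑ R ∈ 𝓡, bilinForm P₁ ((primesIoc (exp (v * T)) (exp (v' * T))).filter
        fun p : ℕ ↦ (p : ZMod q) = b) e (a R) R| ≤ ε := by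
  set A := max (log (u' / u)) (log (v' / v)) + 1 with hA
  have hA0 : 0 ≤ A := by
    have := log_nonneg ((one_le_div hu).2 huu')
    linarith [le_max_left (log (u' / u)) (log (v' / v))]
  set σ := min (min u v) 1 / 8 with hσ
  have hσ0 : 0 < σ := by positivity
  have hσ1 : 8 * σ = min (min u v) 1 := by rw [hσ]; ring
  have hσu : 8 * σ ≤ u := hσ1.le.trans ((min_le_left _ _).trans (min_le_left _ _))
  have hσv : 8 * σ ≤ v := hσ1.le.trans ((min_le_left _ _).trans (min_le_right _ _))
  have hσ8 : σ ≤ 1 / 8 := by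
    have := hσ1.le.trans (min_le_right _ _)
    linarith
  obtain ⟨C₁, hC₁, Y₀, h1⟩ := exists_abs_sum_bilinForm_le_rpow hσ0 hσu hσv hσ8 hA0
  obtain ⟨C₂, hC₂, κ, hκ, h2⟩ :=
    exists_abs_sum_bilinForm_le_exp hu (huu'.trans hu1) hv hσ0 hϱ hϱv hϱ1 hA0
  set ρ : ℝ := 2 ^ (-(3 / 8) : ℝ) with hρ
  have hρ0 : 0 < ρ := by positivity
  have hρ1 : ρ < 1 := rpow_lt_one_of_one_lt_of_neg (by norm_num) (by norm_num)
  have hρk : ∀ k : ℕ, ((2 : ℝ) ^ (k + 1)) ^ (-(3 / 8) : ℝ) ≤ ρ ^ k := by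
    intro k
    rw [← rpow_pow_comm (by norm_num) (-(3 / 8) : ℝ) (k + 1)]
    exact pow_le_pow_of_le_one hρ0.le hρ1.le (Nat.le_succ k)
  obtain ⟨k₀, hk₀, hk₀'⟩ : ∃ k₀ : ℕ, C₁ * (ρ ^ k₀ / (1 - ρ)) ≤ ε / 3 ∧ Y₀ ≤ 2 ^ k₀ := by
    have t1 : Tendsto (fun k : ℕ ↦ C₁ * (ρ ^ k / (1 - ρ))) atTop (𝓝 (C₁ * (0 / (1 - ρ)))) :=
      ((tendsto_pow_atTop_nhds_zero_of_lt_one hρ0.le hρ1).div_const _).const_mul _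
    have t2 := tendsto_pow_atTop_atTop_of_one_lt (r := (2 : ℝ)) (by norm_num)
    rw [zero_div, mul_zero] at t1
    exact ((t1.eventually (ge_mem_nhds (by positivity))).and (t2.eventually_ge_atTop Y₀)).exists
  set 𝓢 : Finset (Finset ℕ) := (Finset.range (2 ^ k₀)).powerset.filter
    fun R ↦ R.Nonempty ∧ ∀ p ∈ R, p.Prime ∧ ¬ p ∣ q with h𝓢
  have hsmall := (Filter.eventually_all_finset 𝓢).2 fun R hR ↦ eventually_bilinForm_le hb hv hvv'
    (Finset.mem_filter.1 hR).2.1 (Finset.mem_filter.1 hR).2.2 A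
    (ε := ε / (3 * (𝓢.card + 1))) (by positivity)
  have t3 : Tendsto (fun T : ℝ ↦ 3 * C₂ * (T ^ (2 : ℝ) * exp (-κ * T))) atTop (𝓝 (3 * C₂ * 0)) :=
    (tendsto_rpow_mul_exp_neg_mul_atTop_nhds_zero 2 κ hκ).const_mul _
  rw [mul_zero] at t3
  have hA1 : log (u' / u) < A := by linarith [le_max_left (log (u' / u)) (log (v' / v))]
  have hA2 : log (v' / v) < A := by linarith [le_max_right (log (u' / u)) (log (v' / v))]
  filter_upwards [h1, h2, hsmall, eventually_sum_primesIoc_inv_le hu huu' hA1,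
    eventually_sum_primesIoc_inv_le hv hvv' hA2, t3.eventually (ge_mem_nhds (by positivity :
      0 < ε / 3)), eventually_ge_atTop 1]
    with T h1 h2 hsmall hP₁A hP₂A h3 hT P₁ hP₁ 𝓡 h𝓡 e a he ha ha0
  have hT0 : 0 < T := by linarith
  set P₂ := (primesIoc (exp (v * T)) (exp (v' * T))).filter fun p : ℕ ↦ (p : ZMod q) = b with hP₂
  set B : Finset ℕ → ℝ := fun R ↦ bilinForm P₁ P₂ e (a R) R with hB
  set ℓ : Finset ℕ → ℕ := fun R ↦ Nat.log 2 (∏ p ∈ R, p) with hℓ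
  have hpos : ∀ R ∈ 𝓡, ∏ p ∈ R, p ≠ 0 := fun R hR ↦
    Finset.prod_ne_zero_iff.2 fun p hp ↦ ((h𝓡 R hR).2.1 p hp).1.ne_zero
  have hℓ1 : ∀ R ∈ 𝓡, 2 ^ ℓ R ≤ ∏ p ∈ R, p := fun R hR ↦ Nat.pow_log_le_self 2 (hpos R hR)
  have hℓ2 : ∀ R, ∏ p ∈ R, p < 2 ^ (ℓ R + 1) := fun R ↦ Nat.lt_pow_succ_log_self (by norm_num) _
  have hblock : ∀ k ≥ k₀, |∑ R ∈ 𝓡 with ℓ R = k, B R| ≤ C₁ * ρ ^ k + C₂ * T * exp (-κ * T) := by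
    intro k hk
    rcases (𝓡.filter fun R ↦ ℓ R = k).eq_empty_or_nonempty with h0 | ⟨R₀, hR₀⟩
    · rw [h0, Finset.sum_empty, abs_zero]
      positivity
    have hmem : ∀ R ∈ 𝓡.filter (fun R ↦ ℓ R = k), R ∈ 𝓡 ∧ ℓ R = k := fun R hR ↦
      Finset.mem_filter.1 hR
    have hIs : IsBlock P₁ P₂ (exp (u * T)) (exp (v * T)) (exp T) A (2 ^ (k + 1))
        (𝓡.filter fun R ↦ ℓ R = k) e a := by
      refine ⟨fun n hn ↦ ?_, fun n hn ↦ ?_, fun R hR p hp ↦ ((h𝓡 R (hmem R hR).1).2.1 p hp).1,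
        fun R hR ↦ ?_, fun R hR ↦ ?_, fun R hR ↦ he R (hmem R hR).1,
        fun R hR ↦ ha R (hmem R hR).1, fun R hR ↦ ha0 R (hmem R hR).1, hP₁A _ hP₁,
        hP₂A _ (Finset.filter_subset _ _)⟩
      · obtain ⟨a1, a2, a3⟩ := mem_primesIoc.1 (hP₁ hn)
        exact ⟨a1, a2, a3.trans (exp_le_exp.2 (by nlinarith))⟩
      · obtain ⟨a1, a2, a3⟩ := mem_primesIoc.1 (Finset.mem_filter.1 hn).1
        exact ⟨a1, a2, a3.trans (exp_le_exp.2 (by nlinarith))⟩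
      · have := hℓ1 R (hmem R hR).1
        rw [(hmem R hR).2] at this
        rw [pow_succ, mul_div_assoc, div_self two_ne_zero, mul_one]
        exact_mod_cast this
      · have := (hℓ2 R).le
        rw [(hmem R hR).2] at this
        exact_mod_cast this
    have hY1 : (1 : ℝ) ≤ 2 ^ (k + 1) := one_le_pow₀ (by norm_num)
    rcases le_or_gt ((2 : ℝ) ^ (k + 1)) (exp (σ * T)) with hle | hgt
    · have hY₀ : Y₀ ≤ (2 : ℝ) ^ (k + 1) :=
        hk₀'.trans (pow_le_pow_right₀ (by norm_num) (by linarith))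
      refine (h1 _ hY₀ hY1 hle P₁ P₂ _ e a hIs).trans ?_
      have := mul_le_mul_of_nonneg_left (hρk k) hC₁
      have : 0 ≤ C₂ * T * exp (-κ * T) := by positivity
      linarith
    · have hup : (2 : ℝ) ^ (k + 1) ≤ 2 * exp (ϱ * T) := by
        have a1 := hℓ1 R₀ (hmem R₀ hR₀).1
        rw [(hmem R₀ hR₀).2] at a1
        have a2 : (2 : ℝ) ^ k ≤ (∏ p ∈ R₀, p : ℕ) := by exact_mod_cast a1
        rw [pow_succ]
        linarith [(h𝓡 R₀ (hmem R₀ hR₀).1).2.2]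
      refine (h2 _ hgt.le hup P₁ P₂ _ e a hIs).trans ?_
      have : 0 ≤ C₁ * ρ ^ k := by positivity
      linarith
  set M := ⌊2 * T⌋₊ + 1 with hM
  have hmaps : ∀ R ∈ 𝓡.filter (fun R ↦ ¬ ℓ R < k₀), ℓ R ∈ Finset.Ico k₀ M := by
    intro R hR
    obtain ⟨hR1, hR2⟩ := Finset.mem_filter.1 hR
    refine Finset.mem_Ico.2 ⟨not_lt.1 hR2, Nat.lt_succ_of_le (Nat.le_floor ?_)⟩
    have a2 : (2 : ℝ) ^ ℓ R ≤ exp (ϱ * T) := by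
      have : (2 : ℝ) ^ ℓ R ≤ (∏ p ∈ R, p : ℕ) := by exact_mod_cast hℓ1 R hR1
      exact this.trans (h𝓡 R hR1).2.2
    have a3 := log_le_log (by positivity) a2
    rw [log_pow, log_exp] at a3
    have := log_two_gt_d9
    have : ϱ * T ≤ 1 * T := by gcongr
    have : (ℓ R : ℝ) * (1 / 2) ≤ ℓ R * log 2 := by gcongr; linarith
    linarith
  have hlarge : |∑ R ∈ 𝓡 with ¬ ℓ R < k₀, B R| ≤ ε / 3 + ε / 3 := by
    rw [← Finset.sum_fiberwise_of_maps_to hmaps]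
    have hMT : (M : ℝ) ≤ 3 * T := by
      rw [hM]
      push_cast
      linarith [Nat.floor_le (by positivity : 0 ≤ 2 * T)]
    calc _ ≤ ∑ k ∈ Finset.Ico k₀ M, (C₁ * ρ ^ k + C₂ * T * exp (-κ * T)) := by
          refine (Finset.abs_sum_le_sum_abs _ _).trans (Finset.sum_le_sum fun k hk ↦ ?_)
          have hk' := (Finset.mem_Ico.1 hk).1
          have : (𝓡.filter fun R ↦ ¬ ℓ R < k₀).filter (fun R ↦ ℓ R = k) =
              𝓡.filter fun R ↦ ℓ R = k := by
            ext R
            simp only [Finset.mem_filter, not_lt]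
            constructor
            · tauto
            · rintro ⟨b1, b2⟩
              exact ⟨⟨b1, b2 ▸ hk'⟩, b2⟩
          rw [this]
          exact hblock k hk'
      _ = C₁ * ∑ k ∈ Finset.Ico k₀ M, ρ ^ k + (M - k₀ : ℕ) * (C₂ * T * exp (-κ * T)) := by
          rw [Finset.sum_add_distrib, Finset.mul_sum, Finset.sum_const, Nat.card_Ico, nsmul_eq_mul]
      _ ≤ C₁ * (ρ ^ k₀ / (1 - ρ)) + 3 * T * (C₂ * T * exp (-κ * T)) := by
          have a1 := geom_sum_Ico_le_of_lt_one (m := k₀) (n := M) hρ0.le hρ1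
          have a2 : ((M - k₀ : ℕ) : ℝ) ≤ 3 * T := le_trans (by exact_mod_cast Nat.sub_le _ _) hMT
          gcongr
      _ = C₁ * (ρ ^ k₀ / (1 - ρ)) + 3 * C₂ * (T ^ (2 : ℝ) * exp (-κ * T)) := by
          rw [rpow_two]
          ring
      _ ≤ _ := by linarith
  have hfew : |∑ R ∈ 𝓡 with ℓ R < k₀, B R| ≤ ε / 3 := by
    have hsub : 𝓡.filter (fun R ↦ ℓ R < k₀) ⊆ 𝓢 := by
      intro R hR
      obtain ⟨hR1, hR2⟩ := Finset.mem_filter.1 hR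
      refine Finset.mem_filter.2 ⟨Finset.mem_powerset.2 fun p hp ↦ Finset.mem_range.2 ?_,
        (h𝓡 R hR1).1, (h𝓡 R hR1).2.1⟩
      calc p ≤ ∏ p ∈ R, p := Nat.le_of_dvd (Nat.pos_of_ne_zero (hpos R hR1))
            (Finset.dvd_prod_of_mem _ hp)
        _ < 2 ^ (ℓ R + 1) := hℓ2 R
        _ ≤ 2 ^ k₀ := Nat.pow_le_pow_right (by norm_num) hR2
    calc |∑ R ∈ 𝓡 with ℓ R < k₀, B R| ≤ ∑ R ∈ 𝓡 with ℓ R < k₀, ε / (3 * (𝓢.card + 1)) := by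
          refine (Finset.abs_sum_le_sum_abs _ _).trans (Finset.sum_le_sum fun R hR ↦ ?_)
          have hR1 := (Finset.mem_filter.1 hR).1
          exact hsmall R (hsub hR) P₁ e (a R) (he R hR1) (ha R hR1) (ha0 R hR1) (hP₁A _ hP₁)
      _ = (𝓡.filter fun R ↦ ℓ R < k₀).card * (ε / (3 * (𝓢.card + 1))) := by
          rw [Finset.sum_const, nsmul_eq_mul]
      _ ≤ (𝓢.card + 1) * (ε / (3 * (𝓢.card + 1))) := by
          have : ((𝓡.filter fun R ↦ ℓ R < k₀).card : ℝ) ≤ 𝓢.card := by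
            exact_mod_cast Finset.card_le_card hsub
          gcongr
          linarith
      _ = ε / 3 := by field_simp
  rw [← Finset.sum_filter_add_sum_filter_not 𝓡 (fun R ↦ ℓ R < k₀)]
  refine (abs_add_le _ _).trans ?_
  linarith

end ErrorSum

section SieveBasic

open Filter Topology Real

/-- The logarithm of the product of the elements of `A`. -/
noncomputable def logProd (A : Finset ℕ) : ℝ := ∑ p ∈ A, log p

theorem logProd_nonneg (A : Finset ℕ) : 0 ≤ logProd A :=
  Finset.sum_nonneg fun _ _ ↦ log_natCast_nonneg _

theorem logProd_mono {A B : Finset ℕ} (h : A ⊆ B) : logProd A ≤ logProd B :=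
  Finset.sum_le_sum_of_subset_of_nonneg h fun _ _ _ ↦ log_natCast_nonneg _

theorem logProd_union {A B : Finset ℕ} (h : Disjoint A B) :
    logProd (A ∪ B) = logProd A + logProd B := Finset.sum_union h

theorem exp_logProd {A : Finset ℕ} (hA : ∀ p ∈ A, p.Prime) :
    exp (logProd A) = (∏ p ∈ A, p : ℕ) := by
  rw [logProd, exp_sum, Nat.cast_prod]
  exact Finset.prod_congr rfl fun p hp ↦ exp_log (by exact_mod_cast (hA p hp).pos)

theorem mem_powerset_primesIoc {w : ℕ} {L : ℝ} {A : Finset ℕ} :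
    A ∈ (primesIoc w (exp L)).powerset ↔ ∀ p ∈ A, p.Prime ∧ w < p ∧ (p : ℝ) ≤ exp L := by
  rw [Finset.mem_powerset]
  constructor
  · intro h p hp
    obtain ⟨h1, h2, h3⟩ := mem_primesIoc.1 (h hp)
    exact ⟨h1, by exact_mod_cast h2, h3⟩
  · intro h p hp
    obtain ⟨h1, h2, h3⟩ := h p hp
    exact mem_primesIoc.2 ⟨h1, by exact_mod_cast h2, h3⟩

/-- Asymptotics of sums of `∏ k/(p-b)` over subsets of the primes in `(w, exp L]`. -/
theorem tendsto_sum_powerset_primesIoc {k b w : ℕ} (hb : b ≤ 3) (hw : 6 ≤ w)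
    (hk : k + 1 = 1 ∨ k + 1 = 2 ∨ k + 1 = 3) {φ : ℝ → ℝ} (hφ : Continuous φ) {a : ℝ}
    (ha : 0 ≤ a) (ha1 : a ≤ 1) :
    Tendsto (fun L : ℝ ↦ (∑ A ∈ (primesIoc w (exp L)).powerset,
      (∏ p ∈ A, ((k + 1 : ℕ) : ℝ) / (p - b)) *
      (if logProd A ≤ a * L then φ (logProd A / L) else 0)) / L ^ (k + 1))
      atTop (𝓝 (sieveConst (k + 1) b w *
        ∫ t in (0 : ℝ)..a, φ t * (t ^ k / (k.factorial : ℝ)))) := by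
  refine (tendsto_sieveWeight_sum hb hw hk hφ ha).congr' ?_
  filter_upwards [eventually_ge_atTop 0] with L hL
  rw [tsum_eq_sum (s := (primesIoc w (exp L)).powerset)]
  · refine congrArg (· / L ^ (k + 1)) (Finset.sum_congr rfl fun A hA ↦ ?_)
    rw [mem_powerset_primesIoc] at hA
    refine congrArg₂ (· * ·) (Finset.prod_congr rfl fun p hp ↦ ?_) rfl
    rw [sieveWeight_of_prime (hA p hp).1 (hA p hp).2.1]
  · intro A hA
    by_cases hA1 : ∀ p ∈ A, p.Prime ∧ w < p
    · rw [if_neg, mul_zero]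
      intro h
      refine hA (mem_powerset_primesIoc.2 fun p hp ↦ ⟨(hA1 p hp).1, (hA1 p hp).2, ?_⟩)
      rw [← log_le_iff_le_exp (by exact_mod_cast (hA1 p hp).1.pos)]
      have : log (p : ℝ) ≤ ∑ p ∈ A, log (p : ℝ) :=
        Finset.single_le_sum (f := fun p : ℕ ↦ log (p : ℝ)) (fun _ _ ↦ log_natCast_nonneg _) hp
      nlinarith
    · push Not at hA1
      obtain ⟨p, hp, h⟩ := hA1
      rw [Finset.prod_eq_zero hp, zero_mul]
      rw [sieveWeight, if_neg]
      exact fun h' ↦ absurd h'.2 (not_lt.2 (h h'.1))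

/-- The set of shifts. -/
def shifts : Finset ℕ := {0, 4, 10}

/-- `p` divides some shift of `x`. -/
def HitsShift (p : ℕ) (x : ℤ) : Prop := ∃ h ∈ shifts, (p : ℤ) ∣ x + h

open scoped Classical in
theorem sum_range_hitsShift {p : ℕ} (hp : p.Prime) (hp10 : 10 < p) (k : ℤ) (a b : ℝ) :
    ∑ c ∈ Finset.range p, (if HitsShift p (c + k) then a else b) = 3 * a + (p - 3) * b := by
  have : Fact p.Prime := ⟨hp⟩
  have h1 : ∀ c : ℕ, HitsShift p (c + k) ↔
      (c : ZMod p) ∈ shifts.image fun h : ℕ ↦ -((k : ZMod p) + h) := by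
    intro c
    simp only [HitsShift, Finset.mem_image]
    refine exists_congr fun h ↦ and_congr_right fun _ ↦ ?_
    rw [← ZMod.intCast_zmod_eq_zero_iff_dvd]
    push_cast
    rw [add_assoc, add_eq_zero_iff_eq_neg, eq_comm]
  have h2 : ∑ c ∈ Finset.range p, (if HitsShift p (c + k) then a else b) =
      ∑ c : ZMod p, if c ∈ shifts.image (fun h : ℕ ↦ -((k : ZMod p) + h)) then a else b := by
    refine Finset.sum_bij' (fun c _ ↦ (c : ZMod p)) (fun c _ ↦ c.val) (fun _ _ ↦ Finset.mem_univ _)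
      (fun c _ ↦ Finset.mem_range.2 c.val_lt) (fun c hc ↦ ZMod.val_cast_of_lt (Finset.mem_range.1 hc))
      (fun c _ ↦ ZMod.natCast_zmod_val c) fun c _ ↦ ?_
    simp only [h1]
  have hcard : (shifts.image fun h : ℕ ↦ -((k : ZMod p) + h)).card = 3 := by
    rw [Finset.card_image_of_injOn]
    · rfl
    · intro x hx y hy hxy
      have h10 : ∀ x ∈ shifts, x ≤ 10 := by decide
      have hx' : x < p := lt_of_le_of_lt (h10 x hx) hp10
      have hy' : y < p := lt_of_le_of_lt (h10 y hy) hp10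
      have h3 : (x : ZMod p) = y := by simpa using hxy
      rw [ZMod.natCast_eq_natCast_iff', Nat.mod_eq_of_lt hx', Nat.mod_eq_of_lt hy'] at h3
      exact h3
  rw [h2, Finset.sum_ite, Finset.sum_const, Finset.sum_const, Finset.filter_mem_eq_inter,
    Finset.univ_inter, hcard]
  have h4 : (Finset.univ.filter fun c : ZMod p ↦ c ∉ shifts.image fun h : ℕ ↦
      -((k : ZMod p) + h)).card = p - 3 := by
    rw [Finset.filter_not, Finset.filter_mem_eq_inter, Finset.univ_inter,
      Finset.card_sdiff_of_subset (Finset.subset_univ _), hcard, Finset.card_univ, ZMod.card]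
  rw [h4, nsmul_eq_mul, nsmul_eq_mul, Nat.cast_sub (by omega)]
  norm_num

open scoped Classical in
/-- The centred sieve factor at `p`. -/
noncomputable def sieveFactor (p n : ℕ) : ℝ := if HitsShift p n then -1 else 3 / (p - 3)

open scoped Classical in
/-- The centred sieve factor at `p` on units, as a function of the shifted variable. -/
noncomputable def unitFactor (h p x : ℕ) : ℝ :=
  if p ∣ x then 0 else if HitsShift p (x - h) then -1 else 2 / (p - 3)

theorem HitsShift.add_self_iff {p : ℕ} {x y : ℤ} (h : (p : ℤ) ∣ y - x) :
    HitsShift p y ↔ HitsShift p x := by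
  refine exists_congr fun k ↦ and_congr_right fun _ ↦ ?_
  exact dvd_iff_dvd_of_dvd_sub (by simpa using h)

theorem periodic_sieveFactor (p : ℕ) : Function.Periodic (sieveFactor p) p := by
  intro n
  simp only [sieveFactor]
  rw [HitsShift.add_self_iff (x := (n : ℤ)) (by push_cast; simp)]

theorem periodic_unitFactor (h p : ℕ) : Function.Periodic (unitFactor h p) p := by
  intro n
  simp only [unitFactor, Nat.dvd_add_self_right]
  rw [HitsShift.add_self_iff (x := (n : ℤ) - h) (by push_cast; ring_nf; simp)]

theorem sum_range_sieveFactor {p : ℕ} (hp : p.Prime) (hp10 : 10 < p) :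
    ∑ c ∈ Finset.range p, sieveFactor p c = 0 := by
  classical
  have := sum_range_hitsShift hp hp10 0 (-1) (3 / ((p : ℝ) - 3))
  have h3 : (p : ℝ) - 3 ≠ 0 := by
    have : (10 : ℝ) < p := by exact_mod_cast hp10
    linarith
  have h1 : ∀ c : ℕ, sieveFactor p c =
      if HitsShift p ((c : ℤ) + 0) then -1 else 3 / ((p : ℝ) - 3) := by
    intro c
    simp [sieveFactor]
  simp only [h1, this]
  field_simp
  ring

theorem sum_range_sieveFactor_sq {p : ℕ} (hp : p.Prime) (hp10 : 10 < p) :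
    ∑ c ∈ Finset.range p, sieveFactor p c ^ 2 = p * (3 / (p - 3)) := by
  classical
  have := sum_range_hitsShift hp hp10 0 ((-1) ^ 2) ((3 / ((p : ℝ) - 3)) ^ 2)
  have h3 : (p : ℝ) - 3 ≠ 0 := by
    have : (10 : ℝ) < p := by exact_mod_cast hp10
    linarith
  have h1 : ∀ c : ℕ, sieveFactor p c =
      if HitsShift p ((c : ℤ) + 0) then -1 else 3 / ((p : ℝ) - 3) := by
    intro c
    simp [sieveFactor]
  simp only [h1, ite_pow, this]
  field_simp
  ring

theorem abs_sieveFactor_le {p : ℕ} (hp10 : 10 < p) (n : ℕ) : |sieveFactor p n| ≤ 1 := by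
  have : (11 : ℝ) ≤ p := by exact_mod_cast hp10
  rw [sieveFactor]
  split_ifs
  · simp
  · rw [abs_of_nonneg (div_nonneg (by norm_num) (by linarith)), div_le_one (by linarith)]
    linarith

open scoped Classical in
theorem isSieveFactor_unitFactor {h p : ℕ} (hh : h ∈ shifts) (hp : p.Prime) (hp10 : 10 < p) :
    IsSieveFactor p (unitFactor h p) := by
  have hp' : (10 : ℝ) < p := by exact_mod_cast hp10
  have h3 : (p : ℝ) - 3 ≠ 0 := by linarith
  have hhit : ∀ c : ℕ, p ∣ c → HitsShift p ((c : ℤ) + -h) := fun c hc ↦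
    ⟨h, hh, by simpa using Int.natCast_dvd_natCast.2 hc⟩
  have hsum : ∀ a : ℝ, ∑ c ∈ Finset.range p, (if p ∣ c then a else 0) = a := by
    intro a
    rw [Finset.sum_eq_single_of_mem 0 (Finset.mem_range.2 hp.pos)]
    · simp
    · intro c hc hc0
      exact if_neg fun h ↦ hc0 (Nat.eq_zero_of_dvd_of_lt h (Finset.mem_range.1 hc))
  refine ⟨periodic_unitFactor h p, by simp [unitFactor], ?_, ?_⟩
  · have h1 : ∀ c : ℕ, unitFactor h p c =
        (if HitsShift p ((c : ℤ) + -(h : ℤ)) then (-1 : ℝ) else 2 / ((p : ℝ) - 3)) +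
          if p ∣ c then (1 : ℝ) else 0 := by
      intro c
      rw [unitFactor, sub_eq_add_neg]
      by_cases hc : p ∣ c
      · simp [hc, hhit c hc]
      · simp [hc]
    simp only [h1]
    rw [Finset.sum_add_distrib, sum_range_hitsShift hp hp10, hsum]
    field_simp
    ring
  · have h1 : ∀ c : ℕ, |unitFactor h p c| =
        (if HitsShift p ((c : ℤ) + -(h : ℤ)) then (1 : ℝ) else 2 / ((p : ℝ) - 3)) +
          if p ∣ c then (-1 : ℝ) else 0 := by
      intro c
      rw [unitFactor, sub_eq_add_neg]
      by_cases hc : p ∣ c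
      · simp [hc, hhit c hc]
      · simp only [hc, if_false, add_zero]
        split_ifs
        · simp
        · exact abs_of_nonneg (div_nonneg (by norm_num) (by linarith))
    simp only [h1]
    rw [Finset.sum_add_distrib, sum_range_hitsShift hp hp10, hsum]
    field_simp
    linarith

end SieveBasic

section SieveUpper

open Filter Topology Real

/-- The smoothing profile of the sieve weights. -/
noncomputable def profile (t : ℝ) : ℝ := if t ≤ 1 then 1 + 3 * (1 - t) + 3 * (1 - t) ^ 2 else 0

theorem profile_nonneg (t : ℝ) : 0 ≤ profile t := by
  rw [profile]
  split_ifs with h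
  · nlinarith [sq_nonneg (1 - t)]
  · rfl

theorem antitone_profile : Antitone profile := by
  intro s t hst
  rw [profile, profile]
  split_ifs with h1 h2 h2
  · nlinarith
  · linarith
  · nlinarith [sq_nonneg (1 - s)]
  · rfl

theorem profile_le {t : ℝ} (ht : 0 ≤ t) : profile t ≤ 7 := by
  refine (antitone_profile ht).trans ?_
  norm_num [profile]

theorem profile_of_one_lt {t : ℝ} (ht : 1 < t) : profile t = 0 := if_neg (not_le.2 ht)

/-- The truncated sieve sum. -/
noncomputable def sieveSum (w : ℕ) (L : ℝ) (n : ℕ) : ℝ :=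
  ∑ A ∈ (primesIoc w (exp L)).powerset, profile (logProd A / L) * ∏ p ∈ A, sieveFactor p n

theorem abs_sum_range_periodic_le {D : ℕ} (hD : 0 < D) {f : ℕ → ℝ} (hf : Function.Periodic f D)
    (h0 : ∑ c ∈ Finset.range D, f c = 0) {K : ℝ} (hK : ∀ n, |f n| ≤ K) (N : ℕ) :
    |∑ i ∈ Finset.range N, f i| ≤ K * D := by
  have hblock : ∀ k, ∑ i ∈ Finset.range (D * k), f i = 0 := by
    intro k
    induction k with
    | zero => simp
    | succ k ih =>
      rw [Nat.mul_succ, Finset.sum_range_add, ih, zero_add, ← h0]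
      refine Finset.sum_congr rfl fun c _ ↦ ?_
      rw [add_comm, mul_comm]
      exact hf.nat_mul k c
  have hK0 : 0 ≤ K := (abs_nonneg _).trans (hK 0)
  rw [← Nat.div_add_mod N D, Finset.sum_range_add, hblock, zero_add]
  refine (Finset.abs_sum_le_sum_abs _ _).trans
    ((Finset.sum_le_sum fun i _ ↦ hK _).trans ?_)
  rw [Finset.sum_const, Finset.card_range, nsmul_eq_mul, mul_comm]
  exact mul_le_mul_of_nonneg_left (by exact_mod_cast (Nat.mod_lt N hD).le) hK0

theorem abs_sum_progression_sub_le {D W m : ℕ} (hD : 0 < D) (hW : W.Coprime D) (hm : 0 < m)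
    {f : ℕ → ℝ} (hf : Function.Periodic f D) {μ : ℝ} (h0 : ∑ c ∈ Finset.range D, f c = D * μ)
    (hμ : |μ| ≤ 1) (hK : ∀ n, |f n| ≤ 1) (N : ℕ) :
    |∑ i ∈ Finset.range N, 1 / ((m : ℝ) + W * i) * f (m + W * i) -
      μ * ∑ i ∈ Finset.range N, 1 / ((m : ℝ) + W * i)| ≤ 2 * D / m := by
  have hm' : (0 : ℝ) < m := by exact_mod_cast hm
  have hc : Antitone fun i : ℕ ↦ 1 / ((m : ℝ) + W * i) := by
    intro i j hij
    have : (i : ℝ) ≤ j := by exact_mod_cast hij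
    dsimp only
    gcongr
  have hf' : Function.Periodic (fun i ↦ f (m + W * i) - μ) D := by
    intro i
    have := hf.nat_mul W (m + W * i)
    dsimp only
    rw [← this, Nat.cast_id, mul_add, add_assoc]
  have h0' : ∑ c ∈ Finset.range D, (f (m + W * c) - μ) = 0 := by
    rw [Finset.sum_sub_distrib, sum_range_mul_left_periodic hD hW m hf, h0]
    simp
  have := norm_sum_antitone_smul_le hc (fun i ↦ by positivity)
    (z := fun i ↦ f (m + W * i) - μ) (B := 2 * D)
    (fun n ↦ abs_sum_range_periodic_le hD hf' h0'
      (fun n ↦ (abs_sub _ _).trans (by linarith [hK (m + W * n)])) n) N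
  rw [Real.norm_eq_abs] at this
  simp only [smul_eq_mul, mul_sub, Finset.sum_sub_distrib] at this
  rw [← Finset.sum_mul, mul_comm _ μ] at this
  refine this.trans (le_of_eq ?_)
  simp only [Nat.cast_zero, mul_zero, add_zero]
  ring

theorem sum_range_prod_sieveFactor {A B : Finset ℕ} (hA : ∀ p ∈ A, p.Prime ∧ 10 < p)
    (hB : ∀ p ∈ B, p.Prime ∧ 10 < p) :
    ∑ c ∈ Finset.range (∏ p ∈ A ∪ B, p),
        (∏ p ∈ A, sieveFactor p c) * ∏ p ∈ B, sieveFactor p c =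
      ((∏ p ∈ A ∪ B, p : ℕ) : ℝ) * if A = B then ∏ p ∈ A, (3 : ℝ) / (p - 3) else 0 := by
  have hAB : ∀ p ∈ A ∪ B, p.Prime ∧ 10 < p := fun p hp ↦
    (Finset.mem_union.1 hp).elim (hA p) (hB p)
  have h1 : ∀ c : ℕ, (∏ p ∈ A, sieveFactor p c) * ∏ p ∈ B, sieveFactor p c =
      ∏ p ∈ A ∪ B, ((if p ∈ A then sieveFactor p c else 1) *
        if p ∈ B then sieveFactor p c else 1) := by
    intro c
    rw [Finset.prod_mul_distrib, Finset.prod_ite_mem, Finset.prod_ite_mem,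
      Finset.inter_eq_right.2 Finset.subset_union_left,
      Finset.inter_eq_right.2 Finset.subset_union_right]
  simp only [h1]
  rw [sum_range_prod_periodic (fun p hp ↦ (hAB p hp).1) (f := fun p c ↦
    (if p ∈ A then sieveFactor p c else 1) * if p ∈ B then sieveFactor p c else 1)]
  · split_ifs with h
    · subst h
      rw [Finset.union_self, Nat.cast_prod, ← Finset.prod_mul_distrib]
      refine Finset.prod_congr rfl fun p hp ↦ ?_
      rw [← sum_range_sieveFactor_sq (hA p hp).1 (hA p hp).2]
      exact Finset.sum_congr rfl fun c _ ↦ by rw [if_pos hp, sq]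
    · obtain ⟨p, hp⟩ : ∃ p, ¬(p ∈ A ↔ p ∈ B) := by
        by_contra! h'
        exact h (Finset.ext h')
      rw [mul_zero]
      have hp' : p ∈ A ∪ B := by
        rw [Finset.mem_union]
        tauto
      refine Finset.prod_eq_zero hp' ?_
      rw [← sum_range_sieveFactor (hAB p hp').1 (hAB p hp').2]
      refine Finset.sum_congr rfl fun c _ ↦ ?_
      by_cases hpA : p ∈ A <;> by_cases hpB : p ∈ B <;> simp_all
  · intro p hp n
    dsimp only
    rw [periodic_sieveFactor p n]

theorem abs_prod_sieveFactor_le {A : Finset ℕ} (hA : ∀ p ∈ A, p.Prime ∧ 10 < p) (n : ℕ) :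
    |∏ p ∈ A, sieveFactor p n| ≤ 1 := by
  rw [Finset.abs_prod]
  exact Finset.prod_le_one (fun _ _ ↦ abs_nonneg _) fun p hp ↦ abs_sieveFactor_le (hA p hp).2 n

theorem prod_three_div_le {A : Finset ℕ} (hA : ∀ p ∈ A, p.Prime ∧ 10 < p) :
    |∏ p ∈ A, (3 : ℝ) / (p - 3)| ≤ 1 := by
  rw [Finset.abs_prod]
  refine Finset.prod_le_one (fun _ _ ↦ abs_nonneg _) fun p hp ↦ ?_
  have : (11 : ℝ) ≤ p := by exact_mod_cast (hA p hp).2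
  rw [abs_of_nonneg (div_nonneg (by norm_num) (by linarith)), div_le_one (by linarith)]
  linarith

theorem sum_progression_sq_le {W m : ℕ} (hm : 0 < m) {𝓐 : Finset (Finset ℕ)}
    (h𝓐 : ∀ A ∈ 𝓐, ∀ p ∈ A, p.Prime ∧ 10 < p ∧ ¬p ∣ W) (y : Finset ℕ → ℝ) (N : ℕ) :
    ∑ i ∈ Finset.range N, 1 / ((m : ℝ) + W * i) *
        (∑ A ∈ 𝓐, y A * ∏ p ∈ A, sieveFactor p (m + W * i)) ^ 2 ≤
      (∑ A ∈ 𝓐, y A ^ 2 * ∏ p ∈ A, (3 : ℝ) / (p - 3)) *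
        (∑ i ∈ Finset.range N, 1 / ((m : ℝ) + W * i)) +
      2 / m * (∑ A ∈ 𝓐, |y A| * (∏ p ∈ A, p : ℕ)) ^ 2 := by
  have hm' : (0 : ℝ) < m := by exact_mod_cast hm
  set H : ℝ := ∑ i ∈ Finset.range N, 1 / ((m : ℝ) + W * i)
  have h𝓐' : ∀ A ∈ 𝓐, ∀ p ∈ A, p.Prime ∧ 10 < p := fun A hA p hp ↦
    ⟨(h𝓐 A hA p hp).1, (h𝓐 A hA p hp).2.1⟩
  have hpair : ∀ A ∈ 𝓐, ∀ B ∈ 𝓐,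
      y A * y B * ∑ i ∈ Finset.range N, 1 / ((m : ℝ) + W * i) *
        ((∏ p ∈ A, sieveFactor p (m + W * i)) * ∏ p ∈ B, sieveFactor p (m + W * i)) ≤
      y A * y B * ((if A = B then ∏ p ∈ A, (3 : ℝ) / (p - 3) else 0) * H) +
        2 / m * ((|y A| * (∏ p ∈ A, p : ℕ)) * (|y B| * (∏ p ∈ B, p : ℕ))) := by
    intro A hA B hB
    have hAB : ∀ p ∈ A ∪ B, p.Prime ∧ ¬p ∣ W := fun p hp ↦
      (Finset.mem_union.1 hp).elim (fun h ↦ ⟨(h𝓐 A hA p h).1, (h𝓐 A hA p h).2.2⟩)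
        fun h ↦ ⟨(h𝓐 B hB p h).1, (h𝓐 B hB p h).2.2⟩
    have hD0 : 0 < ∏ p ∈ A ∪ B, p := Finset.prod_pos fun p hp ↦ (hAB p hp).1.pos
    have hper : Function.Periodic
        (fun n ↦ (∏ p ∈ A, sieveFactor p n) * ∏ p ∈ B, sieveFactor p n) (∏ p ∈ A ∪ B, p) := by
      intro n
      have hp : ∀ p ∈ A ∪ B, sieveFactor p (n + ∏ p ∈ A ∪ B, p) = sieveFactor p n := by
        intro p hp
        obtain ⟨k, hk⟩ := Finset.dvd_prod_of_mem (fun p ↦ p) hp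
        rw [hk, mul_comm]
        exact (periodic_sieveFactor p).nat_mul k n
      exact congrArg₂ (· * ·)
        (Finset.prod_congr rfl fun p h ↦ hp p (Finset.mem_union_left _ h))
        (Finset.prod_congr rfl fun p h ↦ hp p (Finset.mem_union_right _ h))
    have h1 := abs_sum_progression_sub_le hD0 (W := W)
      (Nat.Coprime.symm (Nat.Coprime.prod_left fun p hp ↦
        ((hAB p hp).1.coprime_iff_not_dvd).2 (hAB p hp).2)) hm hper
      (sum_range_prod_sieveFactor (h𝓐' A hA) (h𝓐' B hB))
      (by split_ifs
          · exact prod_three_div_le (h𝓐' A hA)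
          · simp)
      (fun n ↦ by
        rw [abs_mul]
        exact mul_le_one₀ (abs_prod_sieveFactor_le (h𝓐' A hA) n) (abs_nonneg _)
          (abs_prod_sieveFactor_le (h𝓐' B hB) n)) N
    have hD : ((∏ p ∈ A ∪ B, p : ℕ) : ℝ) ≤ (∏ p ∈ A, p : ℕ) * (∏ p ∈ B, p : ℕ) := by
      have : (∏ p ∈ A ∪ B, p) * ∏ p ∈ A ∩ B, p = (∏ p ∈ A, p) * ∏ p ∈ B, p :=
        Finset.prod_union_inter
      have h2 : 1 ≤ ∏ p ∈ A ∩ B, p := Finset.prod_pos fun p hp ↦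
        (h𝓐 A hA p (Finset.mem_inter.1 hp).1).1.pos
      exact_mod_cast (Nat.le_mul_of_pos_right _ h2).trans this.le
    have h3 : y A * y B * ∑ i ∈ Finset.range N, 1 / ((m : ℝ) + W * i) *
        ((∏ p ∈ A, sieveFactor p (m + W * i)) * ∏ p ∈ B, sieveFactor p (m + W * i)) -
      y A * y B * ((if A = B then ∏ p ∈ A, (3 : ℝ) / (p - 3) else 0) * H) ≤
        |y A * y B| * (2 * (∏ p ∈ A ∪ B, p : ℕ) / m) := by
      rw [← mul_sub]
      refine (le_abs_self _).trans ?_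
      rw [abs_mul]
      exact mul_le_mul_of_nonneg_left h1 (abs_nonneg _)
    have h4 : |y A * y B| * (2 * (∏ p ∈ A ∪ B, p : ℕ) / m) ≤
        2 / m * ((|y A| * (∏ p ∈ A, p : ℕ)) * (|y B| * (∏ p ∈ B, p : ℕ))) := by
      calc |y A * y B| * (2 * (∏ p ∈ A ∪ B, p : ℕ) / m)
          ≤ |y A * y B| * (2 * ((∏ p ∈ A, p : ℕ) * (∏ p ∈ B, p : ℕ)) / m) := by gcongr
        _ = _ := by rw [abs_mul]; ring
    linarith
  calc _ = ∑ A ∈ 𝓐, ∑ B ∈ 𝓐, y A * y B * ∑ i ∈ Finset.range N, 1 / ((m : ℝ) + W * i) *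
        ((∏ p ∈ A, sieveFactor p (m + W * i)) * ∏ p ∈ B, sieveFactor p (m + W * i)) := by
        simp only [sq, Finset.sum_mul_sum]
        simp only [Finset.mul_sum]
        rw [Finset.sum_comm]
        refine Finset.sum_congr rfl fun A _ ↦ ?_
        rw [Finset.sum_comm]
        exact Finset.sum_congr rfl fun B _ ↦ Finset.sum_congr rfl fun i _ ↦ by ring
    _ ≤ ∑ A ∈ 𝓐, ∑ B ∈ 𝓐,
        (y A * y B * ((if A = B then ∏ p ∈ A, (3 : ℝ) / (p - 3) else 0) * H) +
        2 / m * ((|y A| * (∏ p ∈ A, p : ℕ)) * (|y B| * (∏ p ∈ B, p : ℕ)))) :=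
        Finset.sum_le_sum fun A hA ↦ Finset.sum_le_sum fun B hB ↦ hpair A hA B hB
    _ = _ := by
        simp only [Finset.sum_add_distrib]
        congr 1
        · rw [Finset.sum_mul]
          refine Finset.sum_congr rfl fun A hA ↦ ?_
          rw [Finset.sum_eq_single_of_mem A hA]
          · rw [if_pos rfl]
            ring
          · intro B _ hBA
            rw [if_neg hBA.symm]
            ring
        · rw [sq, Finset.sum_mul_sum, Finset.mul_sum]
          exact Finset.sum_congr rfl fun A _ ↦ by rw [Finset.mul_sum]

theorem injOn_prod_primes : Set.InjOn (fun A : Finset ℕ ↦ ∏ p ∈ A, p)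
    {A : Finset ℕ | ∀ p ∈ A, p.Prime} := by
  intro A hA B hB h
  rw [← Nat.primeFactors_prod hA, ← Nat.primeFactors_prod hB]
  exact congrArg Nat.primeFactors h

theorem card_filter_prod_le (w : ℕ) (L M : ℝ) :
    (((primesIoc w (exp L)).powerset.filter fun A ↦ logProd A ≤ M).card : ℝ) ≤ exp M := by
  have hprime : ∀ A ∈ (primesIoc w (exp L)).powerset, ∀ p ∈ A, p.Prime :=
    fun A hA p hp ↦ (mem_powerset_primesIoc.1 hA p hp).1
  have : ((primesIoc w (exp L)).powerset.filter fun A ↦ logProd A ≤ M).card ≤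
      (Finset.Icc 1 ⌊exp M⌋₊).card := by
    refine Finset.card_le_card_of_injOn (fun A ↦ ∏ p ∈ A, p) ?_ ?_
    · intro A hA
      obtain ⟨hA1, hA2⟩ := Finset.mem_filter.1 hA
      refine Finset.mem_coe.2 (Finset.mem_Icc.2
        ⟨Finset.prod_pos fun p hp ↦ (hprime A hA1 p hp).pos, Nat.le_floor ?_⟩)
      rw [← exp_logProd (hprime A hA1)]
      exact exp_le_exp.2 hA2
    · intro A hA B hB
      exact injOn_prod_primes (hprime A (Finset.mem_filter.1 hA).1)
        (hprime B (Finset.mem_filter.1 hB).1)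
  rw [Nat.card_Icc, Nat.add_sub_cancel] at this
  exact (Nat.cast_le.2 this).trans (Nat.floor_le (exp_pos M).le)

/-- The integers `n ≡ b` modulo `W` in `(exp ((1 - δ) T) / 2, exp T]`. -/
noncomputable def sieveRange (W b : ℕ) (δ T : ℝ) : Finset ℕ := by
  classical
  exact (Finset.Icc 1 ⌊exp T⌋₊).filter fun n : ℕ ↦ exp ((1 - δ) * T) / 2 < n ∧ n ≡ b [MOD W]

theorem mem_sieveRange {W b n : ℕ} {δ T : ℝ} : n ∈ sieveRange W b δ T ↔
    (n : ℝ) ≤ exp T ∧ exp ((1 - δ) * T) / 2 < n ∧ n ≡ b [MOD W] := by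
  classical
  rw [sieveRange, Finset.mem_filter, Finset.mem_Icc, Nat.le_floor_iff (exp_pos T).le]
  constructor
  · rintro ⟨⟨_, h1⟩, h2⟩
    exact ⟨h1, h2⟩
  · rintro ⟨h1, h2⟩
    refine ⟨⟨?_, h1⟩, h2⟩
    have : (0 : ℝ) < n := by linarith [exp_pos ((1 - δ) * T)]
    exact_mod_cast this

theorem sum_sieveRange_le {W : ℕ} (hW : 0 < W) (b : ℕ) {δ T : ℝ} (hT : (W : ℝ) ≤ exp T)
    (hδ : 0 ≤ δ * T) {F : ℕ → ℝ} (hF : ∀ n, 0 ≤ F n) :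
    ∃ m N : ℕ, 0 < m ∧ exp ((1 - δ) * T) / 2 ≤ m ∧
      ∑ i ∈ Finset.range N, 1 / ((m : ℝ) + W * i) ≤
        2 * exp (-((1 - δ) * T)) + 1 / W * (δ * T + log 5) ∧
      ∑ n ∈ sieveRange W b δ T, F n ≤ ∑ i ∈ Finset.range N, F (m + W * i) := by
  classical
  set K := ⌊exp ((1 - δ) * T) / 2⌋₊ + 1 with hK
  have hW' : (0 : ℝ) < W := by exact_mod_cast hW
  obtain ⟨m, hm1, hm2, hm3⟩ : ∃ m, K ≤ m ∧ m < K + W ∧ m ≡ b [MOD W] := by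
    refine ⟨K + (b + (W - K % W)) % W, Nat.le_add_right _ _, ?_, ?_⟩
    · have := Nat.mod_lt (b + (W - K % W)) hW
      omega
    · have h1 : K + (b + (W - K % W)) % W ≡ K % W + (b + (W - K % W)) [MOD W] :=
        ((Nat.mod_modEq K W).symm).add (Nat.mod_modEq _ _)
      refine h1.trans ?_
      have h2 := Nat.mod_lt K hW
      rw [show K % W + (b + (W - K % W)) = b + W by omega]
      exact Nat.add_modEq_right
  have hm0 : 0 < m := by omega
  have hmK : exp ((1 - δ) * T) / 2 ≤ m := by
    have h1 : exp ((1 - δ) * T) / 2 < K := by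
      rw [hK]
      push_cast
      exact Nat.lt_floor_add_one _
    exact h1.le.trans (by exact_mod_cast hm1)
  have hm' : (0 : ℝ) < m := by exact_mod_cast hm0
  refine ⟨m, ⌊exp T⌋₊ / W + 1, hm0, hmK, ?_, ?_⟩
  · refine (sum_one_div_add_mul_le hm' hW _).trans (add_le_add ?_ ?_)
    · rw [one_div, exp_neg, inv_le_comm₀ hm' (by positivity), mul_inv, inv_inv]
      linarith
    · gcongr
      have h1 : (W : ℝ) * ((⌊exp T⌋₊ / W + 1 : ℕ) : ℝ) ≤ 2 * exp T := by
        have h2 : W * (⌊exp T⌋₊ / W) ≤ ⌊exp T⌋₊ := Nat.mul_div_le _ _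
        have h3 : ((W * (⌊exp T⌋₊ / W) : ℕ) : ℝ) ≤ exp T :=
          (Nat.cast_le.2 h2).trans (Nat.floor_le (exp_pos T).le)
        push_cast at h3 ⊢
        linarith
      have h2 : 1 + (W : ℝ) * ((⌊exp T⌋₊ / W + 1 : ℕ) : ℝ) / m ≤ 5 * exp (δ * T) := by
        have h3 : (W : ℝ) * ((⌊exp T⌋₊ / W + 1 : ℕ) : ℝ) / m ≤ 4 * exp (δ * T) := by
          rw [div_le_iff₀ hm']
          refine h1.trans ?_
          have : exp T = exp (δ * T) * exp ((1 - δ) * T) := by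
            rw [← exp_add]
            ring_nf
          rw [this]
          nlinarith [exp_pos (δ * T)]
        linarith [one_le_exp hδ]
      calc log (1 + (W : ℝ) * ((⌊exp T⌋₊ / W + 1 : ℕ) : ℝ) / m) ≤ log (5 * exp (δ * T)) :=
            log_le_log (by positivity) h2
        _ = δ * T + log 5 := by
            rw [log_mul (by norm_num) (exp_pos _).ne', log_exp, add_comm]
  · have hsub : sieveRange W b δ T ⊆
        (Finset.range (⌊exp T⌋₊ / W + 1)).image fun i ↦ m + W * i := by
      intro n hn
      obtain ⟨h1, h2, h3⟩ := mem_sieveRange.1 hn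
      have hKn : K ≤ n := (Nat.floor_lt (by positivity)).2 h2
      have hmod : m ≡ n [MOD W] := hm3.trans h3.symm
      have hmn : m ≤ n := by
        by_contra! hlt
        have h4 : W ∣ m - n := (Nat.modEq_iff_dvd' hlt.le).1 hmod.symm
        have := Nat.le_of_dvd (by omega) h4
        omega
      obtain ⟨k, hk⟩ := (Nat.modEq_iff_dvd' hmn).1 hmod
      refine Finset.mem_image.2 ⟨k, Finset.mem_range.2 (Nat.lt_succ_of_le ?_), by omega⟩
      rw [Nat.le_div_iff_mul_le hW]
      have : n ≤ ⌊exp T⌋₊ := Nat.le_floor h1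
      rw [mul_comm]
      omega
    calc ∑ n ∈ sieveRange W b δ T, F n
        ≤ ∑ n ∈ (Finset.range (⌊exp T⌋₊ / W + 1)).image fun i ↦ m + W * i, F n :=
          Finset.sum_le_sum_of_subset_of_nonneg hsub fun n _ _ ↦ hF n
      _ = _ := Finset.sum_image fun i _ j _ h ↦ by
          have : W * i = W * j := by simpa using h
          exact Nat.eq_of_mul_eq_mul_left hW this

theorem eventually_sum_sieveSum_sq_le {w W : ℕ} (hw : 10 ≤ w) (hW : 0 < W)
    (hWw : ∀ p : ℕ, p.Prime → p ∣ W → p ≤ w) (b : ℕ) {r δ ε : ℝ} (hr : 0 < r) (hδ : 0 < δ)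
    (hrδ : 4 * r < 1 - δ) (hε : 0 < ε) :
    ∀ᶠ T : ℝ in atTop, ∑ n ∈ sieveRange W b δ T, 1 / (n : ℝ) * sieveSum w (r * T) n ^ 2 ≤
      T ^ 4 * (1 / W * δ * r ^ 3 * (sieveConst 3 3 w *
        ∫ t in (0 : ℝ)..1, (1 + 3 * (1 - t) + 3 * (1 - t) ^ 2) ^ 2 * (t ^ 2 / 2)) + ε) := by
  set I := ∫ t in (0 : ℝ)..1, (1 + 3 * (1 - t) + 3 * (1 - t) ^ 2) ^ 2 * (t ^ 2 / 2) with hI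
  set M : ℝ → ℝ := fun L ↦ ∑ A ∈ (primesIoc w (exp L)).powerset,
    profile (logProd A / L) ^ 2 * ∏ p ∈ A, (3 : ℝ) / (p - 3) with hM
  have hW' : (0 : ℝ) < W := by exact_mod_cast hW
  have hMlim : Tendsto (fun L ↦ M L / L ^ 3) atTop (𝓝 (sieveConst 3 3 w * I)) := by
    have := tendsto_sum_powerset_primesIoc (k := 2) (b := 3) (w := w) le_rfl (by omega) (by simp)
      (φ := fun t ↦ (1 + 3 * (1 - t) + 3 * (1 - t) ^ 2) ^ 2) (by fun_prop) zero_le_one le_rfl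
    refine (this.congr' ?_).trans (by norm_num [Nat.factorial, hI])
    filter_upwards [eventually_gt_atTop 0] with L hL
    refine congrArg₂ (· / ·) (Finset.sum_congr rfl fun A _ ↦ ?_) rfl
    rw [mul_comm, profile, one_mul]
    simp only [div_le_one hL]
    split_ifs <;> norm_num
  have hlim : Tendsto (fun T : ℝ ↦ M (r * T) / (r * T) ^ 3 * r ^ 3 *
      (2 * (exp (-((1 - δ) * T)) / T) + 1 / W * (δ + log 5 / T)) +
      196 * (exp (-((1 - δ - 4 * r) * T)) / T ^ 4)) atTop
      (𝓝 (sieveConst 3 3 w * I * r ^ 3 * (2 * 0 + 1 / W * (δ + 0)) + 196 * 0)) := by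
    have hexp : ∀ (c : ℝ) (k : ℕ), 0 < c →
        Tendsto (fun T : ℝ ↦ exp (-(c * T)) / T ^ (k + 1)) atTop (𝓝 0) := by
      intro c k hc
      have h1 : Tendsto (fun T : ℝ ↦ exp (-(c * T))) atTop (𝓝 0) :=
        tendsto_exp_neg_atTop_nhds_zero.comp (tendsto_id.const_mul_atTop hc)
      have h2 : Tendsto (fun T : ℝ ↦ (T ^ (k + 1))⁻¹) atTop (𝓝 0) :=
        (tendsto_pow_atTop (by omega)).inv_tendsto_atTop
      simpa [div_eq_mul_inv] using h1.mul h2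
    have hr' : Tendsto (fun T : ℝ ↦ r * T) atTop atTop := tendsto_id.const_mul_atTop hr
    refine (((hMlim.comp hr').mul_const _).mul (((?_ : Tendsto _ _ _).const_mul 2).add
      ((tendsto_const_nhds.add (tendsto_const_nhds.div_atTop tendsto_id)).const_mul _))).add
      ((hexp _ 3 (by linarith)).const_mul _)
    simpa using hexp (1 - δ) 0 (by linarith)
  have hev := hlim.eventually_lt_const (u := 1 / W * δ * r ^ 3 * (sieveConst 3 3 w * I) + ε)
    (by ring_nf; linarith)
  filter_upwards [hev, eventually_gt_atTop 0, tendsto_exp_atTop.eventually_ge_atTop (W : ℝ)]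
    with T hT hT0 hTW
  have hL : 0 < r * T := by positivity
  have hprofile : ∀ A : Finset ℕ, 0 ≤ logProd A / (r * T) := fun A ↦
    div_nonneg (logProd_nonneg A) hL.le
  obtain ⟨m, N, hm0, hm, hH, hS⟩ := sum_sieveRange_le hW b hTW (mul_pos hδ hT0).le
    (F := fun n ↦ 1 / (n : ℝ) * sieveSum w (r * T) n ^ 2) (fun n ↦ by positivity)
  have hm' : (0 : ℝ) < m := by exact_mod_cast hm0
  have hprimes : ∀ A ∈ (primesIoc w (exp (r * T))).powerset, ∀ p ∈ A,
      p.Prime ∧ 10 < p ∧ ¬p ∣ W := by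
    intro A hA p hp
    obtain ⟨h1, h2, h3⟩ := mem_powerset_primesIoc.1 hA p hp
    exact ⟨h1, by omega, fun h ↦ absurd (hWw p h1 h) (not_le.2 h2)⟩
  have hmain := sum_progression_sq_le (W := W) hm0 hprimes
    (fun A ↦ profile (logProd A / (r * T))) N
  have hM0 : 0 ≤ M (r * T) := Finset.sum_nonneg fun A hA ↦ mul_nonneg (sq_nonneg _)
    (Finset.prod_nonneg fun p hp ↦ by
      have : (10 : ℝ) < p := by exact_mod_cast (hprimes A hA p hp).2.1
      exact div_nonneg (by norm_num) (by linarith))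
  have hE : ∑ A ∈ (primesIoc w (exp (r * T))).powerset, |profile (logProd A / (r * T))| *
      (∏ p ∈ A, p : ℕ) ≤ 7 * exp (r * T) * exp (r * T) := by
    calc _ ≤ ∑ A ∈ (primesIoc w (exp (r * T))).powerset,
          (if logProd A ≤ r * T then 7 * exp (r * T) else 0) := by
          refine Finset.sum_le_sum fun A hA ↦ ?_
          rw [← exp_logProd fun p hp ↦ (hprimes A hA p hp).1, abs_of_nonneg (profile_nonneg _)]
          split_ifs with h
          · exact mul_le_mul (profile_le (hprofile A)) (exp_le_exp.2 h) (exp_pos _).le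
              (by norm_num)
          · rw [profile_of_one_lt ((one_lt_div hL).2 (not_le.1 h)), zero_mul]
      _ ≤ _ := by
          rw [← Finset.sum_filter, Finset.sum_const, nsmul_eq_mul, mul_comm]
          exact mul_le_mul_of_nonneg_left (card_filter_prod_le _ _ _) (by positivity)
  have hE0 : 0 ≤ ∑ A ∈ (primesIoc w (exp (r * T))).powerset, |profile (logProd A / (r * T))| *
      (∏ p ∈ A, p : ℕ) := Finset.sum_nonneg fun A _ ↦ by positivity
  have h2m : 2 / (m : ℝ) ≤ 4 * exp (-((1 - δ) * T)) := by
    rw [div_le_iff₀ hm', exp_neg]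
    have : 4 * (exp ((1 - δ) * T))⁻¹ * (exp ((1 - δ) * T) / 2) = 2 := by
      field_simp
      norm_num
    calc 2 = 4 * (exp ((1 - δ) * T))⁻¹ * (exp ((1 - δ) * T) / 2) := this.symm
      _ ≤ _ := by gcongr
  refine hS.trans ?_
  have h3 : ∑ i ∈ Finset.range N, 1 / ((m + W * i : ℕ) : ℝ) * sieveSum w (r * T) (m + W * i) ^ 2 ≤
      M (r * T) * (2 * exp (-((1 - δ) * T)) + 1 / W * (δ * T + log 5)) +
      4 * exp (-((1 - δ) * T)) * (7 * exp (r * T) * exp (r * T)) ^ 2 := by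
    simp only [sieveSum]
    push_cast
    refine hmain.trans (add_le_add (mul_le_mul_of_nonneg_left hH hM0) ?_)
    exact mul_le_mul h2m (pow_le_pow_left₀ hE0 hE 2) (sq_nonneg _) (by positivity)
  refine h3.trans ?_
  refine le_trans (le_of_eq ?_) (mul_le_mul_of_nonneg_left hT.le (by positivity))
  have h4 : exp (-((1 - δ - 4 * r) * T)) =
      exp (-((1 - δ) * T)) * (exp (r * T) * exp (r * T) * (exp (r * T) * exp (r * T))) := by
    simp only [← exp_add]
    ring_nf
  rw [h4]
  field_simp
  ring

end SieveUpper

section SquareExpansion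

open Filter Topology Real
open scoped Classical

theorem sum_powerset_union_disjoint {M : Type*} [AddCommMonoid M] {S T : Finset ℕ}
    (h : Disjoint S T) (K : Finset ℕ → M) :
    ∑ D ∈ (S ∪ T).powerset, K D = ∑ A ∈ S.powerset, ∑ C ∈ T.powerset, K (A ∪ C) := by
  rw [← Finset.sum_product']
  refine Finset.sum_bij' (fun D _ ↦ (D ∩ S, D ∩ T)) (fun x _ ↦ x.1 ∪ x.2) ?_ ?_ ?_ ?_ ?_
  · intro D _
    exact Finset.mem_product.2 ⟨Finset.mem_powerset.2 Finset.inter_subset_right,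
      Finset.mem_powerset.2 Finset.inter_subset_right⟩
  · intro x hx
    obtain ⟨h1, h2⟩ := Finset.mem_product.1 hx
    exact Finset.mem_powerset.2 (Finset.union_subset_union (Finset.mem_powerset.1 h1)
      (Finset.mem_powerset.1 h2))
  · intro D hD
    rw [← Finset.inter_union_distrib_left]
    exact Finset.inter_eq_left.2 (Finset.mem_powerset.1 hD)
  · intro x hx
    obtain ⟨h1, h2⟩ := Finset.mem_product.1 hx
    rw [Finset.mem_powerset] at h1 h2
    refine Prod.ext ?_ ?_
    · change (x.1 ∪ x.2) ∩ S = x.1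
      rw [Finset.union_inter_distrib_right, Finset.inter_eq_left.2 h1,
        Finset.disjoint_iff_inter_eq_empty.1 ((h.mono_right h2).symm), Finset.union_empty]
    · change (x.1 ∪ x.2) ∩ T = x.2
      rw [Finset.union_inter_distrib_right, Finset.inter_eq_left.2 h2,
        Finset.disjoint_iff_inter_eq_empty.1 (h.mono_left h1), Finset.empty_union]
  · intro D hD
    rw [← Finset.inter_union_distrib_left, Finset.inter_eq_left.2 (Finset.mem_powerset.1 hD)]

theorem sum_powerset_mul_prod_add (P : Finset ℕ) (F : Finset ℕ → ℝ) (α β : ℕ → ℝ) :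
    ∑ A ∈ P.powerset, F A * ∏ p ∈ A, (α p + β p) =
      ∑ B ∈ P.powerset, (∑ C ∈ (P \ B).powerset, F (B ∪ C) * ∏ p ∈ C, α p) * ∏ p ∈ B, β p := by
  have h1 : ∀ A ∈ P.powerset, F A * ∏ p ∈ A, (α p + β p) =
      ∑ B ∈ A.powerset, F A * ((∏ p ∈ B, β p) * ∏ p ∈ A \ B, α p) := by
    intro A _
    simp only [add_comm (α _)]
    rw [Finset.prod_add, Finset.mul_sum]
  rw [Finset.sum_congr rfl h1]
  simp only [Finset.sum_mul]
  rw [Finset.sum_sigma', Finset.sum_sigma']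
  refine Finset.sum_bij' (fun x _ ↦ ⟨x.2, x.1 \ x.2⟩) (fun x _ ↦ ⟨x.1 ∪ x.2, x.1⟩) ?_ ?_ ?_ ?_ ?_
  · rintro ⟨A, B⟩ hx
    simp only [Finset.mem_sigma, Finset.mem_powerset] at hx ⊢
    exact ⟨hx.2.trans hx.1, Finset.sdiff_subset_sdiff hx.1 le_rfl⟩
  · rintro ⟨B, C⟩ hx
    simp only [Finset.mem_sigma, Finset.mem_powerset] at hx ⊢
    exact ⟨Finset.union_subset hx.1 (hx.2.trans Finset.sdiff_subset), Finset.subset_union_left⟩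
  · rintro ⟨A, B⟩ hx
    simp only [Finset.mem_sigma, Finset.mem_powerset] at hx
    simp [Finset.union_sdiff_of_subset hx.2]
  · rintro ⟨B, C⟩ hx
    simp only [Finset.mem_sigma, Finset.mem_powerset] at hx
    have : (B ∪ C) \ B = C := by
      rw [Finset.union_sdiff_left]
      exact Finset.sdiff_eq_self_of_disjoint (Finset.disjoint_of_subset_left hx.2
        Finset.sdiff_disjoint)
    simp [this]
  · rintro ⟨A, B⟩ hx
    simp only [Finset.mem_sigma, Finset.mem_powerset] at hx
    simp only [Finset.union_sdiff_of_subset hx.2]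
    ring

/-- Coefficient of the variable at `p` in the reduction of a product of two multilinear monomials
subject to `u ^ 2 = f - (1 - f) * u`. -/
noncomputable def linCoef (f : ℕ → ℝ) (B B' : Finset ℕ) (p : ℕ) : ℝ :=
  if p ∈ B then (if p ∈ B' then -(1 - f p) else 1) else if p ∈ B' then 1 else 0

/-- Constant coefficient in the same reduction. -/
noncomputable def constCoef (f : ℕ → ℝ) (B B' : Finset ℕ) (p : ℕ) : ℝ :=
  if p ∈ B then (if p ∈ B' then f p else 0) else if p ∈ B' then 0 else 1

/-- Coefficients of the square of a multilinear form, reduced by `u ^ 2 = f - (1 - f) * u`. -/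
noncomputable def sqCoef (P : Finset ℕ) (f : ℕ → ℝ) (Y : Finset ℕ → ℝ) (R : Finset ℕ) : ℝ :=
  ∑ B ∈ P.powerset, ∑ B' ∈ P.powerset, Y B * Y B' *
    ((∏ p ∈ R, linCoef f B B' p) * ∏ p ∈ P \ R, constCoef f B B' p)

theorem sq_sum_powerset_eq (P : Finset ℕ) {f u : ℕ → ℝ} (Y : Finset ℕ → ℝ)
    (hu : ∀ p ∈ P, u p ^ 2 = f p - (1 - f p) * u p) :
    (∑ B ∈ P.powerset, Y B * ∏ p ∈ B, u p) ^ 2 =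
      ∑ R ∈ P.powerset, sqCoef P f Y R * ∏ p ∈ R, u p := by
  have h1 : ∀ B ∈ P.powerset, ∀ B' ∈ P.powerset, (∏ p ∈ B, u p) * ∏ p ∈ B', u p =
      ∑ R ∈ P.powerset, (∏ p ∈ R, linCoef f B B' p * u p) * ∏ p ∈ P \ R, constCoef f B B' p := by
    intro B hB B' hB'
    rw [Finset.mem_powerset] at hB hB'
    rw [← Finset.prod_add]
    have h2 : ∀ A ⊆ P, ∏ p ∈ A, u p = ∏ p ∈ P, if p ∈ A then u p else 1 := by
      intro A hA
      rw [Finset.prod_ite_mem, Finset.inter_eq_right.2 hA]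
    rw [h2 B hB, h2 B' hB', ← Finset.prod_mul_distrib]
    refine Finset.prod_congr rfl fun p hp ↦ ?_
    rw [linCoef, constCoef]
    have := hu p hp
    split_ifs <;> linarith
  simp only [sqCoef, Finset.sum_mul]
  rw [sq, Finset.sum_mul_sum]
  symm
  rw [Finset.sum_comm]
  refine Finset.sum_congr rfl fun B hB ↦ ?_
  rw [Finset.sum_comm]
  refine Finset.sum_congr rfl fun B' hB' ↦ ?_
  symm
  calc _ = Y B * Y B' * ((∏ p ∈ B, u p) * ∏ p ∈ B', u p) := by ring
    _ = _ := by
      rw [h1 B hB B' hB', Finset.mul_sum]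
      refine Finset.sum_congr rfl fun R _ ↦ ?_
      rw [Finset.prod_mul_distrib]
      ring

theorem sqCoef_empty (P : Finset ℕ) (f : ℕ → ℝ) (Y : Finset ℕ → ℝ) :
    sqCoef P f Y ∅ = ∑ B ∈ P.powerset, Y B ^ 2 * ∏ p ∈ B, f p := by
  refine Finset.sum_congr rfl fun B hB ↦ ?_
  rw [Finset.sum_eq_single_of_mem B hB]
  · rw [Finset.prod_empty, one_mul, Finset.sdiff_empty, sq]
    have : ∀ p ∈ P, constCoef f B B p = if p ∈ B then f p else 1 := by
      intro p _
      rw [constCoef]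
      split_ifs <;> rfl
    rw [Finset.prod_congr rfl this, Finset.prod_ite_mem,
      Finset.inter_eq_right.2 (Finset.mem_powerset.1 hB)]
  · intro B' hB' hne
    rw [Finset.mem_powerset] at hB hB'
    obtain ⟨p, hp⟩ : ∃ p, ¬(p ∈ B' ↔ p ∈ B) := by
      by_contra! h'
      exact hne (Finset.ext h')
    have hp' : p ∈ P \ ∅ := by
      rw [Finset.sdiff_empty]
      by_cases h : p ∈ B
      · exact hB h
      · exact hB' (by tauto)
    rw [Finset.prod_eq_zero hp', mul_zero, mul_zero]
    rw [constCoef]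
    split_ifs <;> tauto

theorem sum_powerset_sdiff_le (P R : Finset ℕ) {k : Finset ℕ → ℝ} (hk : ∀ A, 0 ≤ k A) :
    ∑ B ∈ P.powerset, k (B \ R) ≤ 2 ^ R.card * ∑ F ∈ P.powerset, k F := by
  have hmaps : ∀ B ∈ P.powerset, B \ R ∈ P.powerset := fun B hB ↦
    Finset.mem_powerset.2 (Finset.sdiff_subset.trans (Finset.mem_powerset.1 hB))
  rw [← Finset.sum_fiberwise_of_maps_to hmaps, Finset.mul_sum]
  refine Finset.sum_le_sum fun F _ ↦ ?_
  rw [Finset.sum_congr rfl fun B hB ↦ by rw [(Finset.mem_filter.1 hB).2], Finset.sum_const,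
    nsmul_eq_mul]
  refine mul_le_mul_of_nonneg_right ?_ (hk F)
  have : (P.powerset.filter fun B ↦ B \ R = F).card ≤ R.powerset.card := by
    refine Finset.card_le_card_of_injOn (fun B ↦ B ∩ R) ?_ ?_
    · intro B _
      exact Finset.mem_coe.2 (Finset.mem_powerset.2 Finset.inter_subset_right)
    · intro B hB B' hB' h
      have h1 := (Finset.mem_filter.1 hB).2
      have h2 := (Finset.mem_filter.1 hB').2
      rw [← Finset.sdiff_union_inter B R, ← Finset.sdiff_union_inter B' R, h1, h2]
      exact congrArg (F ∪ ·) h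
  rw [Finset.card_powerset] at this
  exact_mod_cast this

theorem abs_sqCoef_le {P R : Finset ℕ} (hR : R ⊆ P) {f : ℕ → ℝ} (hf : ∀ p ∈ P, 0 ≤ f p ∧ f p ≤ 1)
    {Y : Finset ℕ → ℝ} {K L : ℝ} (hY : ∀ B ∈ P.powerset, |Y B| ≤ K)
    (hYL : ∀ B ∈ P.powerset, L < logProd B → Y B = 0) :
    |sqCoef P f Y R| ≤ 4 ^ R.card * (K ^ 2 *
      ∑ F ∈ P.powerset, if logProd F ≤ L then ∏ p ∈ F, f p else 0) := by
  set k : Finset ℕ → ℝ := fun F ↦ if F ⊆ P ∧ logProd F ≤ L then ∏ p ∈ F, f p else 0 with hk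
  have hk0 : ∀ F, 0 ≤ k F := by
    intro F
    simp only [hk]
    split_ifs with h
    · exact Finset.prod_nonneg fun p hp ↦ (hf p (h.1 hp)).1
    · rfl
  have hterm : ∀ B ∈ P.powerset, ∀ B' ∈ P.powerset, |Y B * Y B' *
      ((∏ p ∈ R, linCoef f B B' p) * ∏ p ∈ P \ R, constCoef f B B' p)| ≤
      K ^ 2 * (k (B \ R) * if B' \ R = B \ R then 1 else 0) := by
    intro B hB B' hB'
    have hK : 0 ≤ K := (abs_nonneg _).trans (hY B hB)
    by_cases hL : L < logProd B
    · rw [hYL B hB hL, zero_mul, zero_mul, abs_zero]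
      have := hk0 (B \ R)
      positivity
    have hBP := Finset.mem_powerset.1 hB
    have hBP' := Finset.mem_powerset.1 hB'
    have h1 : |∏ p ∈ R, linCoef f B B' p| ≤ 1 := by
      rw [Finset.abs_prod]
      refine Finset.prod_le_one (fun _ _ ↦ abs_nonneg _) fun p hp ↦ ?_
      obtain ⟨h1, h2⟩ := hf p (hR hp)
      rw [linCoef, abs_le]
      split_ifs <;> constructor <;> linarith
    have h2 : |∏ p ∈ P \ R, constCoef f B B' p| ≤
        k (B \ R) * if B' \ R = B \ R then 1 else 0 := by
      by_cases heq : B' \ R = B \ R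
      · rw [if_pos heq, mul_one]
        simp only [hk]
        rw [if_pos ⟨Finset.sdiff_subset.trans hBP,
          (logProd_mono Finset.sdiff_subset).trans (not_lt.1 hL)⟩]
        have : ∀ p ∈ P \ R, constCoef f B B' p = if p ∈ B \ R then f p else 1 := by
          intro p hp
          have hpR := (Finset.mem_sdiff.1 hp).2
          have : p ∈ B' ↔ p ∈ B := by
            have := Finset.ext_iff.1 heq p
            simpa [hpR] using this
          rw [constCoef]
          simp only [this, Finset.mem_sdiff, hpR, not_false_eq_true, and_true]
          split_ifs <;> rfl
        rw [Finset.prod_congr rfl this, Finset.prod_ite_mem,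
          Finset.inter_eq_right.2 (Finset.sdiff_subset_sdiff hBP le_rfl)]
        exact (abs_of_nonneg (Finset.prod_nonneg fun p hp ↦
          (hf p (hBP (Finset.sdiff_subset hp))).1)).le
      · rw [if_neg heq, mul_zero]
        obtain ⟨p, hp⟩ : ∃ p, ¬(p ∈ B' \ R ↔ p ∈ B \ R) := by
          by_contra! h'
          exact heq (Finset.ext h')
        simp only [Finset.mem_sdiff] at hp
        have hp' : p ∈ P \ R := by
          rw [Finset.mem_sdiff]
          have := @hBP p
          have := @hBP' p
          tauto
        rw [Finset.prod_eq_zero hp', abs_zero]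
        rw [constCoef]
        split_ifs <;> tauto
    rw [abs_mul, abs_mul, abs_mul]
    calc |Y B| * |Y B'| * (|∏ p ∈ R, linCoef f B B' p| * |∏ p ∈ P \ R, constCoef f B B' p|)
        ≤ K * K * (1 * (k (B \ R) * if B' \ R = B \ R then 1 else 0)) := by
          have := hY B hB
          have := hY B' hB'
          gcongr
      _ = _ := by ring
  have hfib : ∀ B ∈ P.powerset,
      ∑ B' ∈ P.powerset, (if B' \ R = B \ R then (1 : ℝ) else 0) ≤ 2 ^ R.card := by
    intro B hB
    refine (sum_powerset_sdiff_le P R (k := fun F ↦ if F = B \ R then 1 else 0)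
      fun F ↦ by split_ifs <;> norm_num).trans ?_
    rw [Finset.sum_ite_eq', if_pos, mul_one]
    exact Finset.mem_powerset.2 (Finset.sdiff_subset.trans (Finset.mem_powerset.1 hB))
  calc |sqCoef P f Y R| ≤ ∑ B ∈ P.powerset, ∑ B' ∈ P.powerset,
        K ^ 2 * (k (B \ R) * if B' \ R = B \ R then 1 else 0) :=
        (Finset.abs_sum_le_sum_abs _ _).trans (Finset.sum_le_sum fun B hB ↦
          (Finset.abs_sum_le_sum_abs _ _).trans (Finset.sum_le_sum fun B' hB' ↦ hterm B hB B' hB'))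
    _ ≤ ∑ B ∈ P.powerset, K ^ 2 * (k (B \ R) * 2 ^ R.card) := by
        refine Finset.sum_le_sum fun B hB ↦ ?_
        rw [← Finset.mul_sum, ← Finset.mul_sum]
        have := hfib B hB
        have := hk0 (B \ R)
        gcongr
    _ = K ^ 2 * 2 ^ R.card * ∑ B ∈ P.powerset, k (B \ R) := by
        rw [Finset.mul_sum]
        exact Finset.sum_congr rfl fun B _ ↦ by ring
    _ ≤ K ^ 2 * 2 ^ R.card * (2 ^ R.card * ∑ F ∈ P.powerset, k F) := by
        gcongr
        exact sum_powerset_sdiff_le P R hk0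
    _ = 4 ^ R.card * (K ^ 2 * ∑ F ∈ P.powerset, k F) := by
        rw [show (4 : ℝ) = 2 * 2 by norm_num, mul_pow]
        ring
    _ = _ := by
        congr 2
        refine Finset.sum_congr rfl fun F hF ↦ ?_
        simp only [hk, Finset.mem_powerset.1 hF, true_and]

theorem sqCoef_eq_zero {P R : Finset ℕ} {f : ℕ → ℝ} {Y : Finset ℕ → ℝ} {L : ℝ}
    (hYL : ∀ B ∈ P.powerset, L < logProd B → Y B = 0) (hR : 2 * L < logProd R) :
    sqCoef P f Y R = 0 := by
  refine Finset.sum_eq_zero fun B hB ↦ Finset.sum_eq_zero fun B' hB' ↦ ?_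
  by_cases h1 : L < logProd B
  · rw [hYL B hB h1, zero_mul, zero_mul]
  by_cases h2 : L < logProd B'
  · rw [hYL B' hB' h2, mul_zero, zero_mul]
  have h3 : ¬R ⊆ B ∪ B' := by
    intro h
    have h4 : logProd (B ∪ B') ≤ logProd B + logProd B' := by
      have : logProd (B ∪ B') + logProd (B ∩ B') = logProd B + logProd B' :=
        Finset.sum_union_inter
      linarith [logProd_nonneg (B ∩ B')]
    linarith [logProd_mono h]
  obtain ⟨p, hpR, hp⟩ := Finset.not_subset.1 h3
  rw [Finset.mem_union, not_or] at hp
  rw [Finset.prod_eq_zero hpR, zero_mul, mul_zero]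
  rw [linCoef, if_neg hp.1, if_neg hp.2]

end SquareExpansion

section SieveExpansion

open Filter Topology Real
open scoped Classical

theorem sieveFactor_eq {h p n : ℕ} (hp10 : 10 < p) (hpx : ¬p ∣ n + h) :
    sieveFactor p n = 1 / ((p : ℝ) - 1) + (p : ℝ) / (p - 1) * unitFactor h p (n + h) := by
  have hp' : (10 : ℝ) < p := by exact_mod_cast hp10
  have h1 : (p : ℝ) - 1 ≠ 0 := by linarith
  have h3 : (p : ℝ) - 3 ≠ 0 := by linarith
  rw [sieveFactor, unitFactor, if_neg hpx,
    show ((n + h : ℕ) : ℤ) - h = n by push_cast; ring]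
  split_ifs
  · field_simp
    ring
  · field_simp
    ring

theorem unitFactor_sq {h p x : ℕ} (hpx : ¬p ∣ x) :
    unitFactor h p x ^ 2 =
      2 / ((p : ℝ) - 3) - (1 - 2 / ((p : ℝ) - 3)) * unitFactor h p x := by
  rw [unitFactor, if_neg hpx]
  split_ifs <;> ring

theorem sieveFactor_of_dvd {h p n : ℕ} (hh : h ∈ shifts) (hpx : p ∣ n + h) :
    sieveFactor p n = -1 := by
  rw [sieveFactor, if_pos]
  exact ⟨h, hh, by exact_mod_cast hpx⟩

/-- Difference of the profile over a step `β`. -/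
noncomputable def profileDiff (β t : ℝ) : ℝ := profile t - profile (t + β)

theorem profileDiff_nonneg {β : ℝ} (hβ : 0 ≤ β) (t : ℝ) : 0 ≤ profileDiff β t :=
  sub_nonneg.2 (antitone_profile (by linarith))

theorem profileDiff_le {β t : ℝ} (ht : 0 ≤ t) : profileDiff β t ≤ 7 := by
  have := profile_le ht
  have := profile_nonneg (t + β)
  rw [profileDiff]
  linarith

theorem profileDiff_of_one_lt {β t : ℝ} (hβ : 0 ≤ β) (ht : 1 < t) : profileDiff β t = 0 := by
  rw [profileDiff, profile_of_one_lt ht, profile_of_one_lt (by linarith), sub_zero]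

theorem profileDiff_mono {β β' : ℝ} (h : β ≤ β') (t : ℝ) : profileDiff β t ≤ profileDiff β' t :=
  sub_le_sub_left (antitone_profile (by linarith)) _

/-- Coefficients of the sieve sum with respect to the unit factors. -/
noncomputable def sieveCoef (P : Finset ℕ) (L β : ℝ) (B : Finset ℕ) : ℝ :=
  (∏ p ∈ B, (p : ℝ) / (p - 1)) * ∑ C ∈ (P \ B).powerset,
    profileDiff β (logProd (B ∪ C) / L) * ∏ p ∈ C, 1 / ((p : ℝ) - 1)

theorem sieveSum_eq_sum_sieveFactor {w q n h : ℕ} {L : ℝ} (hL : 0 < L) (hh : h ∈ shifts)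
    (hq : q.Prime) (hqw : w < q) (hqn : q ∣ n + h) :
    sieveSum w L n = ∑ A ∈ ((primesIoc w (exp L)).erase q).powerset,
      profileDiff (log q / L) (logProd A / L) * ∏ p ∈ A, sieveFactor p n := by
  rw [sieveSum]
  by_cases hqP : q ∈ primesIoc w (exp L)
  · conv_lhs => rw [← Finset.insert_erase hqP]
    rw [Finset.sum_powerset_insert (Finset.notMem_erase _ _), ← Finset.sum_add_distrib]
    refine Finset.sum_congr rfl fun A hA ↦ ?_
    have hqA : q ∉ A := fun h ↦ Finset.notMem_erase q _ (Finset.mem_powerset.1 hA h)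
    rw [Finset.prod_insert hqA, sieveFactor_of_dvd hh hqn, logProd, logProd,
      Finset.sum_insert hqA, profileDiff, add_comm (log (q : ℝ)), add_div]
    ring
  · rw [Finset.erase_eq_of_notMem hqP]
    refine Finset.sum_congr rfl fun A _ ↦ ?_
    have hlog : L < log q := by
      rw [lt_log_iff_exp_lt (by exact_mod_cast hq.pos)]
      by_contra! hle
      exact hqP (mem_primesIoc.2 ⟨hq, by exact_mod_cast hqw, hle⟩)
    have h1 : 1 < log q / L := (one_lt_div hL).2 hlog
    have h2 := div_nonneg (logProd_nonneg A) hL.le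
    rw [profileDiff, profile_of_one_lt (by linarith : 1 < logProd A / L + log q / L), sub_zero]

theorem sieveSum_eq_sum_sieveCoef {w q n h : ℕ} {L : ℝ} (hL : 0 < L) (hw : 10 ≤ w)
    (hh : h ∈ shifts) (hq : q.Prime) (hqw : w < q) (hqn : q ∣ n + h)
    (hcop : ∀ p ∈ (primesIoc w (exp L)).erase q, ¬p ∣ n + h) :
    sieveSum w L n = ∑ B ∈ ((primesIoc w (exp L)).erase q).powerset,
      sieveCoef ((primesIoc w (exp L)).erase q) L (log q / L) B *
        ∏ p ∈ B, unitFactor h p (n + h) := by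
  rw [sieveSum_eq_sum_sieveFactor hL hh hq hqw hqn]
  have h1 : ∀ A ∈ ((primesIoc w (exp L)).erase q).powerset, ∏ p ∈ A, sieveFactor p n =
      ∏ p ∈ A, (1 / ((p : ℝ) - 1) + (p : ℝ) / (p - 1) * unitFactor h p (n + h)) := by
    intro A hA
    refine Finset.prod_congr rfl fun p hp ↦ ?_
    have hpP := Finset.mem_powerset.1 hA hp
    have hp10 : w < p := by
      exact_mod_cast (mem_primesIoc.1 (Finset.mem_of_mem_erase hpP)).2.1
    exact sieveFactor_eq (by omega) (hcop p hpP)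
  rw [Finset.sum_congr rfl fun A hA ↦ by rw [h1 A hA], sum_powerset_mul_prod_add]
  refine Finset.sum_congr rfl fun B _ ↦ ?_
  rw [Finset.prod_mul_distrib, sieveCoef]
  ring

theorem sieveSum_sq_eq {w q n h : ℕ} {L : ℝ} (hL : 0 < L) (hw : 10 ≤ w)
    (hh : h ∈ shifts) (hq : q.Prime) (hqw : w < q) (hqn : q ∣ n + h)
    (hcop : ∀ p ∈ (primesIoc w (exp L)).erase q, ¬p ∣ n + h) :
    sieveSum w L n ^ 2 = ∑ R ∈ ((primesIoc w (exp L)).erase q).powerset,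
      sqCoef ((primesIoc w (exp L)).erase q) (fun p ↦ 2 / ((p : ℝ) - 3))
        (sieveCoef ((primesIoc w (exp L)).erase q) L (log q / L)) R *
        ∏ p ∈ R, unitFactor h p (n + h) := by
  rw [sieveSum_eq_sum_sieveCoef hL hw hh hq hqw hqn hcop]
  exact sq_sum_powerset_eq _ _ fun p hp ↦ unitFactor_sq (hcop p hp)

theorem sieveCoef_nonneg {P : Finset ℕ} (hP : ∀ p ∈ P, 10 < p) {L β : ℝ} (hβ : 0 ≤ β)
    {B : Finset ℕ} (hB : B ⊆ P) : 0 ≤ sieveCoef P L β B := by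
  have hP' : ∀ p ∈ P, (10 : ℝ) < p := fun p hp ↦ by exact_mod_cast hP p hp
  refine mul_nonneg (Finset.prod_nonneg fun p hp ↦ ?_) (Finset.sum_nonneg fun C hC ↦
    mul_nonneg (profileDiff_nonneg hβ _) (Finset.prod_nonneg fun p hp ↦ ?_))
  · have := hP' p (hB hp)
    exact div_nonneg (by linarith) (by linarith)
  · have := hP' p (Finset.sdiff_subset (Finset.mem_powerset.1 hC hp))
    exact div_nonneg (by linarith) (by linarith)

theorem sieveCoef_mono {P : Finset ℕ} (hP : ∀ p ∈ P, 10 < p) {L β β' : ℝ} (hβ : β ≤ β')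
    {B : Finset ℕ} (hB : B ⊆ P) : sieveCoef P L β B ≤ sieveCoef P L β' B := by
  have hP' : ∀ p ∈ P, (10 : ℝ) < p := fun p hp ↦ by exact_mod_cast hP p hp
  refine mul_le_mul_of_nonneg_left (Finset.sum_le_sum fun C hC ↦ ?_)
    (Finset.prod_nonneg fun p hp ↦ ?_)
  · refine mul_le_mul_of_nonneg_right (profileDiff_mono hβ _)
      (Finset.prod_nonneg fun p hp ↦ ?_)
    have := hP' p (Finset.sdiff_subset (Finset.mem_powerset.1 hC hp))
    exact div_nonneg (by linarith) (by linarith)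
  · have := hP' p (hB hp)
    exact div_nonneg (by linarith) (by linarith)

theorem sieveCoef_eq_zero {P : Finset ℕ} {L β : ℝ} (hL : 0 < L) (hβ : 0 ≤ β) {B : Finset ℕ}
    (hB : L < logProd B) : sieveCoef P L β B = 0 := by
  rw [sieveCoef, Finset.sum_eq_zero, mul_zero]
  intro C _
  rw [profileDiff_of_one_lt hβ, zero_mul]
  rw [one_lt_div hL]
  exact hB.trans_le (logProd_mono Finset.subset_union_left)

theorem sieveCoef_le {P Q : Finset ℕ} (hPQ : P ⊆ Q) (hQ : ∀ p ∈ Q, 10 < p) {L β : ℝ} (hL : 0 < L)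
    (hβ : 0 ≤ β) {B : Finset ℕ} (hB : B ⊆ P) :
    sieveCoef P L β B ≤ 7 * ∑ D ∈ Q.powerset,
      if logProd D ≤ L then ∏ p ∈ D, 1 / ((p : ℝ) - 1) else 0 := by
  have hQ' : ∀ p ∈ Q, (10 : ℝ) < p := fun p hp ↦ by exact_mod_cast hQ p hp
  have hpos : ∀ D ⊆ Q, 0 ≤ ∏ p ∈ D, 1 / ((p : ℝ) - 1) := fun D hD ↦
    Finset.prod_nonneg fun p hp ↦ by
      have := hQ' p (hD hp)
      exact div_nonneg (by linarith) (by linarith)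
  have h1 : ∏ p ∈ B, (p : ℝ) / (p - 1) = ∑ D ∈ B.powerset, ∏ p ∈ D, 1 / ((p : ℝ) - 1) := by
    rw [← Finset.prod_add_one]
    refine Finset.prod_congr rfl fun p hp ↦ ?_
    have := hQ' p (hPQ (hB hp))
    have : (p : ℝ) - 1 ≠ 0 := by linarith
    field_simp
    ring
  rw [sieveCoef, h1, Finset.sum_mul_sum]
  calc _ ≤ ∑ D ∈ B.powerset, ∑ C ∈ (P \ B).powerset,
        7 * (if logProd (D ∪ C) ≤ L then ∏ p ∈ D ∪ C, 1 / ((p : ℝ) - 1) else 0) := by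
        refine Finset.sum_le_sum fun D hD ↦ Finset.sum_le_sum fun C hC ↦ ?_
        rw [Finset.mem_powerset] at hD hC
        have hdisj : Disjoint D C := Finset.disjoint_of_subset_left hD
          (Finset.disjoint_of_subset_right hC Finset.disjoint_sdiff)
        have hC' : C ⊆ Q := hC.trans (Finset.sdiff_subset.trans hPQ)
        have hD' : D ⊆ Q := hD.trans (hB.trans hPQ)
        have hDC := mul_nonneg (hpos D hD') (hpos C hC')
        split_ifs with h
        · rw [Finset.prod_union hdisj]
          have := profileDiff_le (β := β) (div_nonneg (logProd_nonneg (B ∪ C)) hL.le)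
          nlinarith
        · rw [profileDiff_of_one_lt hβ, zero_mul, mul_zero, mul_zero]
          rw [one_lt_div hL]
          exact (not_le.1 h).trans_le (logProd_mono (Finset.union_subset_union hD le_rfl))
    _ = 7 * ∑ D ∈ (B ∪ P \ B).powerset,
        (if logProd D ≤ L then ∏ p ∈ D, 1 / ((p : ℝ) - 1) else 0) := by
        rw [sum_powerset_union_disjoint Finset.disjoint_sdiff, Finset.mul_sum]
        simp only [Finset.mul_sum]
    _ ≤ _ := by
        refine mul_le_mul_of_nonneg_left (Finset.sum_le_sum_of_subset_of_nonneg
          (Finset.powerset_mono.2 ?_) fun D hD _ ↦ ?_) (by norm_num)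
        · rw [Finset.union_sdiff_of_subset hB]
          exact hPQ
        · split_ifs
          · exact hpos D (Finset.mem_powerset.1 hD)
          · rfl

end SieveExpansion

section MainTerm

open Filter Topology Real
open scoped Classical

/-- The primitive of the profile vanishing on `[1, ∞)`. -/
noncomputable def tailProfile (x : ℝ) : ℝ :=
  max (1 - x) 0 + 3 / 2 * max (1 - x) 0 ^ 2 + max (1 - x) 0 ^ 3

theorem continuous_tailProfile : Continuous tailProfile := by
  unfold tailProfile
  fun_prop

theorem antitone_tailProfile : Antitone tailProfile := by
  intro x y hxy
  have h1 : max (1 - y) 0 ≤ max (1 - x) 0 := max_le_max (by linarith) le_rfl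
  have h0 : 0 ≤ max (1 - y) 0 := le_max_right _ _
  rw [tailProfile, tailProfile]
  gcongr

theorem tailProfile_of_one_le {x : ℝ} (hx : 1 ≤ x) : tailProfile x = 0 := by
  rw [tailProfile, max_eq_right (by linarith)]
  norm_num

theorem tailProfile_zero : tailProfile 0 = 7 / 2 := by
  norm_num [tailProfile]

theorem tailProfile_nonneg (x : ℝ) : 0 ≤ tailProfile x := by
  have : 0 ≤ max (1 - x) 0 := le_max_right _ _
  rw [tailProfile]
  positivity

theorem tailProfile_sub_le {x y : ℝ} (hx : 0 ≤ x) (hxy : x ≤ y) :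
    tailProfile x - tailProfile y ≤ 7 * (y - x) := by
  have h1 : max (1 - y) 0 ≤ max (1 - x) 0 := max_le_max (by linarith) le_rfl
  have h0 : 0 ≤ max (1 - y) 0 := le_max_right _ _
  have h2 : max (1 - x) 0 ≤ 1 := max_le (by linarith) zero_le_one
  have h3 : max (1 - x) 0 - max (1 - y) 0 ≤ y - x := by
    rcases le_total (1 - y) 0 with h | h
    · rw [max_eq_right h]
      have : max (1 - x) 0 ≤ y - x := max_le (by linarith) (by linarith)
      linarith
    · rw [max_eq_left h, max_eq_left (by linarith)]
      linarith
  rw [tailProfile, tailProfile]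
  set a := max (1 - x) 0
  set b := max (1 - y) 0
  have h4 : a + 3 / 2 * a ^ 2 + a ^ 3 - (b + 3 / 2 * b ^ 2 + b ^ 3) =
      (a - b) * (1 + 3 / 2 * (a + b) + (a ^ 2 + a * b + b ^ 2)) := by ring
  rw [h4, mul_comm 7]
  have hb1 : b ≤ 1 := h1.trans h2
  refine mul_le_mul h3 ?_ (by positivity) (by linarith)
  nlinarith

theorem integral_profile_tail {x : ℝ} :
    ∫ t in (0 : ℝ)..(1 - x), (1 + 3 * (1 - (x + t)) + 3 * (1 - (x + t)) ^ 2) =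
      (1 - x) + 3 / 2 * (1 - x) ^ 2 + (1 - x) ^ 3 := by
  have h : ∀ t ∈ Set.uIcc 0 (1 - x), HasDerivAt (fun t : ℝ ↦ -((1 - (x + t)) +
      3 / 2 * (1 - (x + t)) ^ 2 + (1 - (x + t)) ^ 3))
      (1 + 3 * (1 - (x + t)) + 3 * (1 - (x + t)) ^ 2) t := by
    intro t _
    have h1 : HasDerivAt (fun t : ℝ ↦ 1 - (x + t)) (-1) t := by
      simpa using ((hasDerivAt_id t).const_add x).const_sub 1
    refine ((h1.add ((h1.pow 2).const_mul (3 / 2))).add (h1.pow 3)).neg.congr_deriv ?_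
    push_cast
    ring
  rw [intervalIntegral.integral_eq_sub_of_hasDerivAt h
    (Continuous.intervalIntegrable (by fun_prop) _ _)]
  ring

/-- Shifted profile sums over sets of primes in `(w, exp L]`. -/
noncomputable def profileSum (w : ℕ) (L x : ℝ) : ℝ :=
  ∑ C ∈ (primesIoc w (exp L)).powerset,
    profile (x + logProd C / L) * ∏ p ∈ C, 1 / ((p : ℝ) - 1)

theorem prod_primesIoc_nonneg {y z : ℝ} {D : Finset ℕ} (hD : D ⊆ primesIoc y z) :
    0 ≤ ∏ p ∈ D, 1 / ((p : ℝ) - 1) :=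
  prod_one_div_sub_one_nonneg fun _ hq ↦ (mem_primesIoc.1 (hD hq)).1

theorem profileSum_nonneg (w : ℕ) (L x : ℝ) : 0 ≤ profileSum w L x :=
  Finset.sum_nonneg fun _ hC ↦ mul_nonneg (profile_nonneg _)
    (prod_primesIoc_nonneg (Finset.mem_powerset.1 hC))

theorem antitone_profileSum (w : ℕ) (L : ℝ) : Antitone (profileSum w L) := by
  intro x y hxy
  exact Finset.sum_le_sum fun C hC ↦ mul_le_mul_of_nonneg_right
    (antitone_profile (by linarith)) (prod_primesIoc_nonneg (Finset.mem_powerset.1 hC))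

theorem profileSum_of_one_lt {w : ℕ} {L x : ℝ} (hL : 0 < L) (hx : 1 < x) :
    profileSum w L x = 0 := by
  refine Finset.sum_eq_zero fun C _ ↦ ?_
  have := div_nonneg (logProd_nonneg C) hL.le
  rw [profile_of_one_lt (by linarith), zero_mul]

theorem tendsto_profileSum {w : ℕ} (hw : 6 ≤ w) {x : ℝ} (hx : 0 ≤ x) (hx1 : x ≤ 1) :
    Tendsto (fun L ↦ profileSum w L x / L) atTop (𝓝 (mertensProd w * tailProfile x)) := by
  have := tendsto_sum_powerset_primesIoc (k := 0) (b := 1) (w := w) (by norm_num) hw (by simp)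
    (φ := fun t ↦ 1 + 3 * (1 - (x + t)) + 3 * (1 - (x + t)) ^ 2) (by fun_prop)
    (a := 1 - x) (by linarith) (by linarith)
  have h2 : ∫ t in (0 : ℝ)..(1 - x), (1 + 3 * (1 - (x + t)) + 3 * (1 - (x + t)) ^ 2) *
      (t ^ 0 / ((0).factorial : ℝ)) = tailProfile x := by
    simp only [pow_zero, Nat.factorial_zero, Nat.cast_one, div_one, mul_one]
    rw [integral_profile_tail, tailProfile, max_eq_left (by linarith)]
  rw [h2, zero_add, sieveConst_one] at this
  refine this.congr' ?_
  filter_upwards [eventually_gt_atTop 0] with L hL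
  rw [pow_one]
  refine congrArg (· / L) (Finset.sum_congr rfl fun C _ ↦ ?_)
  have h3 : (logProd C ≤ (1 - x) * L) = (x + logProd C / L ≤ 1) := by
    rw [← div_le_iff₀ hL, le_sub_iff_add_le, add_comm]
  rw [profile, mul_comm]
  simp only [h3]
  norm_num

theorem eventually_abs_profileSum_sub_le {w : ℕ} (hw : 10 ≤ w) {ε : ℝ} (hε : 0 < ε) :
    ∀ᶠ L : ℝ in atTop, ∀ x, 0 ≤ x → |profileSum w L x / L - mertensProd w * tailProfile x| ≤ ε := by
  have hγ := mertensProd_pos w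
  obtain ⟨N, hN⟩ := exists_nat_gt (14 * mertensProd w / ε)
  have hN0 : (0 : ℝ) < N := lt_trans (by positivity) hN
  have hN1 : 7 * mertensProd w * (1 / N) ≤ ε / 2 := by
    rw [div_lt_iff₀ hε] at hN
    rw [mul_one_div, div_le_iff₀ hN0]
    linarith
  have hev : ∀ᶠ L : ℝ in atTop, ∀ i ∈ Finset.range (N + 1),
      |profileSum w L ((i : ℝ) / N) / L - mertensProd w * tailProfile ((i : ℝ) / N)| < ε / 2 := by
    rw [eventually_all_finset]
    intro i hi
    have hi' : (i : ℝ) ≤ N := by exact_mod_cast Nat.lt_succ_iff.1 (Finset.mem_range.1 hi)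
    have := tendsto_profileSum (w := w) (by omega) (x := (i : ℝ) / N) (by positivity)
      ((div_le_one hN0).2 hi')
    simpa [Real.dist_eq] using Metric.tendsto_nhds.1 this (ε / 2) (by positivity)
  filter_upwards [hev, eventually_gt_atTop 0] with L hL hL0 x hx
  rcases lt_or_ge 1 x with h1 | h1
  · rw [profileSum_of_one_lt hL0 h1, tailProfile_of_one_le h1.le]
    simpa using hε.le
  rcases h1.eq_or_lt with rfl | h1
  · have := hL N (Finset.mem_range.2 (Nat.lt_succ_self N))
    rw [div_self hN0.ne'] at this
    linarith
  set i := ⌊x * N⌋₊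
  have hi1 : (i : ℝ) / N ≤ x := by
    rw [div_le_iff₀ hN0]
    exact Nat.floor_le (by positivity)
  have hi2 : x ≤ ((i + 1 : ℕ) : ℝ) / N := by
    rw [le_div_iff₀ hN0]
    push_cast
    exact (Nat.lt_floor_add_one _).le
  have hiN : i < N := by
    rw [Nat.floor_lt (by positivity)]
    nlinarith
  have hstep : ((i + 1 : ℕ) : ℝ) / N - (i : ℝ) / N = 1 / N := by
    push_cast
    ring
  have h2 := abs_lt.1 (hL i (Finset.mem_range.2 (by omega)))
  have h3 := abs_lt.1 (hL (i + 1) (Finset.mem_range.2 (by omega)))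
  have h4 : profileSum w L x / L ≤ profileSum w L ((i : ℝ) / N) / L :=
    div_le_div_of_nonneg_right (antitone_profileSum w L hi1) hL0.le
  have h5 : profileSum w L (((i + 1 : ℕ) : ℝ) / N) / L ≤ profileSum w L x / L :=
    div_le_div_of_nonneg_right (antitone_profileSum w L hi2) hL0.le
  have h6 := tailProfile_sub_le (by positivity) hi1
  have h7 := tailProfile_sub_le hx hi2
  rw [abs_le]
  constructor
  · have : mertensProd w * (tailProfile x - tailProfile (((i + 1 : ℕ) : ℝ) / N)) ≤
        7 * mertensProd w * (1 / N) := by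
      rw [mul_comm (7 : ℝ), mul_assoc]
      gcongr
      linarith
    rw [mul_sub] at this
    linarith
  · have : mertensProd w * (tailProfile ((i : ℝ) / N) - tailProfile x) ≤
        7 * mertensProd w * (1 / N) := by
      rw [mul_comm (7 : ℝ), mul_assoc]
      gcongr
      linarith
    rw [mul_sub] at this
    linarith

end MainTerm

section MainLower

open Filter Topology Real
open scoped Classical

theorem prod_div_sub_one_eq {B : Finset ℕ} (hB : ∀ p ∈ B, p.Prime) :
    ∏ p ∈ B, (p : ℝ) / (p - 1) = ∏ p ∈ B, (1 + 1 / ((p : ℝ) - 1)) := by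
  refine Finset.prod_congr rfl fun p hp ↦ ?_
  have h1 : (1 : ℝ) < p := by exact_mod_cast (hB p hp).one_lt
  have : (p : ℝ) - 1 ≠ 0 := by linarith
  field_simp
  ring

theorem one_le_prod_div_sub_one {B : Finset ℕ} (hB : ∀ p ∈ B, p.Prime) :
    1 ≤ ∏ p ∈ B, (p : ℝ) / (p - 1) := by
  refine (Finset.prod_const_one (s := B)).symm.le.trans
    (Finset.prod_le_prod (fun _ _ ↦ zero_le_one) fun p hp ↦ ?_)
  have h1 : (1 : ℝ) < p := by exact_mod_cast (hB p hp).one_lt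
  rw [le_div_iff₀ (by linarith)]
  linarith

theorem sieveCoef_ge {w q : ℕ} {L β : ℝ} (hL : 0 < L) (hq : q.Prime)
    {B : Finset ℕ} (hB : B ⊆ (primesIoc w (exp L)).erase q) :
    (1 - 1 / (q : ℝ)) * profileSum w L (logProd B / L) -
      (∏ p ∈ B, (p : ℝ) / (p - 1)) * profileSum w L (logProd B / L + β) ≤
      sieveCoef ((primesIoc w (exp L)).erase q) L β B := by
  set P := primesIoc w (exp L) with hP
  set P' := P.erase q with hP'
  set s := logProd B / L
  have hprime : ∀ D ⊆ P, ∀ p ∈ D, p.Prime := fun D hD p hp ↦ (mem_primesIoc.1 (hD hp)).1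
  have hP'P : P' ⊆ P := Finset.erase_subset _ _
  have hq1 : (1 : ℝ) < q := by exact_mod_cast hq.one_lt
  have hBprime := hprime B (hB.trans hP'P)
  have hlog : ∀ C ∈ (P' \ B).powerset, logProd (B ∪ C) / L = s + logProd C / L := by
    intro C hC
    rw [logProd_union (Finset.disjoint_of_subset_right (Finset.mem_powerset.1 hC)
      Finset.disjoint_sdiff), add_div]
  have hsub : ∀ C ∈ (P' \ B).powerset, C ⊆ P := fun C hC ↦
    (Finset.mem_powerset.1 hC).trans (Finset.sdiff_subset.trans hP'P)
  have h1 : sieveCoef P' L β B = (∏ p ∈ B, (p : ℝ) / (p - 1)) *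
      (∑ C ∈ (P' \ B).powerset, profile (s + logProd C / L) * ∏ p ∈ C, 1 / ((p : ℝ) - 1)) -
      (∏ p ∈ B, (p : ℝ) / (p - 1)) *
      (∑ C ∈ (P' \ B).powerset, profile (s + β + logProd C / L) * ∏ p ∈ C, 1 / ((p : ℝ) - 1)) := by
    rw [sieveCoef, ← mul_sub, ← Finset.sum_sub_distrib]
    refine congrArg _ (Finset.sum_congr rfl fun C hC ↦ ?_)
    rw [hlog C hC, profileDiff, sub_mul, add_right_comm]
  have h2 : ∑ C ∈ (P' \ B).powerset, profile (s + β + logProd C / L) *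
      ∏ p ∈ C, 1 / ((p : ℝ) - 1) ≤ profileSum w L (s + β) :=
    Finset.sum_le_sum_of_subset_of_nonneg
      (Finset.powerset_mono.2 (Finset.sdiff_subset.trans hP'P)) fun C hC _ ↦
        mul_nonneg (profile_nonneg _) (prod_primesIoc_nonneg (Finset.mem_powerset.1 hC))
  have h3 : ∑ C ∈ P'.powerset, profile (s + logProd C / L) * ∏ p ∈ C, 1 / ((p : ℝ) - 1) ≤
      (∏ p ∈ B, (p : ℝ) / (p - 1)) *
      (∑ C ∈ (P' \ B).powerset, profile (s + logProd C / L) * ∏ p ∈ C, 1 / ((p : ℝ) - 1)) := by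
    rw [prod_div_sub_one_eq hBprime, Finset.prod_one_add, Finset.sum_mul_sum]
    conv_lhs => rw [← Finset.union_sdiff_of_subset hB]
    rw [sum_powerset_union_disjoint Finset.disjoint_sdiff]
    refine Finset.sum_le_sum fun D hD ↦ Finset.sum_le_sum fun C hC ↦ ?_
    have hdisj : Disjoint D C := Finset.disjoint_of_subset_left (Finset.mem_powerset.1 hD)
      (Finset.disjoint_of_subset_right (Finset.mem_powerset.1 hC) Finset.disjoint_sdiff)
    rw [Finset.prod_union hdisj]
    have hD0 := prod_primesIoc_nonneg (y := w) (z := exp L)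
      ((Finset.mem_powerset.1 hD).trans (hB.trans hP'P))
    have hC0 := prod_primesIoc_nonneg (y := w) (z := exp L) (hsub C hC)
    have hg : profile (s + logProd (D ∪ C) / L) ≤ profile (s + logProd C / L) :=
      antitone_profile (by gcongr; exact logProd_mono Finset.subset_union_right)
    calc _ ≤ profile (s + logProd C / L) *
        ((∏ p ∈ D, 1 / ((p : ℝ) - 1)) * ∏ p ∈ C, 1 / ((p : ℝ) - 1)) :=
          mul_le_mul_of_nonneg_right hg (mul_nonneg hD0 hC0)
      _ = _ := by ring
  have h4 : (1 - 1 / (q : ℝ)) * profileSum w L s ≤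
      ∑ C ∈ P'.powerset, profile (s + logProd C / L) * ∏ p ∈ C, 1 / ((p : ℝ) - 1) := by
    set S' := ∑ C ∈ P'.powerset, profile (s + logProd C / L) * ∏ p ∈ C, 1 / ((p : ℝ) - 1)
    have h5 : profileSum w L s ≤ (1 + 1 / ((q : ℝ) - 1)) * S' := by
      have hS : 0 ≤ S' := Finset.sum_nonneg fun C hC ↦ mul_nonneg (profile_nonneg _)
        (prod_primesIoc_nonneg (y := w) (z := exp L) ((Finset.mem_powerset.1 hC).trans hP'P))
      rw [profileSum, ← hP]
      by_cases hqP : q ∈ P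
      · conv_lhs => rw [← Finset.insert_erase hqP]
        rw [Finset.sum_powerset_insert (Finset.notMem_erase _ _), add_mul, one_mul]
        refine add_le_add le_rfl ?_
        rw [Finset.mul_sum]
        refine Finset.sum_le_sum fun C hC ↦ ?_
        have hqC : q ∉ C := fun h ↦ Finset.notMem_erase q _ (Finset.mem_powerset.1 hC h)
        rw [Finset.prod_insert hqC]
        have hC0 := prod_primesIoc_nonneg (y := w) (z := exp L)
          ((Finset.mem_powerset.1 hC).trans hP'P)
        have hg : profile (s + logProd (insert q C) / L) ≤ profile (s + logProd C / L) :=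
          antitone_profile (by gcongr; exact logProd_mono (Finset.subset_insert _ _))
        have hq0 : 0 ≤ 1 / ((q : ℝ) - 1) := div_nonneg zero_le_one (by linarith)
        calc _ ≤ profile (s + logProd C / L) *
            (1 / ((q : ℝ) - 1) * ∏ p ∈ C, 1 / ((p : ℝ) - 1)) :=
              mul_le_mul_of_nonneg_right hg (mul_nonneg hq0 hC0)
          _ = _ := by ring
      · have hS' : S' = ∑ C ∈ P.powerset, profile (s + logProd C / L) *
            ∏ p ∈ C, 1 / ((p : ℝ) - 1) := by
          simp only [S', hP', Finset.erase_eq_of_notMem hqP]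
        rw [← hS']
        have hq0 : 0 ≤ 1 / ((q : ℝ) - 1) := div_nonneg zero_le_one (by linarith)
        nlinarith
    have h6 : (1 - 1 / (q : ℝ)) * (1 + 1 / ((q : ℝ) - 1)) = 1 := by
      have : (q : ℝ) - 1 ≠ 0 := by linarith
      field_simp
      ring
    calc (1 - 1 / (q : ℝ)) * profileSum w L s
        ≤ (1 - 1 / (q : ℝ)) * ((1 + 1 / ((q : ℝ) - 1)) * S') := by
          refine mul_le_mul_of_nonneg_left h5 ?_
          rw [sub_nonneg, div_le_one (by linarith)]
          exact hq1.le
      _ = S' := by rw [← mul_assoc, h6, one_mul]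
  rw [h1]
  have h7 := one_le_prod_div_sub_one hBprime
  exact sub_le_sub (h4.trans h3) (mul_le_mul_of_nonneg_left h2 (by linarith))

theorem sieveCoef_sq_ge {w q : ℕ} (hw : 10 ≤ w) {L β : ℝ} (hL : 0 < L) (hβ : 0 ≤ β) (hq : q.Prime)
    {B : Finset ℕ} (hB : B ⊆ (primesIoc w (exp L)).erase q) :
    (profileSum w L (logProd B / L) - profileSum w L (logProd B / L + β)) ^ 2 -
      2 * profileSum w L 0 ^ 2 * (1 / q + (∏ p ∈ B, (p : ℝ) / (p - 1) - 1)) ≤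
      sieveCoef ((primesIoc w (exp L)).erase q) L β B ^ 2 := by
  have hs := div_nonneg (logProd_nonneg B) hL.le
  have hBP : B ⊆ primesIoc w (exp L) := hB.trans (Finset.erase_subset _ _)
  have h1 := sieveCoef_ge (β := β) hL hq hB
  have h2 := one_le_prod_div_sub_one fun p hp ↦ (mem_primesIoc.1 (hBP hp)).1
  have h3 := antitone_profileSum w L hs
  have h4 := antitone_profileSum w L (by linarith : logProd B / L ≤ logProd B / L + β)
  have h5 := profileSum_nonneg w L (logProd B / L + β)
  have h0 : 0 ≤ sieveCoef ((primesIoc w (exp L)).erase q) L β B := by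
    refine sieveCoef_nonneg (fun p hp ↦ ?_) hβ hB
    have : w < p := by exact_mod_cast (mem_primesIoc.1 (Finset.mem_of_mem_erase hp)).2.1
    omega
  set E := profileSum w L 0
  set a := profileSum w L (logProd B / L)
  set b := profileSum w L (logProd B / L + β)
  set Y := sieveCoef ((primesIoc w (exp L)).erase q) L β B
  set M := ∏ p ∈ B, (p : ℝ) / (p - 1)
  have hq0 : 0 ≤ 1 / (q : ℝ) := by positivity
  set c := 1 / (q : ℝ)
  set e := c * a + (M - 1) * b
  have he : 0 ≤ e := by
    have : 0 ≤ (M - 1) * b := mul_nonneg (by linarith) h5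
    have : 0 ≤ c * a := mul_nonneg hq0 (h5.trans h4)
    linarith
  have h6 : (a - b) - e ≤ Y := by
    simp only [e]
    linarith
  have h7 : e ≤ E * (c + (M - 1)) := by
    have h8 : c * a ≤ c * E := mul_le_mul_of_nonneg_left h3 hq0
    have h9 : (M - 1) * b ≤ (M - 1) * E := mul_le_mul_of_nonneg_left (h4.trans h3) (by linarith)
    simp only [e]
    linarith
  have hab : 0 ≤ a - b := by linarith
  have h8 : (a - b) ^ 2 - 2 * (a - b) * e ≤ Y ^ 2 := by
    rcases le_total e (a - b) with h | h
    · nlinarith [sq_nonneg e]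
    · nlinarith [sq_nonneg Y]
  have h9 : (a - b) * e ≤ E * (E * (c + (M - 1))) :=
    mul_le_mul (by linarith) h7 he (by linarith)
  nlinarith

theorem sum_primesIoc_le {w : ℕ} (hw : 10 ≤ w) (z : ℝ) :
    ∑ p ∈ primesIoc w z, 1 / ((p : ℝ) - 1) * (2 / ((p : ℝ) - 3)) ≤ 2 / ((w : ℝ) - 2) := by
  have hw' : (10 : ℝ) ≤ w := by exact_mod_cast hw
  have hsub : primesIoc w z ⊆ Finset.Ico (w + 1) (w + 1 + ⌊z⌋₊) := by
    intro p hp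
    obtain ⟨h1, h2, h3⟩ := mem_primesIoc.1 hp
    have h4 : w < p := by exact_mod_cast h2
    have h5 : p ≤ ⌊z⌋₊ := Nat.le_floor h3
    exact Finset.mem_Ico.2 ⟨h4, by omega⟩
  have hpos : ∀ p ∈ Finset.Ico (w + 1) (w + 1 + ⌊z⌋₊), (w : ℝ) + 1 ≤ p := fun p hp ↦ by
    exact_mod_cast (Finset.mem_Ico.1 hp).1
  have htel : ∀ k : ℕ, ∑ p ∈ Finset.Ico (w + 1) (w + 1 + k), 1 / ((p : ℝ) - 1) * (2 / ((p : ℝ) - 3))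
      ≤ 2 / ((w : ℝ) - 2) - 2 / ((w : ℝ) + k - 2) := by
    intro k
    induction k with
    | zero => simp
    | succ k ih =>
      rw [← add_assoc, Finset.sum_Ico_succ_top (by omega)]
      have hk : (0 : ℝ) ≤ k := by positivity
      have : 1 / (((w + 1 + k : ℕ) : ℝ) - 1) * (2 / (((w + 1 + k : ℕ) : ℝ) - 3)) ≤
          2 / ((w : ℝ) + k - 2) - 2 / ((w : ℝ) + (k + 1 : ℕ) - 2) := by
        push_cast
        rw [div_sub_div _ _ (by linarith) (by linarith), div_mul_div_comm,
          div_le_div_iff₀ (by nlinarith) (by nlinarith)]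
        nlinarith
      linarith
  calc _ ≤ ∑ p ∈ Finset.Ico (w + 1) (w + 1 + ⌊z⌋₊), 1 / ((p : ℝ) - 1) * (2 / ((p : ℝ) - 3)) :=
        Finset.sum_le_sum_of_subset_of_nonneg hsub fun p hp _ ↦ by
          have := hpos p hp
          exact mul_nonneg (div_nonneg zero_le_one (by linarith))
            (div_nonneg zero_le_two (by linarith))
    _ ≤ _ := by
        refine (htel _).trans (sub_le_self _ (div_nonneg zero_le_two ?_))
        have : (0 : ℝ) ≤ ⌊z⌋₊ := by positivity
        linarith

/-- The truncated mass of `∏ 2/(p-3)`. -/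
noncomputable def truncMass (w : ℕ) (L : ℝ) : ℝ :=
  ∑ F ∈ (primesIoc w (exp L)).powerset, if logProd F ≤ L then ∏ p ∈ F, 2 / ((p : ℝ) - 3) else 0

theorem prod_two_div_nonneg {w : ℕ} (hw : 10 ≤ w) {z : ℝ} {D : Finset ℕ}
    (hD : D ⊆ primesIoc w z) : 0 ≤ ∏ p ∈ D, 2 / ((p : ℝ) - 3) := by
  refine Finset.prod_nonneg fun p hp ↦ ?_
  have h1 := (mem_primesIoc.1 (hD hp)).2.1
  have h2 : (10 : ℝ) ≤ w := by exact_mod_cast hw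
  exact div_nonneg (by norm_num) (by linarith)

theorem truncMass_nonneg {w : ℕ} (hw : 10 ≤ w) (L : ℝ) : 0 ≤ truncMass w L :=
  Finset.sum_nonneg fun F hF ↦ by
    split_ifs
    · exact prod_two_div_nonneg hw (Finset.mem_powerset.1 hF)
    · rfl

theorem sum_truncMass_mul_le {w : ℕ} (hw : 10 ≤ w) (L : ℝ) :
    ∑ B ∈ (primesIoc w (exp L)).powerset,
        (if logProd B ≤ L then ∏ p ∈ B, 2 / ((p : ℝ) - 3) else 0) * ∏ p ∈ B, (p : ℝ) / (p - 1) ≤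
      exp (2 / ((w : ℝ) - 2)) * truncMass w L := by
  set P := primesIoc w (exp L)
  have h1 : ∀ B ∈ P.powerset,
      (if logProd B ≤ L then ∏ p ∈ B, 2 / ((p : ℝ) - 3) else 0) * ∏ p ∈ B, (p : ℝ) / (p - 1) =
      (if logProd B ≤ L then ∏ p ∈ B, 2 / ((p : ℝ) - 3) else 0) *
        ∏ p ∈ B, (1 + 1 / ((p : ℝ) - 1)) := fun B hB ↦ by
    rw [prod_div_sub_one_eq fun p hp ↦ (mem_primesIoc.1 (Finset.mem_powerset.1 hB hp)).1]
  have hFpos := truncMass_nonneg hw L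
  rw [Finset.sum_congr rfl h1, sum_powerset_mul_prod_add]
  calc _ ≤ ∑ B ∈ P.powerset, (∏ p ∈ B, 1 / ((p : ℝ) - 1) * (2 / ((p : ℝ) - 3))) *
        truncMass w L := by
        refine Finset.sum_le_sum fun B hB ↦ ?_
        rw [Finset.mem_powerset] at hB
        have hα := prod_primesIoc_nonneg hB
        have hf := prod_two_div_nonneg hw hB
        rw [Finset.prod_mul_distrib, mul_comm, mul_assoc]
        refine mul_le_mul_of_nonneg_left ?_ hα
        rw [truncMass, Finset.mul_sum]
        refine (Finset.sum_le_sum (g := fun C ↦ (∏ p ∈ B, 2 / ((p : ℝ) - 3)) *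
          if logProd C ≤ L then ∏ p ∈ C, 2 / ((p : ℝ) - 3) else 0) fun C hC ↦ ?_).trans
          (Finset.sum_le_sum_of_subset_of_nonneg
            (Finset.powerset_mono.2 Finset.sdiff_subset) fun C hC _ ↦ ?_)
        · have hC' := Finset.mem_powerset.1 hC
          have hdisj : Disjoint B C := Finset.disjoint_of_subset_right hC' Finset.disjoint_sdiff
          have hC0 := prod_two_div_nonneg hw (hC'.trans Finset.sdiff_subset)
          rw [Finset.prod_const_one, mul_one]
          by_cases h : logProd (B ∪ C) ≤ L
          · rw [if_pos h, if_pos ((logProd_mono Finset.subset_union_right).trans h),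
              Finset.prod_union hdisj]
          · rw [if_neg h]
            split_ifs
            · exact mul_nonneg hf hC0
            · rw [mul_zero]
        · refine mul_nonneg hf ?_
          split_ifs
          · exact prod_two_div_nonneg hw (Finset.mem_powerset.1 hC)
          · rfl
    _ = (∏ p ∈ P, (1 + 1 / ((p : ℝ) - 1) * (2 / ((p : ℝ) - 3)))) * truncMass w L := by
        rw [Finset.prod_one_add, Finset.sum_mul]
    _ ≤ _ := by
        refine mul_le_mul_of_nonneg_right ?_ hFpos
        calc _ ≤ ∏ p ∈ P, exp (1 / ((p : ℝ) - 1) * (2 / ((p : ℝ) - 3))) := by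
              refine Finset.prod_le_prod (fun p hp ↦ ?_) fun p hp ↦ ?_
              · have h1 := prod_primesIoc_nonneg (Finset.singleton_subset_iff.2 hp)
                have h2 := prod_two_div_nonneg hw (Finset.singleton_subset_iff.2 hp)
                rw [Finset.prod_singleton] at h1 h2
                positivity
              · rw [add_comm]
                exact add_one_le_exp _
          _ = exp (∑ p ∈ P, 1 / ((p : ℝ) - 1) * (2 / ((p : ℝ) - 3))) := (exp_sum _ _).symm
          _ ≤ _ := exp_le_exp.2 (sum_primesIoc_le hw _)

theorem sqCoef_empty_ge {w q : ℕ} (hw : 10 ≤ w) {L β : ℝ} (hL : 0 < L) (hβ : 0 ≤ β)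
    (hq : q.Prime) :
    ∑ B ∈ (primesIoc w (exp L)).powerset,
        (if logProd B ≤ L then ∏ p ∈ B, 2 / ((p : ℝ) - 3) else 0) *
          (profileSum w L (logProd B / L) - profileSum w L (logProd B / L + β)) ^ 2 -
      profileSum w L 0 ^ 2 * truncMass w L * (5 / q + 2 * (exp (2 / ((w : ℝ) - 2)) - 1)) ≤
      sqCoef ((primesIoc w (exp L)).erase q) (fun p ↦ 2 / ((p : ℝ) - 3))
        (sieveCoef ((primesIoc w (exp L)).erase q) L β) ∅ := by
  set P := primesIoc w (exp L) with hP
  set g : Finset ℕ → ℝ := fun B ↦ if logProd B ≤ L then ∏ p ∈ B, 2 / ((p : ℝ) - 3) else 0 with hg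
  set D : Finset ℕ → ℝ :=
    fun B ↦ profileSum w L (logProd B / L) - profileSum w L (logProd B / L + β) with hD
  set m : Finset ℕ → ℝ := fun B ↦ ∏ p ∈ B, (p : ℝ) / (p - 1) with hm
  set E := profileSum w L 0 with hE
  have hE0 : 0 ≤ E := profileSum_nonneg w L 0
  have hP'P : P.erase q ⊆ P := Finset.erase_subset _ _
  have hf0 : ∀ B ⊆ P, 0 ≤ ∏ p ∈ B, 2 / ((p : ℝ) - 3) := fun B hB ↦ prod_two_div_nonneg hw hB
  have hg0 : ∀ B ∈ P.powerset, 0 ≤ g B := fun B hB ↦ by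
    simp only [hg]
    split_ifs
    · exact hf0 B (Finset.mem_powerset.1 hB)
    · rfl
  have hF : truncMass w L = ∑ B ∈ P.powerset, g B := rfl
  have hF0 := truncMass_nonneg hw L
  have hq0 : (0 : ℝ) < q := by exact_mod_cast hq.pos
  have hDE : ∀ B, D B ^ 2 ≤ E ^ 2 := fun B ↦ by
    have hs := div_nonneg (logProd_nonneg B) hL.le
    have h3 := antitone_profileSum w L hs
    have h4 := antitone_profileSum w L (by linarith : logProd B / L ≤ logProd B / L + β)
    have h5 := profileSum_nonneg w L (logProd B / L + β)
    exact pow_le_pow_left₀ (by simp only [hD]; linarith) (by simp only [hD]; linarith) 2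
  have hsub : (P.erase q).powerset ⊆ P.powerset := Finset.powerset_mono.2 hP'P
  have hm1 : ∀ B ∈ P.powerset, 1 ≤ m B := fun B hB ↦
    one_le_prod_div_sub_one fun p hp ↦ (mem_primesIoc.1 (Finset.mem_powerset.1 hB hp)).1
  have h1 : ∑ B ∈ (P.erase q).powerset, g B * (D B ^ 2 - 2 * E ^ 2 * (1 / q + (m B - 1))) ≤
      sqCoef (P.erase q) (fun p ↦ 2 / ((p : ℝ) - 3)) (sieveCoef (P.erase q) L β) ∅ := by
    rw [sqCoef_empty]
    refine Finset.sum_le_sum fun B hB ↦ ?_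
    have hB' := Finset.mem_powerset.1 hB
    have h2 := sieveCoef_sq_ge hw hL hβ hq hB'
    rw [mul_comm]
    calc _ ≤ sieveCoef (P.erase q) L β B ^ 2 * g B :=
          mul_le_mul_of_nonneg_right h2 (hg0 B (hsub hB))
      _ ≤ _ := by
          refine mul_le_mul_of_nonneg_left ?_ (sq_nonneg _)
          simp only [hg]
          split_ifs
          · rfl
          · exact hf0 B (hB'.trans hP'P)
  have hgm : ∑ B ∈ P.powerset, g B * m B ≤ exp (2 / ((w : ℝ) - 2)) * truncMass w L :=
    sum_truncMass_mul_le hw L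
  suffices hmain : ∑ B ∈ P.powerset, g B * D B ^ 2 -
      E ^ 2 * truncMass w L * (5 / q + 2 * (exp (2 / ((w : ℝ) - 2)) - 1)) ≤
      sqCoef (P.erase q) (fun p ↦ 2 / ((p : ℝ) - 3)) (sieveCoef (P.erase q) L β) ∅ from hmain
  clear_value D E m
  have h2 : ∑ B ∈ P.powerset, g B * D B ^ 2 - E ^ 2 * (3 / q) * truncMass w L ≤
      ∑ B ∈ (P.erase q).powerset, g B * D B ^ 2 := by
    by_cases hqP : q ∈ P
    · have hq10 : (10 : ℝ) < q := by
        have := (mem_primesIoc.1 hqP).2.1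
        have h10 : (10 : ℝ) ≤ w := by exact_mod_cast hw
        linarith
      have h3 : ∑ B ∈ P.powerset, g B * D B ^ 2 = ∑ B ∈ (P.erase q).powerset, g B * D B ^ 2 +
          ∑ B ∈ (P.erase q).powerset, g (insert q B) * D (insert q B) ^ 2 := by
        rw [← Finset.sum_powerset_insert (Finset.notMem_erase _ _), Finset.insert_erase hqP]
      have h4 : ∑ B ∈ (P.erase q).powerset, g (insert q B) * D (insert q B) ^ 2 ≤
          ∑ B ∈ (P.erase q).powerset, E ^ 2 * (3 / q) * g B := by
        refine Finset.sum_le_sum fun B hB ↦ ?_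
        have hqB : q ∉ B := fun h ↦ Finset.notMem_erase q _ (Finset.mem_powerset.1 hB h)
        have h5 : g (insert q B) ≤ 3 / q * g B := by
          have hgB := hf0 B (Finset.mem_powerset.1 (hsub hB))
          simp only [hg]
          split_ifs with h6 h7 h7
          · rw [Finset.prod_insert hqB]
            refine mul_le_mul_of_nonneg_right ?_ hgB
            rw [div_le_div_iff₀ (by linarith) hq0]
            linarith
          · exact absurd ((logProd_mono (Finset.subset_insert _ _)).trans h6) h7
          · positivity
          · rw [mul_zero]
        calc _ ≤ 3 / q * g B * E ^ 2 := mul_le_mul h5 (hDE _) (sq_nonneg _)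
              (mul_nonneg (by positivity) (hg0 B (hsub hB)))
          _ = _ := by ring
      have h5 : ∑ B ∈ (P.erase q).powerset, E ^ 2 * (3 / q) * g B ≤
          E ^ 2 * (3 / q) * truncMass w L := by
        rw [← Finset.mul_sum, hF]
        exact mul_le_mul_of_nonneg_left
          (Finset.sum_le_sum_of_subset_of_nonneg hsub fun B hB _ ↦ hg0 B hB) (by positivity)
      linarith
    · rw [Finset.erase_eq_of_notMem hqP]
      exact sub_le_self _ (by positivity)
  have h30 : 0 ≤ 2 * E ^ 2 := by positivity
  have h31 : 0 ≤ 1 / (q : ℝ) := by positivity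
  have h3 : ∑ B ∈ (P.erase q).powerset, g B * (2 * E ^ 2 * (1 / q + (m B - 1))) ≤
      2 * E ^ 2 * truncMass w L * (1 / q + (exp (2 / ((w : ℝ) - 2)) - 1)) := by
    calc _ ≤ ∑ B ∈ P.powerset, g B * (2 * E ^ 2 * (1 / q + (m B - 1))) :=
          Finset.sum_le_sum_of_subset_of_nonneg hsub fun B hB _ ↦
            mul_nonneg (hg0 B hB) (mul_nonneg h30 (add_nonneg h31 (sub_nonneg.2 (hm1 B hB))))
      _ = 2 * E ^ 2 * ((1 / q - 1) * ∑ B ∈ P.powerset, g B + ∑ B ∈ P.powerset, g B * m B) := by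
          rw [Finset.mul_sum, ← Finset.sum_add_distrib, Finset.mul_sum]
          refine Finset.sum_congr rfl fun B _ ↦ ?_
          ring
      _ ≤ 2 * E ^ 2 * ((1 / q - 1) * truncMass w L +
            exp (2 / ((w : ℝ) - 2)) * truncMass w L) := by
          rw [hF]
          exact mul_le_mul_of_nonneg_left (add_le_add le_rfl
            (hgm.trans_eq (by rw [hF]))) h30
      _ = _ := by ring
  have h4 : ∑ B ∈ (P.erase q).powerset, g B * (D B ^ 2 - 2 * E ^ 2 * (1 / q + (m B - 1))) =
      ∑ B ∈ (P.erase q).powerset, g B * D B ^ 2 -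
      ∑ B ∈ (P.erase q).powerset, g B * (2 * E ^ 2 * (1 / q + (m B - 1))) := by
    rw [← Finset.sum_sub_distrib]
    exact Finset.sum_congr rfl fun B _ ↦ by ring
  have h5 : E ^ 2 * truncMass w L * (5 / q + 2 * (exp (2 / ((w : ℝ) - 2)) - 1)) =
      E ^ 2 * (3 / q) * truncMass w L +
        2 * E ^ 2 * truncMass w L * (1 / q + (exp (2 / ((w : ℝ) - 2)) - 1)) := by ring
  linarith

/-- The density of the diagonal part of the sieve weight on multiples of a prime `exp (β L)`. -/
noncomputable def energyIntegral (β : ℝ) : ℝ :=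
  ∫ s in (0 : ℝ)..1, (tailProfile s - tailProfile (s + β)) ^ 2 * s

theorem sq_sub_le_sq {γ η Δ x : ℝ} (hη : 0 < η) (hΔ : 0 ≤ Δ) (hΔ' : Δ ≤ 7 / 2)
    (hγ : 0 < γ) (h : γ * Δ - 2 * (γ * η) ≤ x) : γ ^ 2 * Δ ^ 2 - 14 * γ ^ 2 * η ≤ x ^ 2 := by
  have h9 : γ ^ 2 * η * Δ ≤ γ ^ 2 * η * (7 / 2) := mul_le_mul_of_nonneg_left hΔ' (by positivity)
  rcases le_total (2 * (γ * η)) (γ * Δ) with h1 | h1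
  · have h2 := pow_le_pow_left₀ (by linarith) h 2
    nlinarith [sq_nonneg (γ * η)]
  · have : γ * Δ * (γ * Δ) ≤ γ * Δ * (2 * (γ * η)) := mul_le_mul_of_nonneg_left h1 (by positivity)
    nlinarith [sq_nonneg x]

theorem eventually_sqCoef_empty_ge {w : ℕ} (hw : 10 ≤ w) {β ε : ℝ} (hβ : 0 ≤ β) (hε : 0 < ε) :
    ∀ᶠ L : ℝ in atTop, ∀ q : ℕ, q.Prime → L ≤ q → ∀ β', β ≤ β' →
      sieveConst 2 3 w * mertensProd w ^ 2 * L ^ 4 *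
        (energyIntegral β - 13 * (exp (2 / ((w : ℝ) - 2)) - 1) - ε) ≤
      sqCoef ((primesIoc w (exp L)).erase q) (fun p ↦ 2 / ((p : ℝ) - 3))
        (sieveCoef ((primesIoc w (exp L)).erase q) L β') ∅ := by
  have hγ := mertensProd_pos w
  have hc := sieveConst_two_pos (by omega : 6 ≤ w)
  set γ := mertensProd w
  set c := sieveConst 2 3 w
  set κ := exp (2 / ((w : ℝ) - 2)) - 1 with hκ
  have hκ0 : 0 ≤ κ := by
    rw [hκ, sub_nonneg]
    refine one_le_exp (div_nonneg zero_le_two ?_)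
    have : (10 : ℝ) ≤ w := by exact_mod_cast hw
    linarith
  obtain ⟨η, hη0, hη1, hη2⟩ : ∃ η : ℝ, 0 < η ∧ η ≤ 1 / 10 ∧ 14 * η ≤ ε :=
    ⟨min (1 / 10) (ε / 14), by positivity, min_le_left _ _, by
      have := min_le_right (1 / 10) (ε / 14); linarith⟩
  have hcont := continuous_tailProfile
  have hlim1 : Tendsto (fun L ↦ truncMass w L / L ^ 2) atTop (𝓝 (c * (1 / 2))) := by
    have := tendsto_sum_powerset_primesIoc (k := 1) (b := 3) (w := w) (by norm_num) (by omega)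
      (by simp) (φ := fun _ ↦ 1) (by fun_prop) (a := 1) zero_le_one le_rfl
    simpa [truncMass, one_add_one_eq_two] using this
  have hlim2 : Tendsto (fun L ↦ (∑ B ∈ (primesIoc w (exp L)).powerset,
      (if logProd B ≤ L then ∏ p ∈ B, 2 / ((p : ℝ) - 3) else 0) *
        (tailProfile (logProd B / L) - tailProfile (logProd B / L + β)) ^ 2) / L ^ 2) atTop
      (𝓝 (c * energyIntegral β)) := by
    have := tendsto_sum_powerset_primesIoc (k := 1) (b := 3) (w := w) (by norm_num) (by omega)
      (by simp) (φ := fun t ↦ (tailProfile t - tailProfile (t + β)) ^ 2) (by fun_prop)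
      (a := 1) zero_le_one le_rfl
    simpa [energyIntegral, one_add_one_eq_two, ite_mul, mul_ite, mul_comm] using this
  have hlim3 : Tendsto (fun L : ℝ ↦ γ ^ 2 * ((∑ B ∈ (primesIoc w (exp L)).powerset,
      (if logProd B ≤ L then ∏ p ∈ B, 2 / ((p : ℝ) - 3) else 0) *
        (tailProfile (logProd B / L) - tailProfile (logProd B / L + β)) ^ 2) / L ^ 2) -
      14 * γ ^ 2 * η * (truncMass w L / L ^ 2) -
      (3.6 * γ) ^ 2 * (truncMass w L / L ^ 2) * (5 / L + 2 * κ)) atTop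
      (𝓝 (γ ^ 2 * (c * energyIntegral β) - 14 * γ ^ 2 * η * (c * (1 / 2)) -
        (3.6 * γ) ^ 2 * (c * (1 / 2)) * (0 + 2 * κ))) :=
    ((hlim2.const_mul _).sub (hlim1.const_mul _)).sub ((hlim1.const_mul _).mul
      ((tendsto_const_nhds.div_atTop tendsto_id).add_const _))
  have hlt : c * γ ^ 2 * (energyIntegral β - 13 * κ - ε) <
      γ ^ 2 * (c * energyIntegral β) - 14 * γ ^ 2 * η * (c * (1 / 2)) -
        (3.6 * γ) ^ 2 * (c * (1 / 2)) * (0 + 2 * κ) := by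
    have hcγ : 0 < c * γ ^ 2 := by positivity
    have : 0 < c * γ ^ 2 * (13 * κ + ε - 7 * η - 3.6 ^ 2 * κ) :=
      mul_pos hcγ (by norm_num; nlinarith)
    nlinarith
  filter_upwards [hlim3.eventually (lt_mem_nhds hlt), eventually_ge_atTop 1,
    eventually_abs_profileSum_sub_le hw (mul_pos hγ hη0)] with L h1 hL1 hE q hq hqL β' hβ'
  have hL : 0 < L := by linarith
  have hF0 := truncMass_nonneg hw L
  set P := primesIoc w (exp L) with hP
  have hE0 : profileSum w L 0 ≤ 3.6 * γ * L := by
    have h2 := (abs_le.1 (hE 0 le_rfl)).2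
    rw [tailProfile_zero, sub_le_iff_le_add, div_le_iff₀ hL] at h2
    refine h2.trans (mul_le_mul_of_nonneg_right ?_ hL.le)
    nlinarith
  have hD : ∀ B : Finset ℕ, L ^ 2 * (γ ^ 2 *
      (tailProfile (logProd B / L) - tailProfile (logProd B / L + β)) ^ 2 - 14 * γ ^ 2 * η) ≤
      (profileSum w L (logProd B / L) - profileSum w L (logProd B / L + β)) ^ 2 := by
    intro B
    have hs := div_nonneg (logProd_nonneg B) hL.le
    have h2 := (abs_le.1 (hE _ hs)).1
    have h3 := (abs_le.1 (hE _ (add_nonneg hs hβ))).2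
    have h4 := antitone_profileSum w L (by linarith : logProd B / L ≤ logProd B / L + β)
    have h5 := antitone_tailProfile (by linarith : logProd B / L ≤ logProd B / L + β)
    have h6 := antitone_tailProfile hs
    have h7 := tailProfile_nonneg (logProd B / L + β)
    rw [tailProfile_zero] at h6
    set a := profileSum w L (logProd B / L)
    set b := profileSum w L (logProd B / L + β)
    set Δ := tailProfile (logProd B / L) - tailProfile (logProd B / L + β) with hΔ
    have hx : γ * Δ - 2 * (γ * η) ≤ (a - b) / L := by
      rw [sub_div, hΔ]
      linarith
    have hΔ0 : 0 ≤ Δ := by linarith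
    have hΔ1 : Δ ≤ 7 / 2 := by linarith
    have h8 : γ ^ 2 * Δ ^ 2 - 14 * γ ^ 2 * η ≤ ((a - b) / L) ^ 2 :=
      sq_sub_le_sq hη0 hΔ0 hΔ1 hγ hx
    calc _ ≤ L ^ 2 * ((a - b) / L) ^ 2 := mul_le_mul_of_nonneg_left h8 (by positivity)
      _ = (a - b) ^ 2 := by field_simp
  have h2 := sqCoef_empty_ge hw hL hβ hq
  have h3 : L ^ 2 * (γ ^ 2 * (∑ B ∈ P.powerset,
      (if logProd B ≤ L then ∏ p ∈ B, 2 / ((p : ℝ) - 3) else 0) *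
        (tailProfile (logProd B / L) - tailProfile (logProd B / L + β)) ^ 2) -
      14 * γ ^ 2 * η * truncMass w L) ≤
      ∑ B ∈ P.powerset, (if logProd B ≤ L then ∏ p ∈ B, 2 / ((p : ℝ) - 3) else 0) *
          (profileSum w L (logProd B / L) - profileSum w L (logProd B / L + β)) ^ 2 := by
    rw [truncMass, ← hP, Finset.mul_sum, Finset.mul_sum, ← Finset.sum_sub_distrib, Finset.mul_sum]
    refine Finset.sum_le_sum fun B hB ↦ ?_
    have hg0 : 0 ≤ if logProd B ≤ L then ∏ p ∈ B, 2 / ((p : ℝ) - 3) else 0 := by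
      split_ifs
      · exact prod_two_div_nonneg hw (Finset.mem_powerset.1 hB)
      · rfl
    calc _ = (if logProd B ≤ L then ∏ p ∈ B, 2 / ((p : ℝ) - 3) else 0) * (L ^ 2 * (γ ^ 2 *
        (tailProfile (logProd B / L) - tailProfile (logProd B / L + β)) ^ 2 -
          14 * γ ^ 2 * η)) := by ring
      _ ≤ _ := mul_le_mul_of_nonneg_left (hD B) hg0
  have h4 : profileSum w L 0 ^ 2 * truncMass w L * (5 / q + 2 * κ) ≤
      (3.6 * γ * L) ^ 2 * truncMass w L * (5 / L + 2 * κ) := by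
    have := profileSum_nonneg w L 0
    gcongr
  have h5 : sqCoef (P.erase q) (fun p ↦ 2 / ((p : ℝ) - 3)) (sieveCoef (P.erase q) L β) ∅ ≤
      sqCoef (P.erase q) (fun p ↦ 2 / ((p : ℝ) - 3)) (sieveCoef (P.erase q) L β') ∅ := by
    have h10 : ∀ p ∈ P.erase q, 10 < p := fun p hp ↦ by
      have : w < p := by exact_mod_cast (mem_primesIoc.1 (Finset.mem_of_mem_erase hp)).2.1
      omega
    rw [sqCoef_empty, sqCoef_empty]
    refine Finset.sum_le_sum fun B hB ↦ mul_le_mul_of_nonneg_right ?_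
      (prod_two_div_nonneg hw ((Finset.mem_powerset.1 hB).trans (Finset.erase_subset _ _)))
    exact pow_le_pow_left₀ (sieveCoef_nonneg h10 hβ (Finset.mem_powerset.1 hB))
      (sieveCoef_mono h10 hβ' (Finset.mem_powerset.1 hB)) 2
  have h6 := mul_le_mul_of_nonneg_left h1.le (by positivity : 0 ≤ L ^ 4)
  refine le_trans ?_ ((sub_le_sub h3 h4).trans (h2.trans h5))
  refine le_trans (le_of_eq (by ring)) (h6.trans (le_of_eq ?_))
  field_simp

end MainLower

section BoxLower

open Filter Topology Real
open scoped Classical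

theorem exists_abs_sqCoef_le {w : ℕ} (hw : 10 ≤ w) :
    ∃ C : ℝ, 0 < C ∧ ∀ᶠ L : ℝ in atTop, ∀ q : ℕ, ∀ β, 0 ≤ β →
      ∀ R ⊆ (primesIoc w (exp L)).erase q,
        |sqCoef ((primesIoc w (exp L)).erase q) (fun p ↦ 2 / ((p : ℝ) - 3))
          (sieveCoef ((primesIoc w (exp L)).erase q) L β) R| ≤ 4 ^ R.card * (C * L ^ 4) := by
  set D : ℝ → ℝ := fun L ↦ ∑ D ∈ (primesIoc w (exp L)).powerset,
    if logProd D ≤ L then ∏ p ∈ D, 1 / ((p : ℝ) - 1) else 0 with hD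
  have hlim1 : Tendsto (fun L ↦ truncMass w L / L ^ 2) atTop
      (𝓝 (sieveConst 2 3 w * (1 / 2))) := by
    have := tendsto_sum_powerset_primesIoc (k := 1) (b := 3) (w := w) (by norm_num) (by omega)
      (by simp) (φ := fun _ ↦ 1) (by fun_prop) (a := 1) zero_le_one le_rfl
    simpa [truncMass, one_add_one_eq_two] using this
  have hlim2 : Tendsto (fun L ↦ D L / L) atTop (𝓝 (sieveConst 1 1 w)) := by
    have := tendsto_sum_powerset_primesIoc (k := 0) (b := 1) (w := w) (by norm_num) (by omega)
      (by simp) (φ := fun _ ↦ 1) (by fun_prop) (a := 1) zero_le_one le_rfl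
    simpa [hD] using this
  have hc1 : 0 < sieveConst 1 1 w := by
    rw [sieveConst_one]
    exact mertensProd_pos w
  have hc2 := sieveConst_two_pos (by omega : 6 ≤ w)
  set c1 := sieveConst 1 1 w
  set c2 := sieveConst 2 3 w
  refine ⟨(7 * (2 * c1)) ^ 2 * c2, by positivity, ?_⟩
  filter_upwards [hlim1.eventually (gt_mem_nhds (by linarith : c2 * (1 / 2) < c2)),
    hlim2.eventually (gt_mem_nhds (by linarith : c1 < 2 * c1)), eventually_gt_atTop 0] with
    L h1 h2 hL q β hβ R hR
  rw [div_lt_iff₀ (by positivity)] at h1 h2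
  have hQ : ∀ p ∈ primesIoc w (exp L), 10 < p := fun p hp ↦ by
    have : w < p := by exact_mod_cast (mem_primesIoc.1 hp).2.1
    omega
  have hP'P := Finset.erase_subset q (primesIoc w (exp L))
  set P := primesIoc w (exp L) with hP
  have hF0 := truncMass_nonneg hw L
  have h3 := abs_sqCoef_le (K := 7 * D L) (L := L) hR (f := fun p ↦ 2 / ((p : ℝ) - 3))
    (fun p hp ↦ by
      have : (10 : ℝ) < p := by exact_mod_cast hQ p (hP'P hp)
      refine ⟨div_nonneg zero_le_two (by linarith), ?_⟩
      rw [div_le_one (by linarith)]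
      linarith)
    (Y := sieveCoef (P.erase q) L β)
    (fun B hB ↦ by
      rw [abs_of_nonneg (sieveCoef_nonneg (fun p hp ↦ hQ p (hP'P hp)) hβ
        (Finset.mem_powerset.1 hB))]
      exact sieveCoef_le hP'P hQ hL hβ (Finset.mem_powerset.1 hB))
    (fun B _ hBL ↦ sieveCoef_eq_zero hL hβ hBL)
  refine h3.trans (mul_le_mul_of_nonneg_left ?_ (by positivity))
  have hD0 : 0 ≤ D L := Finset.sum_nonneg fun B hB ↦ by
    split_ifs
    · exact prod_primesIoc_nonneg (Finset.mem_powerset.1 hB)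
    · rfl
  have h4 : ∑ F ∈ (P.erase q).powerset,
      (if logProd F ≤ L then ∏ p ∈ F, 2 / ((p : ℝ) - 3) else 0) ≤ truncMass w L :=
    Finset.sum_le_sum_of_subset_of_nonneg (Finset.powerset_mono.2 hP'P) fun B hB _ ↦ by
      split_ifs
      · exact prod_two_div_nonneg hw (Finset.mem_powerset.1 hB)
      · rfl
  calc _ ≤ (7 * (2 * c1 * L)) ^ 2 * (c2 * L ^ 2) :=
        mul_le_mul (pow_le_pow_left₀ (by linarith) (by linarith) 2) (h4.trans h1.le)
          (Finset.sum_nonneg fun B hB ↦ by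
            split_ifs
            · exact prod_two_div_nonneg hw ((Finset.mem_powerset.1 hB).trans hP'P)
            · rfl) (by positivity)
    _ = _ := by ring

theorem sum_powerset_erase_eq {P : Finset ℕ} (m : ℕ) {f : Finset ℕ → ℝ} {L : ℝ}
    (hf : ∀ R ⊆ P.erase m, L < logProd R → f R = 0) :
    ∑ R ∈ (P.erase m).powerset, f R = f ∅ +
      ∑ R ∈ P.powerset.filter (fun R ↦ R.Nonempty ∧ logProd R ≤ L), if m ∈ R then 0 else f R := by
  have h1 : ∑ R ∈ P.powerset.filter (fun R ↦ R.Nonempty ∧ logProd R ≤ L),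
      (if m ∈ R then 0 else f R) =
      ∑ R ∈ (P.erase m).powerset.filter (fun R ↦ R.Nonempty ∧ logProd R ≤ L), f R := by
    rw [← Finset.sum_filter_add_sum_filter_not _ (fun R ↦ m ∈ R), Finset.sum_eq_zero, zero_add]
    · refine Finset.sum_congr ?_ fun R hR ↦ if_neg ?_
      · ext R
        simp only [Finset.mem_filter, Finset.mem_powerset, Finset.subset_erase]
        tauto
      · simp only [Finset.mem_filter, Finset.mem_powerset, Finset.subset_erase] at hR
        exact hR.1.2
    · intro R hR
      exact if_pos (Finset.mem_filter.1 hR).2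
  rw [h1, Finset.sum_filter, ← Finset.sum_erase_add _ _ (Finset.empty_mem_powerset _), add_comm,
    ← Finset.sum_erase_add (a := ∅) _ _ (Finset.empty_mem_powerset (P.erase m)),
    if_neg (by simp), add_zero]
  congr 1
  refine Finset.sum_congr rfl fun R hR ↦ ?_
  rw [Finset.mem_erase, Finset.mem_powerset] at hR
  split_ifs with h
  · rfl
  · refine hf R hR.2 ?_
    by_contra! h2
    exact h ⟨Finset.nonempty_iff_ne_empty.2 hR.1, h2⟩

theorem eventually_box_ge {w W : ℕ} [NeZero W] (hw : 10 ≤ w)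
    (hWw : ∀ p : ℕ, p.Prime → p ∣ W → p ≤ w) {h : ℕ} (hh : h ∈ shifts) {a b : ZMod W}
    (ha : IsUnit a) (hb : IsUnit b) {r u u' v v' ε : ℝ} (hr : 0 < r) (hr1 : 2 * r ≤ 1)
    (hu : 0 < u) (huu' : u ≤ u') (hu1 : u' ≤ 1) (hv : 0 < v) (hvv' : v ≤ v') (hv1 : v' ≤ 1)
    (hruv : 4 * r < u + v) (hrv : 2 * r < v) (hε : 0 < ε) :
    ∀ᶠ T : ℝ in atTop,
      T ^ 4 * (r ^ 4 * (sieveConst 2 3 w * mertensProd w ^ 2 *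
        (energyIntegral (u / r) - 13 * (exp (2 / ((w : ℝ) - 2)) - 1) - ε)) *
          ((W.totient : ℝ)⁻¹ * log (u' / u)) * ((W.totient : ℝ)⁻¹ * log (v' / v)) - ε) ≤
      ∑ m ∈ (primesIoc (exp (u * T)) (exp (u' * T))).filter (fun p : ℕ ↦ (p : ZMod W) = a),
        ∑ n ∈ (primesIoc (exp (v * T)) (exp (v' * T))).filter (fun p : ℕ ↦ (p : ZMod W) = b),
          1 / ((m : ℝ) * n) * sieveSum w (r * T) (m * n - h) ^ 2 := by
  obtain ⟨C, hC, hCT⟩ := exists_abs_sqCoef_le hw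
  set G := sieveConst 2 3 w * mertensProd w ^ 2 *
        (energyIntegral (u / r) - 13 * (exp (2 / ((w : ℝ) - 2)) - 1) - ε) with hG
  have hlim := ((tendsto_sum_primesIoc_inv ha hu huu').const_mul (r ^ 4 * G)).mul
    (tendsto_sum_primesIoc_inv hb hv hvv')
  have hLtop : Tendsto (fun T : ℝ ↦ r * T) atTop atTop := tendsto_id.const_mul_atTop hr
  have hε' : 0 < ε / (2 * (C * r ^ 4)) := by positivity
  have hexp : Tendsto (fun T : ℝ ↦ exp (u * T)) atTop atTop :=
    tendsto_exp_atTop.comp (tendsto_id.const_mul_atTop hu)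
  have hexpr : ∀ᶠ T : ℝ in atTop, r / u * (u * T) ≤ exp (u * T) := by
    have h1 := ((tendsto_exp_div_pow_atTop 1).comp
      (tendsto_id.const_mul_atTop hu)).eventually_ge_atTop (r / u)
    filter_upwards [h1, eventually_gt_atTop 0] with T h2 hT
    simpa [le_div_iff₀ (mul_pos hu hT)] using h2
  filter_upwards [hLtop.eventually hCT,
    hLtop.eventually (eventually_sqCoef_empty_ge hw (by positivity : 0 ≤ u / r) hε),
    eventually_sum_bilinForm_le hb hu huu' hu1 hv hvv' hv1 (ϱ := 2 * r) (by linarith) hrv hr1 hε',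
    hlim.eventually (lt_mem_nhds (sub_lt_self _ (half_pos hε))), hexp.eventually_gt_atTop w,
    hexpr, eventually_gt_atTop 0] with T hT1 hT2 hT3 hT4 hT5 hT6 hT
  set L := r * T with hL
  have hL0 : 0 < L := by positivity
  have hrT : r / u * (u * T) = L := by
    field_simp
    rw [hL]
  rw [hrT] at hT6
  set P := primesIoc w (exp L) with hP
  set P₁ := (primesIoc (exp (u * T)) (exp (u' * T))).filter fun p : ℕ ↦ (p : ZMod W) = a with hP₁
  set P₂ := (primesIoc (exp (v * T)) (exp (v' * T))).filter fun p : ℕ ↦ (p : ZMod W) = b with hP₂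
  set τ : Finset ℕ → ℕ → ℝ := fun R m ↦ sqCoef (P.erase m) (fun p ↦ 2 / ((p : ℝ) - 3))
    (sieveCoef (P.erase m) L (log m / L)) R with hτ
  set 𝓡 := P.powerset.filter (fun R ↦ R.Nonempty ∧ logProd R ≤ 2 * L) with h𝓡
  have hm₁ : ∀ m ∈ P₁, m.Prime ∧ w < m ∧ L ≤ m ∧ u / r ≤ log m / L := by
    intro m hm
    obtain ⟨h1, h2, h3⟩ := mem_primesIoc.1 (Finset.mem_filter.1 hm).1
    refine ⟨h1, by exact_mod_cast hT5.trans h2, hT6.trans h2.le, ?_⟩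
    have h4 : u * T ≤ log m := by
      rw [le_log_iff_exp_le (by linarith [exp_pos (u * T)])]
      exact h2.le
    rw [div_le_div_iff₀ hr hL0, hL]
    nlinarith
  have hβ : ∀ m ∈ P₁, 0 ≤ log m / L := fun m hm ↦
    (by positivity : 0 ≤ u / r).trans (hm₁ m hm).2.2.2
  have hm₂ : ∀ n ∈ P₂, n.Prime ∧ exp L < n := by
    intro n hn
    obtain ⟨h1, h2, h3⟩ := mem_primesIoc.1 (Finset.mem_filter.1 hn).1
    refine ⟨h1, lt_of_le_of_lt (exp_le_exp.2 ?_) h2⟩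
    rw [hL]
    nlinarith
  have hexpand : ∀ m ∈ P₁, ∀ n ∈ P₂, sieveSum w L (m * n - h) ^ 2 = τ ∅ m +
      ∑ R ∈ 𝓡, if m ∈ R then 0 else τ R m * ∏ p ∈ R, unitFactor h p (m * n) := by
    intro m hm n hn
    obtain ⟨h1, h2, h3, h4⟩ := hm₁ m hm
    obtain ⟨h5, h6⟩ := hm₂ n hn
    have hhm : h ≤ m * n := by
      have h7 : h ≤ 10 := by
        simp only [shifts, Finset.mem_insert, Finset.mem_singleton] at hh
        omega
      nlinarith [h5.pos]
    have h7 : m * n - h + h = m * n := Nat.sub_add_cancel hhm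
    rw [sieveSum_sq_eq hL0 hw hh h1 h2 (by rw [h7]; exact dvd_mul_right m n) ?_, h7,
      ← hP]
    · refine (sum_powerset_erase_eq (P := P) m (L := 2 * L)
        (f := fun R ↦ τ R m * ∏ p ∈ R, unitFactor h p (m * n)) fun R hR hRL ↦ ?_).trans ?_
      · simp only [hτ]
        rw [sqCoef_eq_zero (fun B _ hBL ↦ sieveCoef_eq_zero hL0 (hβ m hm) hBL) hRL, zero_mul]
      · rw [Finset.prod_empty, mul_one]
    · intro p hp hpn
      rw [h7] at hpn
      have hp' := mem_primesIoc.1 (Finset.mem_of_mem_erase hp)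
      rcases (hp'.1.dvd_mul).1 hpn with h8 | h8
      · exact Finset.ne_of_mem_erase hp ((Nat.prime_dvd_prime_iff_eq hp'.1 h1).1 h8)
      · rw [Nat.prime_dvd_prime_iff_eq hp'.1 h5] at h8
        rw [h8] at hp'
        linarith [hp'.2.2]
  set A := C * L ^ 4 with hA
  have hA0 : 0 < A := by positivity
  set α : Finset ℕ → ℕ → ℝ := fun R m ↦ if m ∈ R then 0 else τ R m / (m * A) with hα
  have hbil : ∑ m ∈ P₁, ∑ n ∈ P₂, 1 / ((m : ℝ) * n) *
      ∑ R ∈ 𝓡, (if m ∈ R then 0 else τ R m * ∏ p ∈ R, unitFactor h p (m * n)) =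
      A * ∑ R ∈ 𝓡, bilinForm P₁ P₂ (unitFactor h) (α R) R := by
    simp only [bilinForm, Finset.mul_sum]
    rw [Finset.sum_comm, Finset.sum_comm' (t' := P₂) (s' := fun _ ↦ 𝓡) (by simp [and_comm])]
    refine Finset.sum_congr rfl fun n _ ↦ ?_
    rw [Finset.sum_comm]
    refine Finset.sum_congr rfl fun R _ ↦ Finset.sum_congr rfl fun m hm ↦ ?_
    have hm0 : (m : ℝ) ≠ 0 := by exact_mod_cast (hm₁ m hm).1.ne_zero
    simp only [hα]
    split_ifs
    · simp
    · field_simp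
  have hbound := hT3 P₁ (Finset.filter_subset _ _) 𝓡 ?_ (fun p ↦ unitFactor h p) α ?_ ?_ ?_
  · have hsplit : ∑ m ∈ P₁, ∑ n ∈ P₂, 1 / ((m : ℝ) * n) * sieveSum w L (m * n - h) ^ 2 =
        (∑ m ∈ P₁, 1 / (m : ℝ) * τ ∅ m) * (∑ n ∈ P₂, 1 / (n : ℝ)) +
          A * ∑ R ∈ 𝓡, bilinForm P₁ P₂ (unitFactor h) (α R) R := by
      rw [← hbil, Finset.sum_mul_sum, ← Finset.sum_add_distrib]
      refine Finset.sum_congr rfl fun m hm ↦ ?_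
      rw [← Finset.sum_add_distrib]
      refine Finset.sum_congr rfl fun n hn ↦ ?_
      rw [hexpand m hm n hn, mul_add, ← one_div_mul_one_div]
      ring
    have hmain : G * L ^ 4 * (∑ m ∈ P₁, 1 / (m : ℝ)) * (∑ n ∈ P₂, 1 / (n : ℝ)) ≤
        (∑ m ∈ P₁, 1 / (m : ℝ) * τ ∅ m) * (∑ n ∈ P₂, 1 / (n : ℝ)) := by
      refine mul_le_mul_of_nonneg_right ?_ (Finset.sum_nonneg fun n _ ↦ by positivity)
      rw [Finset.mul_sum]
      refine Finset.sum_le_sum fun m hm ↦ ?_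
      obtain ⟨h1, h2, h3, h4⟩ := hm₁ m hm
      rw [mul_comm]
      refine mul_le_mul_of_nonneg_left ?_ (by positivity)
      refine le_trans (le_of_eq ?_) (hT2 m h1 h3 _ h4)
      rw [hG]
      ring
    have herr : A * |∑ R ∈ 𝓡, bilinForm P₁ P₂ (unitFactor h) (α R) R| ≤ T ^ 4 * (ε / 2) := by
      refine (mul_le_mul_of_nonneg_left hbound hA0.le).trans (le_of_eq ?_)
      rw [hA, hL]
      field_simp
    have hge := mul_le_mul_of_nonneg_left hT4.le (by positivity : 0 ≤ T ^ 4)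
    have habs := neg_abs_le (∑ R ∈ 𝓡, bilinForm P₁ P₂ (unitFactor h) (α R) R)
    have habs' := mul_le_mul_of_nonneg_left habs hA0.le
    rw [hsplit]
    have hL4 : G * L ^ 4 * (∑ m ∈ P₁, 1 / (m : ℝ)) * (∑ n ∈ P₂, 1 / (n : ℝ)) =
      T ^ 4 * (r ^ 4 * G * (∑ m ∈ P₁, 1 / (m : ℝ)) * (∑ n ∈ P₂, 1 / (n : ℝ))) := by
      rw [hL]
      ring
    rw [hL4] at hmain
    linarith
  · intro R hR
    obtain ⟨h1, h2, h3⟩ := Finset.mem_filter.1 hR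
    rw [Finset.mem_powerset] at h1
    refine ⟨h2, fun p hp ↦ ⟨(mem_primesIoc.1 (h1 hp)).1, fun hpW ↦ ?_⟩, ?_⟩
    · have h4 := mem_primesIoc.1 (h1 hp)
      have h5 : w < p := by exact_mod_cast h4.2.1
      have := hWw p h4.1 hpW
      omega
    · rw [← exp_logProd fun p hp ↦ (mem_primesIoc.1 (h1 hp)).1]
      refine exp_le_exp.2 (h3.trans (le_of_eq ?_))
      rw [hL]
      ring
  · intro R hR p hp
    have h4 := mem_primesIoc.1 (Finset.mem_powerset.1 (Finset.mem_filter.1 hR).1 hp)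
    have h5 : w < p := by exact_mod_cast h4.2.1
    exact isSieveFactor_unitFactor hh h4.1 (by omega)
  · intro R hR m hm
    have hm0 : (0 : ℝ) < m := by exact_mod_cast (hm₁ m hm).1.pos
    simp only [hα]
    split_ifs with hmR
    · rw [abs_zero]
      positivity
    · rw [abs_div, abs_of_pos (mul_pos hm0 hA0), div_le_div_iff₀ (mul_pos hm0 hA0) hm0]
      have := hT1 m _ (hβ m hm) R (Finset.subset_erase.2
        ⟨Finset.mem_powerset.1 (Finset.mem_filter.1 hR).1, hmR⟩)
      calc _ ≤ 4 ^ R.card * A * m := mul_le_mul_of_nonneg_right this hm0.le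
        _ = _ := by ring
  · intro R hR m hm p hp hpm
    have h4 := mem_primesIoc.1 (Finset.mem_powerset.1 (Finset.mem_filter.1 hR).1 hp)
    rw [Nat.prime_dvd_prime_iff_eq h4.1 (hm₁ m hm).1] at hpm
    simp only [hα]
    exact if_pos (hpm ▸ hp)

end BoxLower

section Combine

open Filter Topology Real
open scoped Classical

/-- Fixing the residue class of a product bounds the double sum from below by the sum over
pairs of residue classes. -/
lemma sum_units_le_sum_mul_eq {W : ℕ} [NeZero W] {c : ZMod W} (A B : Finset ℕ)
    {f : ℕ → ℕ → ℝ} (hf : ∀ m n, 0 ≤ f m n) :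
    ∑ a : (ZMod W)ˣ, ∑ m ∈ A.filter (fun p : ℕ ↦ (p : ZMod W) = a),
        ∑ n ∈ B.filter (fun p : ℕ ↦ (p : ZMod W) = c * ↑a⁻¹), f m n ≤
      ∑ m ∈ A, ∑ n ∈ B.filter (fun n : ℕ ↦ ((m * n : ℕ) : ZMod W) = c), f m n := by
  set G : ℕ → ℝ := fun m ↦ ∑ n ∈ B.filter (fun n : ℕ ↦ ((m * n : ℕ) : ZMod W) = c), f m n with hG
  have hG0 : ∀ m, 0 ≤ G m := fun m ↦ Finset.sum_nonneg fun n _ ↦ hf m n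
  have h1 : ∀ a : (ZMod W)ˣ, ∑ m ∈ A.filter (fun p : ℕ ↦ (p : ZMod W) = a),
      ∑ n ∈ B.filter (fun p : ℕ ↦ (p : ZMod W) = c * ↑a⁻¹), f m n =
      ∑ m ∈ A.filter (fun p : ℕ ↦ (p : ZMod W) = a), G m := by
    intro a
    refine Finset.sum_congr rfl fun m hm ↦ ?_
    have hma : (m : ZMod W) = a := (Finset.mem_filter.mp hm).2
    refine Finset.sum_congr (Finset.filter_congr fun n _ ↦ ?_) fun _ _ ↦ rfl
    push_cast
    rw [hma, Units.eq_mul_inv_iff_mul_eq, mul_comm]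
  rw [Finset.sum_congr rfl fun a _ ↦ h1 a]
  calc ∑ a : (ZMod W)ˣ, ∑ m ∈ A.filter (fun p : ℕ ↦ (p : ZMod W) = a), G m
      = ∑ x ∈ Finset.univ.map ⟨((↑) : (ZMod W)ˣ → ZMod W), Units.val_injective⟩,
          ∑ m ∈ A.filter (fun p : ℕ ↦ (p : ZMod W) = x), G m := by
        rw [Finset.sum_map]; rfl
    _ ≤ ∑ x : ZMod W, ∑ m ∈ A.filter (fun p : ℕ ↦ (p : ZMod W) = x), G m :=
        Finset.sum_le_sum_of_subset_of_nonneg (Finset.subset_univ _)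
          fun x _ _ ↦ Finset.sum_nonneg fun m _ ↦ hG0 m
    _ = ∑ m ∈ A, G m := Finset.sum_fiberwise _ _ _

lemma eventually_sum_box_ge {w W : ℕ} [NeZero W] (hw : 10 ≤ w)
    (hWw : ∀ p : ℕ, p.Prime → p ∣ W → p ≤ w) {h : ℕ} (hh : h ∈ shifts)
    {c : ZMod W} (hc : IsUnit c) {r u u' v v' ε : ℝ} (hr : 0 < r) (hr1 : 2 * r ≤ 1) (hu : 0 < u)
    (huu' : u ≤ u') (hu1 : u' ≤ 1) (hv : 0 < v) (hvv' : v ≤ v') (hv1 : v' ≤ 1)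
    (hruv : 4 * r < u + v) (hrv : 2 * r < v) (hε : 0 < ε) :
    ∀ᶠ T : ℝ in atTop,
      T ^ 4 * ((W.totient : ℝ)⁻¹ * (r ^ 4 * (sieveConst 2 3 w * mertensProd w ^ 2 *
          (energyIntegral (u / r) - 13 * (exp (2 / ((w : ℝ) - 2)) - 1)))) *
            (log (u' / u) * log (v' / v)) - ε) ≤
        ∑ m ∈ primesIoc (exp (u * T)) (exp (u' * T)),
          ∑ n ∈ (primesIoc (exp (v * T)) (exp (v' * T))).filter
              (fun n : ℕ ↦ ((m * n : ℕ) : ZMod W) = c),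
            1 / ((m : ℝ) * n) * sieveSum w (r * T) (m * n - h) ^ 2 := by
  have hφ : (0 : ℝ) < W.totient := by exact_mod_cast Nat.totient_pos.mpr (NeZero.pos W)
  have hL : 0 ≤ log (u' / u) := log_nonneg ((one_le_div hu).mpr huu')
  have hL' : 0 ≤ log (v' / v) := log_nonneg ((one_le_div hv).mpr hvv')
  have hc2 : 0 < sieveConst 2 3 w := sieveConst_two_pos (by omega)
  obtain ⟨φ, hφdef⟩ : ∃ φ : ℝ, φ = W.totient := ⟨_, rfl⟩
  rw [← hφdef] at hφ ⊢
  set D : ℝ := φ⁻¹ * (r ^ 4 * (sieveConst 2 3 w * mertensProd w ^ 2)) *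
    (log (u' / u) * log (v' / v)) + φ with hD
  have hDpos : 0 < D := by positivity
  have hev : ∀ᶠ T : ℝ in atTop, ∀ a : (ZMod W)ˣ, _ :=
    Filter.eventually_all.mpr fun a : (ZMod W)ˣ ↦ eventually_box_ge hw hWw hh a.isUnit
      (hc.mul (a⁻¹).isUnit) hr hr1 hu huu' hu1 hv hvv' hv1 hruv hrv (div_pos hε hDpos)
  filter_upwards [hev] with T hT
  refine le_trans (le_of_eq ?_) ((Finset.sum_le_sum fun a _ ↦ hT a).trans
    (sum_units_le_sum_mul_eq _ _ fun m n ↦ by positivity))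
  rw [Finset.sum_const, Finset.card_univ, ZMod.card_units_eq_totient, nsmul_eq_mul, ← hφdef]
  have hεD : ε = ε / D * D := by field_simp
  generalize ε / D = ε₀ at hεD ⊢
  rw [hεD, hD]
  field_simp
  ring

end Combine

section Boxes

open Filter Topology Real
open scoped Classical

lemma prime_mul_prime_eq {m n m' n' : ℕ} (hm : m.Prime) (hm' : m'.Prime)
    (hn' : n'.Prime) (hmn : m < n) (hmn' : m' < n') (h : m * n = m' * n') : m = m' ∧ n = n' := by
  have h1 : m ∣ m' * n' := h ▸ dvd_mul_right m n
  rcases (Nat.Prime.dvd_mul hm).mp h1 with h2 | h2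
  · rw [Nat.prime_dvd_prime_iff_eq hm hm'] at h2
    subst h2
    exact ⟨rfl, Nat.eq_of_mul_eq_mul_left hm.pos h⟩
  · rw [Nat.prime_dvd_prime_iff_eq hm hn'] at h2
    subst h2
    have : n = m' := Nat.eq_of_mul_eq_mul_left hm.pos (by rw [h, mul_comm])
    omega

lemma shifts_sub {h h' : ℕ} (hh : h ∈ shifts) (hh' : h' ∈ shifts) (hlt : h < h') :
    h' - h = 4 ∨ h' - h = 6 ∨ h' - h = 10 := by
  simp only [shifts, Finset.mem_insert, Finset.mem_singleton] at hh hh'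
  omega

lemma sum_boxes_le {w W b K N : ℕ} {u : ℕ → ℝ} {δ T L : ℝ} (hu : Monotone u)
    (hT : 0 ≤ T) (hKT : (K : ℝ) ≤ exp (u 0 * T)) (hδT : 20 ≤ exp ((1 - δ) * T))
    (huv : ∀ j < N, u (j + 1) ≤ 1 - δ - u j)
    (hno : ∀ p₁ p₂ p₃ p₄ d : ℕ, p₁.Prime → p₂.Prime → p₃.Prime → p₄.Prime → K < p₁ → K < p₂ →
      K < p₃ → K < p₄ → p₁ ≠ p₂ → p₃ ≠ p₄ → (d = 4 ∨ d = 6 ∨ d = 10) → p₃ * p₄ ≠ p₁ * p₂ + d) :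
    ∑ h ∈ shifts, ∑ j ∈ Finset.range N,
      ∑ m ∈ primesIoc (exp (u j * T)) (exp (u (j + 1) * T)),
        ∑ n ∈ (primesIoc (exp ((1 - δ - u j) * T)) (exp ((1 - u (j + 1)) * T))).filter
            (fun n : ℕ ↦ ((m * n : ℕ) : ZMod W) = ((b + h : ℕ) : ZMod W)),
          1 / ((m : ℝ) * n) * sieveSum w L (m * n - h) ^ 2 ≤
      ∑ x ∈ sieveRange W b δ T, 1 / (x : ℝ) * sieveSum w L x ^ 2 := by
  set A : ℕ → Finset ℕ := fun j ↦ primesIoc (exp (u j * T)) (exp (u (j + 1) * T)) with hA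
  set B : ℕ → Finset ℕ :=
    fun j ↦ primesIoc (exp ((1 - δ - u j) * T)) (exp ((1 - u (j + 1)) * T)) with hB
  set S : Finset (Σ _ : ℕ × ℕ, ℕ × ℕ) := (shifts ×ˢ Finset.range N).sigma fun a ↦
    (A a.2 ×ˢ B a.2).filter (fun q ↦ ((q.1 * q.2 : ℕ) : ZMod W) = ((b + a.1 : ℕ) : ZMod W)) with hS
  have hAlt : ∀ j m, m ∈ A j → m.Prime ∧ K < m := by
    intro j m hm
    obtain ⟨h1, h2, -⟩ := mem_primesIoc.mp hm
    refine ⟨h1, ?_⟩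
    have h3 : exp (u 0 * T) ≤ exp (u j * T) :=
      exp_le_exp.mpr (mul_le_mul_of_nonneg_right (hu (Nat.zero_le j)) hT)
    exact_mod_cast hKT.trans_lt (h3.trans_lt h2)
  have hAB : ∀ j < N, ∀ m ∈ A j, ∀ n ∈ B j, n.Prime ∧ m < n := by
    intro j hj m hm n hn
    obtain ⟨-, -, h1⟩ := mem_primesIoc.mp hm
    obtain ⟨h2, h3, -⟩ := mem_primesIoc.mp hn
    refine ⟨h2, ?_⟩
    have h4 : exp (u (j + 1) * T) ≤ exp ((1 - δ - u j) * T) :=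
      exp_le_exp.mpr (mul_le_mul_of_nonneg_right (huv j hj) hT)
    exact_mod_cast h1.trans_lt (h4.trans_lt h3)
  have hprod : ∀ j, ∀ m ∈ A j, ∀ n ∈ B j,
      exp ((1 - δ) * T) < (m * n : ℝ) ∧ (m * n : ℝ) ≤ exp T := by
    intro j m hm n hn
    obtain ⟨-, h1, h2⟩ := mem_primesIoc.mp hm
    obtain ⟨-, h3, h4⟩ := mem_primesIoc.mp hn
    constructor
    · rw [show (1 - δ) * T = u j * T + (1 - δ - u j) * T by ring, exp_add]
      exact mul_lt_mul'' h1 h3 (exp_pos _).le (exp_pos _).le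
    · rw [show T = u (j + 1) * T + (1 - u (j + 1)) * T by ring, exp_add]
      exact mul_le_mul h2 h4 (Nat.cast_nonneg _) (exp_pos _).le
  have h10 : ∀ h ∈ shifts, h ≤ 10 := by
    intro h hh
    simp only [shifts, Finset.mem_insert, Finset.mem_singleton] at hh
    omega
  have hbig : ∀ j, ∀ m ∈ A j, ∀ n ∈ B j, 20 < m * n := by
    intro j m hm n hn
    exact_mod_cast hδT.trans_lt (hprod j m hm n hn).1
  have hmemS : ∀ x ∈ S, (x.1.1 ∈ shifts ∧ x.1.2 < N) ∧ (x.2.1 ∈ A x.1.2 ∧ x.2.2 ∈ B x.1.2) ∧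
      ((x.2.1 * x.2.2 : ℕ) : ZMod W) = ((b + x.1.1 : ℕ) : ZMod W) := by
    intro x hx
    simpa only [hS, Finset.mem_sigma, Finset.mem_product, Finset.mem_range,
      Finset.mem_filter] using hx
  have hne : ∀ x ∈ S, ∀ y ∈ S, x.2.1 * x.2.2 - x.1.1 = y.2.1 * y.2.2 - y.1.1 →
      ¬ x.1.1 < y.1.1 := by
    intro x hx y hy hxy hlt
    obtain ⟨⟨hx1, hx2⟩, ⟨hx3, hx4⟩, -⟩ := hmemS x hx
    obtain ⟨⟨hy1, hy2⟩, ⟨hy3, hy4⟩, -⟩ := hmemS y hy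
    obtain ⟨ha, ha'⟩ := hAlt _ _ hx3
    obtain ⟨hb, hb'⟩ := hAlt _ _ hy3
    obtain ⟨hc, hc'⟩ := hAB _ hx2 _ hx3 _ hx4
    obtain ⟨hd, hd'⟩ := hAB _ hy2 _ hy3 _ hy4
    refine hno _ _ _ _ (y.1.1 - x.1.1) ha hc hb hd ha' (ha'.trans hc') hb' (hb'.trans hd')
      hc'.ne hd'.ne (shifts_sub hx1 hy1 hlt) ?_
    have := hbig _ _ hx3 _ hx4
    have := hbig _ _ hy3 _ hy4
    have := h10 _ hx1
    have := h10 _ hy1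
    omega
  have hinj : Set.InjOn (fun x : Σ _ : ℕ × ℕ, ℕ × ℕ ↦ x.2.1 * x.2.2 - x.1.1) S := by
    intro x hx y hy hxy
    have hhh : x.1.1 = y.1.1 := by
      have h1 := hne x hx y hy hxy
      have h2 := hne y hy x hx hxy.symm
      omega
    obtain ⟨⟨hx1, hx2⟩, ⟨hx3, hx4⟩, -⟩ := hmemS x hx
    obtain ⟨⟨hy1, hy2⟩, ⟨hy3, hy4⟩, -⟩ := hmemS y hy
    obtain ⟨hc, hc'⟩ := hAB _ hx2 _ hx3 _ hx4
    obtain ⟨hd, hd'⟩ := hAB _ hy2 _ hy3 _ hy4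
    have hmul : x.2.1 * x.2.2 = y.2.1 * y.2.2 := by
      have := hbig _ _ hx3 _ hx4
      have := hbig _ _ hy3 _ hy4
      have := h10 _ hx1
      have := h10 _ hy1
      simp only at hxy
      omega
    obtain ⟨hm, hn⟩ := prime_mul_prime_eq (hAlt _ _ hx3).1 (hAlt _ _ hy3).1 hd hc' hd' hmul
    have hjj : ∀ i j m, m ∈ A i → m ∈ A j → ¬ i < j := by
      intro i j m hi hj hij
      obtain ⟨-, -, h1⟩ := mem_primesIoc.mp hi
      obtain ⟨-, h2, -⟩ := mem_primesIoc.mp hj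
      have h3 : exp (u (i + 1) * T) ≤ exp (u j * T) :=
        exp_le_exp.mpr (mul_le_mul_of_nonneg_right (hu (by omega)) hT)
      linarith
    have hj : x.1.2 = y.1.2 := by
      have h1 := hjj _ _ _ hx3 (hm ▸ hy3)
      have h2 := hjj _ _ _ hy3 (hm ▸ hx3)
      omega
    exact Sigma.ext (Prod.ext hhh hj) (heq_of_eq (Prod.ext hm hn))
  have hmaps : ∀ x ∈ S, x.2.1 * x.2.2 - x.1.1 ∈ sieveRange W b δ T := by
    intro x hx
    obtain ⟨⟨hx1, hx2⟩, ⟨hx3, hx4⟩, hx5⟩ := hmemS x hx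
    have h1 := hbig _ _ hx3 _ hx4
    have h2 := h10 _ hx1
    have h3 := hprod _ _ hx3 _ hx4
    have h4 : ((x.1.1 : ℕ) : ℝ) ≤ 10 := by exact_mod_cast h2
    have h5 : (0 : ℝ) ≤ (x.1.1 : ℕ) := Nat.cast_nonneg _
    have h6 : x.1.1 ≤ x.2.1 * x.2.2 := by omega
    rw [mem_sieveRange, Nat.cast_sub h6, Nat.cast_mul]
    refine ⟨by linarith, by linarith, ?_⟩
    rw [← ZMod.natCast_eq_natCast_iff, Nat.cast_sub h6, hx5]
    push_cast
    ring
  have hsum : ∑ h ∈ shifts, ∑ j ∈ Finset.range N, ∑ m ∈ A j,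
      ∑ n ∈ (B j).filter (fun n : ℕ ↦ ((m * n : ℕ) : ZMod W) = ((b + h : ℕ) : ZMod W)),
        1 / ((m : ℝ) * n) * sieveSum w L (m * n - h) ^ 2 =
      ∑ x ∈ S, 1 / ((x.2.1 : ℝ) * x.2.2) * sieveSum w L (x.2.1 * x.2.2 - x.1.1) ^ 2 := by
    rw [hS, Finset.sum_sigma, Finset.sum_product]
    refine Finset.sum_congr rfl fun h _ ↦ Finset.sum_congr rfl fun j _ ↦ ?_
    rw [Finset.sum_filter, Finset.sum_product]
    exact Finset.sum_congr rfl fun m _ ↦ Finset.sum_filter _ _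
  rw [hsum]
  calc ∑ x ∈ S, 1 / ((x.2.1 : ℝ) * x.2.2) * sieveSum w L (x.2.1 * x.2.2 - x.1.1) ^ 2
      ≤ ∑ x ∈ S, 1 / ((x.2.1 * x.2.2 - x.1.1 : ℕ) : ℝ) *
          sieveSum w L (x.2.1 * x.2.2 - x.1.1) ^ 2 := by
        refine Finset.sum_le_sum fun x hx ↦ mul_le_mul_of_nonneg_right ?_ (sq_nonneg _)
        obtain ⟨⟨hx1, hx2⟩, ⟨hx3, hx4⟩, -⟩ := hmemS x hx
        have h1 := hbig _ _ hx3 _ hx4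
        have h2 := h10 _ hx1
        refine one_div_le_one_div_of_le (by exact_mod_cast (by omega)) ?_
        exact_mod_cast Nat.sub_le _ _
    _ = ∑ y ∈ S.image (fun x : Σ _ : ℕ × ℕ, ℕ × ℕ ↦ x.2.1 * x.2.2 - x.1.1),
          1 / ((y : ℕ) : ℝ) * sieveSum w L y ^ 2 :=
        (Finset.sum_image (f := fun y : ℕ ↦ 1 / (y : ℝ) * sieveSum w L y ^ 2) hinj).symm
    _ ≤ _ := by
        refine Finset.sum_le_sum_of_subset_of_nonneg ?_ fun y _ _ ↦ by positivity
        intro y hy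
        obtain ⟨x, hx, rfl⟩ := Finset.mem_image.mp hy
        exact hmaps x hx

end Boxes

section BoxIneq

open Filter Topology Real
open scoped Classical

lemma totient_primorial (w : ℕ) : ((primorial w).totient : ℝ) = primorial w * mertensProd w := by
  have h := Nat.totient_eq_mul_prod_factors (primorial w)
  have h' : (((primorial w).totient : ℚ) : ℝ) = _ := congrArg _ h
  push_cast at h'
  rw [h', primeFactors_primorial, mertensProd]
  congr 1
  exact Finset.prod_congr rfl fun p _ ↦ by rw [one_div]

lemma exists_coprime_shifts (w : ℕ) :
    ∃ b : ℕ, ∀ h ∈ shifts, (b + h).Coprime (primorial w) := by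
  set V : ℕ := ∏ p ∈ ((Finset.range (w + 1)).filter Nat.Prime).erase 3, p with hV
  have h3V : Nat.Coprime 3 V := by
    refine Nat.Coprime.prod_right fun p hp ↦ ?_
    obtain ⟨h1, h2⟩ := Finset.mem_erase.mp hp
    exact (Nat.coprime_primes Nat.prime_three (Finset.mem_filter.mp h2).2).mpr (Ne.symm h1)
  have hV0 : 0 < V := Finset.prod_pos fun p hp ↦
    (Finset.mem_filter.mp (Finset.mem_of_mem_erase hp)).2.pos
  obtain ⟨b, hb1, hb2⟩ := Nat.chineseRemainder h3V 1 (V - 1)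
  refine ⟨b, fun h hh ↦ ?_⟩
  refine Nat.Coprime.symm (Nat.coprime_of_dvd fun p hp hpW hpb ↦ ?_)
  simp only [shifts, Finset.mem_insert, Finset.mem_singleton] at hh
  by_cases hp3 : p = 3
  · subst hp3
    have : b % 3 = 1 := hb1
    omega
  · have hpV : p ∣ V := Finset.dvd_prod_of_mem (fun p ↦ p) (Finset.mem_erase.mpr
      ⟨hp3, Finset.mem_filter.mpr ⟨Finset.mem_range.mpr
        (Nat.lt_succ_of_le ((Nat.Prime.dvd_primorial_iff hp).mp hpW)), hp⟩⟩)
    have h1 : V ∣ b + 1 := by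
      have := hb2.add_right 1
      rw [Nat.sub_add_cancel hV0] at this
      exact (Nat.modEq_zero_iff_dvd.mp (this.trans (Nat.modEq_zero_iff_dvd.mpr dvd_rfl)))
    have h2 : p ∣ b + 1 := hpV.trans h1
    rcases hh with rfl | rfl | rfl
    · exact hp.one_lt.ne' (Nat.dvd_one.mp ((Nat.dvd_add_right hpb).mp h2))
    · have h3 : p ∣ 3 := by
        have := Nat.dvd_sub hpb h2
        rwa [show b + 4 - (b + 1) = 3 by omega] at this
      exact hp3 ((Nat.prime_dvd_prime_iff_eq hp Nat.prime_three).mp h3)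
    · have h3 : p ∣ 3 ^ 2 := by
        have := Nat.dvd_sub hpb h2
        rwa [show b + 10 - (b + 1) = 3 ^ 2 by omega] at this
      exact hp3 ((Nat.prime_dvd_prime_iff_eq hp Nat.prime_three).mp (hp.dvd_of_dvd_pow h3))

/-- The inequality between the weighted count of products of two primes and the total sieve weight
that holds when no two products of large primes differ by `4`, `6` or `10`. -/
theorem box_inequality_of_level {w K N : ℕ} (hw : 10 ≤ w) {u : ℕ → ℝ} {r δ : ℝ} (hr : 0 < r)
    (hδ : 0 < δ) (hrδ : 4 * r < 1 - δ) (hu : Monotone u) (hu0 : 0 < u 0)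
    (huδ : ∀ j < N, u (j + 1) - u j ≤ δ)
    (huv : ∀ j < N, u (j + 1) ≤ 1 - δ - u j) (huN : ∀ j < N, u j ≤ (1 - δ) / 2)
    (hno : ∀ p₁ p₂ p₃ p₄ d : ℕ, p₁.Prime → p₂.Prime → p₃.Prime → p₄.Prime → K < p₁ → K < p₂ →
      K < p₃ → K < p₄ → p₁ ≠ p₂ → p₃ ≠ p₄ → (d = 4 ∨ d = 6 ∨ d = 10) → p₃ * p₄ ≠ p₁ * p₂ + d) :
    3 * r * ∑ j ∈ Finset.range N,
        (energyIntegral (u j / r) - 13 * (exp (2 / ((w : ℝ) - 2)) - 1)) *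
          (log (u (j + 1) / u j) * log ((1 - u (j + 1)) / (1 - δ - u j))) ≤
      δ * ∫ t in (0 : ℝ)..1, (1 + 3 * (1 - t) + 3 * (1 - t) ^ 2) ^ 2 * (t ^ 2 / 2) := by
  obtain ⟨W, hWdef⟩ : ∃ W, W = primorial w := ⟨_, rfl⟩
  have hW0 : 0 < W := hWdef ▸ primorial_pos w
  have : NeZero W := ⟨hW0.ne'⟩
  have hWw : ∀ p : ℕ, p.Prime → p ∣ W → p ≤ w := fun p hp hpW ↦
    (Nat.Prime.dvd_primorial_iff hp).mp (hWdef ▸ hpW)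
  obtain ⟨b, hb⟩ := exists_coprime_shifts w
  rw [← hWdef] at hb
  have hγ := mertensProd_pos w
  have hc2 : 0 < sieveConst 2 3 w := sieveConst_two_pos (by omega)
  have hφ : (W.totient : ℝ) = W * mertensProd w := hWdef ▸ totient_primorial w
  have hWR : (0 : ℝ) < W := by exact_mod_cast hW0
  set I := ∫ t in (0 : ℝ)..1, (1 + 3 * (1 - t) + 3 * (1 - t) ^ 2) ^ 2 * (t ^ 2 / 2) with hI
  set X : ℕ → ℝ := fun j ↦ (W.totient : ℝ)⁻¹ * (r ^ 4 * (sieveConst 2 3 w * mertensProd w ^ 2 *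
    (energyIntegral (u j / r) - 13 * (exp (2 / ((w : ℝ) - 2)) - 1)))) *
      (log (u (j + 1) / u j) * log ((1 - u (j + 1)) / (1 - δ - u j))) with hX
  have hupos : ∀ j, 0 < u j := fun j ↦ hu0.trans_le (hu (Nat.zero_le j))
  have hmain : ∀ ε > 0, ∑ h ∈ shifts, ∑ j ∈ Finset.range N, (X j - ε) ≤
      1 / W * δ * r ^ 3 * (sieveConst 3 3 w * I) + ε := by
    intro ε hε
    have hlow : ∀ᶠ T : ℝ in atTop, ∀ h ∈ shifts, ∀ j ∈ Finset.range N,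
        T ^ 4 * (X j - ε) ≤ ∑ m ∈ primesIoc (exp (u j * T)) (exp (u (j + 1) * T)),
          ∑ n ∈ (primesIoc (exp ((1 - δ - u j) * T)) (exp ((1 - u (j + 1)) * T))).filter
            (fun n : ℕ ↦ ((m * n : ℕ) : ZMod W) = ((b + h : ℕ) : ZMod W)),
          1 / ((m : ℝ) * n) * sieveSum w (r * T) (m * n - h) ^ 2 := by
      rw [Filter.eventually_all_finset]
      intro h hh
      rw [Filter.eventually_all_finset]
      intro j hj
      have hjN := Finset.mem_range.mp hj
      have h1 := huδ j hjN
      have h2 := huv j hjN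
      have h3 := huN j hjN
      have h4 := hupos j
      have h5 := hu (Nat.le_succ j)
      exact eventually_sum_box_ge hw hWw hh ((ZMod.isUnit_iff_coprime _ _).mpr (hb h hh)) hr
        (by linarith) h4 h5 (by linarith) (by linarith) (by linarith) (by linarith)
        (by linarith) (by linarith) hε
    have hup := eventually_sum_sieveSum_sq_le hw hW0 hWw b hr hδ hrδ hε
    have hT1 : ∀ᶠ T : ℝ in atTop, (K : ℝ) ≤ exp (u 0 * T) :=
      (tendsto_exp_atTop.comp (tendsto_id.const_mul_atTop hu0)).eventually_ge_atTop _
    have hT2 : ∀ᶠ T : ℝ in atTop, 20 ≤ exp ((1 - δ) * T) :=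
      (tendsto_exp_atTop.comp (tendsto_id.const_mul_atTop
        (by linarith : (0 : ℝ) < 1 - δ))).eventually_ge_atTop _
    obtain ⟨T, h1, h2, h3, h4, h5⟩ :=
      (hlow.and (hup.and (hT1.and (hT2.and (eventually_gt_atTop (0 : ℝ)))))).exists
    have h6 := sum_boxes_le (w := w) (W := W) (b := b) (L := r * T) hu h5.le h3 h4 huv hno
    have h7 := (Finset.sum_le_sum fun h hh ↦ Finset.sum_le_sum fun j hj ↦ h1 h hh j hj).trans
      (h6.trans h2)
    simp only [← Finset.mul_sum] at h7
    exact le_of_mul_le_mul_left h7 (by positivity)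
  have hlim : 3 * ∑ j ∈ Finset.range N, X j ≤ 1 / W * δ * r ^ 3 * (sieveConst 3 3 w * I) := by
    refine le_of_forall_pos_le_add fun ε hε ↦ ?_
    have h1 := hmain (ε / (3 * N + 1)) (by positivity)
    have hcard : shifts.card = 3 := rfl
    rw [Finset.sum_const, hcard, Finset.sum_sub_distrib, Finset.sum_const, Finset.card_range] at h1
    have h2 : ε = (3 * N + 1) * (ε / (3 * N + 1)) := by field_simp
    simp only [nsmul_eq_mul] at h1
    push_cast at h1
    rw [h2]
    linarith
  have hXj : ∀ j, X j = sieveConst 3 3 w / W * r ^ 3 * (r *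
      ((energyIntegral (u j / r) - 13 * (exp (2 / ((w : ℝ) - 2)) - 1)) *
      (log (u (j + 1) / u j) * log ((1 - u (j + 1)) / (1 - δ - u j))))) := by
    intro j
    simp only [hX]
    rw [hφ, sieveConst_three (by omega)]
    field_simp
  simp only [hXj, ← Finset.mul_sum] at hlim
  have hc3 : 0 < sieveConst 3 3 w := by
    rw [sieveConst_three (by omega)]; positivity
  refine le_of_mul_le_mul_left ?_ (by positivity : 0 < sieveConst 3 3 w / W * r ^ 3)
  calc _ = _ := by ring
    _ ≤ _ := hlim
    _ = _ := by ring

theorem box_inequality {K N : ℕ} {u : ℕ → ℝ} {r δ : ℝ} (hr : 0 < r)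
    (hδ : 0 < δ) (hrδ : 4 * r < 1 - δ) (hu : Monotone u) (hu0 : 0 < u 0)
    (huδ : ∀ j < N, u (j + 1) - u j ≤ δ)
    (huv : ∀ j < N, u (j + 1) ≤ 1 - δ - u j) (huN : ∀ j < N, u j ≤ (1 - δ) / 2)
    (hno : ∀ p₁ p₂ p₃ p₄ d : ℕ, p₁.Prime → p₂.Prime → p₃.Prime → p₄.Prime → K < p₁ → K < p₂ →
      K < p₃ → K < p₄ → p₁ ≠ p₂ → p₃ ≠ p₄ → (d = 4 ∨ d = 6 ∨ d = 10) → p₃ * p₄ ≠ p₁ * p₂ + d) :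
    3 * r * ∑ j ∈ Finset.range N, energyIntegral (u j / r) *
          (log (u (j + 1) / u j) * log ((1 - u (j + 1)) / (1 - δ - u j))) ≤
      δ * ∫ t in (0 : ℝ)..1, (1 + 3 * (1 - t) + 3 * (1 - t) ^ 2) ^ 2 * (t ^ 2 / 2) := by
  have hlim : Tendsto (fun w : ℕ ↦ 3 * r * ∑ j ∈ Finset.range N,
      (energyIntegral (u j / r) - 13 * (exp (2 / ((w : ℝ) - 2)) - 1)) *
        (log (u (j + 1) / u j) * log ((1 - u (j + 1)) / (1 - δ - u j)))) atTop
      (𝓝 (3 * r * ∑ j ∈ Finset.range N, (energyIntegral (u j / r) - 13 * (exp 0 - 1)) *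
        (log (u (j + 1) / u j) * log ((1 - u (j + 1)) / (1 - δ - u j))))) := by
    have h0 : Tendsto (fun w : ℕ ↦ exp (2 / ((w : ℝ) - 2))) atTop (𝓝 (exp 0)) :=
      (continuous_exp.tendsto 0).comp (tendsto_const_nhds.div_atTop
        (tendsto_atTop_add_const_right _ _ tendsto_natCast_atTop_atTop))
    exact (tendsto_finsetSum _ fun j _ ↦ (tendsto_const_nhds.sub
      ((h0.sub_const 1).const_mul 13)).mul_const _).const_mul _
  rw [exp_zero, sub_self, mul_zero] at hlim
  simp only [sub_zero] at hlim
  exact le_of_tendsto hlim (eventually_atTop.mpr ⟨10, fun w hw ↦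
    box_inequality_of_level hw hr hδ hrδ hu hu0 huδ huv huN hno⟩)

end BoxIneq

section EnergyEval

open Filter Topology Real

lemma integral_sum_mul_pow (c : ℕ → ℝ) (n : ℕ) (a b : ℝ) :
    ∫ x in a..b, ∑ i ∈ Finset.range n, c i * x ^ i =
      ∑ i ∈ Finset.range n, c i * ((b ^ (i + 1) - a ^ (i + 1)) / (i + 1)) := by
  rw [intervalIntegral.integral_finsetSum fun i _ ↦
    (by fun_prop : Continuous fun x : ℝ ↦ c i * x ^ i).intervalIntegrable _ _]
  refine Finset.sum_congr rfl fun i _ ↦ ?_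
  rw [intervalIntegral.integral_const_mul, integral_pow]

lemma continuous_energyIntegrand (β : ℝ) :
    Continuous fun s ↦ (tailProfile s - tailProfile (s + β)) ^ 2 * s := by
  have := continuous_tailProfile
  fun_prop

lemma energyIntegral_nonneg (β : ℝ) : 0 ≤ energyIntegral β :=
  intervalIntegral.integral_nonneg zero_le_one fun _ hs ↦ mul_nonneg (sq_nonneg _) hs.1

lemma energyIntegral_mono {β β' : ℝ} (hβ : 0 ≤ β) (h : β ≤ β') :
    energyIntegral β ≤ energyIntegral β' := by
  refine intervalIntegral.integral_mono_on zero_le_one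
    ((continuous_energyIntegrand β).intervalIntegrable _ _)
    ((continuous_energyIntegrand β').intervalIntegrable _ _) fun s hs ↦ ?_
  have h1 : tailProfile (s + β) ≤ tailProfile s := antitone_tailProfile (by linarith)
  have h2 : tailProfile (s + β') ≤ tailProfile (s + β) := antitone_tailProfile (by linarith)
  refine mul_le_mul_of_nonneg_right (pow_le_pow_left₀ (by linarith) (by linarith) 2) hs.1

lemma tailProfile_of_le_one {x : ℝ} (hx : x ≤ 1) :
    tailProfile x = (1 - x) + 3 / 2 * (1 - x) ^ 2 + (1 - x) ^ 3 := by
  rw [tailProfile, max_eq_left (by linarith)]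

lemma energyIntegral_of_one_le {β : ℝ} (hβ : 1 ≤ β) : energyIntegral β = 13 / 28 := by
  have h : energyIntegral β = ∫ s in (0 : ℝ)..1, ∑ i ∈ Finset.range 8,
      [0, 49 / 4, -49, 161 / 2, -70, 137 / 4, -9, 1].getD i 0 * s ^ i := by
    refine intervalIntegral.integral_congr fun s hs ↦ ?_
    rw [Set.uIcc_of_le zero_le_one] at hs
    rw [tailProfile_of_le_one hs.2, tailProfile_of_one_le (by linarith [hs.1])]
    simp [Finset.sum_range_succ]
    ring
  rw [h, integral_sum_mul_pow]
  simp [Finset.sum_range_succ]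
  norm_num

lemma energyIntegral_of_le_one {β : ℝ} (hβ : 0 ≤ β) (hβ1 : β ≤ 1) :
    energyIntegral β = 79 / 20 * β ^ 2 - 469 / 60 * β ^ 3 + 55 / 8 * β ^ 4 - 7 / 2 * β ^ 5 +
      7 / 6 * β ^ 6 - 33 / 140 * β ^ 7 + 1 / 40 * β ^ 8 := by
  rw [energyIntegral, ← intervalIntegral.integral_add_adjacent_intervals (b := 1 - β)
    ((continuous_energyIntegrand β).intervalIntegrable _ _)
    ((continuous_energyIntegrand β).intervalIntegrable _ _)]
  have h1 : ∫ s in (0 : ℝ)..(1 - β), (tailProfile s - tailProfile (s + β)) ^ 2 * s =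
      ∫ s in (0 : ℝ)..(1 - β), ∑ i ∈ Finset.range 6,
        [0, β ^ 2 * (7 - 9 / 2 * β + β ^ 2) ^ 2,
          2 * β ^ 2 * (7 - 9 / 2 * β + β ^ 2) * (3 * β - 9),
          β ^ 2 * ((3 * β - 9) ^ 2 + 6 * (7 - 9 / 2 * β + β ^ 2)), 6 * β ^ 2 * (3 * β - 9),
          9 * β ^ 2].getD i 0 * s ^ i := by
    refine intervalIntegral.integral_congr fun s hs ↦ ?_
    rw [Set.uIcc_of_le (by linarith)] at hs
    rw [tailProfile_of_le_one (by linarith [hs.2]), tailProfile_of_le_one (by linarith [hs.2])]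
    simp [Finset.sum_range_succ]
    ring
  have h2 : ∫ s in (1 - β)..1, (tailProfile s - tailProfile (s + β)) ^ 2 * s =
      ∫ s in (1 - β)..1, ∑ i ∈ Finset.range 8,
        [0, 49 / 4, -49, 161 / 2, -70, 137 / 4, -9, 1].getD i 0 * s ^ i := by
    refine intervalIntegral.integral_congr fun s hs ↦ ?_
    rw [Set.uIcc_of_le (by linarith)] at hs
    rw [tailProfile_of_le_one hs.2, tailProfile_of_one_le (by linarith [hs.1])]
    simp [Finset.sum_range_succ]
    ring
  rw [h1, h2, integral_sum_mul_pow, integral_sum_mul_pow]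
  simp [Finset.sum_range_succ]
  ring

lemma integral_sieve_profile :
    ∫ t in (0 : ℝ)..1, (1 + 3 * (1 - t) + 3 * (1 - t) ^ 2) ^ 2 * (t ^ 2 / 2) = 361 / 420 := by
  have h : ∫ t in (0 : ℝ)..1, (1 + 3 * (1 - t) + 3 * (1 - t) ^ 2) ^ 2 * (t ^ 2 / 2) =
      ∫ t in (0 : ℝ)..1, ∑ i ∈ Finset.range 7,
        [0, 0, 49 / 2, -63, 123 / 2, -27, 9 / 2].getD i 0 * t ^ i := by
    refine intervalIntegral.integral_congr fun t _ ↦ ?_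
    simp [Finset.sum_range_succ]
    ring
  rw [h, integral_sum_mul_pow]
  simp [Finset.sum_range_succ]
  norm_num

end EnergyEval

section Numerics

open Filter Topology Real

lemma integral_le_sum_mesh {g : ℝ → ℝ} (hg : Continuous g) {t₀ μ : ℝ} (hμ : 0 ≤ μ) {c : ℕ → ℝ}
    (N : ℕ) (hc : ∀ j < N, ∀ t, t₀ + j * μ ≤ t → t ≤ t₀ + (j + 1) * μ → g t ≤ c j) :
    ∫ t in t₀..(t₀ + N * μ), g t ≤ ∑ j ∈ Finset.range N, μ * c j := by
  have h := intervalIntegral.sum_integral_adjacent_intervals (f := g) (μ := MeasureTheory.volume)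
    (a := fun j : ℕ ↦ t₀ + j * μ) (n := N) fun k _ ↦ hg.intervalIntegrable _ _
  simp only [Nat.cast_zero, zero_mul, add_zero] at h
  rw [← h]
  refine Finset.sum_le_sum fun j hj ↦ ?_
  have hle : t₀ + (j : ℝ) * μ ≤ t₀ + ((j + 1 : ℕ) : ℝ) * μ := by push_cast; linarith
  calc ∫ t in (t₀ + (j : ℝ) * μ)..(t₀ + ((j + 1 : ℕ) : ℝ) * μ), g t
      ≤ ∫ _ in (t₀ + (j : ℝ) * μ)..(t₀ + ((j + 1 : ℕ) : ℝ) * μ), c j := by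
        refine intervalIntegral.integral_mono_on hle (hg.intervalIntegrable _ _)
          intervalIntegrable_const fun t ht ↦ hc j (Finset.mem_range.mp hj) t ht.1 ?_
        have := ht.2
        push_cast at this
        exact this
    _ = μ * c j := by
        rw [intervalIntegral.integral_const, smul_eq_mul]
        push_cast
        ring

lemma geom_sum_le_inv {x : ℝ} (hx : 0 ≤ x) (hx1 : x < 1) (n : ℕ) :
    ∑ i ∈ Finset.range n, x ^ i ≤ 1 / (1 - x) := by
  rw [le_div_iff₀ (by linarith), geom_sum_mul_neg]
  linarith [pow_nonneg hx n]

lemma log_mul_log_ge {a b δ μ : ℝ} (ha : 0 < a) (hb : b = a + μ) (hμ : 0 ≤ μ) (hμδ : μ ≤ δ)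
    (hab : b ≤ 1 - δ - a) :
    (δ - μ) * μ / (b * (1 - b)) ≤ log (b / a) * log ((1 - b) / (1 - δ - a)) := by
  have hb0 : 0 < b := by linarith
  have hb1 : 0 < 1 - b := by linarith
  have hd : 0 < 1 - δ - a := by linarith
  have h1 : μ / b ≤ log (b / a) := by
    refine le_trans (le_of_eq ?_) (one_sub_inv_le_log_of_pos (div_pos hb0 ha))
    rw [inv_div, eq_sub_iff_add_eq, ← add_div, div_eq_one_iff_eq hb0.ne']
    linarith
  have h2 : (δ - μ) / (1 - b) ≤ log ((1 - b) / (1 - δ - a)) := by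
    refine le_trans (le_of_eq ?_) (one_sub_inv_le_log_of_pos (div_pos hb1 hd))
    rw [inv_div, eq_sub_iff_add_eq, ← add_div, div_eq_one_iff_eq hb1.ne']
    linarith
  calc (δ - μ) * μ / (b * (1 - b)) = μ / b * ((δ - μ) / (1 - b)) := by
        rw [div_mul_div_comm, mul_comm (δ - μ)]
    _ ≤ _ := mul_le_mul h1 h2 (div_nonneg (by linarith) hb1.le) ((div_nonneg hμ hb0.le).trans h1)

/-- The polynomial minorant of the density on the range where the energy integral varies. -/
noncomputable def lowDensity (r t : ℝ) : ℝ :=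
  ∑ k ∈ Finset.range 7, ∑ i ∈ Finset.range 6,
    [79 / 20, -469 / 60, 55 / 8, -7 / 2, 7 / 6, -33 / 140, 1 / 40].getD k 0 / r ^ (k + 2) *
      t ^ (k + i + 1)

/-- The polynomial minorant of the density on the range where the energy integral is constant. -/
noncomputable def highDensity (t : ℝ) : ℝ :=
  13 / 7 * ∑ i ∈ Finset.range 6, ((1 - 2 * t) ^ 2) ^ i

lemma lowDensity_le {r t : ℝ} (ht : 0 < t) (htr : t ≤ r) (ht1 : t < 1) :
    lowDensity r t ≤ energyIntegral (t / r) / (t * (1 - t)) := by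
  have hr : 0 < r := ht.trans_le htr
  have h1 : lowDensity r t = energyIntegral (t / r) / t * ∑ i ∈ Finset.range 6, t ^ i := by
    rw [energyIntegral_of_le_one (div_nonneg ht.le hr.le) ((div_le_one hr).mpr htr), lowDensity]
    simp [Finset.sum_range_succ]
    field_simp
    ring
  rw [h1, ← div_div, div_eq_mul_one_div (energyIntegral (t / r) / t) (1 - t)]
  exact mul_le_mul_of_nonneg_left (geom_sum_le_inv ht.le ht1 6)
    (div_nonneg (energyIntegral_nonneg _) ht.le)

lemma highDensity_le {t : ℝ} (ht : 0 < t) (ht1 : t < 1) :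
    highDensity t ≤ 13 / 28 / (t * (1 - t)) := by
  have h1 : (1 - 2 * t) ^ 2 < 1 := by nlinarith
  have h2 := geom_sum_le_inv (sq_nonneg (1 - 2 * t)) h1 6
  have h3 : 1 - (1 - 2 * t) ^ 2 = 4 * (t * (1 - t)) := by ring
  have h4 : 0 < t * (1 - t) := mul_pos ht (by linarith)
  rw [h3] at h2
  rw [highDensity]
  calc 13 / 7 * ∑ i ∈ Finset.range 6, ((1 - 2 * t) ^ 2) ^ i ≤ 13 / 7 * (1 / (4 * (t * (1 - t)))) :=
        mul_le_mul_of_nonneg_left h2 (by norm_num)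
    _ = 13 / 28 / (t * (1 - t)) := by field_simp; norm_num

lemma integral_lowDensity (r a b : ℝ) : ∫ t in a..b, lowDensity r t =
    ∑ k ∈ Finset.range 7, ∑ i ∈ Finset.range 6,
      [79 / 20, -469 / 60, 55 / 8, -7 / 2, 7 / 6, -33 / 140, 1 / 40].getD k 0 / r ^ (k + 2) *
        ((b ^ (k + i + 2) - a ^ (k + i + 2)) / (k + i + 2)) := by
  unfold lowDensity
  rw [intervalIntegral.integral_finsetSum fun k _ ↦ Continuous.intervalIntegrable (by fun_prop) _ _]
  refine Finset.sum_congr rfl fun k _ ↦ ?_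
  rw [intervalIntegral.integral_finsetSum fun k _ ↦ Continuous.intervalIntegrable (by fun_prop) _ _]
  refine Finset.sum_congr rfl fun i _ ↦ ?_
  rw [intervalIntegral.integral_const_mul, integral_pow]
  push_cast
  ring

lemma integral_highDensity (a b : ℝ) : ∫ t in a..b, highDensity t =
    13 / 7 * ∑ i ∈ Finset.range 6,
      (((1 - 2 * a) ^ (2 * i + 1) - (1 - 2 * b) ^ (2 * i + 1)) / (2 * (2 * i + 1))) := by
  unfold highDensity
  rw [intervalIntegral.integral_const_mul, intervalIntegral.integral_finsetSum
    fun k _ ↦ Continuous.intervalIntegrable (by fun_prop) _ _]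
  congr 1
  refine Finset.sum_congr rfl fun i _ ↦ ?_
  simp only [← pow_mul]
  rw [intervalIntegral.integral_comp_sub_mul (fun x ↦ x ^ (2 * i)) two_ne_zero, integral_pow,
    smul_eq_mul]
  push_cast
  field_simp

lemma density_numeric : 361 / 420 < 3 * (2499 / 10000 : ℝ) * (799 / 800 / (10005 / 10000)) *
    ((∫ t in (1 / 1000 : ℝ)..(2499 / 10000), lowDensity (2499 / 10000) t) +
      ∫ t in (2499 / 10000 : ℝ)..(4998 / 10000), highDensity t) := by
  rw [integral_lowDensity, integral_highDensity]
  norm_num [Finset.sum_range_succ]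

end Numerics

section Final

open Filter Topology Real

lemma div_mul_one_sub_le {t b μ J J' : ℝ} (ht : 1 / 1000 ≤ t) (htb : t ≤ b)
    (hbt : b ≤ t + 2 * μ) (hb : b < 1) (hμ : μ ≤ 1 / 4000000) (hJ : 0 ≤ J) (hJJ' : J ≤ J') :
    J / (t * (1 - t)) ≤ 10005 / 10000 * J' / (b * (1 - b)) := by
  have h1 : 0 < t * (1 - t) := mul_pos (by linarith) (by linarith)
  have h2 : 0 < b * (1 - b) := mul_pos (by linarith) (by linarith)
  have h3 : b * (1 - b) ≤ 10005 / 10000 * (t * (1 - t)) := by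
    calc b * (1 - b) ≤ b * (1 - t) := mul_le_mul_of_nonneg_left (by linarith) (by linarith)
      _ ≤ 10005 / 10000 * t * (1 - t) := mul_le_mul_of_nonneg_right (by linarith) (by linarith)
      _ = _ := by ring
  rw [div_le_div_iff₀ h1 h2]
  calc J * (b * (1 - b)) ≤ J' * (10005 / 10000 * (t * (1 - t))) :=
        mul_le_mul hJJ' h3 h2.le (hJ.trans hJJ')
    _ = _ := by ring

lemma sum_boxes_numeric {r δ μ : ℝ} {N₁ N₂ : ℕ} {u : ℕ → ℝ} (hr : r = 2499 / 10000)
    (hδ : δ = 1 / 5000) (hμ : μ = 1 / 4000000) (hN₁ : (N₁ : ℝ) = 995600)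
    (hN₂ : (N₂ : ℝ) = 999600) (hu : ∀ j, u j = 1 / 1000 + ((j : ℝ) + 1) * μ) :
    δ * (361 / 420) < 3 * r * ∑ j ∈ Finset.range (N₁ + N₂), energyIntegral (u j / r) *
      (log (u (j + 1) / u j) * log ((1 - u (j + 1)) / (1 - δ - u j))) := by
  have hμ0 : 0 < μ := by rw [hμ]; norm_num
  have hr0 : 0 < r := by rw [hr]; norm_num
  have hus : ∀ j, u (j + 1) = u j + μ := fun j ↦ by rw [hu, hu]; push_cast; ring
  have hulow : ∀ j, 1 / 1000 ≤ u j := fun j ↦ by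
    rw [hu]
    have : 0 ≤ ((j : ℝ) + 1) * μ := by positivity
    linarith
  have huhigh : ∀ j < N₁ + N₂, u j ≤ 4998 / 10000 := fun j hj ↦ by
    have h1 : (j : ℝ) + 1 ≤ N₁ + N₂ := by exact_mod_cast hj
    rw [hN₁, hN₂] at h1
    rw [hu, hμ]
    linarith
  set c : ℕ → ℝ := fun j ↦
    10005 / 10000 * energyIntegral (u j / r) / (u (j + 1) * (1 - u (j + 1))) with hc
  have hlow : ∫ t in (1 / 1000 : ℝ)..(2499 / 10000), lowDensity (2499 / 10000) t ≤
      ∑ j ∈ Finset.range N₁, μ * c j := by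
    have h := integral_le_sum_mesh (g := lowDensity r) (by unfold lowDensity; fun_prop)
      (t₀ := 1 / 1000) hμ0.le (c := c) N₁ fun j hj t ht1 ht2 ↦ ?_
    · rwa [hr, hN₁, hμ, show (1 / 1000 + 995600 * (1 / 4000000) : ℝ) = 2499 / 10000 by norm_num,
        ← hμ] at h
    · rw [← hu] at ht2
      have h1 : 1 / 1000 ≤ t := le_trans (by linarith [show 0 ≤ (j : ℝ) * μ by positivity]) ht1
      have h2 : u j ≤ r := by
        have h1 : (j : ℝ) + 1 ≤ N₁ := by exact_mod_cast hj
        rw [hN₁] at h1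
        rw [hu, hμ, hr]
        linarith
      have h3 : u j < 1 - μ := by rw [hμ]; rw [hr] at h2; linarith
      refine (lowDensity_le (by linarith) (ht2.trans h2) (by linarith)).trans ?_
      refine div_mul_one_sub_le h1 (by rw [hus]; linarith) ?_ (by rw [hus]; linarith) hμ.le
        (energyIntegral_nonneg _) (energyIntegral_mono (div_nonneg (by linarith) hr0.le)
          (div_le_div_of_nonneg_right ht2 hr0.le))
      rw [hus, hu]
      linarith
  have hhigh : ∫ t in (2499 / 10000 : ℝ)..(4998 / 10000), highDensity t ≤
      ∑ j ∈ Finset.range N₂, μ * c (N₁ + j) := by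
    have h := integral_le_sum_mesh (g := highDensity) (by unfold highDensity; fun_prop)
      (t₀ := 2499 / 10000) hμ0.le (c := fun j ↦ c (N₁ + j)) N₂ fun j hj t ht1 ht2 ↦ ?_
    · rwa [hN₂, hμ, show (2499 / 10000 + 999600 * (1 / 4000000) : ℝ) = 4998 / 10000 by norm_num,
        ← hμ] at h
    · have huj : u (N₁ + j) = 2499 / 10000 + (j + 1) * μ := by
        rw [hu, Nat.cast_add, hN₁, hμ]
        ring
      rw [← huj] at ht2
      have h0 : 0 ≤ (j : ℝ) * μ := by positivity
      have h3 := huhigh (N₁ + j) (by omega)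
      have h4 : (1 : ℝ) ≤ u (N₁ + j) / r := by
        rw [one_le_div hr0, huj, hr]
        linarith
      refine (highDensity_le (by linarith) (by linarith)).trans ?_
      refine div_mul_one_sub_le (by linarith) (by rw [hus]; linarith) ?_
        (by rw [hus, hμ]; linarith) hμ.le (by norm_num) (energyIntegral_of_one_le h4).ge
      rw [hus, huj]
      linarith
  have hterm : ∀ j ∈ Finset.range (N₁ + N₂), (δ - μ) / (10005 / 10000) * (μ * c j) ≤
      energyIntegral (u j / r) *
        (log (u (j + 1) / u j) * log ((1 - u (j + 1)) / (1 - δ - u j))) := by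
    intro j hj
    have h1 := huhigh j (Finset.mem_range.mp hj)
    have h2 := hulow j
    refine le_trans (le_of_eq ?_) (mul_le_mul_of_nonneg_left (log_mul_log_ge (μ := μ)
      (by linarith) (hus j) hμ0.le (by rw [hμ, hδ]; norm_num)
      (by rw [hus, hμ, hδ]; linarith)) (energyIntegral_nonneg _))
    simp only [hc]
    ring
  have hsum := Finset.sum_le_sum hterm
  rw [← Finset.mul_sum, Finset.sum_range_add] at hsum
  have hnum := density_numeric
  have hδ0 : (0 : ℝ) < δ := by rw [hδ]; norm_num
  calc δ * (361 / 420) < δ * _ := mul_lt_mul_of_pos_left hnum hδ0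
    _ ≤ δ * (3 * (2499 / 10000 : ℝ) * (799 / 800 / (10005 / 10000)) *
        (∑ j ∈ Finset.range N₁, μ * c j + ∑ j ∈ Finset.range N₂, μ * c (N₁ + j))) := by
        refine mul_le_mul_of_nonneg_left (mul_le_mul_of_nonneg_left (add_le_add hlow hhigh)
          (by norm_num)) hδ0.le
    _ = 3 * r * ((δ - μ) / (10005 / 10000) *
        (∑ j ∈ Finset.range N₁, μ * c j + ∑ j ∈ Finset.range N₂, μ * c (N₁ + j))) := by
        rw [hr, hδ, show (1 / 5000 - μ : ℝ) = 1 / 5000 * (799 / 800) by rw [hμ]; norm_num]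
        ring
    _ ≤ _ := mul_le_mul_of_nonneg_left hsum (by positivity)

/-- There are two products of two distinct primes, all exceeding `K`, at distance `4`, `6`
or `10`. -/
theorem exists_primes_mul_eq_mul_add (K : ℕ) :
    ∃ p₁ p₂ p₃ p₄ d : ℕ, p₁.Prime ∧ p₂.Prime ∧ p₃.Prime ∧ p₄.Prime ∧ K < p₁ ∧ K < p₂ ∧
      K < p₃ ∧ K < p₄ ∧ p₁ ≠ p₂ ∧ p₃ ≠ p₄ ∧ (d = 4 ∨ d = 6 ∨ d = 10) ∧ p₃ * p₄ = p₁ * p₂ + d := by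
  by_contra hcon
  obtain ⟨N₁, hN₁⟩ : ∃ N : ℕ, (N : ℝ) = 995600 := ⟨995600, by norm_num⟩
  obtain ⟨N₂, hN₂⟩ : ∃ N : ℕ, (N : ℝ) = 999600 := ⟨999600, by norm_num⟩
  obtain ⟨μ, hμ⟩ : ∃ μ : ℝ, μ = 1 / 4000000 := ⟨_, rfl⟩
  obtain ⟨u, hu⟩ : ∃ u : ℕ → ℝ, ∀ j, u j = 1 / 1000 + ((j : ℝ) + 1) * μ := ⟨_, fun _ ↦ rfl⟩
  have hus : ∀ j, u (j + 1) = u j + μ := fun j ↦ by rw [hu, hu]; push_cast; ring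
  have huhigh : ∀ j < N₁ + N₂, u j ≤ 4998 / 10000 := fun j hj ↦ by
    have h1 : (j : ℝ) + 1 ≤ N₁ + N₂ := by exact_mod_cast hj
    rw [hN₁, hN₂] at h1
    rw [hu, hμ]
    linarith
  have h1 := sum_boxes_numeric rfl rfl hμ hN₁ hN₂ hu
  have h2 := box_inequality (K := K) (N := N₁ + N₂) (u := u) (r := 2499 / 10000) (δ := 1 / 5000)
    (by norm_num) (by norm_num) (by norm_num)
    (monotone_nat_of_le_succ fun j ↦ by rw [hus, hμ]; norm_num)
    (by rw [hu, hμ]; norm_num) (fun j _ ↦ by rw [hus, hμ]; norm_num)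
    (fun j hj ↦ by rw [hus, hμ]; linarith [huhigh j hj])
    (fun j hj ↦ by linarith [huhigh j hj])
    fun p₁ p₂ p₃ p₄ d a1 a2 a3 a4 b1 b2 b3 b4 c1 c2 hd he ↦
      hcon ⟨p₁, p₂, p₃, p₄, d, a1, a2, a3, a4, b1, b2, b3, b4, c1, c2, hd, he⟩
  rw [integral_sieve_profile] at h2
  exact h1.not_ge h2

end Final

/-- For every constant `C` and positive integer `n`, there are `E₂` numbers
`q₁ = p₁p₂` and `q₂ = p₃p₄` with `p₁, p₂, p₃, p₄` four distinct primes, each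
exceeding `C` and none dividing `2n`, such that `q₂ - q₁ ∈ {4, 6, 10}`. -/
theorem stmt_15 (C : ℕ) (n : ℕ) (hn : 0 < n) :
    ∃ p₁ p₂ p₃ p₄ : ℕ, p₁.Prime ∧ p₂.Prime ∧ p₃.Prime ∧ p₄.Prime ∧
      p₁ ≠ p₂ ∧ p₁ ≠ p₃ ∧ p₁ ≠ p₄ ∧ p₂ ≠ p₃ ∧ p₂ ≠ p₄ ∧ p₃ ≠ p₄ ∧
      C < p₁ ∧ C < p₂ ∧ C < p₃ ∧ C < p₄ ∧
      ¬ (p₁ ∣ 2 * n) ∧ ¬ (p₂ ∣ 2 * n) ∧ ¬ (p₃ ∣ 2 * n) ∧ ¬ (p₄ ∣ 2 * n) ∧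
      ∃ d : ℕ, (d = 4 ∨ d = 6 ∨ d = 10) ∧ p₃ * p₄ = p₁ * p₂ + d := by
  obtain ⟨p₁, p₂, p₃, p₄, d, h₁, h₂, h₃, h₄, k₁, k₂, k₃, k₄, h₁₂, h₃₄, hd, heq⟩ :=
    exists_primes_mul_eq_mul_add (C + 2 * n + 10)
  have hndvd : ∀ p, C + 2 * n + 10 < p → ¬ p ∣ 2 * n := fun p hp h ↦ by
    have := Nat.le_of_dvd (by omega) h
    omega
  have hne : ∀ p, C + 2 * n + 10 < p → p ∣ p₁ * p₂ → ¬ p ∣ p₃ * p₄ := fun p hp h h' ↦ by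
    have := Nat.le_of_dvd (by omega) ((Nat.dvd_add_right h).mp (heq ▸ h'))
    omega
  refine ⟨p₁, p₂, p₃, p₄, h₁, h₂, h₃, h₄, h₁₂, ?_, ?_, ?_, ?_, h₃₄, by omega, by omega, by omega,
    by omega, hndvd _ k₁, hndvd _ k₂, hndvd _ k₃, hndvd _ k₄, d, hd, heq⟩
  · rintro rfl
    exact hne _ k₁ (dvd_mul_right _ _) (dvd_mul_right _ _)
  · rintro rfl
    exact hne _ k₁ (dvd_mul_right _ _) (dvd_mul_left _ _)
  · rintro rfl
    exact hne _ k₂ (dvd_mul_left _ _) (dvd_mul_right _ _)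
  · rintro rfl
    exact hne _ k₂ (dvd_mul_left _ _) (dvd_mul_left _ _)
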